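/- There is a constant C₃ depending only on k with the following property. In the setup below, with ρ = k·2^{k+3}, for all sufficiently large n and all η, ε ∈ (0,1): | Σ_{x,y,z∈ℤ_N, x+y=z} a(x)a(y)𝔞(z) − Σ_{x,y,z∈ℤ_N, x+y=z} a'(x)a'(y)𝔞'(z) | ≤ C₃·K^{1/(ρ+1)}·(ε²·η^{−k·2^{k+3}} + η^{1/(k·2^{k+3}+1)})·N^{−1}. -/

import Mathlib

open Finset

/-- `e(t) = exp(2πit)`. -/
noncomputable def eC (t : ℝ) : ℂ := Complex.exp (2 * Real.pi * Complex.I * t)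

/-- `λ_{b,W}(x) = (φ(W)/W)·log(Wx+b)` if `Wx+b` is prime, and `0` otherwise. -/
noncomputable def lam (b W x : ℕ) : ℝ :=
  if Nat.Prime (W * x + b) then ((Nat.totient W : ℝ) / W) * Real.log (W * x + b) else 0

/-- The (unnormalized) Fourier transform `f̃(r) = Σ_{x=1}^{N} f(x) e(−xr/N)`
of a function `f : ℤ_N → ℝ`. -/
noncomputable def dft (N : ℕ) (f : ZMod N → ℝ) (r : ZMod N) : ℂ :=
  ∑ x ∈ Finset.Icc 1 N, (f ((x : ℕ) : ZMod N) : ℂ) *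
    eC (-(((x : ℕ) : ℝ) * ((r.val : ℕ) : ℝ)) / N)

/-- `‖t‖`: the distance from the real number `t` to the nearest integer. -/
noncomputable def nint (t : ℝ) : ℝ := |t - round t|

/-- `λ_{b,W}` for an integer shift `b`: `(φ(W)/W)·log(Wx+b)` if `Wx+b` is a
(positive) prime, and `0` otherwise. -/
noncomputable def lamZ (b : ℤ) (W x : ℕ) : ℝ :=
  if Nat.Prime ((W * x + b : ℤ)).toNat
    then ((Nat.totient W : ℝ) / W) * Real.log (((W * x + b : ℤ) : ℤ) : ℝ) else 0

lemma eC_add (s t : ℝ) : eC (s + t) = eC s * eC t := by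
  unfold eC; rw [← Complex.exp_add]; push_cast; ring_nf

lemma eC_zero : eC 0 = 1 := by simp [eC]

lemma norm_eC (t : ℝ) : ‖eC t‖ = 1 := by
  unfold eC
  rw [show 2 * (Real.pi : ℂ) * Complex.I * (t : ℂ) = ((2 * Real.pi * t : ℝ) : ℂ) * Complex.I by
    push_cast; ring]
  exact Complex.norm_exp_ofReal_mul_I _

lemma eC_ne_zero (t : ℝ) : eC t ≠ 0 := by
  rw [← norm_ne_zero_iff, norm_eC]; norm_num

lemma eC_intCast (n : ℤ) : eC n = 1 := by
  unfold eC
  rw [Complex.exp_eq_one_iff]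
  exact ⟨n, by push_cast; ring⟩

lemma eC_neg (t : ℝ) : eC (-t) = (starRingEnd ℂ) (eC t) := by
  unfold eC
  rw [← Complex.exp_conj]
  congr 1
  simp only [Complex.ofReal_neg, map_mul, Complex.conj_ofReal, Complex.conj_I, map_ofNat]
  ring

lemma eC_add_intCast (t : ℝ) (n : ℤ) : eC (t + n) = eC t := by
  rw [eC_add, eC_intCast, mul_one]

lemma eC_eq_of_sub_eq_intCast {s t : ℝ} (n : ℤ) (h : s - t = n) : eC s = eC t := by
  rw [show s = t + n by linarith, eC_add_intCast]

lemma eC_eq_one_iff (t : ℝ) : eC t = 1 ↔ ∃ n : ℤ, t = n := by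
  constructor
  · intro h
    unfold eC at h
    rw [Complex.exp_eq_one_iff] at h
    obtain ⟨n, hn⟩ := h
    refine ⟨n, ?_⟩
    have h2 : (2 * (Real.pi : ℂ) * Complex.I) ≠ 0 := Complex.two_pi_I_ne_zero
    have : (t : ℂ) = ((n : ℝ) : ℂ) := by
      apply mul_left_cancel₀ h2
      rw [hn]; push_cast; ring
    exact_mod_cast this
  · rintro ⟨n, rfl⟩
    exact eC_intCast n

lemma eC_nat_mul (n : ℕ) (t : ℝ) : eC (n * t) = eC t ^ n := by
  unfold eC
  rw [← Complex.exp_nat_mul]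
  congr 1
  push_cast; ring

lemma norm_eC_sub_one_eq (t : ℝ) : ‖eC t - 1‖ = 2 * |Real.sin (Real.pi * t)| := by
  have h := Complex.norm_exp_I_mul_ofReal_sub_one (2 * Real.pi * t)
  unfold eC
  rw [show 2 * (Real.pi : ℂ) * Complex.I * (t : ℂ)
    = Complex.I * ((2 * Real.pi * t : ℝ) : ℂ) by push_cast; ring, h]
  rw [show 2 * Real.pi * t / 2 = Real.pi * t by ring, norm_mul]
  simp [Real.norm_eq_abs]

lemma norm_eC_sub_one_le (t : ℝ) : ‖eC t - 1‖ ≤ 2 * Real.pi * |t| := by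
  rw [norm_eC_sub_one_eq]
  have := Real.abs_sin_le_abs (x := Real.pi * t)
  rw [abs_mul, abs_of_pos Real.pi_pos] at this
  linarith

lemma norm_eC_sub_eC_le (s t : ℝ) : ‖eC s - eC t‖ ≤ 2 * Real.pi * |s - t| := by
  have : eC s - eC t = eC t * (eC (s - t) - 1) := by
    rw [mul_sub, ← eC_add]; ring_nf
  rw [this, norm_mul, norm_eC, one_mul]
  exact norm_eC_sub_one_le _

lemma nint_le_abs_sub (t : ℝ) (n : ℤ) : nint t ≤ |t - n| := round_le t n

lemma nint_add_intCast (t : ℝ) (n : ℤ) : nint (t + n) = nint t := by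
  unfold nint
  rw [round_add_intCast]; push_cast; ring_nf

lemma nint_neg (t : ℝ) : nint (-t) = nint t := by
  apply le_antisymm
  · have := nint_le_abs_sub (-t) (-round t)
    rw [show -t - ((-round t : ℤ) : ℝ) = -(t - round t) by push_cast; ring, abs_neg] at this
    exact this
  · have := nint_le_abs_sub t (-round (-t))
    rw [show t - ((-round (-t) : ℤ) : ℝ) = -(-t - round (-t)) by push_cast; ring, abs_neg] at this
    exact this

lemma nint_add_le (s t : ℝ) : nint (s + t) ≤ nint s + nint t := by
  have := nint_le_abs_sub (s + t) (round s + round t)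
  refine this.trans ?_
  unfold nint
  rw [show s + t - ((round s + round t : ℤ) : ℝ) = (s - round s) + (t - round t) by
    push_cast; ring]
  exact abs_add_le _ _

lemma nint_le_abs (t : ℝ) : nint t ≤ |t| := by
  simpa using nint_le_abs_sub t 0

lemma four_mul_nint_le (t : ℝ) : 4 * nint t ≤ ‖eC t - 1‖ := by
  have h1 : eC t = eC (t - round t) := by
    refine eC_eq_of_sub_eq_intCast (round t) (by ring)
  rw [h1, norm_eC_sub_one_eq]
  set x := t - round t with hx
  have hx2 : |x| ≤ 1 / 2 := abs_sub_round t
  have : nint t = |x| := rfl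
  rw [this]
  have h3 : |Real.sin (Real.pi * x)| = Real.sin (Real.pi * |x|) := by
    rcases abs_cases x with ⟨h, h0⟩ | ⟨h, h0⟩
    · rw [h] at hx2 ⊢
      apply abs_of_nonneg
      apply Real.sin_nonneg_of_nonneg_of_le_pi
      · positivity
      · nlinarith [Real.pi_pos]
    · rw [h] at hx2 ⊢
      rw [mul_neg, Real.sin_neg]
      apply abs_of_nonpos
      apply Real.sin_nonpos_of_nonpos_of_neg_pi_le
      · nlinarith [Real.pi_pos]
      · nlinarith [Real.pi_pos]
  rw [h3]
  have := Real.mul_le_sin (x := Real.pi * |x|) (by positivity) (by nlinarith [Real.pi_pos])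
  have h4 : 2 / Real.pi * (Real.pi * |x|) = 2 * |x| := by
    field_simp
  linarith

lemma norm_geom_eC_mul_nint_le (β : ℝ) (t : ℕ) :
    ‖∑ z ∈ range t, eC (β * z)‖ * (2 * nint β) ≤ 1 := by
  have h1 : ∀ z : ℕ, eC (β * z) = eC β ^ z := fun z => by rw [mul_comm, eC_nat_mul]
  simp_rw [h1]
  have h2 := geom_sum_mul (eC β) t
  have h3 : ‖∑ z ∈ range t, eC β ^ z‖ * ‖eC β - 1‖ ≤ 2 := by
    rw [← norm_mul, h2]
    calc _ ≤ ‖eC β ^ t‖ + ‖(1 : ℂ)‖ := norm_sub_le _ _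
      _ = 2 := by rw [norm_pow, norm_eC]; norm_num
  have h4 := four_mul_nint_le β
  nlinarith [norm_nonneg (∑ z ∈ range t, eC β ^ z)]

lemma norm_sum_eC_le {ι : Type*} (s : Finset ι) (g : ι → ℝ) :
    ‖∑ z ∈ s, eC (g z)‖ ≤ #s := by
  refine (norm_sum_le _ _).trans ?_
  simp [norm_eC]

/-- The largest partial exponential sum of length at most `M` with linear phase `β`. -/
noncomputable def linSup (M : ℕ) (β : ℝ) : ℝ :=
  (range (M + 1)).sup' nonempty_range_add_one fun t => ‖∑ z ∈ range t, eC (β * z)‖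

lemma le_linSup {M t : ℕ} (h : t ≤ M) (β : ℝ) : ‖∑ z ∈ range t, eC (β * z)‖ ≤ linSup M β :=
  le_sup' (fun t => ‖∑ z ∈ range t, eC (β * z)‖) (mem_range.2 (Nat.lt_succ_of_le h))

lemma linSup_nonneg (M : ℕ) (β : ℝ) : 0 ≤ linSup M β :=
  (norm_nonneg _).trans (le_linSup le_rfl β)

lemma linSup_le (M : ℕ) (β : ℝ) : linSup M β ≤ M := by
  refine sup'_le _ _ fun t ht => (norm_sum_eC_le _ _).trans ?_
  rw [card_range]
  exact_mod_cast Nat.lt_succ_iff.1 (mem_range.1 ht)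

lemma linSup_mul_nint_le (M : ℕ) (β : ℝ) : linSup M β * (2 * nint β) ≤ 1 := by
  obtain ⟨t, -, ht⟩ := exists_mem_eq_sup' (nonempty_range_add_one (n := M))
    fun t => ‖∑ z ∈ range t, eC (β * z)‖
  rw [linSup, ht]
  exact norm_geom_eC_mul_nint_le β t

lemma linSup_le_of_le_nint {M : ℕ} {β c : ℝ} (hc : 0 < c) (h : c ≤ nint β) :
    linSup M β ≤ 1 / (2 * c) := by
  rw [le_div_iff₀ (by positivity)]
  refine le_trans ?_ (linSup_mul_nint_le M β)
  exact mul_le_mul_of_nonneg_left (by linarith) (linSup_nonneg M β)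

/-- The sums of linear phases that result from `j` Weyl differencing steps. -/
noncomputable def weylSum (M : ℕ) : ℕ → ℝ → ℝ
  | 0, α => linSup M α
  | j + 1, α => ∑ h ∈ range M, weylSum M j ((j + 2) * h * α)

lemma norm_sum_sq_le_differenced (g : ℕ → ℝ) (t : ℕ) :
    ‖∑ z ∈ range t, eC (g z)‖ ^ 2 ≤
      2 * ∑ h ∈ range t, ‖∑ z ∈ range (t - h), eC (g (z + h) - g z)‖ := by
  have key : ‖∑ z ∈ range t, eC (g z)‖ ^ 2 ≤
      2 * (∑ z ∈ range t, ∑ h ∈ range (z + 1), eC (g (z - h + h) - g (z - h))).re := by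
    induction t with
    | zero => simp
    | succ t ih =>
      rw [sum_range_succ, sum_range_succ (n := t), Complex.add_re]
      have e1 : ∑ h ∈ range (t + 1), eC (g (t - h + h) - g (t - h))
          = eC (g t) * (starRingEnd ℂ) (∑ z ∈ range t, eC (g z)) + 1 := by
        rw [← sum_range_reflect, map_sum, mul_sum, sum_range_succ]
        congr 1
        · refine sum_congr rfl fun z hz => ?_
          have := mem_range.1 hz
          rw [← eC_neg, ← eC_add, show t - (t + 1 - 1 - z) = z by omega,
            show z + (t + 1 - 1 - z) = t by omega, sub_eq_add_neg]
        · rw [show t + 1 - 1 - t = 0 by omega]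
          simp [eC_zero]
      have e2 : Complex.normSq (eC (g t)) = 1 := by rw [← Complex.sq_norm, norm_eC, one_pow]
      rw [e1, Complex.sq_norm, Complex.normSq_add, ← Complex.sq_norm, e2]
      have e3 : ((∑ z ∈ range t, eC (g z)) * (starRingEnd ℂ) (eC (g t))).re
        = (eC (g t) * (starRingEnd ℂ) (∑ z ∈ range t, eC (g z))).re := by
        simp only [Complex.mul_re, Complex.conj_re, Complex.conj_im]; ring
      rw [e3]
      simp only [Complex.add_re, Complex.one_re]
      linarith
  refine key.trans ?_
  gcongr
  rw [sum_range_diag_flip t (fun h z => eC (g (z + h) - g z))]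
  exact (Complex.re_le_norm _).trans (norm_sum_le _ _)

lemma coeff_taylor_sub {j : ℕ} {g : Polynomial ℝ} (hg : g.natDegree ≤ j + 2) (h : ℝ) :
    (Polynomial.taylor h g - g).natDegree ≤ j + 1 ∧
      (Polynomial.taylor h g - g).coeff (j + 1) = (j + 2) * h * g.coeff (j + 2) := by
  constructor
  · rw [Polynomial.natDegree_le_iff_coeff_eq_zero]
    intro n hn
    rw [Polynomial.coeff_sub, Polynomial.taylor_coeff]
    have h1 := (Polynomial.natDegree_hasseDeriv_le g n).trans
      (show g.natDegree - n ≤ 0 by omega)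
    rw [Polynomial.eq_C_of_natDegree_le_zero h1, Polynomial.hasseDeriv_coeff]
    simp
  · rw [Polynomial.coeff_sub, Polynomial.taylor_coeff]
    have h1 := (Polynomial.natDegree_hasseDeriv_le g (j + 1)).trans
      (show g.natDegree - (j + 1) ≤ 1 by omega)
    rw [Polynomial.eval_eq_sum_range' (Nat.lt_succ_of_le h1), sum_range_succ, sum_range_one,
      Polynomial.hasseDeriv_coeff, Polynomial.hasseDeriv_coeff]
    rw [show 1 + (j + 1) = j + 2 by ring, show (j + 2).choose (j + 1) = j + 2 from
      Nat.choose_succ_self_right (j + 1)]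
    simp
    ring

lemma weyl_differencing (M : ℕ) (j : ℕ) : ∀ (g : Polynomial ℝ) (t : ℕ), g.natDegree ≤ j + 1 →
    t ≤ M → ‖∑ z ∈ range t, eC (g.eval (z : ℝ))‖ ^ 2 ^ j * (M : ℝ) ^ (j + 1) ≤
      2 ^ 2 ^ j * (M : ℝ) ^ 2 ^ j * weylSum M j (g.coeff (j + 1)) := by
  induction j with
  | zero =>
    intro g t hg ht
    have h1 : ∀ z : ℕ, eC (g.eval (z : ℝ)) = eC (g.coeff 0) * eC (g.coeff 1 * z) := by
      intro z
      rw [Polynomial.eval_eq_sum_range' (n := 2) (by omega), sum_range_succ, sum_range_one, ← eC_add]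
      simp
    simp_rw [h1, ← mul_sum]
    rw [norm_mul, norm_eC]
    have := le_linSup ht (g.coeff 1)
    simp only [weylSum, pow_zero, pow_one, zero_add, one_mul]
    have h3 : (0 : ℝ) ≤ M := Nat.cast_nonneg _
    have h4 := linSup_nonneg M (g.coeff 1)
    nlinarith [mul_nonneg h3 h4, mul_le_mul_of_nonneg_left this h3]
  | succ j ih =>
    intro g t hg ht
    rcases Nat.eq_zero_or_pos M with hM | hM
    · subst hM
      simp
    set D : ℕ → ℝ := fun h =>
      ‖∑ z ∈ range (t - h), eC (g.eval (((z + h : ℕ)) : ℝ) - g.eval (z : ℝ))‖ with hD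
    have h1 : ‖∑ z ∈ range t, eC (g.eval (z : ℝ))‖ ^ 2 ≤ 2 * ∑ h ∈ range M, D h := by
      refine (norm_sum_sq_le_differenced (fun z => g.eval (z : ℝ)) t).trans ?_
      gcongr
    have h2 : ∀ h, D h ^ 2 ^ j * (M : ℝ) ^ (j + 1) ≤
        2 ^ 2 ^ j * (M : ℝ) ^ 2 ^ j * weylSum M j ((j + 2) * h * g.coeff (j + 2)) := by
      intro h
      obtain ⟨ha, hb⟩ := coeff_taylor_sub hg (h : ℝ)
      have := ih (Polynomial.taylor (h : ℝ) g - g) (t - h) ha (by omega)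
      rw [hb] at this
      refine le_trans (le_of_eq ?_) this
      simp only [hD, Polynomial.eval_sub, Polynomial.taylor_eval]
      push_cast
      rfl
    obtain ⟨q, hq⟩ : ∃ q, 2 ^ j = q + 1 := ⟨2 ^ j - 1, by have := Nat.one_le_two_pow (n := j); omega⟩
    have h3 := pow_sum_div_card_le_sum_pow (s := range M) (f := D) (fun h _ => norm_nonneg _) q
    rw [card_range, div_le_iff₀ (by positivity), ← hq] at h3
    have hM0 : (0 : ℝ) ≤ M := Nat.cast_nonneg _
    calc ‖∑ z ∈ range t, eC (g.eval (z : ℝ))‖ ^ 2 ^ (j + 1) * (M : ℝ) ^ (j + 1 + 1)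
        = (‖∑ z ∈ range t, eC (g.eval (z : ℝ))‖ ^ 2) ^ 2 ^ j * (M : ℝ) ^ (j + 1 + 1) := by
          rw [← pow_mul, pow_succ' 2 j]
      _ ≤ (2 * ∑ h ∈ range M, D h) ^ 2 ^ j * (M : ℝ) ^ (j + 1 + 1) := by gcongr
      _ = 2 ^ 2 ^ j * (∑ h ∈ range M, D h) ^ 2 ^ j * (M : ℝ) ^ (j + 1 + 1) := by rw [mul_pow]
      _ ≤ 2 ^ 2 ^ j * ((∑ h ∈ range M, D h ^ 2 ^ j) * (M : ℝ) ^ q) * (M : ℝ) ^ (j + 1 + 1) := by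
          gcongr
      _ = 2 ^ 2 ^ j * (M : ℝ) ^ 2 ^ j * ∑ h ∈ range M, D h ^ 2 ^ j * (M : ℝ) ^ (j + 1) := by
          rw [← sum_mul, hq]; ring
      _ ≤ 2 ^ 2 ^ j * (M : ℝ) ^ 2 ^ j * ∑ h ∈ range M,
            2 ^ 2 ^ j * (M : ℝ) ^ 2 ^ j * weylSum M j ((j + 2) * h * g.coeff (j + 2)) := by
          exact mul_le_mul_of_nonneg_left (sum_le_sum fun h _ => h2 h) (by positivity)
      _ = _ := by
          rw [← mul_sum, weylSum, pow_succ 2 j, pow_mul, pow_mul]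
          simp only [show j + 1 + 1 = j + 2 by ring]
          ring

lemma exists_card_divisors_le (ε : ℝ) (hε : 0 < ε) :
    ∃ C : ℝ, 1 ≤ C ∧ ∀ n : ℕ, n ≠ 0 → (#n.divisors : ℝ) ≤ C * (n : ℝ) ^ ε := by
  have hl2 : 0 < Real.log 2 := Real.log_pos (by norm_num)
  set c : ℝ := 1 + 1 / (ε * Real.log 2) with hc
  have hc1 : 1 ≤ c := by rw [hc]; have : 0 < 1 / (ε * Real.log 2) := by positivity
                         linarith
  obtain ⟨P, hP⟩ := exists_nat_ge ((2 : ℝ) ^ (1 / ε))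
  have small : ∀ p a : ℕ, 2 ≤ p → ((a + 1 : ℕ) : ℝ) ≤ c * ((p : ℝ) ^ a) ^ ε := by
    intro p a hp
    have h1 : ((2 : ℝ) ^ a) ^ ε ≤ ((p : ℝ) ^ a) ^ ε := by
      have : (2 : ℝ) ≤ p := by exact_mod_cast hp
      gcongr
    have h2 : 1 + a * (ε * Real.log 2) ≤ ((2 : ℝ) ^ a) ^ ε := by
      rw [Real.rpow_def_of_pos (by positivity), Real.log_pow]
      have := Real.add_one_le_exp (a * Real.log 2 * ε)
      linarith
    have h3 : ((a + 1 : ℕ) : ℝ) ≤ c * (1 + a * (ε * Real.log 2)) := by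
      have : c * (1 + a * (ε * Real.log 2)) =
        1 + a * (ε * Real.log 2) + 1 / (ε * Real.log 2) + a := by
        rw [hc]; field_simp; ring
      rw [this]; push_cast
      have : 0 < 1 / (ε * Real.log 2) := by positivity
      have : 0 ≤ a * (ε * Real.log 2) := by positivity
      linarith
    exact h3.trans (mul_le_mul_of_nonneg_left (h2.trans h1) (by linarith))
  have large : ∀ p a : ℕ, P ≤ p → ((a + 1 : ℕ) : ℝ) ≤ ((p : ℝ) ^ a) ^ ε := by
    intro p a hp
    have h0 : (2 : ℝ) ^ (1 / ε) ≤ p := hP.trans (by exact_mod_cast hp)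
    have h1 : (((2 : ℝ) ^ (1 / ε)) ^ a) ^ ε ≤ ((p : ℝ) ^ a) ^ ε := by gcongr
    have h2 : (((2 : ℝ) ^ (1 / ε)) ^ a) ^ ε = 2 ^ a := by
      have h20 : (0 : ℝ) ≤ 2 := by norm_num
      rw [← Real.rpow_natCast, ← Real.rpow_mul h20, ← Real.rpow_mul h20, ← Real.rpow_natCast]
      congr 1
      field_simp
    refine le_trans ?_ (h2 ▸ h1)
    exact_mod_cast Nat.lt_two_pow_self
  refine ⟨c ^ P, one_le_pow₀ hc1, fun n hn => ?_⟩
  have hn2 : (n : ℝ) = ∏ p ∈ n.primeFactors, (p : ℝ) ^ n.factorization p := by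
    conv_lhs => rw [← Nat.prod_factorization_pow_eq_self hn]
    rw [Finsupp.prod, Nat.support_factorization]
    push_cast
    rfl
  rw [Nat.card_divisors hn, hn2, ← Real.finsetProd_rpow _ _ (fun _ _ => by positivity)]
  push_cast
  calc ∏ p ∈ n.primeFactors, ((n.factorization p : ℝ) + 1)
      ≤ ∏ p ∈ n.primeFactors, ((if p < P then c else 1) *
          ((p : ℝ) ^ n.factorization p) ^ ε) := by
        refine prod_le_prod (fun _ _ => by positivity) fun p hp => ?_
        split_ifs with h
        · exact_mod_cast small p _ (Nat.prime_of_mem_primeFactors hp).two_le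
        · rw [one_mul]
          exact_mod_cast large p _ (not_lt.1 h)
    _ = (∏ p ∈ n.primeFactors, if p < P then c else 1) *
          ∏ p ∈ n.primeFactors, ((p : ℝ) ^ n.factorization p) ^ ε := prod_mul_distrib
    _ ≤ c ^ P * _ := by
        refine mul_le_mul_of_nonneg_right ?_ (prod_nonneg fun _ _ => by positivity)
        rw [← prod_filter, prod_const]
        refine pow_le_pow_right₀ hc1 ?_
        calc _ ≤ #(range P) := card_le_card fun p hp => by
              simp only [mem_filter] at hp; exact mem_range.2 hp.2
          _ = P := card_range P

lemma weylSum_le_trivial (M j : ℕ) : ∀ α, weylSum M j α ≤ (M : ℝ) ^ (j + 1) := by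
  induction j with
  | zero => exact fun α => by simpa [weylSum] using linSup_le M α
  | succ j ih =>
    intro α
    rw [weylSum]
    refine (sum_le_card_nsmul _ _ _ fun h _ => ih _).trans ?_
    rw [card_range, nsmul_eq_mul, pow_succ' _ (j + 1)]

lemma sum_sum_mul_le_card_divisors {F : ℕ → ℝ} (hF : ∀ m, 0 ≤ F m) {s t : Finset ℕ} {c X : ℕ}
    {D : ℝ} (hc : 0 < c) (hs : ∀ h ∈ s, 0 < h) (ht : ∀ m ∈ t, 0 < m)
    (hX : ∀ h ∈ s, ∀ m ∈ t, c * h * m ≤ X) (hD : ∀ m ∈ Icc 1 X, (#m.divisors : ℝ) ≤ D) :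
    ∑ h ∈ s, ∑ m ∈ t, F (c * h * m) ≤ D * ∑ m ∈ Icc 1 X, F m := by
  rw [← sum_product' s t (fun h m => F (c * h * m))]
  have hmaps : ∀ x ∈ s ×ˢ t, c * x.1 * x.2 ∈ Icc 1 X := by
    intro x hx
    rw [mem_product] at hx
    rw [mem_Icc]
    exact ⟨Nat.succ_le_of_lt (by have := hs _ hx.1; have := ht _ hx.2; positivity), hX _ hx.1 _ hx.2⟩
  rw [← sum_fiberwise_of_maps_to hmaps, mul_sum]
  refine sum_le_sum fun n hn => ?_
  have h1 : ∑ x ∈ s ×ˢ t with c * x.1 * x.2 = n, F (c * x.1 * x.2) =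
      #{x ∈ s ×ˢ t | c * x.1 * x.2 = n} * F n := by
    rw [← nsmul_eq_mul, ← sum_const]
    exact sum_congr rfl fun x hx => by rw [(mem_filter.1 hx).2]
  rw [h1]
  refine mul_le_mul_of_nonneg_right (le_trans ?_ (hD n hn)) (hF n)
  rw [Nat.cast_le]
  refine card_le_card_of_injOn Prod.fst ?_ ?_
  · intro x hx
    have hx := mem_filter.1 (mem_coe.1 hx)
    rw [mem_coe, Nat.mem_divisors]
    refine ⟨⟨c * x.2, by rw [← hx.2]; ring⟩, ?_⟩
    have := (mem_Icc.1 hn).1; omega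
  · intro x hx y hy hxy
    have hx := mem_filter.1 (mem_coe.1 hx)
    have hy := mem_filter.1 (mem_coe.1 hy)
    have h0 := hs _ (mem_product.1 hx.1).1
    refine Prod.ext hxy ?_
    have : c * x.1 * x.2 = c * x.1 * y.2 := by rw [hx.2, hxy, hy.2]
    exact Nat.eq_of_mul_eq_mul_left (by positivity) this

lemma weylSum_le_sum_linSup {M : ℕ} (hM : 1 ≤ M) {D : ℝ} (j : ℕ)
    (hD : ∀ m ∈ Icc 1 ((j + 1).factorial * M ^ j), (#m.divisors : ℝ) ≤ D) : ∀ α,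
    weylSum M j α ≤ j * (M : ℝ) ^ j +
      D ^ j * ∑ m ∈ Icc 1 ((j + 1).factorial * M ^ j), linSup M (m * α) := by
  induction j with
  | zero => intro α; simp [weylSum]
  | succ j ih =>
    intro α
    have hmono : (j + 1).factorial * M ^ j ≤ (j + 1 + 1).factorial * M ^ (j + 1) :=
      Nat.mul_le_mul (Nat.factorial_le (by omega)) (Nat.pow_le_pow_right hM (by omega))
    have ih' := ih fun m hm => hD m (Icc_subset_Icc le_rfl hmono hm)
    obtain ⟨M', rfl⟩ : ∃ M', M = M' + 1 := ⟨M - 1, by omega⟩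
    set M := M' + 1 with hMdef
    have hD0 : 0 ≤ D := (Nat.cast_nonneg _).trans (hD 1 (by
      rw [mem_Icc]; exact ⟨le_rfl, Nat.succ_le_of_lt (by positivity)⟩))
    rw [weylSum, sum_range_succ']
    have hb : weylSum M j ((j + 2) * ((0 : ℕ) : ℝ) * α) ≤ (M : ℝ) ^ (j + 1) :=
      weylSum_le_trivial _ _ _
    have ha : ∑ h ∈ range M', weylSum M j ((j + 2) * ((h + 1 : ℕ) : ℝ) * α) ≤
        M * (j * (M : ℝ) ^ j) + D ^ j *
          ∑ h ∈ Icc 1 M', ∑ m ∈ Icc 1 ((j + 1).factorial * M ^ j),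
            linSup M (((j + 2) * h * m : ℕ) * α) := by
      calc _ ≤ ∑ h ∈ range M', (j * (M : ℝ) ^ j + D ^ j *
            ∑ m ∈ Icc 1 ((j + 1).factorial * M ^ j),
              linSup M (m * ((j + 2) * ((h + 1 : ℕ) : ℝ) * α))) :=
            sum_le_sum fun h _ => ih' _
        _ = M' * (j * (M : ℝ) ^ j) + D ^ j * ∑ h ∈ range M',
            ∑ m ∈ Icc 1 ((j + 1).factorial * M ^ j),
              linSup M (m * ((j + 2) * ((h + 1 : ℕ) : ℝ) * α)) := by
            rw [sum_add_distrib, sum_const, card_range, nsmul_eq_mul, mul_sum]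
        _ = M' * (j * (M : ℝ) ^ j) + D ^ j * ∑ h ∈ Icc 1 M',
            ∑ m ∈ Icc 1 ((j + 1).factorial * M ^ j),
              linSup M (((j + 2) * h * m : ℕ) * α) := by
            congr 2
            rw [range_eq_Ico, sum_Ico_add' (fun h : ℕ =>
              ∑ m ∈ Icc 1 ((j + 1).factorial * M ^ j),
              linSup M (m * ((j + 2) * (h : ℝ) * α))) 0 M' 1]
            refine sum_congr (by ext; simp) fun h _ => sum_congr rfl fun m _ => ?_
            congr 1
            push_cast
            ring_nf
        _ ≤ _ := by
            have : (M' : ℝ) ≤ M := by rw [hMdef]; push_cast; linarith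
            gcongr
    have hc := sum_sum_mul_le_card_divisors (F := fun m => linSup M (m * α))
      (fun m => linSup_nonneg _ _) (s := Icc 1 M')
      (t := Icc 1 ((j + 1).factorial * M ^ j)) (c := j + 2) (by omega)
      (fun h hh => (mem_Icc.1 hh).1) (fun h hh => (mem_Icc.1 hh).1)
      (fun h hh m hm => by
        calc (j + 2) * h * m ≤ (j + 2) * M * ((j + 1).factorial * M ^ j) :=
              Nat.mul_le_mul (Nat.mul_le_mul le_rfl ((mem_Icc.1 hh).2.trans (by omega)))
                (mem_Icc.1 hm).2
          _ = (j + 1 + 1).factorial * M ^ (j + 1) := by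
              rw [Nat.factorial_succ (j + 1)]; ring) hD
    have hd := mul_le_mul_of_nonneg_left hc (pow_nonneg hD0 j)
    calc _ ≤ _ := add_le_add ha hb
      _ ≤ M * (j * (M : ℝ) ^ j) + D ^ j * (D * ∑ m ∈ Icc 1 ((j + 1 + 1).factorial * M ^ (j + 1)),
            linSup M (m * α)) + (M : ℝ) ^ (j + 1) := by gcongr
      _ = _ := by push_cast; ring

lemma div_le_nint_of_residue {v : ℕ} (hv : 0 < v) {y : ℝ} {a : ℤ} (h : |v * y - a| ≤ 3 / 2)
    {s : ℕ} (hs : (a % v).toNat = s) (h1 : 2 ≤ s) (h2 : s + 2 ≤ v) :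
    min (s : ℝ) (v - s) / (4 * v) ≤ nint y := by
  have hv' : (0 : ℝ) < v := by exact_mod_cast hv
  have ha : (a : ℝ) = v * (a / (v : ℤ) : ℤ) + s := by
    have h3 := Int.mul_ediv_add_emod a v
    have h4 : (0 : ℤ) ≤ a % v := Int.emod_nonneg _ (by omega)
    have h5 : a % v = s := by omega
    rw [h5] at h3
    exact_mod_cast h3.symm
  set q : ℤ := a / (v : ℤ)
  set n : ℤ := round y - q with hn
  have key : min (s : ℝ) (v - s) / 4 ≤ v * nint y := by
    have e1 : v * nint y = |v * y - v * round y| := by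
      unfold nint
      rw [← mul_sub, abs_mul, abs_of_pos hv']
    have h3 : min (s : ℝ) (v - s) ≤ |(s : ℝ) - v * n| := by
      rcases le_or_gt n 0 with h0 | h0
      · refine (min_le_left _ _).trans ?_
        have : (n : ℝ) ≤ 0 := by exact_mod_cast h0
        refine le_trans ?_ (le_abs_self _)
        nlinarith
      · refine (min_le_right _ _).trans ?_
        have : (1 : ℝ) ≤ n := by exact_mod_cast h0
        refine le_trans ?_ (neg_abs_le _ |> neg_le.1)
        nlinarith
    have h4 : (2 : ℝ) ≤ min (s : ℝ) (v - s) := by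
      refine le_min (by exact_mod_cast h1) ?_
      have : ((s + 2 : ℕ) : ℝ) ≤ v := by exact_mod_cast h2
      push_cast at this; linarith
    have h5 : |(s : ℝ) - v * n| ≤ |v * y - v * round y| + 3 / 2 := by
      have : (s : ℝ) - v * n = (v * y - v * round y) - (v * y - a) := by
        rw [ha, hn]; push_cast; ring
      rw [this]
      exact (abs_sub _ _).trans (by linarith)
    rw [e1]; linarith
  rw [div_le_iff₀ (by positivity)]
  linarith

lemma sum_comp_affine_residue {v : ℕ} (hv : 0 < v) {u c : ℤ} (huv : IsCoprime u (v : ℤ))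
    (G : ℕ → ℝ) : ∑ i ∈ range v, G ((c + i * u) % v).toNat = ∑ s ∈ range v, G s := by
  have hmaps : ∀ i ∈ range v, ((c + i * u) % v).toNat ∈ range v := by
    intro i _
    have h1 : (0 : ℤ) ≤ (c + i * u) % v := Int.emod_nonneg _ (by omega)
    have h2 := Int.emod_lt_of_pos (c + i * u) (show (0 : ℤ) < v by omega)
    rw [mem_range]; omega
  have hinj : Set.InjOn (fun i : ℕ => ((c + i * u) % v).toNat) (range v) := by
    intro i hi i' hi' h
    have hi := mem_range.1 (mem_coe.1 hi)
    have hi' := mem_range.1 (mem_coe.1 hi')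
    have h1 : (0 : ℤ) ≤ (c + i * u) % v := Int.emod_nonneg _ (by omega)
    have h2 : (0 : ℤ) ≤ (c + i' * u) % v := Int.emod_nonneg _ (by omega)
    have h3 : (c + i * u) % v = (c + i' * u) % v := by
      simp only at h; omega
    have h4 : (v : ℤ) ∣ (i' - i) * u := by
      have h5 := Int.ModEq.dvd (show (c + i * u) ≡ (c + i' * u) [ZMOD v] from h3)
      have : (i' - i : ℤ) * u = (c + i' * u) - (c + i * u) := by ring
      rw [this]; exact h5
    have h5 : (v : ℤ) ∣ (i' - i) := huv.symm.dvd_of_dvd_mul_right h4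
    have h6 : (i' - i : ℤ) = 0 := Int.eq_zero_of_abs_lt_dvd h5 (by rw [abs_lt]; constructor <;> omega)
    omega
  have himg : (range v).image (fun i : ℕ => ((c + i * u) % v).toNat) = range v := by
    apply eq_of_subset_of_card_le
    · intro x hx
      obtain ⟨i, hi, rfl⟩ := mem_image.1 hx
      exact hmaps i hi
    · rw [card_image_of_injOn hinj]
  conv_rhs => rw [← himg]
  rw [sum_image hinj]

lemma sum_inv_range_le (v : ℕ) : ∑ s ∈ range v, 1 / (s : ℝ) ≤ 1 + Real.log v := by
  rcases v with _ | v
  · simp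
  · rw [sum_range_succ']
    have h := harmonic_le_one_add_log v
    rw [harmonic] at h
    push_cast at h
    have h2 : Real.log v ≤ Real.log (v + 1 : ℕ) := by
      rcases Nat.eq_zero_or_pos v with h0 | h0
      · simp [h0]
      · exact Real.log_le_log (by exact_mod_cast h0) (by push_cast; linarith)
    simp only [Nat.cast_zero, div_zero, add_zero, one_div]
    push_cast at h2 ⊢
    linarith

lemma sum_inv_sub_range_le (v : ℕ) : ∑ s ∈ range v, 1 / ((v : ℝ) - s) ≤ 1 + Real.log v := by
  rw [← sum_range_reflect]
  have h := harmonic_le_one_add_log v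
  rw [harmonic] at h
  push_cast at h
  refine le_trans (le_of_eq (sum_congr rfl fun s hs => ?_)) h
  have := mem_range.1 hs
  rw [one_div, show v - 1 - s = v - (s + 1) by omega, Nat.cast_sub (by omega)]
  push_cast; ring_nf

lemma sum_linSup_block_le {v M : ℕ} (hv : 0 < v) {u c : ℤ} (huv : IsCoprime u (v : ℤ))
    {y : ℕ → ℝ} (hy : ∀ i < v, |v * y i - (c + i * u : ℤ)| ≤ 3 / 2) :
    ∑ i ∈ range v, linSup M (y i) ≤ 3 * M + 4 * v * (1 + Real.log v) := by
  set G : ℕ → ℝ := fun s => (if s = 0 then (M : ℝ) else 0) + (if s = 1 then (M : ℝ) else 0) +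
    (if s = v - 1 then (M : ℝ) else 0) + 2 * v * (1 / s + 1 / (v - s)) with hG
  have hv' : (0 : ℝ) < v := by exact_mod_cast hv
  have hM : (0 : ℝ) ≤ M := Nat.cast_nonneg _
  have h1 : ∀ i ∈ range v, linSup M (y i) ≤ G ((c + i * u) % v).toNat := by
    intro i hi
    set s := ((c + i * u) % v).toNat with hs
    have hsv : s < v := by
      have h1 : (0 : ℤ) ≤ (c + i * u) % v := Int.emod_nonneg _ (by omega)
      have h2 := Int.emod_lt_of_pos (c + i * u) (show (0 : ℤ) < v by omega)
      omega
    have hsv' : (s : ℝ) < v := by exact_mod_cast hsv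
    have hpos : 0 ≤ 2 * v * (1 / (s : ℝ) + 1 / (v - s)) := by
      have : 0 < (v : ℝ) - s := by linarith
      positivity
    by_cases h : s = 0 ∨ s = 1 ∨ s = v - 1
    · refine (linSup_le _ _).trans ?_
      simp only [hG]
      rcases h with h | h | h <;> rw [if_pos h] <;> split_ifs <;> linarith
    · have h2 := div_le_nint_of_residue hv (hy i (mem_range.1 hi)) hs.symm (by omega) (by omega)
      have hs0 : (0 : ℝ) < s := by exact_mod_cast (show 0 < s by omega)
      have hs1 : (0 : ℝ) < v - s := by linarith
      have hmin : 0 < min (s : ℝ) (v - s) := lt_min hs0 hs1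
      refine (linSup_le_of_le_nint (by positivity) h2).trans ?_
      have h3 : 1 / min (s : ℝ) (v - s) ≤ 1 / (s : ℝ) + 1 / (v - s) := by
        have := one_div_pos.2 hs0
        have := one_div_pos.2 hs1
        rcases min_choice (s : ℝ) (v - s) with h | h <;> rw [h] <;> linarith
      have h4 : 1 / (2 * (min (s : ℝ) (v - s) / (4 * v))) = 2 * v * (1 / min (s : ℝ) (v - s)) := by
        field_simp; ring
      rw [h4]
      have h5 := mul_le_mul_of_nonneg_left h3 (show 0 ≤ 2 * (v : ℝ) by positivity)
      simp only [hG]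
      split_ifs <;> linarith
  refine (sum_le_sum h1).trans ?_
  rw [sum_comp_affine_residue hv huv G]
  simp only [hG, sum_add_distrib, sum_ite_eq', ← mul_sum]
  have h2 := sum_inv_range_le v
  have h3 := sum_inv_sub_range_le v
  have h4 := mul_le_mul_of_nonneg_left (add_le_add h2 h3) (show 0 ≤ 2 * (v : ℝ) by positivity)
  split_ifs <;> linarith

lemma sum_linSup_le {v M : ℕ} (hv : 0 < v) {u : ℤ} (huv : IsCoprime u (v : ℤ)) {α : ℝ}
    (hα : |α - u / v| ≤ 1 / (v : ℝ) ^ 2) (X : ℕ) :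
    ∑ m ∈ Icc 1 X, linSup M (m * α) ≤
      (X / v + 1) * (3 * M + 4 * v * (1 + Real.log v)) := by
  have hv' : (0 : ℝ) < v := by exact_mod_cast hv
  have hlog : 0 ≤ Real.log v := Real.log_natCast_nonneg v
  have block : ∀ m₀ : ℕ, ∑ i ∈ range v, linSup M (((m₀ + i + 1 : ℕ) : ℝ) * α) ≤
      3 * M + 4 * v * (1 + Real.log v) := by
    intro m₀
    refine sum_linSup_block_le hv huv (c := round (v * ((m₀ + 1 : ℕ) * α))) fun i hi => ?_
    have h1 := abs_sub_round ((v : ℝ) * ((m₀ + 1 : ℕ) * α))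
    have h2 : |(i : ℝ) * (v * (α - u / v))| ≤ 1 := by
      rw [abs_mul, abs_mul, abs_of_pos hv', abs_of_nonneg (Nat.cast_nonneg i)]
      have : (i : ℝ) ≤ v := by exact_mod_cast hi.le
      calc (i : ℝ) * (v * |α - u / v|) ≤ v * (v * (1 / (v : ℝ) ^ 2)) := by gcongr
        _ = 1 := by field_simp
    have h3 : (v : ℝ) * (((m₀ + i + 1 : ℕ) : ℝ) * α) -
        ((round ((v : ℝ) * ((m₀ + 1 : ℕ) * α)) + i * u : ℤ) : ℝ) =
        ((v : ℝ) * ((m₀ + 1 : ℕ) * α) - round ((v : ℝ) * ((m₀ + 1 : ℕ) * α))) +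
          (i : ℝ) * (v * (α - u / v)) := by
      push_cast; field_simp; ring
    rw [h3]
    exact (abs_add_le _ _).trans (by linarith)
  have blocks : ∀ n : ℕ, ∑ i ∈ range (n * v), linSup M (((i + 1 : ℕ) : ℝ) * α) ≤
      n * (3 * M + 4 * v * (1 + Real.log v)) := by
    intro n
    induction n with
    | zero => simp
    | succ n ih =>
      rw [Nat.succ_mul, sum_range_add]
      have := block (n * v)
      push_cast at this ih ⊢
      linarith
  have h1 : ∑ m ∈ Icc 1 X, linSup M (m * α) ≤
      ∑ i ∈ range ((X / v + 1) * v), linSup M (((i + 1 : ℕ) : ℝ) * α) := by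
    rw [range_eq_Ico, sum_Ico_add' (fun m : ℕ => linSup M (m * α)) 0 _ 1]
    refine sum_le_sum_of_subset_of_nonneg ?_ fun _ _ _ => linSup_nonneg _ _
    intro m hm
    rw [mem_Icc] at hm
    rw [mem_Ico]
    have := Nat.lt_div_mul_add (a := X) hv
    rw [Nat.add_mul]
    omega
  refine h1.trans ((blocks _).trans ?_)
  have h2 : ((X / v : ℕ) : ℝ) ≤ X / v := Nat.cast_div_le
  push_cast
  gcongr

/-- Weyl's inequality. -/
lemma exists_weyl_bound (k : ℕ) (hk : 2 ≤ k) (ε : ℝ) (hε : 0 < ε) :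
    ∃ C : ℝ, 0 < C ∧ ∀ (M v : ℕ) (u : ℤ) (g : Polynomial ℝ), 1 ≤ M → 0 < v →
      IsCoprime u (v : ℤ) → g.natDegree ≤ k → |g.coeff k - u / v| ≤ 1 / (v : ℝ) ^ 2 →
      v ≤ M ^ k → ∀ t ≤ M, ‖∑ z ∈ range t, eC (g.eval (z : ℝ))‖ ^ 2 ^ (k - 1) ≤
        C * (M : ℝ) ^ 2 ^ (k - 1) * (M : ℝ) ^ ε * (1 / v + 1 / M + v / (M : ℝ) ^ k) := by
  obtain ⟨j, rfl⟩ : ∃ j, k = j + 1 := ⟨k - 1, by omega⟩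
  have hj : 1 ≤ j := by omega
  set δ : ℝ := ε / (2 * (j + 1) ^ 2) with hδ
  have hδ0 : 0 < δ := by positivity
  obtain ⟨C₀, hC₀, hdiv⟩ := exists_card_divisors_le δ hδ0
  set F : ℝ := ((j + 1).factorial : ℝ) with hF
  have hF1 : 1 ≤ F := by rw [hF]; exact_mod_cast Nat.succ_le_of_lt (Nat.factorial_pos _)
  set L : ℝ := 1 + (j + 1) * (1 / (ε / 2)) with hL
  have hL1 : 1 ≤ L := by rw [hL]; have : 0 < ((j : ℝ) + 1) * (1 / (ε / 2)) := by positivity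
                         linarith
  refine ⟨2 ^ 2 ^ j * (j + (C₀ * F ^ δ) ^ j * (11 * F * L)), by positivity, ?_⟩
  intro M v u g hM hv huv hg hα hvM t ht
  have hM1 : (1 : ℝ) ≤ M := by exact_mod_cast hM
  have hM0 : (0 : ℝ) < M := by linarith
  have hv1 : (1 : ℝ) ≤ v := by exact_mod_cast hv
  have hv0 : (0 : ℝ) < v := by linarith
  rw [Nat.add_sub_cancel]
  set D : ℝ := C₀ * F ^ δ * (M : ℝ) ^ (j * δ) with hD
  have hDdiv : ∀ m ∈ Icc 1 ((j + 1).factorial * M ^ j), (#m.divisors : ℝ) ≤ D := by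
    intro m hm
    rw [mem_Icc] at hm
    refine (hdiv m (by omega)).trans ?_
    rw [hD, mul_assoc]
    gcongr
    calc (m : ℝ) ^ δ ≤ (F * (M : ℝ) ^ j) ^ δ := by
          gcongr; rw [hF]; exact_mod_cast hm.2
      _ = F ^ δ * (M : ℝ) ^ (j * δ) := by
          rw [Real.mul_rpow (by positivity) (by positivity), ← Real.rpow_natCast (M : ℝ) j,
            ← Real.rpow_mul hM0.le]
  have h1 := weyl_differencing M j g t hg ht
  have h2 := weylSum_le_sum_linSup hM j hDdiv (g.coeff (j + 1))
  have h3 := sum_linSup_le (M := M) hv huv hα ((j + 1).factorial * M ^ j)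
  have hlog : 1 + Real.log v ≤ L * (M : ℝ) ^ (ε / 2) := by
    have h4 : Real.log v ≤ (j + 1) * Real.log M := by
      have : Real.log v ≤ Real.log ((M : ℝ) ^ (j + 1)) :=
        Real.log_le_log hv0 (by exact_mod_cast hvM)
      rwa [Real.log_pow, Nat.cast_add, Nat.cast_one] at this
    have h5 := Real.log_le_rpow_div hM0.le (show 0 < ε / 2 by positivity)
    have h6 : 1 ≤ (M : ℝ) ^ (ε / 2) := Real.one_le_rpow hM1 (by positivity)
    have h7 : Real.log v ≤ (j + 1) * ((M : ℝ) ^ (ε / 2) / (ε / 2)) :=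
      h4.trans (mul_le_mul_of_nonneg_left h5 (by positivity))
    rw [hL, add_mul, one_mul]
    calc _ ≤ _ := add_le_add h6 h7
      _ = _ := by ring
  have hDj : D ^ j ≤ (C₀ * F ^ δ) ^ j * (M : ℝ) ^ (ε / 2) := by
    rw [hD, mul_pow, ← Real.rpow_natCast ((M : ℝ) ^ (j * δ)), ← Real.rpow_mul hM0.le]
    gcongr
    rw [hδ]
    have hj0 : (0 : ℝ) ≤ j := Nat.cast_nonneg _
    rw [show (j : ℝ) * (ε / (2 * (j + 1) ^ 2)) * j = (ε / 2) * (j ^ 2 / (j + 1) ^ 2) by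
      field_simp]
    refine mul_le_of_le_one_right (by positivity) ?_
    rw [div_le_one (by positivity)]
    gcongr; linarith
  set E : ℝ := 1 / (v : ℝ) + 1 / M + v / (M : ℝ) ^ (j + 1) with hE
  set Y : ℝ := (M : ℝ) ^ (ε / 2) with hY
  have hY1 : 1 ≤ Y := Real.one_le_rpow hM1 (by positivity)
  have hYY : Y * Y = (M : ℝ) ^ ε := by
    rw [hY, ← Real.rpow_add hM0]; ring_nf
  have h4 : ∑ m ∈ Icc 1 ((j + 1).factorial * M ^ j), linSup M (m * g.coeff (j + 1)) ≤
      11 * F * L * Y * (M : ℝ) ^ (j + 1) * E := by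
    refine h3.trans ?_
    push_cast
    rw [← hF]
    have h5 : 3 * (M : ℝ) + 4 * v * (1 + Real.log v) ≤ L * Y * (3 * M + 4 * v) := by
      have : 3 * (M : ℝ) ≤ L * Y * (3 * M) :=
        le_mul_of_one_le_left (by positivity) (one_le_mul_of_one_le_of_one_le hL1 hY1)
      have := mul_le_mul_of_nonneg_left hlog (show (0 : ℝ) ≤ 4 * v by positivity)
      linarith
    calc (F * (M : ℝ) ^ j / v + 1) * (3 * M + 4 * v * (1 + Real.log v))
        ≤ (F * (M : ℝ) ^ j / v + F * 1) * (L * Y * (3 * M + 4 * v)) := by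
          gcongr; linarith
      _ = F * L * Y * (3 * (M : ℝ) ^ (j + 1) / v + 4 * M ^ j + 3 * M + 4 * v) := by
          field_simp; ring
      _ ≤ F * L * Y * (11 * ((M : ℝ) ^ (j + 1) / v + M ^ j + v)) := by
          gcongr
          have : (M : ℝ) ≤ M ^ j := le_self_pow₀ hM1 (by omega)
          have h9 : 0 ≤ (M : ℝ) ^ (j + 1) / v := by positivity
          rw [mul_div_assoc]
          linarith
      _ = _ := by
          rw [hE]; field_simp; ring
  have h5 : weylSum M j (g.coeff (j + 1)) ≤
      (j + (C₀ * F ^ δ) ^ j * (11 * F * L)) * ((M : ℝ) ^ ε * (M : ℝ) ^ (j + 1) * E) := by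
    have hD0 : 0 ≤ D ^ j := by positivity
    have hME : (M : ℝ) ^ j ≤ (M : ℝ) ^ ε * (M : ℝ) ^ (j + 1) * E := by
      have e1 : (M : ℝ) ^ j = 1 * (M : ℝ) ^ (j + 1) * (1 / M) := by field_simp; ring
      rw [e1]
      have : 1 / (M : ℝ) ≤ E := by
        rw [hE]
        have : 0 ≤ 1 / (v : ℝ) := by positivity
        have : 0 ≤ v / (M : ℝ) ^ (j + 1) := by positivity
        linarith
      gcongr
      exact Real.one_le_rpow hM1 hε.le
    calc _ ≤ _ := h2
      _ ≤ j * ((M : ℝ) ^ ε * (M : ℝ) ^ (j + 1) * E) + ((C₀ * F ^ δ) ^ j * Y) *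
          (11 * F * L * Y * (M : ℝ) ^ (j + 1) * E) := by
          gcongr
          exact sum_nonneg fun _ _ => linSup_nonneg _ _
      _ = _ := by rw [← hYY]; ring
  have h6 := h1.trans (mul_le_mul_of_nonneg_left h5 (by positivity))
  have h7 : (0 : ℝ) < (M : ℝ) ^ (j + 1) := by positivity
  refine le_of_mul_le_mul_right (h6.trans (le_of_eq ?_)) h7
  ring

lemma sum_mul_eq_by_parts (G s : ℕ → ℂ) (M : ℕ) :
    ∑ z ∈ range (M + 1), G z * s z = G M * ∑ z ∈ range (M + 1), s z -
      ∑ z ∈ range M, (G (z + 1) - G z) * ∑ y ∈ range (z + 1), s y := by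
  induction M with
  | zero => simp
  | succ M ih =>
    rw [sum_range_succ (fun z => G z * s z), ih, sum_range_succ s (M + 1),
      sum_range_succ (fun z => (G (z + 1) - G z) * ∑ y ∈ range (z + 1), s y) M]
    ring

lemma norm_sum_mul_le_of_partial_sums {G s : ℕ → ℂ} {M : ℕ} {B : ℝ}
    (h : ∀ t ≤ M + 1, ‖∑ z ∈ range t, s z‖ ≤ B) :
    ‖∑ z ∈ range (M + 1), G z * s z‖ ≤
      B * (‖G M‖ + ∑ z ∈ range M, ‖G (z + 1) - G z‖) := by
  rw [sum_mul_eq_by_parts]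
  refine (norm_sub_le _ _).trans ?_
  rw [mul_add, norm_mul, mul_comm ‖G M‖, mul_sum]
  refine add_le_add ?_ ((norm_sum_le _ _).trans (sum_le_sum fun z hz => ?_))
  · gcongr; exact h _ le_rfl
  · rw [norm_mul, mul_comm]
    have := mem_range.1 hz
    gcongr; exact h _ (by omega)

/-- The mean of `χ` over `{0, …, m - 1}`. -/
noncomputable def rangeMean (χ : ℕ → ℂ) (m : ℕ) : ℂ := (∑ z ∈ range m, χ z) / m

lemma sum_range_add_of_periodic {χ : ℕ → ℂ} {m : ℕ} (h : ∀ z, χ (z + m) = χ z) (a : ℕ) :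
    ∑ z ∈ range m, χ (z + a) = ∑ z ∈ range m, χ z := by
  induction a with
  | zero => rfl
  | succ a ih =>
    rw [← ih]
    have h1 := sum_range_succ (fun z => χ (z + a)) m
    have h2 := sum_range_succ' (fun z => χ (z + a)) m
    rw [h1] at h2
    have h3 : χ (m + a) = χ (0 + a) := by rw [add_comm m a, h, zero_add]
    rw [h3] at h2
    simp only [add_right_comm _ 1 a] at h2
    exact (add_right_cancel h2).symm

lemma rangeMean_mul_of_periodic {χ : ℕ → ℂ} {m : ℕ} (hm : 0 < m) (h : ∀ z, χ (z + m) = χ z)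
    {d : ℕ} (hd : 0 < d) : rangeMean χ (m * d) = rangeMean χ m := by
  have hiter : ∀ e z, χ (z + m * e) = χ z := by
    intro e
    induction e with
    | zero => simp
    | succ e ih => intro z; rw [Nat.mul_succ, ← add_assoc, h, ih]
  have : ∀ e : ℕ, ∑ z ∈ range (m * e), χ z = e * ∑ z ∈ range m, χ z := by
    intro e
    induction e with
    | zero => simp
    | succ e ih =>
      rw [Nat.mul_succ, sum_range_add, ih]
      have : ∀ z, χ (m * e + z) = χ z := fun z => by rw [add_comm, hiter]
      simp_rw [this]
      push_cast; ring
  unfold rangeMean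
  rw [this]
  have h1 : (m : ℂ) ≠ 0 := by exact_mod_cast hm.ne'
  have h2 : (d : ℂ) ≠ 0 := by exact_mod_cast hd.ne'
  push_cast
  field_simp

lemma rangeMean_eq_zero_of_shift {χ : ℕ → ℂ} {m : ℕ} (h : ∀ z, χ (z + m) = χ z) {a : ℕ} {c : ℂ}
    (hc : c ≠ 1) (ha : ∀ z, χ (z + a) = c * χ z) : rangeMean χ m = 0 := by
  have h1 := sum_range_add_of_periodic h a
  simp_rw [ha, ← mul_sum] at h1
  have h2 : (c - 1) * ∑ z ∈ range m, χ z = 0 := by rw [sub_mul, h1]; ring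
  have h3 := (mul_eq_zero.1 h2).resolve_left (sub_ne_zero.2 hc)
  simp [rangeMean, h3]

lemma norm_rangeMean_le {χ : ℕ → ℂ} (h1 : ∀ z, ‖χ z‖ = 1) (m : ℕ) : ‖rangeMean χ m‖ ≤ 1 := by
  unfold rangeMean
  rw [norm_div, Complex.norm_natCast]
  refine div_le_one_of_le₀ ((norm_sum_le _ _).trans ?_) (Nat.cast_nonneg _)
  simp [h1]

lemma norm_sum_sub_rangeMean_le {χ : ℕ → ℂ} {m : ℕ} (hm : 0 < m) (h : ∀ z, χ (z + m) = χ z)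
    (h1 : ∀ z, ‖χ z‖ = 1) (t : ℕ) : ‖∑ z ∈ range t, (χ z - rangeMean χ m)‖ ≤ 2 * m := by
  induction t using Nat.strong_induction_on with
  | _ t ih =>
    by_cases ht : t < m
    · refine (norm_sum_le _ _).trans ?_
      calc ∑ z ∈ range t, ‖χ z - rangeMean χ m‖ ≤ ∑ z ∈ range t, (2 : ℝ) :=
            sum_le_sum fun z _ => (norm_sub_le _ _).trans
              (by rw [h1]; linarith [norm_rangeMean_le h1 m])
        _ = t * 2 := by simp
        _ ≤ 2 * m := by have : (t : ℝ) ≤ m := by exact_mod_cast ht.le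
                        linarith
    · have := ih (t - m) (by omega)
      rw [show t = m + (t - m) by omega, sum_range_add]
      have h2 : ∑ z ∈ range m, (χ z - rangeMean χ m) = 0 := by
        rw [sum_sub_distrib, sum_const, card_range, nsmul_eq_mul, rangeMean,
          mul_div_cancel₀ _ (by exact_mod_cast hm.ne'), sub_self]
      rw [h2, zero_add]
      simp_rw [add_comm m, h]
      exact this

/-- The increments `f(z) - f(z-1)`, extended by `0` at `z = 0`. -/
noncomputable def polyIncr (f : Polynomial ℤ) (z : ℕ) : ℝ :=
  if z = 0 then 0 else ((f.eval (z : ℤ) - f.eval ((z : ℤ) - 1) : ℤ) : ℝ)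

lemma polyIncr_succ (f : Polynomial ℤ) (z : ℕ) :
    polyIncr f (z + 1) = ((f.eval ((z + 1 : ℕ) : ℤ) : ℤ) : ℝ) - ((f.eval (z : ℤ) : ℤ) : ℝ) := by
  simp [polyIncr]

/-- The exponential sum over the values of `f`, weighted by the increments of `f`. -/
noncomputable def polySum (f : Polynomial ℤ) (M : ℕ) (α β : ℝ) : ℂ :=
  ∑ z ∈ range (M + 1), (polyIncr f z : ℂ) * eC (α * (f.eval (z : ℤ) : ℤ) + β * z)

/-- A bound for the size and the total variation of the increments. -/
def IncrBound (f : Polynomial ℤ) (M : ℕ) (V : ℝ) : Prop :=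
  (∀ z ≤ M, 0 ≤ polyIncr f z ∧ polyIncr f z ≤ V) ∧
    polyIncr f M + ∑ z ∈ range M, |polyIncr f (z + 1) - polyIncr f z| ≤ V

lemma sum_polyIncr (f : Polynomial ℤ) (h0 : f.eval 0 = 0) (M : ℕ) :
    ∑ z ∈ range (M + 1), polyIncr f z = f.eval (M : ℤ) := by
  induction M with
  | zero => simp [polyIncr, h0]
  | succ M ih => rw [sum_range_succ, ih, polyIncr_succ]; ring

lemma norm_eC_sub_one_sub_le {x : ℝ} (hx : |x| ≤ 1 / 8) :
    ‖eC x - 1 - 2 * Real.pi * Complex.I * x‖ ≤ 40 * x ^ 2 := by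
  have h2 : ‖2 * (Real.pi : ℂ) * Complex.I * (x : ℂ)‖ = 2 * Real.pi * |x| := by
    simp [abs_of_pos Real.pi_pos]
  have h1 := Complex.norm_exp_sub_one_sub_id_le (x := 2 * Real.pi * Complex.I * x) (by
    rw [h2]; nlinarith [Real.pi_lt_four, abs_nonneg x])
  rw [h2] at h1
  refine h1.trans ?_
  rw [mul_pow, sq_abs]
  have : Real.pi < 3.15 := Real.pi_lt_d2
  have : (2 * Real.pi) ^ 2 ≤ 40 := by nlinarith [Real.pi_pos]
  gcongr

lemma norm_polySum_zero_le {f : Polynomial ℤ} (h0 : f.eval 0 = 0) {M : ℕ} {V : ℝ}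
    (hV : IncrBound f M V) (θ β : ℝ) : ‖polySum f M θ β‖ ≤ f.eval (M : ℤ) := by
  rw [← sum_polyIncr f h0]
  refine (norm_sum_le _ _).trans (sum_le_sum fun z hz => ?_)
  rw [norm_mul, norm_eC, mul_one, Complex.norm_real, Real.norm_eq_abs,
    abs_of_nonneg (hV.1 z (Nat.lt_succ_iff.1 (mem_range.1 hz))).1]

lemma abs_mul_norm_polySum_le {f : Polynomial ℤ} (h0 : f.eval 0 = 0) {M : ℕ} {V : ℝ}
    (hV : IncrBound f M V) {θ : ℝ} (hθ : |θ| * V ≤ 1 / 8) :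
    |θ| * ‖polySum f M θ 0‖ ≤ 1 + 8 * θ ^ 2 * V * f.eval (M : ℤ) := by
  have tele : ∑ z ∈ range (M + 1), eC (θ * (f.eval (z : ℤ) : ℤ)) * (1 - eC (-(θ * polyIncr f z)))
      = eC (θ * (f.eval (M : ℤ) : ℤ)) - 1 := by
    induction M with
    | zero => simp [polyIncr, h0, eC_zero]
    | succ M ih =>
      have hV' : IncrBound f M V := by
        refine ⟨fun z hz => hV.1 z (by omega), le_trans ?_ hV.2⟩
        rw [sum_range_succ]
        have := neg_abs_le (polyIncr f (M + 1) - polyIncr f M)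
        linarith
      rw [sum_range_succ, ih hV', mul_sub, ← eC_add, polyIncr_succ]
      ring_nf
  have main : ‖2 * Real.pi * Complex.I * θ * polySum f M θ 0 -
      (eC (θ * (f.eval (M : ℤ) : ℤ)) - 1)‖ ≤ 40 * θ ^ 2 * V * f.eval (M : ℤ) := by
    rw [← tele, polySum, mul_sum, ← sum_sub_distrib, ← sum_polyIncr f h0, mul_sum]
    refine (norm_sum_le _ _).trans (sum_le_sum fun z hz => ?_)
    obtain ⟨hz0, hz1⟩ := hV.1 z (Nat.lt_succ_iff.1 (mem_range.1 hz))
    have e : 2 * Real.pi * Complex.I * θ * ((polyIncr f z : ℂ) *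
        eC (θ * (f.eval (z : ℤ) : ℤ) + 0 * z)) -
        eC (θ * (f.eval (z : ℤ) : ℤ)) * (1 - eC (-(θ * polyIncr f z))) =
        eC (θ * (f.eval (z : ℤ) : ℤ)) * (eC (-(θ * polyIncr f z)) - 1 -
          2 * Real.pi * Complex.I * ((-(θ * polyIncr f z) : ℝ) : ℂ)) := by
      rw [zero_mul, add_zero]; push_cast; ring
    rw [e, norm_mul, norm_eC, one_mul]
    refine (norm_eC_sub_one_sub_le ?_).trans ?_
    · rw [abs_neg, abs_mul, abs_of_nonneg hz0]
      exact (mul_le_mul_of_nonneg_left hz1 (abs_nonneg θ)).trans hθ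
    · rw [neg_sq, mul_pow, pow_two (polyIncr f z)]
      have := mul_le_mul_of_nonneg_right hz1 hz0
      have h2 : 0 ≤ 40 * θ ^ 2 := by positivity
      nlinarith [mul_le_mul_of_nonneg_left this h2]
  have h2 : ‖2 * (Real.pi : ℂ) * Complex.I * θ * polySum f M θ 0‖ =
      2 * Real.pi * (|θ| * ‖polySum f M θ 0‖) := by
    simp [abs_of_pos Real.pi_pos]; ring
  have h3 := norm_sub_norm_le (2 * (Real.pi : ℂ) * Complex.I * θ * polySum f M θ 0)
    (eC (θ * (f.eval (M : ℤ) : ℤ)) - 1)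
  have h4 : ‖eC (θ * (f.eval (M : ℤ) : ℤ)) - 1‖ ≤ 2 :=
    (norm_sub_le _ _).trans (by rw [norm_eC]; norm_num)
  rw [h2] at h3
  have hpi := Real.pi_gt_three
  have h5 : 0 ≤ |θ| * ‖polySum f M θ 0‖ := by positivity
  nlinarith

lemma norm_polySum_sub_le {f : Polynomial ℤ} (h0 : f.eval 0 = 0) {M : ℕ} {V : ℝ}
    (hV : IncrBound f M V) {α θ β : ℝ} {m : ℕ} (hm : 0 < m)
    (hper : ∀ z : ℕ, eC (α * (f.eval ((z + m : ℕ) : ℤ) : ℤ) + β * (z + m : ℕ)) =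
      eC (α * (f.eval (z : ℤ) : ℤ) + β * z)) :
    ‖polySum f M (α + θ) β - rangeMean (fun z => eC (α * (f.eval (z : ℤ) : ℤ) + β * z)) m *
      polySum f M θ 0‖ ≤ 2 * m * (V * (1 + 7 * |θ| * f.eval (M : ℤ))) := by
  set χ : ℕ → ℂ := fun z => eC (α * (f.eval (z : ℤ) : ℤ) + β * z) with hχ
  set G : ℕ → ℂ := fun z => (polyIncr f z : ℂ) * eC (θ * (f.eval (z : ℤ) : ℤ)) with hG
  have e : polySum f M (α + θ) β - rangeMean χ m * polySum f M θ 0 =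
      ∑ z ∈ range (M + 1), G z * (χ z - rangeMean χ m) := by
    simp only [mul_sub, sum_sub_distrib, ← sum_mul]
    congr 1
    · refine sum_congr rfl fun z _ => ?_
      simp only [hG, hχ]
      rw [mul_assoc, ← eC_add]
      ring_nf
    · rw [mul_comm]
      congr 1
      refine sum_congr rfl fun z _ => ?_
      simp [hG]
  rw [e]
  refine (norm_sum_mul_le_of_partial_sums (fun t _ =>
    norm_sum_sub_rangeMean_le hm hper (fun z => norm_eC _) t)).trans ?_
  have hV0 : 0 ≤ V := (hV.1 M le_rfl).1.trans (hV.1 M le_rfl).2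
  have hGM : ‖G M‖ = polyIncr f M := by
    simp only [hG]
    rw [norm_mul, norm_eC, mul_one, Complex.norm_real, Real.norm_eq_abs,
      abs_of_nonneg (hV.1 M le_rfl).1]
  have hstep : ∀ z ∈ range M, ‖G (z + 1) - G z‖ ≤
      |polyIncr f (z + 1) - polyIncr f z| + 7 * |θ| * V * polyIncr f (z + 1) := by
    intro z hz
    have hz' := mem_range.1 hz
    have e2 : G (z + 1) - G z = ((polyIncr f (z + 1) - polyIncr f z : ℝ) : ℂ) *
        eC (θ * (f.eval ((z + 1 : ℕ) : ℤ) : ℤ)) + (polyIncr f z : ℂ) *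
        (eC (θ * (f.eval ((z + 1 : ℕ) : ℤ) : ℤ)) - eC (θ * (f.eval (z : ℤ) : ℤ))) := by
      simp only [hG]; push_cast; ring
    rw [e2]
    refine (norm_add_le _ _).trans (add_le_add ?_ ?_)
    · rw [norm_mul, norm_eC, mul_one, Complex.norm_real, Real.norm_eq_abs]
    · rw [norm_mul, Complex.norm_real, Real.norm_eq_abs, abs_of_nonneg (hV.1 z hz'.le).1]
      have h1 := norm_eC_sub_eC_le (θ * (f.eval ((z + 1 : ℕ) : ℤ) : ℤ)) (θ * (f.eval (z : ℤ) : ℤ))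
      rw [← mul_sub, ← polyIncr_succ, abs_mul, abs_of_nonneg (hV.1 (z + 1) hz').1] at h1
      have h2 := (hV.1 z hz'.le).2
      have h3 := (hV.1 (z + 1) hz').1
      have hpi : Real.pi < 3.15 := Real.pi_lt_d2
      calc polyIncr f z * _ ≤ V * (2 * Real.pi * (|θ| * polyIncr f (z + 1))) := by
            gcongr
        _ = 2 * Real.pi * (|θ| * V * polyIncr f (z + 1)) := by ring
        _ ≤ 7 * (|θ| * V * polyIncr f (z + 1)) := by
            gcongr; linarith
        _ = _ := by ring
  have hsum : ∑ z ∈ range M, polyIncr f (z + 1) = f.eval (M : ℤ) := by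
    rw [← sum_polyIncr f h0, sum_range_succ']
    simp [polyIncr]
  have h5 := sum_le_sum hstep
  rw [sum_add_distrib, ← mul_sum, hsum] at h5
  refine mul_le_mul_of_nonneg_left ?_ (by positivity)
  rw [hGM]
  nlinarith [hV.2]

/-- The real polynomial `α f(X) + β X`. -/
noncomputable def phasePoly (f : Polynomial ℤ) (α β : ℝ) : Polynomial ℝ :=
  Polynomial.C α * f.map (Int.castRingHom ℝ) + Polynomial.C β * Polynomial.X

lemma eval_phasePoly (f : Polynomial ℤ) (α β : ℝ) (z : ℕ) :
    (phasePoly f α β).eval (z : ℝ) = α * (f.eval (z : ℤ) : ℤ) + β * z := by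
  have : (f.map (Int.castRingHom ℝ)).eval (z : ℝ) = ((f.eval (z : ℤ) : ℤ) : ℝ) := by
    have := Polynomial.eval_intCast_map (Int.castRingHom ℝ) f (z : ℤ)
    simpa using this
  simp [phasePoly, this]

lemma natDegree_phasePoly_le {f : Polynomial ℤ} {k : ℕ} (hk : 1 ≤ k) (hf : f.natDegree ≤ k)
    (α β : ℝ) : (phasePoly f α β).natDegree ≤ k := by
  refine Polynomial.natDegree_add_le_of_degree_le ?_ ?_
  · exact (Polynomial.natDegree_C_mul_le _ _).trans (Polynomial.natDegree_map_le.trans hf)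
  · exact (Polynomial.natDegree_C_mul_le _ _).trans (Polynomial.natDegree_X_le.trans hk)

lemma coeff_phasePoly {k : ℕ} (hk : 2 ≤ k) (f : Polynomial ℤ) (α β : ℝ) :
    (phasePoly f α β).coeff k = α * (f.coeff k : ℤ) := by
  simp [phasePoly, Polynomial.coeff_X, show (1 : ℕ) ≠ k by omega]

/-- The condition on the coefficients of `f` at the primes that divide, resp. do not
divide, `W`. -/
def LocalCond (f : Polynomial ℤ) (W : ℕ) : Prop :=
  ∀ p : ℕ, p.Prime → (p ∣ W → ¬ (p : ℤ) ∣ f.coeff 1 ∧ ∀ j, 2 ≤ j → (p : ℤ) ∣ f.coeff j) ∧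
    (¬ p ∣ W → ¬ (p : ℤ) ∣ f.leadingCoeff)

section residues

variable {P : ℕ} [NeZero P]

lemma addOrderOf_dvd_iff_exists_int (γ : ZMod P) (n : ℕ) :
    addOrderOf γ ∣ n ↔ ∃ j : ℤ, (γ.val : ℝ) / P * n = j := by
  have hP : (P : ℝ) ≠ 0 := by exact_mod_cast NeZero.ne P
  rw [addOrderOf_dvd_iff_nsmul_eq_zero, nsmul_eq_mul]
  have h : ((n : ZMod P) * γ = 0) ↔ P ∣ n * γ.val := by
    rw [← ZMod.natCast_eq_zero_iff]
    push_cast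
    rw [ZMod.natCast_zmod_val]
  rw [h]
  constructor
  · rintro ⟨c, hc⟩
    refine ⟨c, ?_⟩
    have : (n : ℝ) * γ.val = P * c := by exact_mod_cast hc
    field_simp
    push_cast
    linarith
  · rintro ⟨j, hj⟩
    have : (n * γ.val : ℝ) = P * j := by
      field_simp at hj
      linarith
    have h2 : ((n * γ.val : ℕ) : ℤ) = P * j := by exact_mod_cast this
    exact_mod_cast Dvd.intro j h2.symm

lemma addOrderOf_dvd_modulus (γ : ZMod P) : addOrderOf γ ∣ P := by
  have := addOrderOf_dvd_card (x := γ)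
  rwa [ZMod.card] at this

lemma card_addOrderOf_eq_le (d : ℕ) : #{γ : ZMod P | addOrderOf γ = d} ≤ d := by
  by_cases h : d ∣ P
  · rw [IsAddCyclic.card_addOrderOf_eq_totient (by rwa [ZMod.card])]
    exact Nat.totient_le d
  · rw [filter_eq_empty_iff.2]
    · simp
    · rintro γ - rfl
      exact h (addOrderOf_dvd_modulus γ)

/-- The phase `z ↦ e(u f(z)/v + γ z/P)`. -/
noncomputable def localPhase (f : Polynomial ℤ) (u : ℤ) (v : ℕ) (γ : ZMod P) (z : ℕ) : ℂ :=
  eC ((u : ℝ) / v * (f.eval (z : ℤ) : ℤ) + (γ.val : ℝ) / P * z)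

/-- The mean of `localPhase` over a full period. -/
noncomputable def localMean (f : Polynomial ℤ) (u : ℤ) (v : ℕ) (γ : ZMod P) : ℂ :=
  rangeMean (localPhase f u v γ) (v * addOrderOf γ)

lemma localPhase_add {f : Polynomial ℤ} {u : ℤ} {v : ℕ} (hv : 0 < v) (γ : ZMod P) (z h : ℕ)
    {d : ℤ} (hd : (v : ℤ) ∣ f.eval ((z + h : ℕ) : ℤ) - f.eval (z : ℤ) - d) :
    localPhase f u v γ (z + h) =
      eC ((u : ℝ) / v * d + (γ.val : ℝ) / P * h) * localPhase f u v γ z := by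
  obtain ⟨c, hc⟩ := hd
  unfold localPhase
  rw [← eC_add]
  refine eC_eq_of_sub_eq_intCast (u * c) ?_
  have hv' : (v : ℝ) ≠ 0 := by exact_mod_cast hv.ne'
  have : ((f.eval ((z + h : ℕ) : ℤ) : ℤ) : ℝ) = (f.eval (z : ℤ) : ℤ) + d + v * c := by
    exact_mod_cast (by linarith : f.eval ((z + h : ℕ) : ℤ) = f.eval (z : ℤ) + d + v * c)
  rw [this]
  push_cast
  field_simp
  ring

lemma localPhase_add_mul {f : Polynomial ℤ} {u : ℤ} {v : ℕ} (hv : 0 < v) (γ : ZMod P)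
    (z d : ℕ) : localPhase f u v γ (z + v * d) =
      eC ((γ.val : ℝ) / P * (v * d : ℕ)) * localPhase f u v γ z := by
  have := localPhase_add (f := f) (u := u) hv γ z (v * d) (d := 0) (by
    rw [sub_zero]
    refine dvd_trans ?_ (Polynomial.sub_dvd_eval_sub _ _ f)
    exact ⟨d, by push_cast; ring⟩)
  simpa using this

lemma localPhase_periodic {f : Polynomial ℤ} {u : ℤ} {v : ℕ} (hv : 0 < v) (γ : ZMod P)
    {d : ℕ} (hd : addOrderOf γ ∣ v * d) (z : ℕ) :
    localPhase f u v γ (z + v * d) = localPhase f u v γ z := by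
  obtain ⟨j, hj⟩ := (addOrderOf_dvd_iff_exists_int γ _).1 hd
  rw [localPhase_add_mul hv, hj, eC_intCast, one_mul]

lemma localMean_eq_zero_of_not_dvd {f : Polynomial ℤ} {u : ℤ} {v : ℕ} (hv : 0 < v) {γ : ZMod P}
    (h : ¬ addOrderOf γ ∣ v) : localMean f u v γ = 0 := by
  refine rangeMean_eq_zero_of_shift (localPhase_periodic hv γ (dvd_mul_left _ _)) (a := v)
    (c := eC ((γ.val : ℝ) / P * v)) ?_ fun z => ?_
  · rw [Ne, eC_eq_one_iff, ← addOrderOf_dvd_iff_exists_int]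
    exact h
  · simpa using localPhase_add_mul hv γ z 1

lemma localMean_eq_of_dvd {f : Polynomial ℤ} {u : ℤ} {v : ℕ} (hv : 0 < v) {γ : ZMod P}
    (h : addOrderOf γ ∣ v) : localMean f u v γ = rangeMean (localPhase f u v γ) v := by
  refine rangeMean_mul_of_periodic hv (fun z => ?_) (addOrderOf_pos γ)
  simpa using localPhase_periodic (f := f) (u := u) hv γ (d := 1) (by simpa using h) z

lemma norm_localMean_le_one (f : Polynomial ℤ) (u : ℤ) (v : ℕ) (γ : ZMod P) :
    ‖localMean f u v γ‖ ≤ 1 := norm_rangeMean_le (fun _ => norm_eC _) _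

lemma localMean_eq_zero_of_prime_dvd {f : Polynomial ℤ} {W : ℕ} (hf : LocalCond f W)
    (hPW : Nat.Coprime P W) {u : ℤ} {v : ℕ} (hv : 0 < v) (huv : IsCoprime u (v : ℤ))
    {p : ℕ} (hp : p.Prime) (hpv : p ∣ v) (hpW : p ∣ W) (γ : ZMod P) :
    localMean f u v γ = 0 := by
  by_cases hq : addOrderOf γ ∣ v
  swap
  · exact localMean_eq_zero_of_not_dvd hv hq
  obtain ⟨h, rfl⟩ := hpv
  have hh : 0 < h := Nat.pos_of_mul_pos_left hv
  obtain ⟨hc1, hcj⟩ := (hf p hp).1 hpW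
  have hqp : Nat.Coprime (addOrderOf γ) p :=
    (hPW.coprime_dvd_left (addOrderOf_dvd_modulus γ)).coprime_dvd_right hpW
  have hqh : addOrderOf γ ∣ h := hqp.dvd_of_dvd_mul_left hq
  obtain ⟨j, hj⟩ := (addOrderOf_dvd_iff_exists_int γ h).1 hqh
  have hdiv : Polynomial.C (p : ℤ) ∣
      f - Polynomial.C (f.coeff 0) - Polynomial.C (f.coeff 1) * Polynomial.X := by
    rw [Polynomial.C_dvd_iff_dvd_coeff]
    intro i
    rcases i with _ | _ | i
    · rw [Polynomial.coeff_sub, Polynomial.coeff_sub, Polynomial.coeff_C_mul,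
        Polynomial.coeff_X_zero, Polynomial.coeff_C_zero]
      simp
    · rw [Polynomial.coeff_sub, Polynomial.coeff_sub, Polynomial.coeff_C_mul,
        Polynomial.coeff_X_one, Polynomial.coeff_C_of_ne_zero (by omega)]
      simp
    · rw [Polynomial.coeff_sub, Polynomial.coeff_sub, Polynomial.coeff_C_mul,
        Polynomial.coeff_X_of_ne_one (by omega), Polynomial.coeff_C_of_ne_zero (by omega)]
      simpa using hcj (i + 2) (by omega)
  obtain ⟨g, hg⟩ := hdiv
  have heval : ∀ x : ℤ, f.eval x = f.coeff 0 + f.coeff 1 * x + p * g.eval x := by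
    intro x
    have := congrArg (Polynomial.eval x) hg
    simp only [Polynomial.eval_sub, Polynomial.eval_mul, Polynomial.eval_C, Polynomial.eval_X]
      at this
    linarith
  have hp0 : (p : ℝ) ≠ 0 := by exact_mod_cast hp.ne_zero
  have hh0 : (h : ℝ) ≠ 0 := by exact_mod_cast hh.ne'
  refine rangeMean_eq_zero_of_shift (localPhase_periodic hv γ (dvd_mul_left _ _)) (a := h)
    (c := eC ((u : ℝ) / (p * h : ℕ) * (f.coeff 1 * h : ℤ) + (γ.val : ℝ) / P * h)) ?_ fun z => ?_
  · rw [Ne, eC_eq_one_iff, hj]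
    rintro ⟨n, hn⟩
    have h1 : ((u * f.coeff 1 : ℤ) : ℝ) = (p : ℝ) * (n - j : ℤ) := by
      push_cast at hn ⊢
      field_simp at hn
      linarith
    have h2 : (p : ℤ) ∣ u * f.coeff 1 := ⟨n - j, by exact_mod_cast h1⟩
    rcases Int.Prime.dvd_mul' hp h2 with h3 | h3
    · have h4 : (p : ℤ) ∣ ((p * h : ℕ) : ℤ) := ⟨h, by push_cast; ring⟩
      have h5 := huv.isUnit_of_dvd' h3 h4
      rw [Int.isUnit_iff] at h5
      have := hp.two_le
      omega
    · exact hc1 h3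
  · refine localPhase_add hv γ z h ?_
    rw [heval, heval]
    obtain ⟨c, hc⟩ := Polynomial.sub_dvd_eval_sub ((z + h : ℕ) : ℤ) (z : ℤ) g
    have : (((z + h : ℕ) : ℤ) - (z : ℤ)) = h := by push_cast; ring
    rw [this] at hc
    refine ⟨c, ?_⟩
    have e : f.coeff 0 + f.coeff 1 * ((z + h : ℕ) : ℤ) + p * g.eval ((z + h : ℕ) : ℤ) -
      (f.coeff 0 + f.coeff 1 * (z : ℤ) + p * g.eval (z : ℤ)) - f.coeff 1 * h =
      p * (g.eval ((z + h : ℕ) : ℤ) - g.eval (z : ℤ)) := by push_cast; ring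
    rw [e, hc]; push_cast; ring

/-- The total contribution of the residues `γ` at the rational point `u / v`. -/
noncomputable def localSum (f : Polynomial ℤ) (u : ℤ) (v : ℕ) (P : ℕ) [NeZero P] : ℝ :=
  ∑ γ : ZMod P, (#(addOrderOf γ).divisors : ℝ) ^ 3 / addOrderOf γ * ‖localMean f u v γ‖

lemma localSum_nonneg (f : Polynomial ℤ) (u : ℤ) (v : ℕ) : 0 ≤ localSum f u v P :=
  sum_nonneg fun _ _ => by positivity

lemma localSum_eq_zero_of_prime_dvd {f : Polynomial ℤ} {W : ℕ} (hf : LocalCond f W)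
    (hPW : Nat.Coprime P W) {u : ℤ} {v : ℕ} (hv : 0 < v) (huv : IsCoprime u (v : ℤ))
    {p : ℕ} (hp : p.Prime) (hpv : p ∣ v) (hpW : p ∣ W) : localSum f u v P = 0 := by
  refine sum_eq_zero fun γ _ => ?_
  rw [localMean_eq_zero_of_prime_dvd hf hPW hv huv hp hpv hpW, norm_zero, mul_zero]

lemma localSum_le_of_norm_le {f : Polynomial ℤ} {u : ℤ} {v : ℕ} (hv : 0 < v) {B : ℝ}
    (hB0 : 0 ≤ B) (hB : ∀ γ : ZMod P, addOrderOf γ ∣ v → ‖localMean f u v γ‖ ≤ B) :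
    localSum f u v P ≤ (#v.divisors : ℝ) ^ 4 * B := by
  have h1 : ∀ γ : ZMod P, (#(addOrderOf γ).divisors : ℝ) ^ 3 / addOrderOf γ *
      ‖localMean f u v γ‖ ≤
      if addOrderOf γ ∣ v then (#v.divisors : ℝ) ^ 3 * B * (1 / addOrderOf γ) else 0 := by
    intro γ
    split_ifs with h
    · have h2 : (#(addOrderOf γ).divisors : ℝ) ≤ #v.divisors := by
        exact_mod_cast card_le_card (Nat.divisors_subset_of_dvd hv.ne' h)
      calc _ ≤ (#v.divisors : ℝ) ^ 3 / addOrderOf γ * B := by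
            gcongr; exact hB γ h
        _ = _ := by ring
    · rw [localMean_eq_zero_of_not_dvd hv h, norm_zero, mul_zero]
  refine (sum_le_sum fun γ _ => h1 γ).trans ?_
  rw [← sum_filter, ← mul_sum]
  have h2 : ∑ γ : ZMod P with addOrderOf γ ∣ v, 1 / (addOrderOf γ : ℝ) ≤ #v.divisors := by
    have hmaps : ∀ γ ∈ (univ.filter fun γ : ZMod P => addOrderOf γ ∣ v),
        addOrderOf γ ∈ v.divisors := fun γ hγ =>
      Nat.mem_divisors.2 ⟨(mem_filter.1 hγ).2, hv.ne'⟩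
    rw [← sum_fiberwise_of_maps_to hmaps, ← nsmul_one, ← sum_const]
    refine sum_le_sum fun d hd => ?_
    have hd0 : 0 < d := Nat.pos_of_mem_divisors hd
    calc _ = ∑ γ ∈ (univ.filter fun γ : ZMod P => addOrderOf γ ∣ v) with addOrderOf γ = d,
          1 / (d : ℝ) := sum_congr rfl fun γ hγ => by rw [(mem_filter.1 hγ).2]
      _ = #{γ ∈ (univ.filter fun γ : ZMod P => addOrderOf γ ∣ v) | addOrderOf γ = d} *
          (1 / (d : ℝ)) := by rw [sum_const, nsmul_eq_mul]
      _ ≤ d * (1 / (d : ℝ)) := by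
          gcongr
          refine (card_le_card ?_).trans (card_addOrderOf_eq_le (P := P) d)
          exact filter_subset_filter _ (subset_univ _)
      _ = 1 := by field_simp
  calc _ ≤ (#v.divisors : ℝ) ^ 3 * B * #v.divisors := by gcongr
    _ = _ := by ring

lemma eq_X_of_localCond {f : Polynomial ℤ} {W : ℕ} (hf : LocalCond f W) (hdeg : f.natDegree = 1)
    (h0 : f.eval 0 = 0) (hlc : 0 < f.leadingCoeff) : f = Polynomial.X := by
  have hc : f.leadingCoeff = f.coeff 1 := by rw [Polynomial.leadingCoeff, hdeg]
  have h1 : f.coeff 1 = 1 := by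
    rw [hc] at hlc
    by_contra h
    obtain ⟨p, hp, hpd⟩ := Nat.exists_prime_and_dvd (n := (f.coeff 1).natAbs) (by omega)
    have hpd' : (p : ℤ) ∣ f.coeff 1 := Int.natCast_dvd.2 hpd
    by_cases hpW : p ∣ W
    · exact ((hf p hp).1 hpW).1 hpd'
    · exact (hf p hp).2 hpW (hc ▸ hpd')
  rw [Polynomial.eq_X_add_C_of_natDegree_le_one hdeg.le, h1, Polynomial.coeff_zero_eq_eval_zero, h0]
  simp

lemma localMean_X_ne_zero {u : ℤ} {v : ℕ} (hv : 0 < v) (huv : IsCoprime u (v : ℤ)) {γ : ZMod P}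
    (h : localMean Polynomial.X u v γ ≠ 0) :
    addOrderOf γ = v ∧ ∃ j : ℤ, (u : ℝ) / v + (γ.val : ℝ) / P = j := by
  have hj : ∃ j : ℤ, (u : ℝ) / v + (γ.val : ℝ) / P = j := by
    rw [← eC_eq_one_iff]
    by_contra hne
    refine h (rangeMean_eq_zero_of_shift (localPhase_periodic hv γ (dvd_mul_left _ _)) (a := 1)
      hne fun z => ?_)
    have := localPhase_add (f := Polynomial.X) (u := u) hv γ z 1 (d := 1) (by simp)
    simpa using this
  refine ⟨Nat.dvd_antisymm ?_ ?_, hj⟩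
  · by_contra hq
    exact h (localMean_eq_zero_of_not_dvd hv hq)
  · obtain ⟨j, hj⟩ := hj
    obtain ⟨i, hi⟩ := (addOrderOf_dvd_iff_exists_int γ _).1 dvd_rfl
    have hv' : (v : ℝ) ≠ 0 := by exact_mod_cast hv.ne'
    have h1 : (u : ℝ) * addOrderOf γ = v * (j * addOrderOf γ - i) := by
      rw [← hi, ← hj]; field_simp; ring
    have h2 : u * addOrderOf γ = v * (j * addOrderOf γ - i) := by exact_mod_cast h1
    have h3 : (v : ℤ) ∣ (addOrderOf γ : ℤ) := huv.symm.dvd_of_dvd_mul_left ⟨_, h2⟩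
    exact_mod_cast h3

lemma localSum_X_le {u : ℤ} {v : ℕ} (hv : 0 < v) (huv : IsCoprime u (v : ℤ)) :
    localSum Polynomial.X u v P ≤ (#v.divisors : ℝ) ^ 3 / v := by
  classical
  by_cases hex : ∃ γ : ZMod P, localMean Polynomial.X u v γ ≠ 0
  · obtain ⟨γ, hγ⟩ := hex
    obtain ⟨h1, j, hj⟩ := localMean_X_ne_zero hv huv hγ
    unfold localSum
    rw [sum_eq_single γ]
    · rw [h1]
      exact mul_le_of_le_one_right (by positivity) (norm_localMean_le_one _ _ _ _)
    · intro γ' _ hne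
      by_contra hne2
      have h2 : localMean Polynomial.X u v γ' ≠ 0 := fun h0 => hne2 (by rw [h0]; simp)
      obtain ⟨-, j', hj'⟩ := localMean_X_ne_zero hv huv h2
      apply hne
      have hP : (P : ℝ) ≠ 0 := by exact_mod_cast NeZero.ne P
      have h3 : ((γ'.val : ℝ) - γ.val) = P * (j' - j : ℤ) := by
        have : (γ'.val : ℝ) / P - γ.val / P = (j' - j : ℤ) := by push_cast; linarith
        field_simp at this
        linarith
      have h4 : (γ'.val : ℤ) - γ.val = P * (j' - j) := by exact_mod_cast h3
      have h5 := congrArg (Int.cast : ℤ → ZMod P) h4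
      push_cast at h5
      rw [ZMod.natCast_zmod_val, ZMod.natCast_zmod_val, CharP.cast_eq_zero, zero_mul] at h5
      exact sub_eq_zero.1 h5
    · simp
  · push Not at hex
    unfold localSum
    rw [sum_eq_zero fun γ _ => by rw [hex γ]; simp]
    positivity

lemma localSum_X_eq_zero {u : ℤ} {v : ℕ} (hv : 0 < v) (huv : IsCoprime u (v : ℤ))
    (hvP : ¬ v ∣ P) : localSum Polynomial.X u v P = 0 := by
  refine sum_eq_zero fun γ _ => ?_
  by_cases h : localMean Polynomial.X u v γ = 0
  · rw [h]; simp
  · exact absurd ((localMean_X_ne_zero hv huv h).1 ▸ addOrderOf_dvd_modulus γ) hvP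

end residues

lemma exists_localSum_le (k : ℕ) (hk : 1 ≤ k) : ∃ C : ℝ, 0 < C ∧
    ∀ (f : Polynomial ℤ) (W P : ℕ) [NeZero P] (u : ℤ) (v : ℕ), f.natDegree = k →
      f.eval 0 = 0 → 0 < f.leadingCoeff → LocalCond f W → Nat.Coprime P W → 0 < v →
      IsCoprime u (v : ℤ) → localSum f u v P ≤ C * (v : ℝ) ^ (-(1 / 2 ^ k : ℝ)) := by
  rcases Nat.lt_or_ge 1 k with hk2 | hk1
  · obtain ⟨Cw, hCw, hweyl⟩ := exists_weyl_bound k hk2 (1 / 4) (by norm_num)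
    obtain ⟨j, rfl⟩ : ∃ j, k = j + 1 := ⟨k - 1, by omega⟩
    rw [Nat.add_sub_cancel] at hweyl
    obtain ⟨Ct, hCt, hdiv⟩ := exists_card_divisors_le (1 / 4 * (1 / 4 * (1 / 2 ^ j)))
      (by positivity)
    refine ⟨Ct ^ 4 * (3 * Cw) ^ (1 / 2 ^ j : ℝ), by positivity, ?_⟩
    intro f W P _ u v hdeg h0 hlc hf hPW hv huv
    have hv1 : (1 : ℝ) ≤ v := by exact_mod_cast hv
    have hv0 : (0 : ℝ) < v := by linarith
    by_cases hbad : ∃ p : ℕ, p.Prime ∧ p ∣ v ∧ p ∣ W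
    · obtain ⟨p, hp, hpv, hpW⟩ := hbad
      rw [localSum_eq_zero_of_prime_dvd hf hPW hv huv hp hpv hpW]
      positivity
    have hcop : IsCoprime (u * f.coeff (j + 1)) (v : ℤ) := by
      refine IsCoprime.mul_left huv ?_
      rw [Int.isCoprime_iff_nat_coprime, Int.natAbs_natCast]
      refine Nat.coprime_of_dvd fun p hp hpa hpv => ?_
      have hpW : ¬ p ∣ W := fun h => hbad ⟨p, hp, hpv, h⟩
      have := (hf p hp).2 hpW
      rw [Polynomial.leadingCoeff, hdeg] at this
      exact this (Int.natCast_dvd.2 hpa)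
    set B : ℝ := (3 * Cw) ^ (1 / 2 ^ j : ℝ) * (v : ℝ) ^ (-(3 / 4) * (1 / 2 ^ j) : ℝ) with hB
    have hmean : ∀ γ : ZMod P, addOrderOf γ ∣ v → ‖localMean f u v γ‖ ≤ B := by
      intro γ hγ
      rw [localMean_eq_of_dvd hv hγ]
      have h1 := hweyl v v (u * f.coeff (j + 1)) (phasePoly f ((u : ℝ) / v) ((γ.val : ℝ) / P))
        hv hv hcop (natDegree_phasePoly_le hk hdeg.le _ _) (by
          rw [coeff_phasePoly hk2]
          push_cast
          rw [show (u : ℝ) / v * (f.coeff (j + 1)) - u * (f.coeff (j + 1)) / v = 0 by ring]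
          simp) (Nat.le_self_pow (by omega) v) v le_rfl
      simp only [eval_phasePoly] at h1
      have h2 : ‖rangeMean (localPhase f u v γ) v‖ ^ 2 ^ j ≤
          3 * Cw * (v : ℝ) ^ (-(3 / 4) : ℝ) := by
        unfold rangeMean
        rw [norm_div, div_pow, Complex.norm_natCast, div_le_iff₀ (by positivity)]
        refine (h1.trans ?_)
        have e1 : (v : ℝ) ^ (-(3 / 4) : ℝ) = (v : ℝ) ^ (1 / 4 : ℝ) * (1 / v) := by
          rw [one_div (v : ℝ), ← Real.rpow_neg_one, ← Real.rpow_add hv0]; norm_num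
        rw [e1]
        have e2 : v / (v : ℝ) ^ (j + 1) ≤ 1 / v := by
          rw [div_le_div_iff₀ (by positivity) hv0, one_mul, ← pow_two]
          exact pow_le_pow_right₀ hv1 hk2
        calc _ ≤ Cw * (v : ℝ) ^ 2 ^ j * (v : ℝ) ^ (1 / 4 : ℝ) * (1 / v + 1 / v + 1 / v) := by
              gcongr
          _ = _ := by ring
      have h3 : ‖rangeMean (localPhase f u v γ) v‖ =
          (‖rangeMean (localPhase f u v γ) v‖ ^ 2 ^ j) ^ (1 / 2 ^ j : ℝ) := by
        rw [← Real.rpow_natCast, ← Real.rpow_mul (norm_nonneg _)]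
        push_cast
        rw [mul_one_div_cancel (by positivity), Real.rpow_one]
      rw [h3, hB, Real.rpow_mul hv0.le, ← Real.mul_rpow (by positivity) (by positivity)]
      gcongr
    refine (localSum_le_of_norm_le hv (by positivity) hmean).trans ?_
    calc (#v.divisors : ℝ) ^ 4 * B
        ≤ (Ct * (v : ℝ) ^ (1 / 4 * (1 / 4 * (1 / 2 ^ j)) : ℝ)) ^ 4 * B := by
          gcongr; exact hdiv v hv.ne'
      _ = Ct ^ 4 * (3 * Cw) ^ (1 / 2 ^ j : ℝ) * ((v : ℝ) ^ ((1 / 4 * (1 / 2 ^ j)) : ℝ) *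
            (v : ℝ) ^ (-(3 / 4) * (1 / 2 ^ j) : ℝ)) := by
          rw [mul_pow, ← Real.rpow_natCast ((v : ℝ) ^ _), ← Real.rpow_mul hv0.le, hB]
          rw [show (1 / 4 * (1 / 4 * (1 / 2 ^ j)) : ℝ) * ((4 : ℕ) : ℝ) = 1 / 4 * (1 / 2 ^ j) by
            push_cast; ring]
          ring
      _ = _ := by
          rw [← Real.rpow_add hv0]
          congr 2
          rw [pow_succ]; field_simp; ring
  · have hk' : k = 1 := by omega
    subst hk'
    obtain ⟨Ct, hCt, hdiv⟩ := exists_card_divisors_le (1 / 6) (by positivity)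
    refine ⟨Ct ^ 3, by positivity, ?_⟩
    intro f W P _ u v hdeg h0 hlc hf hPW hv huv
    have hv0 : (0 : ℝ) < v := by exact_mod_cast hv
    rw [eq_X_of_localCond hf hdeg h0 hlc]
    refine (localSum_X_le hv huv).trans ?_
    calc (#v.divisors : ℝ) ^ 3 / v ≤ (Ct * (v : ℝ) ^ (1 / 6 : ℝ)) ^ 3 / v := by
          gcongr; exact hdiv v hv.ne'
      _ = Ct ^ 3 * ((v : ℝ) ^ (1 / 2 : ℝ) * (v : ℝ) ^ (-1 : ℝ)) := by
          rw [mul_pow, ← Real.rpow_natCast ((v : ℝ) ^ _), ← Real.rpow_mul hv0.le,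
            Real.rpow_neg_one]
          norm_num
          ring
      _ = _ := by rw [← Real.rpow_add hv0]; norm_num

/-- The conditions on a polynomial `f`, a length `M` and a size `N` under which the
exponential sums `polySum f M` are estimated. -/
structure Admissible (k : ℕ) (δ : ℝ) (f : Polynomial ℤ) (W M N : ℕ) (V : ℝ) : Prop where
  natDegree_eq : f.natDegree = k
  eval_zero : f.eval 0 = 0
  leadingCoeff_pos : 0 < f.leadingCoeff
  localCond : LocalCond f W
  leadingCoeff_le : (f.leadingCoeff : ℝ) ≤ (N : ℝ) ^ δ
  incrBound : IncrBound f M V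
  mul_le : V * M ≤ (N : ℝ) ^ δ * (f.eval (M : ℤ) : ℤ)
  half_le : (N : ℝ) / 2 ≤ (f.eval (M : ℤ) : ℤ)
  le_size : ((f.eval (M : ℤ) : ℤ) : ℝ) ≤ N
  le_pow : (N : ℝ) ≤ (N : ℝ) ^ δ * (M : ℝ) ^ k
  le : M ≤ N

lemma rpow_mul_rpow_le {x a b c : ℝ} (hx : 1 ≤ x) (h : a + b ≤ c) : x ^ a * x ^ b ≤ x ^ c := by
  rw [← Real.rpow_add (by linarith)]
  exact Real.rpow_le_rpow_of_exponent_le hx h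

lemma Admissible.rpow_le {k : ℕ} {δ : ℝ} {f : Polynomial ℤ} {W M N : ℕ} {V : ℝ}
    (h : Admissible k δ f W M N V) (hk : 1 ≤ k) (hδ : 0 ≤ δ) (hN : 1 ≤ N) :
    (N : ℝ) ^ (1 / (k : ℝ) - δ) ≤ M := by
  have hN1 : (1 : ℝ) ≤ N := by exact_mod_cast hN
  have hN0 : (0 : ℝ) < N := by linarith
  have hk0 : (1 : ℝ) ≤ k := by exact_mod_cast hk
  have h1 : (N : ℝ) ^ (1 - δ) ≤ (M : ℝ) ^ k := by
    rw [Real.rpow_sub hN0, Real.rpow_one, div_le_iff₀ (by positivity), mul_comm]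
    exact h.le_pow
  refine le_of_pow_le_pow_left₀ (n := k) (by omega) (by positivity) ?_
  refine le_trans ?_ h1
  rw [← Real.rpow_natCast, ← Real.rpow_mul hN0.le]
  refine Real.rpow_le_rpow_of_exponent_le hN1 ?_
  rw [sub_mul, one_div, inv_mul_cancel₀ (by positivity)]
  nlinarith

lemma Admissible.one_le {k : ℕ} {δ : ℝ} {f : Polynomial ℤ} {W M N : ℕ} {V : ℝ}
    (h : Admissible k δ f W M N V) (hN : 1 ≤ N) : 1 ≤ M := by
  have hN1 : (1 : ℝ) ≤ N := by exact_mod_cast hN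
  rcases Nat.eq_zero_or_pos M with rfl | h1
  · have := h.half_le
    simp only [Nat.cast_zero, h.eval_zero, Int.cast_zero] at this
    linarith
  · exact h1

lemma exists_weyl_minor (k : ℕ) (hk : 2 ≤ k) (δ : ℝ) (hδ : 0 < δ) (hδ1 : δ ≤ 1 / (16 * k)) :
    ∃ C : ℝ, 0 < C ∧ ∀ (f : Polynomial ℤ) (W M N : ℕ) (V : ℝ), Admissible k δ f W M N V →
      1 ≤ N → ∀ (α β : ℝ) (u : ℤ) (v : ℕ), 0 < v → IsCoprime u (v : ℤ) →
      |α * f.leadingCoeff - u / v| ≤ 1 / (v : ℝ) ^ 2 → (N : ℝ) ^ (1 / (8 * k : ℝ)) < v →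
      (v : ℝ) ≤ (N : ℝ) ^ (1 - 1 / (8 * k : ℝ)) → ∀ t ≤ M + 1,
      ‖∑ z ∈ range t, eC (α * (f.eval (z : ℤ) : ℤ) + β * z)‖ ≤
        C * (N : ℝ) ^ (-(1 / (k * 2 ^ (k + 2) : ℝ) - 2 * δ)) * M := by
  obtain ⟨C, hC, hweyl⟩ := exists_weyl_bound k hk δ hδ
  obtain ⟨j, rfl⟩ : ∃ j, k = j + 1 := ⟨k - 1, by omega⟩
  rw [Nat.add_sub_cancel] at hweyl
  refine ⟨(3 * C) ^ (1 / 2 ^ j : ℝ) + 1, by positivity, ?_⟩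
  intro f W M N V h hN α β u v hv huv hα hv1 hv2 t ht
  set k : ℝ := ((j + 1 : ℕ) : ℝ) with hkdef
  have hk2 : (2 : ℝ) ≤ k := by rw [hkdef]; exact_mod_cast hk
  have hk0 : 0 < k := by linarith
  have hN1 : (1 : ℝ) ≤ N := by exact_mod_cast hN
  have hN0 : (0 : ℝ) < N := by linarith
  have hM := h.one_le hN
  have hM1 : (1 : ℝ) ≤ M := by exact_mod_cast hM
  have hMk := h.rpow_le (by omega) hδ.le hN
  rw [← hkdef] at hMk
  set τ : ℝ := 1 / (8 * k) with hτ
  have hkτ : 1 / k = 8 * τ := by rw [hτ]; field_simp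
  have hτ0 : 0 < τ := by positivity
  have hδτ : 2 * δ ≤ τ := by
    have : τ = 2 * (1 / (16 * k)) := by rw [hτ]; field_simp; norm_num
    linarith
  rw [hkτ] at hMk
  have hσ : 1 / (k * 2 ^ (j + 1 + 2)) = τ / 2 ^ j := by
    rw [hτ]; field_simp; ring
  rw [hσ]
  have h2j : (1 : ℝ) ≤ 2 ^ j := one_le_pow₀ (by norm_num)
  have hMpow : (N : ℝ) ^ (1 - δ) ≤ (M : ℝ) ^ (j + 1) := by
    rw [Real.rpow_sub hN0, Real.rpow_one, div_le_iff₀ (by positivity), mul_comm]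
    exact h.le_pow
  have hvM : v ≤ M ^ (j + 1) := by
    have : (v : ℝ) ≤ (M : ℝ) ^ (j + 1) :=
      hv2.trans ((Real.rpow_le_rpow_of_exponent_le hN1 (by linarith)).trans hMpow)
    exact_mod_cast this
  have hlc : f.leadingCoeff = f.coeff (j + 1) := by
    rw [Polynomial.leadingCoeff, h.natDegree_eq]
  have key : ∀ t ≤ M, ‖∑ z ∈ range t, eC (α * (f.eval (z : ℤ) : ℤ) + β * z)‖ ≤
      (3 * C) ^ (1 / 2 ^ j : ℝ) * (N : ℝ) ^ (-(τ / 2 ^ j - 2 * δ)) * M := by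
    intro t ht
    have h1 := hweyl M v u (phasePoly f α β) hM hv huv
      (natDegree_phasePoly_le (by omega) h.natDegree_eq.le _ _)
      (by rw [coeff_phasePoly hk, ← hlc]; exact hα) hvM t ht
    simp only [eval_phasePoly] at h1
    refine le_of_pow_le_pow_left₀ (n := 2 ^ j) (by positivity) (by positivity) (h1.trans ?_)
    rw [mul_pow, mul_pow, ← Real.rpow_natCast ((3 * C) ^ _), ← Real.rpow_mul (by positivity),
      ← Real.rpow_natCast ((N : ℝ) ^ _), ← Real.rpow_mul hN0.le]
    have e1 : (1 / 2 ^ j * (2 ^ j : ℕ) : ℝ) = 1 := by push_cast; field_simp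
    rw [e1, Real.rpow_one]
    have b0 : (M : ℝ) ^ δ ≤ (N : ℝ) ^ δ := by
      have : (M : ℝ) ≤ N := by exact_mod_cast h.le
      gcongr
    have b1 : 1 / (v : ℝ) ≤ (N : ℝ) ^ (δ - τ) := by
      rw [show δ - τ = -(τ - δ) by ring, Real.rpow_neg hN0.le, one_div]
      gcongr
      exact (Real.rpow_le_rpow_of_exponent_le hN1 (by linarith)).trans hv1.le
    have b2 : 1 / (M : ℝ) ≤ (N : ℝ) ^ (δ - τ) := by
      rw [show δ - τ = -(τ - δ) by ring, Real.rpow_neg hN0.le, one_div]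
      gcongr
      exact (Real.rpow_le_rpow_of_exponent_le hN1 (by linarith)).trans hMk
    have b3 : (v : ℝ) / (M : ℝ) ^ (j + 1) ≤ (N : ℝ) ^ (δ - τ) := by
      rw [div_le_iff₀ (by positivity)]
      calc (v : ℝ) ≤ (N : ℝ) ^ (1 - τ) := hv2
        _ = (N : ℝ) ^ (δ - τ) * (N : ℝ) ^ (1 - δ) := by rw [← Real.rpow_add hN0]; congr 1; ring
        _ ≤ _ := by gcongr
    calc C * (M : ℝ) ^ 2 ^ j * (M : ℝ) ^ δ * (1 / v + 1 / M + v / (M : ℝ) ^ (j + 1))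
        ≤ C * (M : ℝ) ^ 2 ^ j * (N : ℝ) ^ δ *
          ((N : ℝ) ^ (δ - τ) + (N : ℝ) ^ (δ - τ) + (N : ℝ) ^ (δ - τ)) := by gcongr
      _ = 3 * C * ((N : ℝ) ^ δ * (N : ℝ) ^ (δ - τ)) * (M : ℝ) ^ 2 ^ j := by ring
      _ ≤ _ := by
        gcongr
        refine rpow_mul_rpow_le hN1 ?_
        push_cast
        rw [neg_mul, sub_mul, div_mul_cancel₀ _ (by positivity)]
        nlinarith
  have hone : 1 ≤ (N : ℝ) ^ (-(τ / 2 ^ j - 2 * δ)) * M := by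
    calc (1 : ℝ) ≤ (N : ℝ) ^ (-(τ / 2 ^ j - 2 * δ) + (8 * τ - δ)) := by
          refine Real.one_le_rpow hN1 ?_
          have : τ / 2 ^ j ≤ τ := div_le_self hτ0.le h2j
          linarith
      _ ≤ _ := by rw [Real.rpow_add hN0]; gcongr
  rcases Nat.lt_or_ge M t with h1 | h1
  · obtain rfl : t = M + 1 := by omega
    rw [sum_range_succ]
    refine (norm_add_le _ _).trans ?_
    rw [norm_eC]
    have := key M le_rfl
    nlinarith
  · have := key t h1
    nlinarith

lemma one_div_le_nint {t : ℝ} {d : ℕ} (hd : 0 < d) {j : ℤ} (h : t * d = j) (ht : ∀ n : ℤ, t ≠ n) :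
    1 / (d : ℝ) ≤ nint t := by
  have hd0 : (0 : ℝ) < d := by exact_mod_cast hd
  rw [nint, div_le_iff₀ hd0]
  have h1 : |t - round t| * d = |((j - round t * d : ℤ) : ℝ)| := by
    have h2 : |t - round t| * d = |(t - round t) * d| := by rw [abs_mul, abs_of_pos hd0]
    rw [h2, sub_mul, h]; push_cast; rfl
  rw [h1, ← Int.cast_abs]
  have : j - round t * d ≠ 0 := by
    intro h0
    refine ht (round t) ?_
    have h2 : (j : ℝ) - (round t : ℝ) * d = 0 := by exact_mod_cast h0
    rw [← h, ← sub_mul] at h2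
    rcases mul_eq_zero.1 h2 with h3 | h3
    · linarith
    · exact absurd h3 hd0.ne'
  exact_mod_cast Int.one_le_abs this

lemma norm_sum_linear_minor_le {P : ℕ} [NeZero P] {X : ℝ} {δ : ℝ} (hX : 1 ≤ X) (hδ : δ ≤ 1 / 80)
    (hX2 : 2 * X ^ (2 * δ) ≤ X ^ (7 / 8 : ℝ)) {α : ℝ} {γ : ZMod P} {u : ℤ} {v : ℕ} (hv : 0 < v)
    (huv : IsCoprime u (v : ℤ)) (hα : |α - u / v| ≤ 1 / (v * X ^ (7 / 8 : ℝ)))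
    (hv1 : X ^ (1 / 8 : ℝ) < v) (hv2 : v ≤ X ^ (7 / 8 : ℝ))
    (hq : (addOrderOf γ : ℝ) ≤ X ^ (2 * δ)) (t : ℕ) :
    ‖∑ z ∈ range t, eC (α * z + (γ.val : ℝ) / P * z)‖ ≤ X ^ (7 / 8 + 2 * δ : ℝ) := by
  have hX0 : 0 < X := by linarith
  have hv0 : (0 : ℝ) < v := by exact_mod_cast hv
  set q := addOrderOf γ with hqdef
  have hqpos : 0 < q := addOrderOf_pos γ
  have hq0 : (0 : ℝ) < q := by exact_mod_cast hqpos
  obtain ⟨j, hj⟩ := (addOrderOf_dvd_iff_exists_int γ q).1 dvd_rfl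
  set s : ℝ := (u : ℝ) / v + (γ.val : ℝ) / P with hs
  have hlow : 1 / ((v * q : ℕ) : ℝ) ≤ nint s := by
    refine one_div_le_nint (by positivity) (j := u * q + v * j) ?_ fun n hn => ?_
    · push_cast
      rw [hs, add_mul, ← hj]
      field_simp
    · have h1 : (v : ℤ) ∣ u * q := by
        refine ⟨n * q - j, ?_⟩
        have : (u : ℝ) * q = v * (n * q - j) := by
          rw [← hj, ← hn, hs]; field_simp; ring
        exact_mod_cast this
      have h2 : v ∣ q := by exact_mod_cast huv.symm.dvd_of_dvd_mul_left h1
      have h3 : (v : ℝ) ≤ q := by exact_mod_cast Nat.le_of_dvd hqpos h2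
      have h4 : X ^ (2 * δ) ≤ X ^ (1 / 8 : ℝ) :=
        Real.rpow_le_rpow_of_exponent_le hX (by linarith)
      linarith
  have hdist : 1 / (2 * (v * q) : ℝ) ≤ nint (α + (γ.val : ℝ) / P) := by
    have h1 := nint_add_le (α + (γ.val : ℝ) / P) (u / v - α)
    have h2 : nint (u / v - α) ≤ 1 / (2 * (v * q) : ℝ) := by
      refine (nint_le_abs _).trans ?_
      rw [abs_sub_comm]
      refine hα.trans ?_
      apply one_div_le_one_div_of_le (by positivity)
      nlinarith
    rw [show α + (γ.val : ℝ) / P + (u / v - α) = s by rw [hs]; ring] at h1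
    have h3 : 1 / ((v * q : ℕ) : ℝ) = 1 / (2 * (v * q) : ℝ) + 1 / (2 * (v * q) : ℝ) := by
      push_cast; field_simp; ring
    linarith
  have h4 := norm_geom_eC_mul_nint_le (α + (γ.val : ℝ) / P) t
  simp only [add_mul] at h4
  have h5 : ‖∑ z ∈ range t, eC (α * z + (γ.val : ℝ) / P * z)‖ ≤ v * q := by
    have h6 : ‖∑ z ∈ range t, eC (α * z + (γ.val : ℝ) / P * z)‖ * (2 * (1 / (2 * (v * q)))) ≤ 1 :=
      le_trans (by gcongr) h4
    rw [show (2 * (1 / (2 * (v * q))) : ℝ) = 1 / (v * q) by field_simp, mul_one_div,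
      div_le_one (by positivity)] at h6
    exact h6
  refine h5.trans ?_
  rw [Real.rpow_add hX0]
  gcongr

section orderSum

variable {P : ℕ} [NeZero P]

/-- A weighted sum of `polySum f M α β` over the rationals `β` of small denominator
dividing `P`. -/
noncomputable def orderSum (f : Polynomial ℤ) (M P : ℕ) [NeZero P] (T α : ℝ) : ℝ :=
  ∑ γ : ZMod P with (addOrderOf γ : ℝ) ≤ T,
    (#(addOrderOf γ).divisors : ℝ) ^ 3 / addOrderOf γ * ‖polySum f M α ((γ.val : ℝ) / P)‖

lemma sum_weights_le {T : ℝ} (hT : 0 ≤ T) :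
    ∑ γ : ZMod P with (addOrderOf γ : ℝ) ≤ T,
      (#(addOrderOf γ).divisors : ℝ) ^ 3 / addOrderOf γ ≤ T ^ 4 := by
  classical
  have hmap : ∀ γ ∈ (univ.filter fun γ : ZMod P => (addOrderOf γ : ℝ) ≤ T),
      addOrderOf γ ∈ Icc 1 ⌊T⌋₊ := fun γ hγ => by
    rw [mem_filter] at hγ
    exact mem_Icc.2 ⟨addOrderOf_pos γ, Nat.le_floor hγ.2⟩
  rw [← sum_fiberwise_of_maps_to hmap]
  calc _ ≤ ∑ q ∈ Icc 1 ⌊T⌋₊, T ^ 3 := by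
        refine sum_le_sum fun q hq => ?_
        obtain ⟨hq1, hq2⟩ := mem_Icc.1 hq
        have hq0 : (0 : ℝ) < q := by exact_mod_cast hq1
        have hqT : (q : ℝ) ≤ T := (Nat.cast_le.2 hq2).trans (Nat.floor_le hT)
        have hdq : (#q.divisors : ℝ) ≤ q := by exact_mod_cast Nat.card_divisors_le_self q
        calc _ ≤ ∑ γ ∈ (univ.filter fun γ : ZMod P => (addOrderOf γ : ℝ) ≤ T) with
                addOrderOf γ = q, (q : ℝ) ^ 2 := by
              refine sum_le_sum fun γ hγ => ?_
              rw [(mem_filter.1 hγ).2, div_le_iff₀ hq0]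
              calc (#q.divisors : ℝ) ^ 3 ≤ (q : ℝ) ^ 3 := by gcongr
                _ = _ := by ring
          _ ≤ q * (q : ℝ) ^ 2 := by
              rw [sum_const, nsmul_eq_mul]
              gcongr
              refine (card_le_card ?_).trans (card_addOrderOf_eq_le (P := P) q)
              exact filter_subset_filter _ (subset_univ _)
          _ = (q : ℝ) ^ 3 := by ring
          _ ≤ _ := by gcongr
    _ ≤ T * T ^ 3 := by
        rw [sum_const, nsmul_eq_mul, Nat.card_Icc, Nat.add_sub_cancel]
        gcongr
        exact Nat.floor_le hT
    _ = _ := by ring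

lemma orderSum_le {f : Polynomial ℤ} {M : ℕ} {T α B : ℝ} (hT : 0 ≤ T) (hB : 0 ≤ B)
    (h : ∀ γ : ZMod P, (addOrderOf γ : ℝ) ≤ T → ‖polySum f M α ((γ.val : ℝ) / P)‖ ≤ B) :
    orderSum f M P T α ≤ T ^ 4 * B := by
  refine le_trans ?_ (mul_le_mul_of_nonneg_right (sum_weights_le (P := P) hT) hB)
  rw [orderSum, sum_mul]
  refine sum_le_sum fun γ hγ => ?_
  have := h γ (mem_filter.1 hγ).2
  gcongr

lemma norm_polySum_le_of_partial {f : Polynomial ℤ} {M : ℕ} {V α β B : ℝ}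
    (hV : IncrBound f M V) (hB : 0 ≤ B)
    (h : ∀ t ≤ M + 1, ‖∑ z ∈ range t, eC (α * (f.eval (z : ℤ) : ℤ) + β * z)‖ ≤ B) :
    ‖polySum f M α β‖ ≤ B * V := by
  refine (norm_sum_mul_le_of_partial_sums h).trans ?_
  gcongr
  refine le_trans (le_of_eq ?_) hV.2
  rw [Complex.norm_real, Real.norm_eq_abs, abs_of_nonneg (hV.1 M le_rfl).1]
  congr 1
  refine sum_congr rfl fun z _ => ?_
  rw [← Complex.ofReal_sub, Complex.norm_real, Real.norm_eq_abs]

end orderSum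

section pointwise

variable {P : ℕ} [NeZero P]

lemma orderSum_minor_le {k : ℕ} {σ δ C : ℝ} (hδ : 0 < δ) (hδσ : 400 * δ ≤ σ) (hC : 0 < C)
    {f : Polynomial ℤ} {W M N : ℕ} {V : ℝ} (h : Admissible k δ f W M N V) (hN : 1 ≤ N) {α : ℝ}
    (hpart : ∀ γ : ZMod P, (addOrderOf γ : ℝ) ≤ (N : ℝ) ^ (2 * δ) → ∀ t ≤ M + 1,
      ‖∑ z ∈ range t, eC (α * (f.eval (z : ℤ) : ℤ) + (γ.val : ℝ) / P * z)‖ ≤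
        C * (N : ℝ) ^ (-(σ - 3 * δ)) * M) :
    orderSum f M P ((N : ℝ) ^ (2 * δ)) α ≤
      C * (N : ℝ) ^ (-(3 / 4 * σ)) * (f.eval (M : ℤ) : ℤ) := by
  have hN1 : (1 : ℝ) ≤ N := by exact_mod_cast hN
  have hN0 : (0 : ℝ) < N := by linarith
  have hF : (0 : ℝ) ≤ (f.eval (M : ℤ) : ℤ) := le_trans (by positivity) h.half_le
  refine (orderSum_le (B := C * (N : ℝ) ^ (-(σ - 3 * δ)) * ((N : ℝ) ^ δ * (f.eval (M : ℤ) : ℤ)))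
    (by positivity) (by positivity) fun γ hγ => ?_).trans ?_
  · refine (norm_polySum_le_of_partial h.incrBound (by positivity) (hpart γ hγ)).trans ?_
    rw [mul_assoc _ (M : ℝ) V, mul_comm (M : ℝ)]
    have := h.mul_le
    gcongr
  · calc _ = C * (((N : ℝ) ^ (2 * δ)) ^ 4 * (N : ℝ) ^ (-(σ - 3 * δ)) * (N : ℝ) ^ δ) *
          (f.eval (M : ℤ) : ℤ) := by ring
      _ ≤ _ := by
        gcongr
        rw [← Real.rpow_natCast, ← Real.rpow_mul hN0.le, ← Real.rpow_add hN0, ← Real.rpow_add hN0]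
        refine Real.rpow_le_rpow_of_exponent_le hN1 ?_
        push_cast
        linarith

lemma norm_polySum_major_le {k : ℕ} {δ τ : ℝ} (hk : 1 ≤ k) (hτ : τ = 1 / (8 * k)) (hδ : 0 < δ)
    (hδτ : 100 * δ ≤ τ) {f : Polynomial ℤ} {W M N : ℕ} {V : ℝ} (h : Admissible k δ f W M N V)
    (hN : 1 ≤ N) (hN8 : 8 ≤ (N : ℝ) ^ τ) {θ : ℝ} (hθ : |θ| ≤ (N : ℝ) ^ (τ - 1)) :
    ‖polySum f M θ 0‖ ≤ (f.eval (M : ℤ) : ℤ) * (8 / (1 + N * |θ|)) := by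
  have hN1 : (1 : ℝ) ≤ N := by exact_mod_cast hN
  have hN0 : (0 : ℝ) < N := by linarith
  have hM := h.one_le hN
  have hM1 : (1 : ℝ) ≤ M := by exact_mod_cast hM
  have hMk := h.rpow_le hk hδ.le hN
  have hk0 : (0 : ℝ) < k := by exact_mod_cast hk
  have hkτ : 1 / (k : ℝ) = 8 * τ := by rw [hτ]; field_simp
  rw [hkτ] at hMk
  have hF : (0 : ℝ) < (f.eval (M : ℤ) : ℤ) := lt_of_lt_of_le (by positivity) h.half_le
  set F : ℝ := ((f.eval (M : ℤ) : ℤ) : ℝ) with hFdef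
  have hV0 : 0 ≤ V := (h.incrBound.1 0 (by omega)).1.trans (h.incrBound.1 0 (by omega)).2
  have hV : V ≤ (N : ℝ) ^ (1 + 2 * δ - 8 * τ) := by
    rw [show 1 + 2 * δ - 8 * τ = (1 + δ) - (8 * τ - δ) by ring, Real.rpow_sub hN0,
      le_div_iff₀ (by positivity)]
    calc V * (N : ℝ) ^ (8 * τ - δ) ≤ V * M := by gcongr
      _ ≤ (N : ℝ) ^ δ * F := h.mul_le
      _ ≤ (N : ℝ) ^ δ * N := by have := h.le_size; gcongr
      _ = _ := by rw [Real.rpow_add hN0, Real.rpow_one, mul_comm]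
  have h8 : (N : ℝ) ^ (-τ) ≤ 1 / 8 := by
    rw [Real.rpow_neg hN0.le, one_div]
    gcongr
  have h1 : |θ| * V ≤ 1 / 8 := by
    calc |θ| * V ≤ (N : ℝ) ^ (τ - 1) * (N : ℝ) ^ (1 + 2 * δ - 8 * τ) := by gcongr
      _ ≤ (N : ℝ) ^ (-τ) := rpow_mul_rpow_le hN1 (by linarith)
      _ ≤ _ := h8
  have h2 : 8 * θ ^ 2 * V * F ≤ 1 := by
    calc 8 * θ ^ 2 * V * F = 8 * (|θ| * (|θ| * V) * F) := by rw [← sq_abs θ]; ring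
      _ ≤ 8 * ((N : ℝ) ^ (τ - 1) * ((N : ℝ) ^ (τ - 1) * (N : ℝ) ^ (1 + 2 * δ - 8 * τ)) * N) := by
          have := h.le_size
          gcongr
      _ = 8 * (N : ℝ) ^ ((τ - 1) + ((τ - 1) + (1 + 2 * δ - 8 * τ)) + 1) := by
          rw [Real.rpow_add hN0, Real.rpow_add hN0, Real.rpow_add hN0, Real.rpow_one]
      _ ≤ 8 * (N : ℝ) ^ (-τ) := by
          gcongr 8 * ?_
          exact Real.rpow_le_rpow_of_exponent_le hN1 (by linarith)
      _ ≤ 1 := by linarith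
  have h3 := abs_mul_norm_polySum_le h.eval_zero h.incrBound h1
  have h4 := norm_polySum_zero_le h.eval_zero h.incrBound θ 0
  have h5 := h.half_le
  rw [← hFdef] at h3 h4 h5
  rw [mul_div_assoc', le_div_iff₀ (by positivity)]
  have h6 : (N : ℝ) * (|θ| * ‖polySum f M θ 0‖) ≤ N * 2 := by
    gcongr
    linarith
  nlinarith

lemma orderSum_major_le {k : ℕ} {δ τ : ℝ} (hk : 1 ≤ k) (hτ : τ = 1 / (8 * k)) (hδ : 0 < δ)
    (hδτ : 100 * δ ≤ τ) {f : Polynomial ℤ} {W M N : ℕ} {V : ℝ} (h : Admissible k δ f W M N V)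
    (hN : 1 ≤ N) (hN8 : 8 ≤ (N : ℝ) ^ τ) {u : ℤ} {v : ℕ} (hv : 0 < v)
    (hvN : (v : ℝ) ≤ (N : ℝ) ^ (τ + δ)) {θ : ℝ} (hθ : |θ| ≤ (N : ℝ) ^ (τ - 1)) :
    orderSum f M P ((N : ℝ) ^ (2 * δ)) (u / v + θ) ≤
      (f.eval (M : ℤ) : ℤ) *
        (8 * localSum f u v P / (1 + N * |θ|) + 16 * (N : ℝ) ^ (-(3 / 4 * τ))) := by
  have hN1 : (1 : ℝ) ≤ N := by exact_mod_cast hN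
  have hN0 : (0 : ℝ) < N := by linarith
  have hM := h.one_le hN
  have hM1 : (1 : ℝ) ≤ M := by exact_mod_cast hM
  have hMk := h.rpow_le hk hδ.le hN
  have hk0 : (0 : ℝ) < k := by exact_mod_cast hk
  have hkτ : 1 / (k : ℝ) = 8 * τ := by rw [hτ]; field_simp
  rw [hkτ] at hMk
  have hmain := norm_polySum_major_le hk hτ hδ hδτ h hN hN8 hθ
  have hF : (0 : ℝ) < (f.eval (M : ℤ) : ℤ) := lt_of_lt_of_le (by positivity) h.half_le
  set F : ℝ := ((f.eval (M : ℤ) : ℤ) : ℝ) with hFdef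
  have hV0 : 0 ≤ V := (h.incrBound.1 0 (by omega)).1.trans (h.incrBound.1 0 (by omega)).2
  have hV : V ≤ F * (N : ℝ) ^ (2 * δ - 8 * τ) := by
    rw [show 2 * δ - 8 * τ = δ - (8 * τ - δ) by ring, Real.rpow_sub hN0, mul_div_assoc',
      le_div_iff₀ (by positivity), mul_comm F]
    exact le_trans (by gcongr) h.mul_le
  set T : ℝ := (N : ℝ) ^ (2 * δ) with hT
  have herr : ∀ γ : ZMod P, (addOrderOf γ : ℝ) ≤ T →
      ‖polySum f M (u / v + θ) ((γ.val : ℝ) / P)‖ ≤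
        ‖localMean f u v γ‖ * ‖polySum f M θ 0‖ + 16 * F * (N : ℝ) ^ (5 * δ - 6 * τ) := by
    intro γ hγ
    have h1 := norm_polySum_sub_le h.eval_zero h.incrBound (α := (u : ℝ) / v) (θ := θ)
      (β := (γ.val : ℝ) / P) (m := v * addOrderOf γ) (Nat.mul_pos hv (addOrderOf_pos γ))
      (fun z => localPhase_periodic (f := f) (u := u) hv γ (dvd_mul_left _ _) z)
    have h2 : 2 * ((v * addOrderOf γ : ℕ) : ℝ) * (V * (1 + 7 * |θ| * F)) ≤
        16 * F * (N : ℝ) ^ (5 * δ - 6 * τ) := by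
      have h3 : 1 + 7 * |θ| * F ≤ 8 * (N : ℝ) ^ τ := by
        have h4 : |θ| * F ≤ (N : ℝ) ^ τ := by
          calc |θ| * F ≤ (N : ℝ) ^ (τ - 1) * N := by have := h.le_size; gcongr
            _ = _ := by rw [Real.rpow_sub hN0, Real.rpow_one, div_mul_cancel₀ _ hN0.ne']
        nlinarith
      push_cast
      calc 2 * ((v : ℝ) * addOrderOf γ) * (V * (1 + 7 * |θ| * F))
          ≤ 2 * ((N : ℝ) ^ (τ + δ) * (N : ℝ) ^ (2 * δ)) *
            ((F * (N : ℝ) ^ (2 * δ - 8 * τ)) * (8 * (N : ℝ) ^ τ)) := by gcongr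
        _ = 16 * F * ((N : ℝ) ^ (τ + δ) * (N : ℝ) ^ (2 * δ) * (N : ℝ) ^ (2 * δ - 8 * τ) *
            (N : ℝ) ^ τ) := by ring
        _ = _ := by
          rw [← Real.rpow_add hN0, ← Real.rpow_add hN0, ← Real.rpow_add hN0]
          congr 2; ring
    have h3 := norm_le_norm_add_norm_sub' (polySum f M (u / v + θ) ((γ.val : ℝ) / P))
      (localMean f u v γ * polySum f M θ 0)
    rw [norm_mul] at h3
    have h4 := h1.trans h2
    exact h3.trans (by gcongr; exact h4)
  calc orderSum f M P T (u / v + θ)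
      ≤ ∑ γ : ZMod P with (addOrderOf γ : ℝ) ≤ T,
        ((#(addOrderOf γ).divisors : ℝ) ^ 3 / addOrderOf γ * ‖localMean f u v γ‖ *
            ‖polySum f M θ 0‖ +
          (#(addOrderOf γ).divisors : ℝ) ^ 3 / addOrderOf γ *
            (16 * F * (N : ℝ) ^ (5 * δ - 6 * τ))) := by
        refine sum_le_sum fun γ hγ => ?_
        rw [mul_assoc, ← mul_add]
        have := herr γ (mem_filter.1 hγ).2
        gcongr
    _ ≤ localSum f u v P * ‖polySum f M θ 0‖ +
          T ^ 4 * (16 * F * (N : ℝ) ^ (5 * δ - 6 * τ)) := by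
        rw [sum_add_distrib, ← sum_mul, ← sum_mul]
        gcongr
        · exact sum_le_sum_of_subset_of_nonneg (subset_univ _) fun _ _ _ => by positivity
        · exact sum_weights_le (by positivity)
    _ ≤ localSum f u v P * (F * (8 / (1 + N * |θ|))) +
          F * (16 * (N : ℝ) ^ (-(3 / 4 * τ))) := by
        have := localSum_nonneg (P := P) f u v
        gcongr ?_ + ?_
        · gcongr
        · calc T ^ 4 * (16 * F * (N : ℝ) ^ (5 * δ - 6 * τ))
              = F * (16 * (T ^ 4 * (N : ℝ) ^ (5 * δ - 6 * τ))) := by ring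
            _ ≤ _ := by
              gcongr
              rw [hT, ← Real.rpow_natCast, ← Real.rpow_mul hN0.le, ← Real.rpow_add hN0]
              refine Real.rpow_le_rpow_of_exponent_le hN1 ?_
              push_cast
              linarith
    _ = _ := by ring

theorem exists_orderSum_le (k : ℕ) (hk : 1 ≤ k) {σ : ℝ} (hσ : σ = 1 / (k * 2 ^ (k + 2))) :
    ∃ C : ℝ, 0 < C ∧ ∀ (f : Polynomial ℤ) (W M N P : ℕ) [NeZero P] (V : ℝ),
      Admissible k (σ / 400) f W M N V → 1 ≤ N → 8 ≤ (N : ℝ) ^ (1 / (8 * k) : ℝ) → ∀ α : ℝ,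
      orderSum f M P ((N : ℝ) ^ (2 * (σ / 400))) α ≤
        C * (N : ℝ) ^ (-(3 / 4 * σ)) * (f.eval (M : ℤ) : ℤ) ∨
      ∃ (u : ℤ) (v : ℕ) (θ : ℝ), 0 < v ∧ IsCoprime u (v : ℤ) ∧ α = u / v + θ ∧ |θ| ≤ 1 ∧
        orderSum f M P ((N : ℝ) ^ (2 * (σ / 400))) α ≤ (f.eval (M : ℤ) : ℤ) *
          (8 * localSum f u v P / (1 + N * |θ|) + 16 * (N : ℝ) ^ (-(3 / 4 * σ))) := by
  have hk1 : (1 : ℝ) ≤ k := by exact_mod_cast hk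
  have hk0 : (0 : ℝ) < k := by linarith
  set τ : ℝ := 1 / (8 * k) with hτ
  set δ : ℝ := σ / 400 with hδdef
  have hστ : σ = τ / 2 ^ (k - 1) := by
    obtain ⟨j, rfl⟩ : ∃ j, k = j + 1 := ⟨k - 1, by omega⟩
    rw [hσ, hτ, Nat.add_sub_cancel]; field_simp; ring
  have hτ0 : 0 < τ := by positivity
  have hτ8 : τ ≤ 1 / 8 := by
    rw [hτ]; exact one_div_le_one_div_of_le (by norm_num) (by linarith)
  have hσ0 : 0 < σ := by rw [hστ]; positivity
  have hσle : σ ≤ τ := by rw [hστ]; exact div_le_self hτ0.le (one_le_pow₀ (by norm_num))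
  have hδ : 0 < δ := by positivity
  have hδ400 : 400 * δ = σ := by rw [hδdef]; ring
  have hpart : ∃ C : ℝ, 0 < C ∧ ∀ (f : Polynomial ℤ) (W M N P : ℕ) [NeZero P] (V : ℝ),
      Admissible k δ f W M N V → 1 ≤ N → 8 ≤ (N : ℝ) ^ τ → ∀ (α : ℝ) (u : ℤ) (v : ℕ), 0 < v →
      IsCoprime u (v : ℤ) → |α * f.leadingCoeff - u / v| ≤ 1 / (v * (N : ℝ) ^ (1 - τ)) →
      (N : ℝ) ^ τ < v → (v : ℝ) ≤ (N : ℝ) ^ (1 - τ) →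
      ∀ γ : ZMod P, (addOrderOf γ : ℝ) ≤ (N : ℝ) ^ (2 * δ) → ∀ t ≤ M + 1,
      ‖∑ z ∈ range t, eC (α * (f.eval (z : ℤ) : ℤ) + (γ.val : ℝ) / P * z)‖ ≤
        C * (N : ℝ) ^ (-(σ - 3 * δ)) * M := by
    rcases Nat.lt_or_ge 1 k with hk2 | hk2
    · obtain ⟨C, hC, h⟩ := exists_weyl_minor k hk2 δ hδ (by
        rw [show 1 / (16 * k : ℝ) = τ / 2 by rw [hτ]; field_simp; norm_num]; linarith)
      refine ⟨C, hC, fun f W M N P _ V had hN _ α u v hv huv hα hv1 hv2 γ _ t ht => ?_⟩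
      have hN1 : (1 : ℝ) ≤ N := by exact_mod_cast hN
      have hv0 : (0 : ℝ) < v := by exact_mod_cast hv
      refine (h f W M N V had hN α _ u v hv huv (hα.trans ?_) hv1 hv2 t ht).trans ?_
      · rw [sq]; gcongr
      · rw [← hσ]
        gcongr C * ?_ * _
        exact Real.rpow_le_rpow_of_exponent_le hN1 (by linarith)
    · obtain rfl : k = 1 := by omega
      refine ⟨1, one_pos, fun f W M N P _ V had hN hN8 α u v hv huv hα hv1 hv2 γ hγ t _ => ?_⟩
      have hN1 : (1 : ℝ) ≤ N := by exact_mod_cast hN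
      have hN0 : (0 : ℝ) < N := by linarith
      have hτ1 : τ = 1 / 8 := by rw [hτ]; norm_num
      have hτ7 : 1 - τ = 7 / 8 := by rw [hτ1]; norm_num
      obtain rfl := eq_X_of_localCond had.localCond had.natDegree_eq had.eval_zero
        had.leadingCoeff_pos
      rw [hτ7] at hα hv2
      rw [hτ1] at hv1 hN8
      have h2 : 2 * (N : ℝ) ^ (2 * δ) ≤ (N : ℝ) ^ (7 / 8 : ℝ) := by
        calc 2 * (N : ℝ) ^ (2 * δ) ≤ (N : ℝ) ^ (1 / 8 : ℝ) * (N : ℝ) ^ (2 * δ) := by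
              gcongr; linarith
          _ ≤ _ := rpow_mul_rpow_le hN1 (by linarith)
      have h3 := norm_sum_linear_minor_le (X := N) (δ := δ) hN1 (by linarith) h2 hv huv
        (by simpa using hα) hv1 hv2 hγ t
      have h4 := had.rpow_le le_rfl hδ.le hN
      simp only [Polynomial.eval_X, Int.cast_natCast]
      refine h3.trans ?_
      calc (N : ℝ) ^ (7 / 8 + 2 * δ) ≤ (N : ℝ) ^ (-(σ - 3 * δ)) * (N : ℝ) ^ (1 - δ) := by
            rw [← Real.rpow_add hN0]
            exact Real.rpow_le_rpow_of_exponent_le hN1 (by linarith)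
        _ ≤ _ := by
            rw [one_mul]
            gcongr
            simpa using h4
  obtain ⟨C, hC, hpart⟩ := hpart
  refine ⟨C, hC, fun f W M N P _ V had hN hN8 α => ?_⟩
  have hN1 : (1 : ℝ) ≤ N := by exact_mod_cast hN
  have hN0 : (0 : ℝ) < N := by linarith
  obtain ⟨q, hq, hqn⟩ := Real.exists_rat_abs_sub_le_and_den_le (α * f.leadingCoeff)
    (n := ⌊(N : ℝ) ^ (1 - τ)⌋₊) (Nat.floor_pos.2 (Real.one_le_rpow hN1 (by linarith)))
  have hden : (0 : ℝ) < q.den := by exact_mod_cast q.den_pos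
  have hq2 : (q.den : ℝ) ≤ (N : ℝ) ^ (1 - τ) :=
    (Nat.cast_le.2 hqn).trans (Nat.floor_le (by positivity))
  have hq1 : |α * f.leadingCoeff - q.num / q.den| ≤ 1 / (q.den * (N : ℝ) ^ (1 - τ)) := by
    rw [← Rat.cast_def]
    refine hq.trans ?_
    rw [mul_comm]
    have := (Nat.lt_floor_add_one ((N : ℝ) ^ (1 - τ))).le
    gcongr
  have hcop : IsCoprime q.num (q.den : ℤ) := Rat.isCoprime_num_den q
  rcases lt_or_ge ((N : ℝ) ^ τ) q.den with hlt | hle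
  · exact Or.inl (orderSum_minor_le hδ hδ400.le hC had hN fun γ hγ =>
      hpart f W M N P V had hN hN8 α q.num q.den q.den_pos hcop hq1 hlt hq2 γ hγ)
  · right
    set A := f.leadingCoeff with hA
    have hA0 : (0 : ℝ) < A := by exact_mod_cast had.leadingCoeff_pos
    have hA1 : (1 : ℝ) ≤ A := by exact_mod_cast had.leadingCoeff_pos
    set r : ℚ := q / A with hr
    have hrq : (r : ℝ) = q / A := by rw [hr]; push_cast; rfl
    have hrden : r.den ≤ q.den * A.toNat := by
      have hAn : ((A.toNat : ℕ) : ℤ) = A := Int.toNat_of_nonneg had.leadingCoeff_pos.le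
      refine Nat.le_of_dvd (Nat.mul_pos q.den_pos (by have := had.leadingCoeff_pos; omega)) ?_
      have h1 : r = Rat.divInt q.num ((q.den * A.toNat : ℕ) : ℤ) := by
        rw [Rat.divInt_eq_div, hr]
        have hAq : ((A.toNat : ℕ) : ℚ) = (A : ℚ) := by exact_mod_cast hAn
        push_cast
        rw [hAq, ← div_div, Rat.num_div_den]
      rw [h1]
      exact_mod_cast Rat.den_dvd q.num ((q.den * A.toNat : ℕ) : ℤ)
    have hθ : |α - r| ≤ (N : ℝ) ^ (τ - 1) := by
      have h1 : α - r = (α * A - q.num / q.den) / A := by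
        rw [← Rat.cast_def, hrq]; field_simp
      rw [h1, abs_div, abs_of_pos hA0]
      refine (div_le_self (abs_nonneg _) hA1).trans (hq1.trans ?_)
      rw [show τ - 1 = -(1 - τ) by ring, Real.rpow_neg hN0.le, one_div]
      gcongr
      have : (1 : ℝ) ≤ q.den := by exact_mod_cast q.den_pos
      exact le_mul_of_one_le_left (by positivity) this
    refine ⟨r.num, r.den, α - r, r.den_pos, Rat.isCoprime_num_den r, ?_, hθ.trans ?_, ?_⟩
    · rw [← Rat.cast_def]; ring
    · exact Real.rpow_le_one_of_one_le_of_nonpos hN1 (by linarith)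
    · have h1 := orderSum_major_le (P := P) hk hτ hδ (by linarith) had hN hN8 (u := r.num)
        r.den_pos ?_ hθ
      · rw [← Rat.cast_def, add_sub_cancel] at h1
        refine h1.trans ?_
        have hF : (0 : ℝ) < (f.eval (M : ℤ) : ℤ) := lt_of_lt_of_le (by positivity) had.half_le
        gcongr _ * (_ + 16 * ?_)
        exact Real.rpow_le_rpow_of_exponent_le hN1 (by linarith)
      · calc (r.den : ℝ) ≤ ((q.den * A.toNat : ℕ) : ℝ) := by exact_mod_cast hrden
          _ = q.den * A := by
            rw [Nat.cast_mul, ← Int.cast_natCast A.toNat,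
              Int.toNat_of_nonneg had.leadingCoeff_pos.le]
          _ ≤ (N : ℝ) ^ τ * (N : ℝ) ^ δ := by
            have := had.leadingCoeff_le
            gcongr
          _ = _ := by rw [Real.rpow_add hN0]

end pointwise

section characters

variable {P : ℕ} [NeZero P]

lemma eC_val_add (x y : ZMod P) (n : ℤ) :
    eC (((x + y).val : ℝ) / P * n) = eC ((x.val : ℝ) / P * n) * eC ((y.val : ℝ) / P * n) := by
  have hP : (P : ℝ) ≠ 0 := by exact_mod_cast NeZero.ne P
  rw [← eC_add]
  refine eC_eq_of_sub_eq_intCast (-(((x.val + y.val) / P : ℕ) : ℤ) * n) ?_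
  have h1 := Nat.mod_add_div (x.val + y.val) P
  have h2 : (((x.val + y.val) % P : ℕ) : ℝ) = x.val + y.val - P * ((x.val + y.val) / P : ℕ) := by
    have : (((x.val + y.val) % P + P * ((x.val + y.val) / P) : ℕ) : ℝ) =
        ((x.val + y.val : ℕ) : ℝ) := by rw [h1]
    push_cast at this ⊢
    linarith
  rw [ZMod.val_add, h2]
  generalize (x.val + y.val) / P = c
  push_cast
  field_simp
  ring

lemma eC_val_neg (x : ZMod P) (n : ℤ) :
    eC (((-x).val : ℝ) / P * n) = eC (-((x.val : ℝ) / P * n)) := by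
  have h := eC_val_add x (-x) n
  rw [add_neg_cancel, ZMod.val_zero, Nat.cast_zero, zero_div, zero_mul, eC_zero] at h
  have h2 : eC ((x.val : ℝ) / P * n) * eC (-((x.val : ℝ) / P * n)) = 1 := by
    rw [← eC_add, add_neg_cancel, eC_zero]
  exact mul_left_cancel₀ (eC_ne_zero _) (h.symm.trans h2.symm)

lemma sum_eC_of_nsmul_eq_zero {q : ℕ} (hq : q ∣ P) {n : ℤ} (hn : IsCoprime n (P : ℤ)) :
    ∑ x : ZMod P with q • x = 0, eC ((x.val : ℝ) / P * n) = if q = 1 then 1 else 0 := by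
  have hP : (P : ℝ) ≠ 0 := by exact_mod_cast NeZero.ne P
  obtain ⟨d, hd⟩ := hq
  have hPpos : 0 < P := Nat.pos_of_ne_zero (NeZero.ne P)
  have hd0 : 0 < d := Nat.pos_of_ne_zero (by rintro rfl; simp at hd; omega)
  have hq0 : 0 < q := Nat.pos_of_ne_zero (by rintro rfl; simp at hd; omega)
  split_ifs with h
  · subst h
    have : (univ.filter fun x : ZMod P => 1 • x = 0) = {0} := by
      ext x; simp
    rw [this, sum_singleton, ZMod.val_zero, Nat.cast_zero, zero_div, zero_mul, eC_zero]
  · have hdP : d < P := by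
      rw [hd]
      have : 2 ≤ q := by omega
      nlinarith
    set y : ZMod P := (d : ZMod P) with hy
    have hyv : y.val = d := ZMod.val_cast_of_lt hdP
    have hqy : q • y = 0 := by
      rw [hy, nsmul_eq_mul, ← Nat.cast_mul, ← hd, ZMod.natCast_self]
    have hdR : (d : ℝ) ≠ 0 := by exact_mod_cast hd0.ne'
    have hqR : (q : ℝ) ≠ 0 := by exact_mod_cast hq0.ne'
    have hne : eC ((y.val : ℝ) / P * n) ≠ 1 := by
      rw [Ne, eC_eq_one_iff, hyv]
      rintro ⟨m, hm⟩
      have h1 : (n : ℝ) = q * m := by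
        have hPq : (P : ℝ) = q * d := by exact_mod_cast hd
        rw [← hm, hPq]; field_simp
      have h2 : (q : ℤ) ∣ n := ⟨m, by exact_mod_cast h1⟩
      have h3 := hn.isUnit_of_dvd' h2 ⟨d, by exact_mod_cast hd⟩
      rw [Int.isUnit_iff] at h3
      omega
    have hshift : ∑ x : ZMod P with q • x = 0, eC ((x.val : ℝ) / P * n) =
        eC ((y.val : ℝ) / P * n) * ∑ x : ZMod P with q • x = 0, eC ((x.val : ℝ) / P * n) := by
      rw [mul_sum]
      symm
      refine sum_bij (fun x _ => y + x) (fun x hx => ?_) (fun _ _ _ _ h => add_left_cancel h)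
        (fun x hx => ⟨x - y, ?_, by abel⟩) (fun x _ => (eC_val_add _ _ _).symm)
      · rw [mem_filter] at hx ⊢
        exact ⟨mem_univ _, by rw [smul_add, hqy, hx.2, add_zero]⟩
      · rw [mem_filter] at hx ⊢
        exact ⟨mem_univ _, by rw [smul_sub, hqy, hx.2, sub_zero]⟩
    by_contra h0
    exact hne (mul_right_cancel₀ h0 (by rw [one_mul]; exact hshift.symm))

lemma sum_eC_of_addOrderOf_eq {q : ℕ} (hq : q ∣ P) {n : ℤ} (hn : IsCoprime n (P : ℤ)) :
    ∑ x : ZMod P with addOrderOf x = q, eC ((x.val : ℝ) / P * n) =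
      (ArithmeticFunction.moebius q : ℂ) := by
  classical
  have hPpos : 0 < P := Nat.pos_of_ne_zero (NeZero.ne P)
  have key := (ArithmeticFunction.sum_eq_iff_sum_mul_moebius_eq_on (R := ℂ)
    (f := fun q => ∑ x : ZMod P with addOrderOf x = q, eC ((x.val : ℝ) / P * n))
    (g := fun q => if q = 1 then 1 else 0) {q | q ∣ P} (fun _ _ h1 h2 => h1.trans h2)).1 ?_
    q (Nat.pos_of_dvd_of_pos hq hPpos) hq
  · rw [← key, sum_eq_single (q, 1)]
    · simp
    · rintro ⟨a, b⟩ hab hne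
      have : b ≠ 1 := by
        rintro rfl
        rw [Nat.mem_divisorsAntidiagonal] at hab
        exact hne (by rw [← hab.1, mul_one])
      simp [this]
    · intro h
      exact absurd (Nat.mem_divisorsAntidiagonal.2
        ⟨mul_one q, (Nat.pos_of_dvd_of_pos hq hPpos).ne'⟩) h
  · intro q hq0 hqP
    rw [← sum_eC_of_nsmul_eq_zero hqP hn, ← sum_fiberwise_of_maps_to
      (s := univ.filter fun x : ZMod P => q • x = 0) (t := q.divisors) (g := addOrderOf)
      (fun x hx => Nat.mem_divisors.2
        ⟨addOrderOf_dvd_iff_nsmul_eq_zero.2 (mem_filter.1 hx).2, hq0.ne'⟩)]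
    refine sum_congr rfl fun d hd => sum_congr ?_ fun _ _ => rfl
    ext x
    simp only [mem_filter, mem_univ, true_and]
    refine ⟨fun h => ⟨addOrderOf_dvd_iff_nsmul_eq_zero.1 (h ▸ Nat.dvd_of_mem_divisors hd), h⟩,
      fun h => h.2⟩

end characters

section selberg

variable (P : ℕ) [NeZero P] (R : ℝ)

/-- The total mass of the sieve weights. -/
noncomputable def sieveMass (P : ℕ) (R : ℝ) : ℝ :=
  ∑ q ∈ P.divisors.filter (fun q : ℕ => (q : ℝ) ≤ R), 1 / (q.totient : ℝ)

/-- The absolute value of the sieve weight at a residue. -/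
noncomputable def sieveWeight (x : ZMod P) : ℝ :=
  if (addOrderOf x : ℝ) ≤ R then 1 / ((addOrderOf x).totient : ℝ) else 0

/-- The Selberg sieve function, as an exponential sum. -/
noncomputable def sieveFun (n : ℤ) : ℂ :=
  1 / (sieveMass P R : ℂ) * ∑ x : ZMod P,
    ((ArithmeticFunction.moebius (addOrderOf x) : ℤ) : ℂ) * (sieveWeight P R x : ℂ) *
      eC ((x.val : ℝ) / P * n)

variable {P R}

lemma sieveWeight_nonneg (x : ZMod P) : 0 ≤ sieveWeight P R x := by
  unfold sieveWeight; split_ifs <;> positivity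

lemma one_le_sieveMass (hR : 1 ≤ R) : 1 ≤ sieveMass P R := by
  have h1 : 1 ∈ P.divisors.filter fun q : ℕ => (q : ℝ) ≤ R :=
    mem_filter.2 ⟨Nat.mem_divisors.2 ⟨one_dvd _, NeZero.ne P⟩, by simpa using hR⟩
  refine le_trans ?_ (single_le_sum (f := fun q : ℕ => 1 / (q.totient : ℝ))
    (fun _ _ => by positivity) h1)
  simp

lemma sieveFun_eq_one (hR : 1 ≤ R) (hP : Squarefree P) {n : ℤ} (hn : IsCoprime n (P : ℤ)) :
    sieveFun P R n = 1 := by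
  classical
  have hG : (sieveMass P R : ℂ) ≠ 0 := by
    exact_mod_cast (lt_of_lt_of_le one_pos (one_le_sieveMass (P := P) hR)).ne'
  rw [sieveFun, one_div, inv_mul_eq_one₀ hG]
  rw [← sum_fiberwise_of_maps_to (s := univ) (t := P.divisors) (g := fun x : ZMod P => addOrderOf x)
    (fun x _ => Nat.mem_divisors.2 ⟨addOrderOf_dvd_modulus x, NeZero.ne P⟩), sieveMass, sum_filter]
  push_cast
  refine sum_congr rfl fun q hq => ?_
  have hqP := Nat.dvd_of_mem_divisors hq
  have h1 : ∀ x ∈ (univ.filter fun x : ZMod P => addOrderOf x = q),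
      ((ArithmeticFunction.moebius (addOrderOf x) : ℤ) : ℂ) * (sieveWeight P R x : ℂ) *
      eC ((x.val : ℝ) / P * n) =
      ((ArithmeticFunction.moebius q : ℤ) : ℂ) * ((if (q : ℝ) ≤ R then 1 / (q.totient : ℝ) else 0 : ℝ) : ℂ)
        * eC ((x.val : ℝ) / P * n) := fun x hx => by
    rw [sieveWeight, (mem_filter.1 hx).2]
  rw [sum_congr rfl h1, ← mul_sum, sum_eC_of_addOrderOf_eq hqP hn]
  have h2 : ((ArithmeticFunction.moebius q : ℤ) : ℂ) * ((ArithmeticFunction.moebius q : ℤ) : ℂ)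
      = 1 := by
    have := ArithmeticFunction.moebius_sq (n := q)
    rw [if_pos (hP.squarefree_of_dvd hqP), sq] at this
    exact_mod_cast this
  rw [mul_right_comm, h2, one_mul]

end selberg

section correlation

variable {P : ℕ} [NeZero P]

lemma coprime_div_gcd {a b : ℕ} (ha : Squarefree a) :
    Nat.Coprime (a / Nat.gcd a b) b := by
  rw [Nat.coprime_iff_gcd_eq_one]
  by_contra h
  obtain ⟨p, hp, hpd⟩ := Nat.exists_prime_and_dvd h
  have h1 : p ∣ a / Nat.gcd a b := hpd.trans (Nat.gcd_dvd_left _ _)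
  have h2 : p ∣ Nat.gcd a b := Nat.dvd_gcd (h1.trans (Nat.div_dvd_of_dvd (Nat.gcd_dvd_left _ _)))
    (hpd.trans (Nat.gcd_dvd_right _ _))
  have h3 : p * p ∣ a := by
    calc p * p ∣ Nat.gcd a b * (a / Nat.gcd a b) := Nat.mul_dvd_mul h2 h1
      _ = a := Nat.mul_div_cancel' (Nat.gcd_dvd_left _ _)
  exact hp.one_lt.ne' (by simpa using ha p h3)

lemma div_gcd_addOrderOf_eq {x y γ : ZMod P} (h : x = y + γ) :
    addOrderOf x / Nat.gcd (addOrderOf x) (addOrderOf γ) =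
      addOrderOf y / Nat.gcd (addOrderOf y) (addOrderOf γ) := by
  rw [← addOrderOf_nsmul, ← addOrderOf_nsmul, h, smul_add, addOrderOf_nsmul_eq_zero, add_zero]

lemma card_addOrderOf_pair_le (hP : Squarefree P) (γ : ZMod P) {q₁ q₂ : ℕ} (h₁ : q₁ ∣ P)
    (h₂ : q₂ ∣ P) :
    #{y : ZMod P | addOrderOf (y + γ) = q₁ ∧ addOrderOf y = q₂} ≤ (Nat.gcd q₁ q₂).totient := by
  classical
  set g := Nat.gcd q₁ q₂ with hg
  have hPpos : 0 < P := Nat.pos_of_ne_zero (NeZero.ne P)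
  have hq₁ : 0 < q₁ := Nat.pos_of_dvd_of_pos h₁ hPpos
  have hq₂ : 0 < q₂ := Nat.pos_of_dvd_of_pos h₂ hPpos
  have hgP : g ∣ P := (Nat.gcd_dvd_left _ _).trans h₁
  have hcard := IsAddCyclic.card_addOrderOf_eq_totient (α := ZMod P) (d := g) (by rwa [ZMod.card])
  rw [← hcard]
  refine card_le_card_of_injOn (fun y => (q₁ / g) • (y + γ)) (fun y hy => ?_) ?_
  · simp only [coe_filter, mem_univ, true_and, Set.mem_ofPred_eq] at hy ⊢
    rw [addOrderOf_nsmul, hy.1, Nat.gcd_eq_right (Nat.div_dvd_of_dvd (Nat.gcd_dvd_left _ _)),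
      Nat.div_div_self (Nat.gcd_dvd_left _ _) hq₁.ne']
  · intro y hy y' hy' heq
    simp only [coe_filter, mem_univ, true_and, Set.mem_ofPred_eq] at hy hy'
    have e1 : (q₁ / g) • (y - y') = 0 := by
      have : (q₁ / g) • (y + γ) - (q₁ / g) • (y' + γ) = 0 := sub_eq_zero.2 heq
      rw [← smul_sub] at this
      simpa using this
    have e2 : q₂ • (y - y') = 0 := by
      have a1 : q₂ • y = 0 := by rw [← hy.2]; exact addOrderOf_nsmul_eq_zero y
      have a2 : q₂ • y' = 0 := by rw [← hy'.2]; exact addOrderOf_nsmul_eq_zero y'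
      rw [smul_sub, a1, a2, sub_zero]
    have e3 := Nat.dvd_gcd (addOrderOf_dvd_iff_nsmul_eq_zero.2 e1)
      (addOrderOf_dvd_iff_nsmul_eq_zero.2 e2)
    rw [coprime_div_gcd (hP.squarefree_of_dvd h₁), Nat.dvd_one,
      AddMonoid.addOrderOf_eq_one_iff, sub_eq_zero] at e3
    exact e3

lemma totient_gcd_mul_le (hP : Squarefree P) {x y γ : ZMod P} (h : x = y + γ) :
    (Nat.gcd (addOrderOf x) (addOrderOf y)).totient * ((addOrderOf γ).totient *
      (addOrderOf y / Nat.gcd (addOrderOf y) (addOrderOf γ)).totient) ≤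
      (addOrderOf x).totient * (addOrderOf y).totient := by
  set q₁ := addOrderOf x with hq₁
  set q₂ := addOrderOf y with hq₂
  set q := addOrderOf γ with hq
  set g := Nat.gcd q₁ q₂ with hg
  have p₁ : 0 < q₁ := addOrderOf_pos x
  have p₂ : 0 < q₂ := addOrderOf_pos y
  have p₀ : 0 < q := addOrderOf_pos γ
  have s₁ : Squarefree q₁ := hP.squarefree_of_dvd (addOrderOf_dvd_modulus x)
  have s₂ : Squarefree q₂ := hP.squarefree_of_dvd (addOrderOf_dvd_modulus y)
  have g₁ : g ∣ q₁ := Nat.gcd_dvd_left _ _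
  have c₁ : Nat.Coprime (q₁ / g) q₂ := coprime_div_gcd s₁
  have c₂ : Nat.Coprime (q₁ / g) g := c₁.coprime_dvd_right (Nat.gcd_dvd_right _ _)
  have t₁ : q₁.totient = g.totient * (q₁ / g).totient := by
    rw [← Nat.totient_mul c₂.symm, Nat.mul_div_cancel' g₁]
  set e := q₂ / Nat.gcd q₂ q with he
  have ce : Nat.Coprime e q := coprime_div_gcd s₂
  have d₁ : q ∣ q₁ / g * q₂ := by
    rw [hq, addOrderOf_dvd_iff_nsmul_eq_zero]
    have a1 : γ = x - y := by rw [h]; abel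
    have a2 : (q₁ / g * q₂) • y = 0 :=
      addOrderOf_dvd_iff_nsmul_eq_zero.1 (dvd_mul_left _ _)
    have a3 : (q₁ / g * q₂) • x = 0 := by
      refine addOrderOf_dvd_iff_nsmul_eq_zero.1 ?_
      rw [← hq₁]
      calc q₁ = q₁ / g * g := (Nat.div_mul_cancel g₁).symm
        _ ∣ q₁ / g * q₂ := Nat.mul_dvd_mul_left _ (Nat.gcd_dvd_right _ _)
    rw [a1, smul_sub, a2, a3, sub_zero]
  have d₂ : e ∣ q₁ / g * q₂ := (Nat.div_dvd_of_dvd (Nat.gcd_dvd_left _ _)).trans (dvd_mul_left _ _)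
  have d₃ : q * e ∣ q₁ / g * q₂ := ce.symm.mul_dvd_of_dvd_of_dvd d₁ d₂
  have h4 : q.totient * e.totient ≤ (q₁ / g).totient * q₂.totient := by
    rw [← Nat.totient_mul ce.symm, ← Nat.totient_mul c₁]
    refine Nat.le_of_dvd (Nat.totient_pos.2 (Nat.mul_pos ?_ p₂)) (Nat.totient_dvd_of_dvd d₃)
    exact Nat.div_pos (Nat.le_of_dvd p₁ g₁) (Nat.pos_of_dvd_of_pos g₁ p₁)
  rw [t₁, mul_assoc]
  exact Nat.mul_le_mul_left _ h4

lemma sieveWeight_correlation_le (hP : Squarefree P) {R : ℝ} (γ : ZMod P) :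
    ∑ y : ZMod P, sieveWeight P R (y + γ) * sieveWeight P R y ≤
      sieveMass P R * ((#(addOrderOf γ).divisors : ℝ) ^ 2 / (addOrderOf γ).totient) := by
  classical
  set q := addOrderOf γ with hq
  have hq0 : 0 < q := addOrderOf_pos γ
  have hφ0 : (0 : ℝ) < q.totient := by exact_mod_cast Nat.totient_pos.2 hq0
  set S := P.divisors.filter (fun q : ℕ => (q : ℝ) ≤ R) with hS
  set ord : ZMod P → ℕ × ℕ := fun y => (addOrderOf (y + γ), addOrderOf y) with hord
  set key : ℕ × ℕ → (ℕ × ℕ) × ℕ :=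
    fun a => ((Nat.gcd a.1 q, Nat.gcd a.2 q), a.2 / Nat.gcd a.2 q) with hkey
  set Y : Finset (ZMod P) := univ.filter fun y =>
    (addOrderOf (y + γ) : ℝ) ≤ R ∧ (addOrderOf y : ℝ) ≤ R with hY
  have hmem : ∀ y ∈ Y, ord y ∈ Y.image ord := fun y hy => mem_image_of_mem _ hy
  have h1 : ∑ y : ZMod P, sieveWeight P R (y + γ) * sieveWeight P R y =
      ∑ y ∈ Y, 1 / ((ord y).1.totient : ℝ) * (1 / ((ord y).2.totient : ℝ)) := by
    rw [hY, sum_filter]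
    refine sum_congr rfl fun y _ => ?_
    unfold sieveWeight
    by_cases a : (addOrderOf (y + γ) : ℝ) ≤ R <;> by_cases b : (addOrderOf y : ℝ) ≤ R <;>
      simp [a, b, hord]
  have h2 : ∀ a ∈ Y.image ord,
      ∑ y ∈ Y with ord y = a, 1 / ((ord y).1.totient : ℝ) * (1 / ((ord y).2.totient : ℝ)) ≤
        1 / (q.totient : ℝ) * (1 / ((key a).2.totient : ℝ)) := by
    intro a ha
    obtain ⟨y₀, hy₀, rfl⟩ := mem_image.1 ha
    have b1 : ∀ y ∈ Y.filter fun y => ord y = ord y₀,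
        1 / ((ord y).1.totient : ℝ) * (1 / ((ord y).2.totient : ℝ)) =
        1 / ((ord y₀).1.totient : ℝ) * (1 / ((ord y₀).2.totient : ℝ)) := fun y hy => by
      rw [(mem_filter.1 hy).2]
    rw [sum_congr rfl b1, sum_const, nsmul_eq_mul]
    have b2 : #(Y.filter fun y => ord y = ord y₀) ≤
        (Nat.gcd (ord y₀).1 (ord y₀).2).totient := by
      refine (card_le_card fun y hy => ?_).trans (card_addOrderOf_pair_le hP γ
        (addOrderOf_dvd_modulus (y₀ + γ)) (addOrderOf_dvd_modulus y₀))
      have := (mem_filter.1 hy).2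
      rw [hord, Prod.mk.injEq] at this
      exact mem_filter.2 ⟨mem_univ _, this⟩
    have b3 := totient_gcd_mul_le hP (x := y₀ + γ) (y := y₀) (γ := γ) rfl
    have t1 : (0 : ℝ) < (ord y₀).1.totient := by
      exact_mod_cast Nat.totient_pos.2 (addOrderOf_pos (y₀ + γ))
    have t2 : (0 : ℝ) < (ord y₀).2.totient := by
      exact_mod_cast Nat.totient_pos.2 (addOrderOf_pos y₀)
    have t3 : (0 : ℝ) < (key (ord y₀)).2.totient := by
      have : 0 < (key (ord y₀)).2 := Nat.div_pos
        (Nat.le_of_dvd (addOrderOf_pos y₀) (Nat.gcd_dvd_left _ _))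
        (Nat.gcd_pos_of_pos_left _ (addOrderOf_pos y₀))
      exact_mod_cast Nat.totient_pos.2 this
    have b4 : ((Nat.gcd (ord y₀).1 (ord y₀).2).totient : ℝ) *
        ((q.totient : ℝ) * ((key (ord y₀)).2.totient : ℝ)) ≤
        ((ord y₀).1.totient : ℝ) * ((ord y₀).2.totient : ℝ) := by exact_mod_cast b3
    calc _ ≤ ((Nat.gcd (ord y₀).1 (ord y₀).2).totient : ℝ) *
          (1 / ((ord y₀).1.totient : ℝ) * (1 / ((ord y₀).2.totient : ℝ))) := by gcongr
      _ ≤ _ := by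
        rw [one_div_mul_one_div, one_div_mul_one_div, mul_one_div, div_le_div_iff₀ (by positivity)
          (by positivity), one_mul]
        exact b4
  have h3 : Set.InjOn key (Y.image ord : Finset (ℕ × ℕ)) := by
    intro a ha b hb hab
    obtain ⟨y, hy, rfl⟩ := mem_image.1 (mem_coe.1 ha)
    obtain ⟨y', hy', rfl⟩ := mem_image.1 (mem_coe.1 hb)
    have e1 := div_gcd_addOrderOf_eq (x := y + γ) (y := y) (γ := γ) rfl
    have e2 := div_gcd_addOrderOf_eq (x := y' + γ) (y := y') (γ := γ) rfl
    simp only [hkey, hord, Prod.mk.injEq] at hab ⊢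
    rw [← hq] at e1 e2
    obtain ⟨⟨i1, i2⟩, i3⟩ := hab
    constructor
    · rw [← Nat.div_mul_cancel (Nat.gcd_dvd_left (addOrderOf (y + γ)) q),
        ← Nat.div_mul_cancel (Nat.gcd_dvd_left (addOrderOf (y' + γ)) q), e1, e2, i3, i1]
    · rw [← Nat.div_mul_cancel (Nat.gcd_dvd_left (addOrderOf y) q),
        ← Nat.div_mul_cancel (Nat.gcd_dvd_left (addOrderOf y') q), i3, i2]
  have h4 : (Y.image ord).image key ⊆ (q.divisors ×ˢ q.divisors) ×ˢ S := by
    intro c hc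
    obtain ⟨a, ha, rfl⟩ := mem_image.1 hc
    obtain ⟨y, hy, rfl⟩ := mem_image.1 ha
    have hyR := (mem_filter.1 hy).2.2
    simp only [hkey, hord, mem_product, Nat.mem_divisors, hS, mem_filter]
    have hdvd : addOrderOf y / Nat.gcd (addOrderOf y) q ∣ addOrderOf y :=
      Nat.div_dvd_of_dvd (Nat.gcd_dvd_left _ _)
    refine ⟨⟨⟨Nat.gcd_dvd_right _ _, hq0.ne'⟩, Nat.gcd_dvd_right _ _, hq0.ne'⟩,
      ⟨hdvd.trans (addOrderOf_dvd_modulus y), NeZero.ne P⟩, le_trans ?_ hyR⟩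
    exact_mod_cast Nat.le_of_dvd (addOrderOf_pos y) hdvd
  rw [h1, ← sum_fiberwise_of_maps_to hmem]
  calc _ ≤ ∑ a ∈ Y.image ord, 1 / (q.totient : ℝ) * (1 / ((key a).2.totient : ℝ)) :=
        sum_le_sum h2
    _ = ∑ c ∈ (Y.image ord).image key, 1 / (q.totient : ℝ) * (1 / (c.2.totient : ℝ)) :=
        (sum_image (f := fun c : (ℕ × ℕ) × ℕ =>
          1 / (q.totient : ℝ) * (1 / (c.2.totient : ℝ))) h3).symm
    _ ≤ ∑ c ∈ (q.divisors ×ˢ q.divisors) ×ˢ S, 1 / (q.totient : ℝ) * (1 / (c.2.totient : ℝ)) :=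
        sum_le_sum_of_subset_of_nonneg h4 fun _ _ _ => by positivity
    _ = _ := by
        rw [sum_product]
        simp only
        rw [sum_const, card_product, nsmul_eq_mul, ← mul_sum, sieveMass]
        push_cast
        ring

lemma sieveWeight_mul_eq_zero {R : ℝ} {y γ : ZMod P} (h : R ^ 2 < addOrderOf γ) :
    sieveWeight P R (y + γ) * sieveWeight P R y = 0 := by
  unfold sieveWeight
  split_ifs with h1 h2
  · exfalso
    have h3 : addOrderOf γ ∣ addOrderOf (y + γ) * addOrderOf y := by
      rw [addOrderOf_dvd_iff_nsmul_eq_zero]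
      have a1 : γ = (y + γ) - y := by abel
      have a2 : (addOrderOf (y + γ) * addOrderOf y) • y = 0 :=
        addOrderOf_dvd_iff_nsmul_eq_zero.1 (dvd_mul_left _ _)
      have a3 : (addOrderOf (y + γ) * addOrderOf y) • (y + γ) = 0 :=
        addOrderOf_dvd_iff_nsmul_eq_zero.1 (dvd_mul_right _ _)
      calc (addOrderOf (y + γ) * addOrderOf y) • γ
          = (addOrderOf (y + γ) * addOrderOf y) • (y + γ) -
            (addOrderOf (y + γ) * addOrderOf y) • y := by rw [← smul_sub, ← a1]
        _ = 0 := by rw [a2, a3, sub_zero]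
    have h4 : (addOrderOf γ : ℝ) ≤ addOrderOf (y + γ) * addOrderOf y := by
      exact_mod_cast Nat.le_of_dvd (Nat.mul_pos (addOrderOf_pos _) (addOrderOf_pos _)) h3
    have h5 : (addOrderOf (y + γ) : ℝ) * addOrderOf y ≤ R * R :=
      mul_le_mul h1 h2 (by positivity) (le_trans (by positivity) h1)
    nlinarith
  all_goals simp

end correlation

section dispersion

variable {P : ℕ} [NeZero P] {R : ℝ}

/-- The Fourier coefficients of the square of the Selberg sieve function. -/
noncomputable def sieveCoeff (P : ℕ) [NeZero P] (R : ℝ) (γ : ZMod P) : ℂ :=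
  ∑ y : ZMod P, ((ArithmeticFunction.moebius (addOrderOf (y + γ)) : ℤ) : ℂ) *
    ((ArithmeticFunction.moebius (addOrderOf y) : ℤ) : ℂ) *
    ((sieveWeight P R (y + γ) * sieveWeight P R y : ℝ) : ℂ)

lemma sieveFun_mul_conj (n : ℤ) :
    ((‖sieveFun P R n‖ ^ 2 : ℝ) : ℂ) = 1 / (sieveMass P R : ℂ) ^ 2 *
      ∑ γ : ZMod P, sieveCoeff P R γ * eC ((γ.val : ℝ) / P * n) := by
  have hconj : (starRingEnd ℂ) (sieveFun P R n) = 1 / (sieveMass P R : ℂ) * ∑ x : ZMod P,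
      ((ArithmeticFunction.moebius (addOrderOf x) : ℤ) : ℂ) * (sieveWeight P R x : ℂ) *
      eC (((-x).val : ℝ) / P * n) := by
    rw [sieveFun, map_mul, map_sum, map_div₀, map_one, Complex.conj_ofReal]
    congr 1
    refine sum_congr rfl fun x _ => ?_
    rw [map_mul, map_mul, Complex.conj_ofReal, ← eC_neg, eC_val_neg]
    congr 2
    exact map_intCast (starRingEnd ℂ) _
  rw [Complex.ofReal_pow, ← Complex.mul_conj', hconj, sieveFun]
  rw [show ∀ a b c : ℂ, 1 / a * b * (1 / a * c) = 1 / a ^ 2 * (c * b) by intros; ring]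
  congr 1
  rw [sum_mul]
  simp_rw [sieveCoeff, sum_mul]
  rw [sum_comm (s := (univ : Finset (ZMod P))) (t := (univ : Finset (ZMod P)))]
  refine sum_congr rfl fun y _ => ?_
  rw [mul_sum, ← Equiv.sum_comp (Equiv.addLeft y)]
  refine sum_congr rfl fun γ _ => ?_
  have : eC ((γ.val : ℝ) / P * n) =
      eC (((y + γ).val : ℝ) / P * n) * eC (((-y).val : ℝ) / P * n) := by
    have h : y + γ + -y = γ := by abel
    rw [← eC_val_add, h]
  rw [this]
  simp only [Equiv.coe_addLeft]
  push_cast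
  ring

lemma norm_moebius_le_one (n : ℕ) : ‖((ArithmeticFunction.moebius n : ℤ) : ℂ)‖ ≤ 1 := by
  rw [Complex.norm_intCast]
  exact_mod_cast ArithmeticFunction.abs_moebius_le_one

lemma norm_sieveCoeff_le (hP : Squarefree P) (γ : ZMod P) :
    ‖sieveCoeff P R γ‖ ≤
      sieveMass P R * ((#(addOrderOf γ).divisors : ℝ) ^ 2 / (addOrderOf γ).totient) := by
  refine le_trans ?_ (sieveWeight_correlation_le hP γ)
  refine (norm_sum_le _ _).trans (sum_le_sum fun y _ => ?_)
  rw [norm_mul, norm_mul, Complex.norm_real, Real.norm_eq_abs,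
    abs_of_nonneg (mul_nonneg (sieveWeight_nonneg _) (sieveWeight_nonneg _))]
  refine mul_le_of_le_one_left (mul_nonneg (sieveWeight_nonneg _) (sieveWeight_nonneg _)) ?_
  exact mul_le_one₀ (norm_moebius_le_one _) (norm_nonneg _) (norm_moebius_le_one _)

lemma sieveCoeff_eq_zero {γ : ZMod P} (h : R ^ 2 < addOrderOf γ) : sieveCoeff P R γ = 0 :=
  sum_eq_zero fun y _ => by rw [sieveWeight_mul_eq_zero h, Complex.ofReal_zero, mul_zero]

lemma le_totient_mul_card_divisors (n : ℕ) : n ≤ n.totient * #n.divisors := by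
  calc n = ∑ d ∈ n.divisors, d.totient := (Nat.sum_totient n).symm
    _ ≤ ∑ d ∈ n.divisors, n.totient := by
        refine sum_le_sum fun d hd => ?_
        have hn := Nat.mem_divisors.1 hd
        exact Nat.le_of_dvd (Nat.totient_pos.2 (Nat.pos_of_ne_zero hn.2))
          (Nat.totient_dvd_of_dvd hn.1)
    _ = _ := by rw [sum_const, smul_eq_mul, mul_comm]

lemma norm_sum_mul_sieveFun_sq_le (hR : 1 ≤ R) (hP : Squarefree P) {ι : Type*} (s : Finset ι)
    (g : ι → ℂ) (n : ι → ℤ) :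
    ‖∑ i ∈ s, ((‖sieveFun P R (n i)‖ ^ 2 : ℝ) : ℂ) * g i‖ ≤ 1 / sieveMass P R *
      ∑ γ : ZMod P with (addOrderOf γ : ℝ) ≤ R ^ 2,
        (#(addOrderOf γ).divisors : ℝ) ^ 3 / addOrderOf γ *
          ‖∑ i ∈ s, g i * eC ((γ.val : ℝ) / P * n i)‖ := by
  have hG := one_le_sieveMass (P := P) hR
  have hG0 : 0 < sieveMass P R := by linarith
  have e1 : ∑ i ∈ s, ((‖sieveFun P R (n i)‖ ^ 2 : ℝ) : ℂ) * g i = 1 / (sieveMass P R : ℂ) ^ 2 *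
      ∑ γ : ZMod P with (addOrderOf γ : ℝ) ≤ R ^ 2, sieveCoeff P R γ *
        ∑ i ∈ s, g i * eC ((γ.val : ℝ) / P * n i) := by
    have e2 : ∑ γ : ZMod P with (addOrderOf γ : ℝ) ≤ R ^ 2, sieveCoeff P R γ *
        ∑ i ∈ s, g i * eC ((γ.val : ℝ) / P * n i) = ∑ γ : ZMod P, sieveCoeff P R γ *
        ∑ i ∈ s, g i * eC ((γ.val : ℝ) / P * n i) := by
      rw [sum_filter]
      refine sum_congr rfl fun γ _ => ?_
      split_ifs with h
      · rfl
      · rw [sieveCoeff_eq_zero (not_le.1 h), zero_mul]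
    rw [e2]
    simp_rw [sieveFun_mul_conj, mul_sum, sum_mul]
    rw [sum_comm]
    refine sum_congr rfl fun γ _ => sum_congr rfl fun i _ => ?_
    ring
  rw [e1, norm_mul, norm_div, norm_one, norm_pow, Complex.norm_real, Real.norm_eq_abs,
    abs_of_pos hG0, show (1 : ℝ) / sieveMass P R ^ 2 = 1 / sieveMass P R * (1 / sieveMass P R) by
      rw [sq, one_div_mul_one_div], mul_assoc]
  refine mul_le_mul_of_nonneg_left ?_ (by positivity)
  rw [one_div, inv_mul_le_iff₀ hG0, mul_sum]
  refine (norm_sum_le _ _).trans (sum_le_sum fun γ _ => ?_)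
  rw [norm_mul, ← mul_assoc]
  refine mul_le_mul_of_nonneg_right ((norm_sieveCoeff_le hP γ).trans ?_) (norm_nonneg _)
  refine mul_le_mul_of_nonneg_left ?_ hG0.le
  have hq : 0 < addOrderOf γ := addOrderOf_pos γ
  have h1 : (0 : ℝ) < (addOrderOf γ).totient := by exact_mod_cast Nat.totient_pos.2 hq
  have h2 : (0 : ℝ) < addOrderOf γ := by exact_mod_cast hq
  have h3 : (addOrderOf γ : ℝ) ≤ (addOrderOf γ).totient * #(addOrderOf γ).divisors := by
    exact_mod_cast le_totient_mul_card_divisors (addOrderOf γ)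
  rw [div_le_div_iff₀ h1 h2]
  calc (#(addOrderOf γ).divisors : ℝ) ^ 2 * addOrderOf γ ≤ (#(addOrderOf γ).divisors : ℝ) ^ 2 *
        ((addOrderOf γ).totient * #(addOrderOf γ).divisors) := by gcongr
    _ = _ := by ring

end dispersion

section primes

/-- The primes up to `z`. -/
noncomputable def primesUpTo (z : ℝ) : Finset ℕ := (Ioc 0 ⌊z⌋₊).filter Nat.Prime

lemma mem_primesUpTo {z : ℝ} (hz : 0 ≤ z) {p : ℕ} :
    p ∈ primesUpTo z ↔ p.Prime ∧ (p : ℝ) ≤ z := by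
  rw [primesUpTo, mem_filter, mem_Ioc, Nat.le_floor_iff hz]
  exact ⟨fun h => ⟨h.2, h.1.2⟩, fun h => ⟨⟨h.1.pos, h.2⟩, h.1⟩⟩

lemma sum_log_div_le (n : ℕ) (hn : 0 < n) :
    ∑ p ∈ primesUpTo n, Real.log p / p ≤ Real.log n + Real.log 4 := by
  have hn0 : (0 : ℝ) < n := by exact_mod_cast hn
  have hdvd : ∏ p ∈ primesUpTo n, p ^ (n / p) ∣ n.factorial := by
    refine Finset.prod_dvd_of_isRelPrime (fun p hp q hq hpq => ?_) fun p hp => ?_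
    · rw [mem_coe, mem_primesUpTo hn0.le] at hp hq
      rw [Function.onFun, ← Nat.coprime_iff_isRelPrime]
      exact ((Nat.coprime_primes hp.1 hq.1).2 hpq).pow _ _
    · have hp' := ((mem_primesUpTo hn0.le).1 hp).1
      refine (hp'.pow_dvd_factorial_iff (b := Nat.log p n + 2) (by omega)).2 ?_
      refine le_trans (by rw [pow_one]) (single_le_sum (f := fun i => n / p ^ i)
        (fun _ _ => Nat.zero_le _) (mem_Ico.2 ⟨le_refl 1, by omega⟩))
  have h1 : ((∏ p ∈ primesUpTo n, p ^ (n / p) : ℕ) : ℝ) ≤ (n : ℝ) ^ n := by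
    exact_mod_cast (Nat.le_of_dvd (Nat.factorial_pos n) hdvd).trans (Nat.factorial_le_pow n)
  have hpos : ∀ p ∈ primesUpTo n, (0 : ℝ) < p := fun p hp => by
    exact_mod_cast ((mem_primesUpTo hn0.le).1 hp).1.pos
  have h2 : ∑ p ∈ primesUpTo n, ((n / p : ℕ) : ℝ) * Real.log p ≤ n * Real.log n := by
    have := Real.log_le_log (by
      push_cast; exact prod_pos fun p hp => pow_pos (hpos p hp) _) h1
    rw [Real.log_pow] at this
    refine le_trans (le_of_eq ?_) this
    push_cast
    rw [Real.log_prod fun p hp => (pow_pos (hpos p hp) _).ne']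
    exact sum_congr rfl fun p _ => by rw [Real.log_pow]
  have h3 : ∑ p ∈ primesUpTo n, Real.log p ≤ Real.log 4 * n := by
    refine le_trans (le_of_eq ?_) (Chebyshev.theta_le_log4_mul_x hn0.le)
    rfl
  have h4 : n * ∑ p ∈ primesUpTo n, Real.log p / p ≤
      ∑ p ∈ primesUpTo n, ((n / p : ℕ) : ℝ) * Real.log p + ∑ p ∈ primesUpTo n, Real.log p := by
    rw [mul_sum, ← sum_add_distrib]
    refine sum_le_sum fun p hp => ?_
    have hp0 := hpos p hp
    have hp1 : (1 : ℝ) ≤ p := by exact_mod_cast ((mem_primesUpTo hn0.le).1 hp).1.one_lt.le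
    have : (n : ℝ) / p ≤ (n / p : ℕ) + 1 := by
      rw [div_le_iff₀ hp0]
      have := Nat.lt_div_mul_add (a := n) ((mem_primesUpTo hn0.le).1 hp).1.pos
      have h5 : (n : ℝ) ≤ (n / p : ℕ) * p + p := by exact_mod_cast this.le
      linarith
    calc (n : ℝ) * (Real.log p / p) = (n / p : ℝ) * Real.log p := by ring
      _ ≤ ((n / p : ℕ) + 1) * Real.log p := by
          gcongr
      _ = _ := by ring
  have h5 : n * ∑ p ∈ primesUpTo n, Real.log p / p ≤ n * (Real.log n + Real.log 4) := by linarith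
  exact le_of_mul_le_mul_left h5 hn0

/-- The Euler product over the primes up to `z`. -/
noncomputable def eulerUpTo (z : ℝ) : ℝ := ∏ p ∈ primesUpTo z, (1 - (p : ℝ)⁻¹)⁻¹

lemma one_le_inv_one_sub_inv {p : ℕ} (hp : p.Prime) : 1 ≤ (1 - (p : ℝ)⁻¹)⁻¹ := by
  have h2 : (2 : ℝ) ≤ p := by exact_mod_cast hp.two_le
  have h3 : (p : ℝ)⁻¹ ≤ 2⁻¹ := by gcongr
  have h4 : 0 < (p : ℝ)⁻¹ := by positivity
  exact (one_le_inv₀ (by linarith)).2 (by linarith)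

lemma exists_eulerUpTo_le {κ : ℝ} (hκ : 0 < κ) :
    ∃ C : ℝ, 1 ≤ C ∧ ∀ z : ℝ, 1 ≤ z → eulerUpTo z ≤ C * z ^ κ := by
  set Y : ℝ := Real.exp (2 / κ) with hY
  have hY1 : 1 ≤ Y := Real.one_le_exp (by positivity)
  refine ⟨Real.exp (2 * Y + κ * Real.log 4), Real.one_le_exp (by
    have := Real.log_nonneg (show (1 : ℝ) ≤ 4 by norm_num); positivity), fun z hz => ?_⟩
  have hfl : 1 ≤ ⌊z⌋₊ := Nat.le_floor (by simpa using hz)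
  have hset : primesUpTo z = primesUpTo (⌊z⌋₊ : ℝ) := by simp [primesUpTo]
  have hf : ∀ p ∈ primesUpTo z, p.Prime := fun p hp => ((mem_primesUpTo (by linarith)).1 hp).1
  have h1 : eulerUpTo z ≤ Real.exp (∑ p ∈ primesUpTo z, 2 / (p : ℝ)) := by
    rw [Real.exp_sum]
    refine prod_le_prod (fun p hp => by linarith [one_le_inv_one_sub_inv (hf p hp)]) fun p hp => ?_
    have h2 : (2 : ℝ) ≤ p := by exact_mod_cast (hf p hp).two_le
    refine le_trans ?_ (Real.add_one_le_exp _)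
    rw [inv_eq_one_div, div_le_iff₀ (by
      have : (p : ℝ)⁻¹ ≤ 2⁻¹ := by gcongr
      linarith)]
    field_simp
    nlinarith
  refine h1.trans ?_
  rw [Real.rpow_def_of_pos (by linarith), ← Real.exp_add, Real.exp_le_exp]
  have h3 : ∑ p ∈ primesUpTo z, 2 / (p : ℝ) ≤ ∑ p ∈ primesUpTo z,
      ((if (p : ℝ) ≤ Y then 2 else 0) + κ * (Real.log p / p)) := by
    refine sum_le_sum fun p hp => ?_
    have h2 : (2 : ℝ) ≤ p := by exact_mod_cast (hf p hp).two_le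
    have hl := Real.log_nonneg (show (1 : ℝ) ≤ p by linarith)
    split_ifs with h
    · have : 2 / (p : ℝ) ≤ 2 := div_le_self (by norm_num) (by linarith)
      have : 0 ≤ κ * (Real.log p / p) := by positivity
      linarith
    · have : 2 / κ ≤ Real.log p := by
        rw [Real.le_log_iff_exp_le (by linarith)]; exact (not_le.1 h).le
      rw [div_le_iff₀ hκ] at this
      rw [zero_add, ← mul_div_assoc]
      gcongr
      linarith
  refine h3.trans ?_
  rw [sum_add_distrib, ← mul_sum]
  have h4 : ∑ p ∈ primesUpTo z, (if (p : ℝ) ≤ Y then (2 : ℝ) else 0) ≤ 2 * Y := by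
    rw [← sum_filter, sum_const, nsmul_eq_mul, mul_comm]
    gcongr
    have : (primesUpTo z).filter (fun p : ℕ => (p : ℝ) ≤ Y) ⊆ Ioc 0 ⌊Y⌋₊ := fun p hp => by
      rw [mem_filter] at hp
      exact mem_Ioc.2 ⟨(hf p hp.1).pos, Nat.le_floor hp.2⟩
    calc ((#((primesUpTo z).filter (fun p : ℕ => (p : ℝ) ≤ Y)) : ℕ) : ℝ) ≤ (⌊Y⌋₊ : ℝ) := by
          exact_mod_cast (card_le_card this).trans (by simp)
      _ ≤ Y := Nat.floor_le (by linarith)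
  have h5 : ∑ p ∈ primesUpTo z, Real.log p / p ≤ Real.log z + Real.log 4 := by
    rw [hset]
    refine (sum_log_div_le _ hfl).trans ?_
    gcongr
    exact Nat.floor_le (by linarith)
  have h6 := mul_le_mul_of_nonneg_left h5 hκ.le
  linarith

end primes

section mass

lemma div_totient_eq_prod {q : ℕ} (hq : 0 < q) :
    (q / q.totient : ℝ) = ∏ p ∈ q.primeFactors, (1 - (p : ℝ)⁻¹)⁻¹ := by
  have h := congrArg (fun x : ℚ => (x : ℝ)) (Nat.totient_eq_mul_prod_factors q)
  push_cast at h
  have hq0 : (q : ℝ) ≠ 0 := by exact_mod_cast hq.ne'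
  rw [h, prod_inv_distrib, div_mul_cancel_left₀ hq0]

lemma one_div_totient_eq {q : ℕ} (hq : 0 < q) :
    1 / (q.totient : ℝ) = (q : ℝ)⁻¹ * ∏ p ∈ q.primeFactors, (1 - (p : ℝ)⁻¹)⁻¹ := by
  have hq0 : (q : ℝ) ≠ 0 := by exact_mod_cast hq.ne'
  rw [← div_totient_eq_prod hq]
  field_simp

lemma sum_inv_factored_le (S : Finset ℕ) (hS : ∀ p ∈ S, p.Prime) (T : Finset ℕ)
    (hT : ∀ m ∈ T, ∀ p, p.Prime → p ∣ m → p ∈ S) :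
    ∑ m ∈ T, (m : ℝ)⁻¹ ≤ ∏ p ∈ S, (1 - (p : ℝ)⁻¹)⁻¹ := by
  let φ : ℕ →* ℝ := (invMonoidWithZeroHom : ℝ →*₀ ℝ).toMonoidHom.comp (Nat.castRingHom ℝ).toMonoidHom
  have h := (EulerProduct.summable_and_hasSum_factoredNumbers_prod_filter_prime_geometric
    (f := φ) (fun {p} hp => by
      change ‖(p : ℝ)⁻¹‖ < 1
      rw [norm_inv, Real.norm_natCast]
      exact inv_lt_one_of_one_lt₀ (by exact_mod_cast hp.one_lt)) S).2
  rw [filter_true_of_mem hS] at h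
  refine le_trans (le_of_eq ?_) (sum_le_hasSum (T.attach.map ⟨fun m => (⟨m.1,
    Nat.mem_factoredNumbers'.2 (hT m.1 m.2)⟩ : Nat.factoredNumbers S), fun a b hab => by
      exact Subtype.ext (congrArg (fun x : Nat.factoredNumbers S => (x : ℕ)) hab)⟩) (fun m _ => ?_) h)
  · rw [sum_map, ← sum_attach]
    rfl
  · change 0 ≤ ((m : ℕ) : ℝ)⁻¹
    positivity

lemma exists_sieve_modulus (W : ℕ) (hW : 0 < W) {R z : ℝ} (hR : 1 ≤ R) (hz : 0 ≤ z) :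
    ∃ P : ℕ, P ≠ 0 ∧ Squarefree P ∧ Nat.Coprime P W ∧
      (∀ p : ℕ, p.Prime → p ∣ P → z < p ∧ (p : ℝ) ≤ R) ∧
      Real.log R ≤ sieveMass P R * ((W / W.totient : ℝ) * eulerUpTo z) := by
  classical
  have hR0 : 0 ≤ R := by linarith
  set S := (primesUpTo R).filter (fun p : ℕ => z < (p : ℝ) ∧ ¬ p ∣ W) with hSdef
  set D := (primesUpTo R).filter (fun p : ℕ => ¬ (z < (p : ℝ) ∧ ¬ p ∣ W)) with hDdef
  have hSp : ∀ p ∈ S, p.Prime := fun p hp => ((mem_primesUpTo hR0).1 (mem_filter.1 hp).1).1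
  have hDp : ∀ p ∈ D, p.Prime := fun p hp => ((mem_primesUpTo hR0).1 (mem_filter.1 hp).1).1
  set P := ∏ p ∈ S, p with hPdef
  have hP0 : P ≠ 0 := prod_ne_zero_iff.2 fun p hp => (hSp p hp).ne_zero
  have hPS : ∀ p : ℕ, p.Prime → p ∣ P → p ∈ S := fun p hp hpP => by
    obtain ⟨q, hq, hpq⟩ := (Prime.dvd_finsetProd_iff hp.prime _).1 hpP
    rwa [(Nat.prime_dvd_prime_iff_eq hp (hSp q hq)).1 hpq]
  have hPsq : Squarefree P := by
    refine Finset.squarefree_prod_of_pairwise_isCoprime (fun p hp q hq hpq => ?_)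
      fun p hp => (hSp p hp).prime.squarefree
    rw [Function.onFun, ← Nat.coprime_iff_isRelPrime]
    exact (Nat.coprime_primes (hSp p hp) (hSp q hq)).2 hpq
  refine ⟨P, hP0, hPsq, ?_, fun p hp hpP => ?_, ?_⟩
  · refine Nat.Coprime.prod_left fun p hp => ?_
    exact (Nat.Prime.coprime_iff_not_dvd (hSp p hp)).2 (mem_filter.1 hp).2.2
  · have := mem_filter.1 (hPS p hp hpP)
    exact ⟨this.2.1, ((mem_primesUpTo hR0).1 this.1).2⟩
  set 𝒬 := P.divisors.filter (fun q : ℕ => (q : ℝ) ≤ R) with h𝒬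
  set E := ∏ p ∈ D, (1 - (p : ℝ)⁻¹)⁻¹ with hE
  have hE0 : 0 ≤ E := prod_nonneg fun p hp => by linarith [one_le_inv_one_sub_inv (hDp p hp)]
  have h1 : Real.log R ≤ ∑ n ∈ Icc 1 ⌊R⌋₊, (n : ℝ)⁻¹ := by
    refine (log_le_harmonic_floor R hR0).trans (le_of_eq ?_)
    rw [harmonic_eq_sum_Icc]; push_cast; rfl
  have hmaps : ∀ n ∈ Icc 1 ⌊R⌋₊, Nat.gcd P n ∈ 𝒬 := fun n hn => by
    rw [mem_Icc] at hn
    refine mem_filter.2 ⟨Nat.mem_divisors.2 ⟨Nat.gcd_dvd_left _ _, hP0⟩, ?_⟩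
    have h2 : Nat.gcd P n ≤ n := Nat.gcd_le_right _ hn.1
    calc ((Nat.gcd P n : ℕ) : ℝ) ≤ n := by exact_mod_cast h2
      _ ≤ ⌊R⌋₊ := by exact_mod_cast hn.2
      _ ≤ R := Nat.floor_le hR0
  have h2 : ∑ n ∈ Icc 1 ⌊R⌋₊, (n : ℝ)⁻¹ ≤ sieveMass P R * E := by
    rw [← sum_fiberwise_of_maps_to hmaps, sieveMass, sum_mul]
    refine sum_le_sum fun q hq => ?_
    rw [h𝒬, mem_filter, Nat.mem_divisors] at hq
    have hq0 : 0 < q := Nat.pos_of_dvd_of_pos hq.1.1 (Nat.pos_of_ne_zero hP0)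
    have hqR : (q : ℝ) ≠ 0 := by exact_mod_cast hq0.ne'
    have hqS : ∀ p ∈ q.primeFactors, p ∈ S := fun p hp =>
      hPS p (Nat.prime_of_mem_primeFactors hp)
        ((Nat.dvd_of_mem_primeFactors hp).trans hq.1.1)
    have hdisj : Disjoint q.primeFactors D := disjoint_left.2 fun p hp hpD =>
      (mem_filter.1 hpD).2 (mem_filter.1 (hqS p hp)).2
    set F := (Icc 1 ⌊R⌋₊).filter (fun n => Nat.gcd P n = q) with hF
    have hFq : ∀ n ∈ F, q ∣ n := fun n hn => by
      rw [← (mem_filter.1 hn).2]; exact Nat.gcd_dvd_right _ _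
    have h3 : ∑ n ∈ F, (n : ℝ)⁻¹ = (q : ℝ)⁻¹ * ∑ m ∈ F.image (fun n => n / q), (m : ℝ)⁻¹ := by
      rw [sum_image, mul_sum]
      · refine sum_congr rfl fun n hn => ?_
        rw [Nat.cast_div (hFq n hn) hqR, inv_div, ← div_eq_inv_mul, div_div_cancel_left' hqR]
      · intro a ha b hb hab
        have h4 := Nat.div_mul_cancel (hFq a ha)
        have h5 := Nat.div_mul_cancel (hFq b hb)
        simp only at hab
        rw [← h4, ← h5, hab]
    rw [h3, one_div_totient_eq hq0, mul_assoc]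
    refine mul_le_mul_of_nonneg_left ?_ (by positivity)
    rw [hE, ← prod_union hdisj]
    refine sum_inv_factored_le _ (fun p hp => ?_) _ fun m hm p hp hpm => ?_
    · rcases mem_union.1 hp with h | h
      · exact Nat.prime_of_mem_primeFactors h
      · exact hDp p h
    · obtain ⟨n, hn, rfl⟩ := mem_image.1 hm
      have hpn : p ∣ n := hpm.trans (Nat.div_dvd_of_dvd (hFq n hn))
      have hn' := mem_filter.1 hn
      have hn1 := mem_Icc.1 hn'.1
      have hpR : p ∈ primesUpTo R := (mem_primesUpTo hR0).2 ⟨hp, by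
        calc (p : ℝ) ≤ n := by exact_mod_cast Nat.le_of_dvd hn1.1 hpn
          _ ≤ ⌊R⌋₊ := by exact_mod_cast hn1.2
          _ ≤ R := Nat.floor_le hR0⟩
      by_cases hc : z < (p : ℝ) ∧ ¬ p ∣ W
      · refine mem_union_left _ (Nat.mem_primeFactors.2 ⟨hp, ?_, hq0.ne'⟩)
        rw [← hn'.2]
        exact Nat.dvd_gcd (dvd_prod_of_mem _ (mem_filter.2 ⟨hpR, hc⟩)) hpn
      · exact mem_union_right _ (mem_filter.2 ⟨hpR, hc⟩)
  have h3 : E ≤ (W / W.totient : ℝ) * eulerUpTo z := by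
    have hsub : D ⊆ W.primeFactors ∪ primesUpTo z := fun p hp => by
      have hp' := hDp p hp
      by_cases hpz : (p : ℝ) ≤ z
      · exact mem_union_right _ ((mem_primesUpTo hz).2 ⟨hp', hpz⟩)
      · refine mem_union_left _ (Nat.mem_primeFactors.2 ⟨hp', ?_, hW.ne'⟩)
        by_contra hc
        exact (mem_filter.1 hp).2 ⟨not_le.1 hpz, hc⟩
    have hpr : ∀ p ∈ W.primeFactors ∪ primesUpTo z, p.Prime := fun p hp => by
      rcases mem_union.1 hp with h | h
      · exact Nat.prime_of_mem_primeFactors h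
      · exact ((mem_primesUpTo hz).1 h).1
    have hone : ∀ p ∈ W.primeFactors ∪ primesUpTo z, 1 ≤ (1 - (p : ℝ)⁻¹)⁻¹ :=
      fun p hp => one_le_inv_one_sub_inv (hpr p hp)
    calc E ≤ ∏ p ∈ W.primeFactors ∪ primesUpTo z, (1 - (p : ℝ)⁻¹)⁻¹ :=
          prod_le_prod_of_subset_of_one_le hsub (fun p hp => by
            linarith [one_le_inv_one_sub_inv (hDp p hp)]) fun p hp _ => hone p hp
      _ ≤ (∏ p ∈ W.primeFactors ∪ primesUpTo z, (1 - (p : ℝ)⁻¹)⁻¹) *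
          ∏ p ∈ W.primeFactors ∩ primesUpTo z, (1 - (p : ℝ)⁻¹)⁻¹ := by
          refine le_mul_of_one_le_right (prod_nonneg fun p hp => by linarith [hone p hp]) ?_
          have : ∀ s : Finset ℕ, (∀ p ∈ s, p.Prime) → 1 ≤ ∏ p ∈ s, (1 - (p : ℝ)⁻¹)⁻¹ := by
            intro s hs
            calc (1 : ℝ) = ∏ p ∈ s, 1 := by simp
              _ ≤ _ := prod_le_prod (fun _ _ => zero_le_one) fun p hp =>
                one_le_inv_one_sub_inv (hs p hp)
          exact this _ fun p hp => Nat.prime_of_mem_primeFactors (mem_inter.1 hp).1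
      _ = _ := by rw [prod_union_inter, div_totient_eq_prod hW, eulerUpTo]
  calc Real.log R ≤ sieveMass P R * E := h1.trans h2
    _ ≤ _ := mul_le_mul_of_nonneg_left h3 (sum_nonneg fun _ _ => by positivity)

end mass

section majorant

lemma eC_val_nsmul {P : ℕ} [NeZero P] (m : ℕ) (γ : ZMod P) (n : ℤ) :
    eC (((m • γ).val : ℝ) / P * n) = eC ((γ.val : ℝ) / P * ((m * n : ℤ) : ℝ)) := by
  induction m with
  | zero => simp [eC_zero]
  | succ m ih =>
    rw [succ_nsmul, eC_val_add, ih, ← eC_add]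
    congr 1
    push_cast
    ring

lemma norm_sum_sieve_le {P : ℕ} [NeZero P] {R : ℝ} (hR : 1 ≤ R) (hP : Squarefree P) {W : ℕ}
    (hPW : Nat.Coprime P W) (f : Polynomial ℤ) (M : ℕ) (c : ℤ) (α : ℝ) :
    ‖∑ z ∈ range (M + 1), ((‖sieveFun P R (W * z + c)‖ ^ 2 : ℝ) : ℂ) *
      ((polyIncr f z : ℂ) * eC (α * (f.eval (z : ℤ) : ℤ)))‖ ≤
      1 / sieveMass P R * orderSum f M P (R ^ 2) α := by
  have hG := one_le_sieveMass (P := P) hR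
  refine (norm_sum_mul_sieveFun_sq_le hR hP _ _ _).trans ?_
  refine mul_le_mul_of_nonneg_left (le_of_eq ?_) (by positivity)
  have hord : ∀ γ : ZMod P, addOrderOf (W • γ) = addOrderOf γ := fun γ =>
    Nat.Coprime.addOrderOf_nsmul (hPW.coprime_dvd_left (addOrderOf_dvd_modulus γ))
  have hinj : Function.Injective fun γ : ZMod P => W • γ := by
    intro x y hxy
    simp only [nsmul_eq_mul] at hxy
    exact (ZMod.isUnit_iff_coprime W P).2 hPW.symm |>.mul_left_cancel hxy
  have hbij := Finite.injective_iff_bijective.1 hinj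
  rw [orderSum, sum_filter, sum_filter,
    ← hbij.sum_comp (fun γ : ZMod P => if (addOrderOf γ : ℝ) ≤ R ^ 2 then
      (#(addOrderOf γ).divisors : ℝ) ^ 3 / addOrderOf γ * ‖polySum f M α ((γ.val : ℝ) / P)‖ else 0)]
  refine sum_congr rfl fun γ _ => ?_
  simp only [hord]
  congr 2
  have : ∑ i ∈ range (M + 1), ((polyIncr f i : ℂ) * eC (α * (f.eval (i : ℤ) : ℤ))) *
      eC ((γ.val : ℝ) / P * ((W * i + c : ℤ) : ℝ)) = eC ((γ.val : ℝ) / P * c) *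
      polySum f M α (((W • γ).val : ℝ) / P) := by
    rw [polySum, mul_sum]
    refine sum_congr rfl fun z _ => ?_
    have h := eC_val_nsmul W γ z
    rw [Int.cast_natCast] at h
    rw [eC_add, h, mul_assoc, ← eC_add, mul_left_comm, ← eC_add, ← eC_add]
    congr 2
    push_cast
    ring
  rw [this, norm_mul, norm_eC, one_mul]

lemma eulerUpTo_pos (z : ℝ) : 1 ≤ eulerUpTo z := by
  calc (1 : ℝ) = ∏ p ∈ primesUpTo z, 1 := by simp
    _ ≤ _ := prod_le_prod (fun _ _ => zero_le_one) fun p hp =>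
      one_le_inv_one_sub_inv (mem_filter.1 hp).2

lemma card_filter_linear_le (W : ℕ) (hW : 0 < W) (c : ℤ) {R : ℝ} (hR : 0 ≤ R) (M : ℕ) :
    (#((range (M + 1)).filter fun z : ℕ => 0 < (W * z + c : ℤ) ∧ ((W * z + c : ℤ) : ℝ) ≤ R) : ℝ)
      ≤ R := by
  have h : #((range (M + 1)).filter fun z : ℕ => 0 < (W * z + c : ℤ) ∧
      ((W * z + c : ℤ) : ℝ) ≤ R) ≤ #(Ioc (0 : ℤ) ⌊R⌋) := by
    refine card_le_card_of_injOn (fun z : ℕ => (W * z + c : ℤ)) (fun z hz => ?_) ?_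
    · have := (mem_filter.1 hz).2
      exact mem_Ioc.2 ⟨this.1, Int.le_floor.2 this.2⟩
    · intro a _ b _ hab
      have hW0 : (W : ℤ) ≠ 0 := by exact_mod_cast hW.ne'
      have h1 : (W : ℤ) * a = W * b := by simpa using hab
      exact_mod_cast mul_left_cancel₀ hW0 h1
  rw [Int.card_Ioc, sub_zero] at h
  calc _ ≤ ((⌊R⌋.toNat : ℕ) : ℝ) := by exact_mod_cast h
    _ = ((⌊R⌋ : ℤ) : ℝ) := by
        have : ((⌊R⌋.toNat : ℕ) : ℤ) = ⌊R⌋ := Int.toNat_of_nonneg (Int.floor_nonneg.2 hR)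
        exact_mod_cast congrArg (fun x : ℤ => (x : ℝ)) this
    _ ≤ R := Int.floor_le R

/-- A Selberg majorant for the primes in a progression, whose exponential sums along a polynomial
are small on the minor arcs and controlled by `localSum` on the major arcs. -/
lemma exists_majorant (k : ℕ) (hk : 1 ≤ k) {σ : ℝ} (hσ : σ = 1 / (k * 2 ^ (k + 2))) :
    ∃ C : ℝ, 0 < C ∧ ∀ (f : Polynomial ℤ) (W M N : ℕ) (c : ℤ) (V z L : ℝ), 0 < W →
      Admissible k (σ / 400) f W M N V → 2 ≤ N → 8 ≤ (N : ℝ) ^ (1 / (8 * k) : ℝ) → 0 ≤ z →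
      0 ≤ L → L ≤ 2 * Real.log N →
      ∃ (P : ℕ) (_ : NeZero P) (ω : ℕ → ℝ), Nat.Coprime P W ∧
        (∀ p : ℕ, p.Prime → p ∣ P → z < p) ∧ (∀ x, 0 ≤ ω x) ∧
        (∀ x : ℕ, Nat.Prime (W * x + c : ℤ).toNat → (W.totient : ℝ) / W * L ≤ ω x) ∧
        ∀ α : ℝ,
          ‖∑ x ∈ range (M + 1), ((ω x * polyIncr f x : ℝ) : ℂ) * eC (α * (f.eval (x : ℤ) : ℤ))‖ ≤
            C * eulerUpTo z * (f.eval (M : ℤ) : ℤ) * (N : ℝ) ^ (-(3 / 4 * σ)) ∨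
          ∃ (u : ℤ) (v : ℕ) (θ : ℝ), 0 < v ∧ IsCoprime u (v : ℤ) ∧ α = u / v + θ ∧ |θ| ≤ 1 ∧
          ‖∑ x ∈ range (M + 1), ((ω x * polyIncr f x : ℝ) : ℂ) * eC (α * (f.eval (x : ℤ) : ℤ))‖ ≤
            C * eulerUpTo z * (f.eval (M : ℤ) : ℤ) *
              (localSum f u v P / (1 + N * |θ|) + (N : ℝ) ^ (-(3 / 4 * σ))) := by
  obtain ⟨C, hC, hmain⟩ := exists_orderSum_le k hk hσ
  have hk0 : (1 : ℝ) ≤ k := by exact_mod_cast hk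
  have hσ0 : 0 < σ := by rw [hσ]; positivity
  set δ := σ / 400 with hδ
  have hδ0 : 0 < δ := by positivity
  refine ⟨2 / δ * C + 40 / δ, by positivity, ?_⟩
  intro f W M N c V z L hW hA hN hN8 hz hL0 hL
  have hN1 : (1 : ℝ) ≤ N := by exact_mod_cast (by omega : 1 ≤ N)
  have hN2 : (2 : ℝ) ≤ N := by exact_mod_cast hN
  have hN0 : (0 : ℝ) < N := by linarith
  have hlogN : 0 < Real.log N := Real.log_pos (by linarith)
  set R := (N : ℝ) ^ δ with hR
  have hR1 : 1 ≤ R := Real.one_le_rpow hN1 hδ0.le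
  obtain ⟨P, hP0, hPsq, hPW, hPp, hG⟩ := exists_sieve_modulus W hW hR1 hz
  have : NeZero P := ⟨hP0⟩
  have hφ0 : (0 : ℝ) < W.totient := by exact_mod_cast Nat.totient_pos.2 hW
  have hW0 : (0 : ℝ) < W := by exact_mod_cast hW
  have hφ1 : (W.totient : ℝ) / W ≤ 1 := by
    rw [div_le_one hW0]; exact_mod_cast Nat.totient_le W
  have hG1 := one_le_sieveMass (P := P) hR1
  have hZ := eulerUpTo_pos z
  set A : ℝ := (W.totient : ℝ) / W * L with hAdef
  have hA0 : 0 ≤ A := by positivity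
  set F : ℝ := ((f.eval (M : ℤ) : ℤ) : ℝ) with hF
  have hF0 : 0 < F := by have := hA.half_le; rw [← hF] at this; linarith
  set Q := (range (M + 1)).filter
    (fun x : ℕ => 0 < (W * x + c : ℤ) ∧ ((W * x + c : ℤ) : ℝ) ≤ R) with hQ
  let ω : ℕ → ℝ := fun x => A * (‖sieveFun P R (W * x + c)‖ ^ 2 +
    if 0 < (W * x + c : ℤ) ∧ ((W * x + c : ℤ) : ℝ) ≤ R then 1 else 0)
  have hω : ∀ x, ω x = A * (‖sieveFun P R (W * x + c)‖ ^ 2 +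
    if 0 < (W * x + c : ℤ) ∧ ((W * x + c : ℤ) : ℝ) ≤ R then 1 else 0) := fun _ => rfl
  refine ⟨P, inferInstance, ω, hPW, fun p hp h => (hPp p hp h).1, fun x => ?_, fun x hx => ?_, ?_⟩
  · rw [hω]; split_ifs <;> positivity
  · rw [hω]
    refine le_mul_of_one_le_right hA0 ?_
    have hpos : 0 < (W * x + c : ℤ) := by
      by_contra h
      rw [Int.toNat_of_nonpos (not_lt.1 h)] at hx
      exact Nat.not_prime_zero hx
    by_cases hs : ((W * x + c : ℤ) : ℝ) ≤ R
    · rw [if_pos ⟨hpos, hs⟩]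
      have := sq_nonneg ‖sieveFun P R (W * x + c)‖
      linarith
    · rw [if_neg fun h => hs h.2, sieveFun_eq_one hR1 hPsq]
      · simp
      · generalize (W * x + c : ℤ) = y at *
        lift y to ℕ using hpos.le
        rw [Int.toNat_natCast] at hx
        rw [Nat.isCoprime_iff_coprime, Nat.Prime.coprime_iff_not_dvd hx]
        intro h
        exact hs (by exact_mod_cast (hPp y hx h).2)
  -- the coefficient in front of the main term
  have hcoef : A * (1 / sieveMass P R) ≤ 2 / δ * eulerUpTo z := by
    have h1 : Real.log R = δ * Real.log N := Real.log_rpow hN0 δ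
    rw [h1] at hG
    rw [mul_one_div, div_le_iff₀ (by linarith), hAdef]
    have h2 : L ≤ 2 / δ * (δ * Real.log N) := by
      rw [← mul_assoc, div_mul_cancel₀ _ hδ0.ne']; exact hL
    calc (W.totient : ℝ) / W * L ≤ (W.totient : ℝ) / W * (2 / δ * (sieveMass P R *
          ((W / W.totient : ℝ) * eulerUpTo z))) := by
          refine mul_le_mul_of_nonneg_left (h2.trans ?_) (by positivity)
          exact mul_le_mul_of_nonneg_left hG (by positivity)
      _ = _ := by field_simp
  have hsmall : A * ∑ x ∈ Q, |polyIncr f x| ≤ 4 / δ * F * (N : ℝ) ^ (-(3 / 4 * σ)) := by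
    have hV := hA.incrBound.1
    have hM0 : (0 : ℝ) < M := lt_of_lt_of_le (by positivity) (hA.rpow_le hk hδ0.le (by omega))
    have h1 : ∑ x ∈ Q, |polyIncr f x| ≤ R * V := by
      have hV0 : 0 ≤ V := (hV 0 (Nat.zero_le _)).1.trans (hV 0 (Nat.zero_le _)).2
      calc ∑ x ∈ Q, |polyIncr f x| ≤ ∑ x ∈ Q, V := sum_le_sum fun x hx => by
            have hxM : x ≤ M := by
              have := mem_range.1 (mem_filter.1 hx).1; omega
            rw [abs_of_nonneg (hV x hxM).1]; exact (hV x hxM).2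
        _ = #Q * V := by rw [sum_const, nsmul_eq_mul]
        _ ≤ R * V := mul_le_mul_of_nonneg_right (card_filter_linear_le W hW c (by linarith) M) hV0
    have h2 : V ≤ R * F * (N : ℝ) ^ (δ - 1 / (k : ℝ)) := by
      have h3 : V ≤ R * F / M := by rw [le_div_iff₀ hM0]; exact hA.mul_le
      refine h3.trans ?_
      rw [div_eq_mul_inv]
      refine mul_le_mul_of_nonneg_left ?_ (by positivity)
      rw [show δ - 1 / (k : ℝ) = -(1 / (k : ℝ) - δ) by ring, Real.rpow_neg hN0.le]
      exact inv_anti₀ (by positivity) (hA.rpow_le hk hδ0.le (by omega))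
    have h3 : A ≤ 2 * (R / δ) := by
      calc A ≤ 1 * L := mul_le_mul_of_nonneg_right hφ1 hL0
        _ ≤ 2 * Real.log N := by rw [one_mul]; exact hL
        _ ≤ 2 * (R / δ) := by
            gcongr
            exact Real.log_le_rpow_div hN0.le hδ0
    calc A * ∑ x ∈ Q, |polyIncr f x| ≤ 2 * (R / δ) * (R * (R * F * (N : ℝ) ^ (δ - 1 / (k : ℝ)))) := by
          refine mul_le_mul h3 (h1.trans ?_) (sum_nonneg fun _ _ => abs_nonneg _) (by positivity)
          gcongr
      _ = 2 / δ * F * ((N : ℝ) ^ δ * ((N : ℝ) ^ δ * ((N : ℝ) ^ δ * (N : ℝ) ^ (δ - 1 / (k : ℝ))))) := by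
          rw [← hR]; ring
      _ = 2 / δ * F * (N : ℝ) ^ (δ + (δ + (δ + (δ - 1 / (k : ℝ))))) := by
          rw [Real.rpow_add hN0, Real.rpow_add hN0, Real.rpow_add hN0]
      _ ≤ 4 / δ * F * (N : ℝ) ^ (-(3 / 4 * σ)) := by
          have hσk : σ ≤ 1 / 8 * (1 / (k : ℝ)) := by
            rw [hσ, ← one_div_mul_one_div, mul_comm]
            gcongr
            calc (8 : ℝ) = 2 ^ 3 := by norm_num
              _ ≤ 2 ^ (k + 2) := pow_le_pow_right₀ (by norm_num) (by omega)
          gcongr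
          · norm_num
          · linarith
  have hsplit : ∀ α : ℝ,
      ‖∑ x ∈ range (M + 1), ((ω x * polyIncr f x : ℝ) : ℂ) * eC (α * (f.eval (x : ℤ) : ℤ))‖ ≤
      2 / δ * eulerUpTo z * orderSum f M P (N ^ (2 * (σ / 400))) α +
        4 / δ * F * (N : ℝ) ^ (-(3 / 4 * σ)) := by
    intro α
    have h1 : ∑ x ∈ range (M + 1), ((ω x * polyIncr f x : ℝ) : ℂ) *
        eC (α * (f.eval (x : ℤ) : ℤ)) = (A : ℂ) * ∑ x ∈ range (M + 1),
        ((‖sieveFun P R (W * x + c)‖ ^ 2 : ℝ) : ℂ) *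
          ((polyIncr f x : ℂ) * eC (α * (f.eval (x : ℤ) : ℤ))) +
        (A : ℂ) * ∑ x ∈ Q, (polyIncr f x : ℂ) * eC (α * (f.eval (x : ℤ) : ℤ)) := by
      rw [hQ, sum_filter, ← mul_add, ← sum_add_distrib, mul_sum]
      refine sum_congr rfl fun x _ => ?_
      rw [hω]
      split_ifs <;> push_cast <;> ring
    have hRT : R ^ 2 = (N : ℝ) ^ (2 * (σ / 400)) := by
      rw [hR, ← Real.rpow_natCast, ← Real.rpow_mul hN0.le, hδ]; congr 1; push_cast; ring
    have h2 := norm_sum_sieve_le hR1 hPsq hPW f M c α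
    rw [hRT] at h2
    have hO : 0 ≤ orderSum f M P ((N : ℝ) ^ (2 * (σ / 400))) α :=
      sum_nonneg fun _ _ => by positivity
    rw [h1]
    refine (norm_add_le _ _).trans (add_le_add ?_ ?_)
    · rw [norm_mul, Complex.norm_real, Real.norm_eq_abs, abs_of_nonneg hA0]
      calc _ ≤ A * (1 / sieveMass P R * orderSum f M P ((N : ℝ) ^ (2 * (σ / 400))) α) :=
            mul_le_mul_of_nonneg_left h2 hA0
        _ ≤ _ := by
            rw [← mul_assoc]
            exact mul_le_mul_of_nonneg_right hcoef hO
    · rw [norm_mul, Complex.norm_real, Real.norm_eq_abs, abs_of_nonneg hA0]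
      refine le_trans (mul_le_mul_of_nonneg_left ((norm_sum_le _ _).trans (le_of_eq ?_)) hA0) hsmall
      refine sum_congr rfl fun x _ => ?_
      rw [norm_mul, norm_eC, mul_one, Complex.norm_real, Real.norm_eq_abs]
  intro α
  set E := (N : ℝ) ^ (-(3 / 4 * σ)) with hE
  have hE0 : 0 < E := by positivity
  have hZF : 0 ≤ (eulerUpTo z - 1) * (4 / δ * F * E) :=
    mul_nonneg (by linarith) (by positivity)
  rcases hmain f W M N P V hA (by omega) hN8 α with h | ⟨u, v, θ, hv, huv, hα, hθ, h⟩
  · left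
    refine (hsplit α).trans ?_
    have h2 := mul_le_mul_of_nonneg_left h (show 0 ≤ 2 / δ * eulerUpTo z by positivity)
    have h3 : 0 ≤ 36 / δ * eulerUpTo z * F * E := by positivity
    have h4 : (2 / δ * C + 40 / δ) * eulerUpTo z * F * E = 2 / δ * eulerUpTo z * (C * E * F) +
        4 / δ * F * E + (eulerUpTo z - 1) * (4 / δ * F * E) + 36 / δ * eulerUpTo z * F * E := by
      ring
    linarith
  · right
    refine ⟨u, v, θ, hv, huv, hα, hθ, (hsplit α).trans ?_⟩
    have h2 := mul_le_mul_of_nonneg_left h (show 0 ≤ 2 / δ * eulerUpTo z by positivity)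
    set S := localSum f u v P / (1 + N * |θ|) with hS
    have hS0 : 0 ≤ S := div_nonneg (localSum_nonneg _ _ _) (by positivity)
    have h8 : 8 * localSum f u v P / (1 + N * |θ|) = 8 * S := by rw [hS]; ring
    rw [h8] at h2
    have h3 : 0 ≤ (2 / δ * C + 24 / δ) * eulerUpTo z * F * S +
      (2 / δ * C + 4 / δ) * eulerUpTo z * F * E := by positivity
    have h4 : (2 / δ * C + 40 / δ) * eulerUpTo z * F * (S + E) =
        2 / δ * eulerUpTo z * (F * (8 * S + 16 * E)) + 4 / δ * F * E +
        (eulerUpTo z - 1) * (4 / δ * F * E) + ((2 / δ * C + 24 / δ) * eulerUpTo z * F * S +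
      (2 / δ * C + 4 / δ) * eulerUpTo z * F * E) := by
      ring
    linarith

end majorant

section fourier

variable {N : ℕ}

/-- The additive characters of `ZMod N`. -/
noncomputable def zchar (r x : ZMod N) : ℂ := eC ((r.val : ℝ) / N * x.val)

lemma zchar_comm (r x : ZMod N) : zchar r x = zchar x r := by
  unfold zchar; congr 1; ring

lemma norm_zchar (r x : ZMod N) : ‖zchar r x‖ = 1 := norm_eC _

variable [NeZero N]

lemma zchar_intCast (r : ZMod N) (n : ℤ) : zchar r (n : ZMod N) = eC ((r.val : ℝ) / N * n) := by
  have hN : (N : ℝ) ≠ 0 := by exact_mod_cast NeZero.ne N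
  have h : (((n : ZMod N).val : ℤ) : ZMod N) = (n : ZMod N) := by
    rw [Int.cast_natCast, ZMod.natCast_zmod_val]
  obtain ⟨m, hm⟩ := (ZMod.intCast_eq_intCast_iff_dvd_sub _ _ N).1 h
  refine eC_eq_of_sub_eq_intCast (-(r.val * m)) ?_
  have h2 : (n : ℝ) - ((n : ZMod N).val : ℝ) = N * m := by exact_mod_cast hm
  have h3 : (((n : ZMod N).val : ℕ) : ℝ) = n - N * m := by linarith
  rw [h3]
  push_cast
  field_simp
  ring

lemma zchar_add_left (r s x : ZMod N) : zchar (r + s) x = zchar r x * zchar s x := by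
  have := eC_val_add r s x.val
  simpa [zchar] using this

lemma zchar_add_right (r x y : ZMod N) : zchar r (x + y) = zchar r x * zchar r y := by
  rw [zchar_comm, zchar_add_left, zchar_comm x, zchar_comm y]

lemma zchar_neg_left (r x : ZMod N) : zchar (-r) x = (starRingEnd ℂ) (zchar r x) := by
  have := eC_val_neg r x.val
  rw [zchar, zchar, ← eC_neg]
  simpa using this

lemma zchar_neg_right (r x : ZMod N) : zchar r (-x) = zchar (-r) x := by
  rw [zchar_comm, zchar_neg_left, zchar_neg_left, zchar_comm]

lemma zchar_zero_right (x : ZMod N) : zchar x 0 = 1 := by simp [zchar, eC_zero]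

lemma zchar_mul_left (r s x : ZMod N) : zchar (s * r) x = zchar r (s * x) := by
  have h1 : s * r = s.val • r := by rw [nsmul_eq_mul, ZMod.natCast_zmod_val]
  have h2 : s * x = ((s.val * x.val : ℤ) : ZMod N) := by
    push_cast
    rw [ZMod.natCast_zmod_val, ZMod.natCast_zmod_val]
  rw [h2, zchar_intCast, h1, ← eC_val_nsmul, zchar]
  simp

lemma sum_zchar (x : ZMod N) : ∑ r : ZMod N, zchar r x = if x = 0 then (N : ℂ) else 0 := by
  split_ifs with h
  · subst h
    simp [zchar_zero_right, ZMod.card]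
  · have hne : zchar 1 x ≠ 1 := by
      intro h1
      have hNpos : 0 < N := Nat.pos_of_ne_zero (NeZero.ne N)
      have hN : (N : ℝ) ≠ 0 := by exact_mod_cast NeZero.ne N
      rw [zchar_comm] at h1
      have h2 := zchar_intCast x 1
      rw [Int.cast_one, Int.cast_one, mul_one] at h2
      rw [h2, eC_eq_one_iff] at h1
      obtain ⟨n, hn⟩ := h1
      have h3 : ((x.val : ℕ) : ℝ) = n * N := by rw [← hn]; field_simp
      have h4 : ((x.val : ℕ) : ℤ) = n * N := by exact_mod_cast h3
      have h5 := ZMod.val_lt x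
      have h6 : (N : ℤ) ∣ x.val := ⟨n, by rw [h4]; ring⟩
      have h7 : N ∣ x.val := by exact_mod_cast h6
      exact h ((ZMod.val_eq_zero x).1 (Nat.eq_zero_of_dvd_of_lt h7 h5))
    have hs : ∑ r : ZMod N, zchar r x = zchar 1 x * ∑ r : ZMod N, zchar r x := by
      rw [mul_sum, ← Equiv.sum_comp (Equiv.addLeft (1 : ZMod N))]
      exact sum_congr rfl fun r _ => zchar_add_left _ _ _
    by_contra h0
    exact hne (mul_right_cancel₀ h0 (by rw [one_mul]; exact hs.symm))

/-- The Fourier transform on `ZMod N`. -/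
noncomputable def zhat (f : ZMod N → ℂ) (r : ZMod N) : ℂ := ∑ x, f x * zchar (-r) x

lemma dft_eq_zhat (f : ZMod N → ℝ) (r : ZMod N) : dft N f r = zhat (fun x => (f x : ℂ)) r := by
  have hN : (N : ℝ) ≠ 0 := by exact_mod_cast NeZero.ne N
  have hNpos : 0 < N := Nat.pos_of_ne_zero (NeZero.ne N)
  rw [dft, zhat]
  refine sum_bij (fun x _ => (x : ZMod N)) (fun _ _ => mem_univ _) (fun a ha b hb hab => ?_)
    (fun x _ => ?_) (fun x _ => ?_)
  · rw [mem_Icc] at ha hb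
    rw [ZMod.natCast_eq_natCast_iff] at hab
    rcases Nat.lt_or_ge a N with h1 | h1 <;> rcases Nat.lt_or_ge b N with h2 | h2
    · exact Nat.ModEq.eq_of_lt_of_lt hab h1 h2
    · have h3 : b = N := by omega
      subst h3
      have := Nat.ModEq.eq_of_lt_of_lt (hab.trans (by simp [Nat.ModEq] : b ≡ 0 [MOD b])) h1 hNpos
      omega
    · have h3 : a = N := by omega
      subst h3
      have := Nat.ModEq.eq_of_lt_of_lt (hab.symm.trans (by simp [Nat.ModEq] : a ≡ 0 [MOD a])) h2 hNpos
      omega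
    · omega
  · by_cases hx : x = 0
    · exact ⟨N, mem_Icc.2 ⟨hNpos, le_rfl⟩, by rw [hx, ZMod.natCast_self]⟩
    · refine ⟨x.val, mem_Icc.2 ⟨?_, (ZMod.val_lt x).le⟩, ZMod.natCast_zmod_val x⟩
      exact Nat.pos_of_ne_zero fun h => hx ((ZMod.val_eq_zero x).1 h)
  · congr 1
    have h := zchar_intCast r (x : ℤ)
    rw [Int.cast_natCast, Int.cast_natCast] at h
    rw [zchar_neg_left, h, ← eC_neg]
    congr 1
    ring

lemma zhat_inversion (f : ZMod N → ℂ) (x : ZMod N) :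
    ∑ r, zhat f r * zchar r x = N * f x := by
  simp_rw [zhat, sum_mul]
  rw [sum_comm]
  have h : ∀ y : ZMod N, ∑ r, f y * zchar (-r) y * zchar r x = f y * if x = y then (N : ℂ) else 0 := by
    intro y
    have : (if x = y then (N : ℂ) else 0) = ∑ r, zchar r (x - y) := by
      rw [sum_zchar]; simp [sub_eq_zero]
    rw [this, mul_sum]
    refine sum_congr rfl fun r _ => ?_
    rw [sub_eq_add_neg, zchar_add_right, zchar_neg_right]; ring
  simp_rw [h]
  simp [mul_comm]

lemma zhat_parseval (f : ZMod N → ℂ) : ∑ r, ‖zhat f r‖ ^ 2 = N * ∑ x, ‖f x‖ ^ 2 := by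
  have h : ∑ r, zhat f r * (starRingEnd ℂ) (zhat f r) = N * ∑ x, f x * (starRingEnd ℂ) (f x) := by
    have h1 : ∀ r, (starRingEnd ℂ) (zhat f r) = ∑ x, (starRingEnd ℂ) (f x) * zchar r x := by
      intro r
      rw [zhat, map_sum]
      refine sum_congr rfl fun x _ => ?_
      rw [map_mul, ← zchar_neg_left, neg_neg]
    simp_rw [h1, mul_sum]
    rw [sum_comm]
    refine sum_congr rfl fun x _ => ?_
    rw [← mul_assoc, ← zhat_inversion f x, sum_mul]
    exact sum_congr rfl fun r _ => by ring
  have h2 : ∀ z : ℂ, z * (starRingEnd ℂ) z = ((‖z‖ ^ 2 : ℝ) : ℂ) := fun z => by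
    rw [Complex.mul_conj', Complex.ofReal_pow]
  simp_rw [h2] at h
  exact_mod_cast h

/-- Convolution on `ZMod N`. -/
noncomputable def zconv (f g : ZMod N → ℝ) (x : ZMod N) : ℝ := ∑ y, f y * g (x - y)

lemma zhat_zconv (f g : ZMod N → ℝ) (r : ZMod N) :
    zhat (fun x => (zconv f g x : ℂ)) r =
      zhat (fun x => (f x : ℂ)) r * zhat (fun x => (g x : ℂ)) r := by
  simp_rw [zhat, zconv, sum_mul_sum]
  push_cast
  simp_rw [sum_mul]
  rw [sum_comm]
  refine sum_congr rfl fun y _ => ?_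
  rw [← Equiv.sum_comp (Equiv.addLeft y)]
  refine sum_congr rfl fun x _ => ?_
  simp only [Equiv.coe_addLeft, add_sub_cancel_left, zchar_add_right]
  ring

lemma sum_norm_zhat_pow_le {f g : ZMod N → ℝ} (h0 : ∀ x, 0 ≤ f x) (h : ∀ x, f x ≤ g x) (s : ℕ) :
    ∑ r, ‖zhat (fun x => (f x : ℂ)) r‖ ^ (2 * s) ≤
      ∑ r, ‖zhat (fun x => (g x : ℂ)) r‖ ^ (2 * s) := by
  have key : ∃ F G : ZMod N → ℝ, (∀ x, 0 ≤ F x) ∧ (∀ x, F x ≤ G x) ∧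
      (∀ r, zhat (fun x => (F x : ℂ)) r = zhat (fun x => (f x : ℂ)) r ^ s) ∧
      (∀ r, zhat (fun x => (G x : ℂ)) r = zhat (fun x => (g x : ℂ)) r ^ s) := by
    induction s with
    | zero =>
      have : ∀ r : ZMod N, zhat (fun x => ((if x = 0 then (1 : ℝ) else 0 : ℝ) : ℂ)) r = 1 := by
        intro r
        rw [zhat, sum_eq_single 0]
        · simp [zchar_zero_right]
        · intro x _ hx; simp [hx]
        · simp
      exact ⟨fun x => if x = 0 then 1 else 0, fun x => if x = 0 then 1 else 0,
        fun x => by dsimp only; split_ifs <;> norm_num, fun x => le_rfl, fun r => by rw [this, pow_zero],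
        fun r => by rw [this, pow_zero]⟩
    | succ s ih =>
      obtain ⟨F, G, hF, hFG, h1, h2⟩ := ih
      refine ⟨zconv F f, zconv G g, fun x => sum_nonneg fun y _ => mul_nonneg (hF _) (h0 _),
        fun x => sum_le_sum fun y _ => mul_le_mul (hFG _) (h _) (h0 _) ((hF _).trans (hFG _)),
        fun r => ?_, fun r => ?_⟩
      · rw [zhat_zconv, h1, pow_succ]
      · rw [zhat_zconv, h2, pow_succ]
  obtain ⟨F, G, hF, hFG, h1, h2⟩ := key
  simp_rw [mul_comm 2 s, pow_mul, ← norm_pow _ s, ← h1, ← h2]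
  rw [zhat_parseval, zhat_parseval]
  gcongr with x
  rw [Complex.norm_real, Complex.norm_real, Real.norm_eq_abs, Real.norm_eq_abs,
    abs_of_nonneg (hF x), abs_of_nonneg ((hF x).trans (hFG x))]
  exact hFG x

end fourier

section moment

lemma summable_one_div_one_add_abs_sq :
    Summable fun j : ℤ => 1 / (1 + |(j : ℝ)|) ^ 2 := by
  have h : Summable fun n : ℕ => 1 / (1 + (n : ℝ)) ^ 2 := by
    have := (summable_nat_add_iff 1).2 (Real.summable_one_div_nat_pow.2 (by norm_num : 1 < 2))
    refine this.congr fun n => ?_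
    push_cast
    rw [add_comm]
  refine Summable.of_nat_of_neg (h.congr fun n => ?_) (h.congr fun n => ?_)
  · simp
  · simp

lemma exists_sum_approximations_le : ∃ C : ℝ, 0 < C ∧ ∀ (N : ℕ) [NeZero N] (S : Finset (ZMod N))
    (u : ZMod N → ℤ) (v : ZMod N → ℕ) (θ : ZMod N → ℝ),
    (∀ r ∈ S, 0 < v r ∧ (r.val : ℝ) / N = u r / v r + θ r ∧ |θ r| ≤ 1) →
    ∑ r ∈ S, 1 / (v r : ℝ) ^ 4 * (1 / (1 + N * |θ r|) ^ 2) ≤ C := by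
  classical
  have hs1 : Summable fun n : ℕ => 1 / (n : ℝ) ^ 2 := Real.summable_one_div_nat_pow.2 (by norm_num)
  have hs2 := summable_one_div_one_add_abs_sq
  set c1 := ∑' n : ℕ, 1 / (n : ℝ) ^ 2 with hc1
  set c2 := ∑' j : ℤ, 1 / (1 + |(j : ℝ)|) ^ 2 with hc2
  have hc1' : 0 ≤ c1 := tsum_nonneg fun _ => by positivity
  have hc2' : 0 ≤ c2 := tsum_nonneg fun _ => by positivity
  refine ⟨36 * (c1 * (c2 * c2)) + 1, by positivity, ?_⟩
  intro N _ S u v θ h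
  have hN : (0 : ℝ) < N := by exact_mod_cast Nat.pos_of_ne_zero (NeZero.ne N)
  let e : ZMod N → ℕ × ℤ × ℤ := fun r => (v r, u r, ⌊N * θ r⌋)
  let H : ℕ × ℤ × ℤ → ℝ := fun t => 1 / (t.1 : ℝ) ^ 2 *
    (1 / (1 + |(t.2.1 : ℝ)|) ^ 2 * (1 / (1 + |(t.2.2 : ℝ)|) ^ 2))
  have hinj : Set.InjOn e S := by
    intro r hr s hs hrs
    have h1 := h r hr
    have h2 := h s hs
    simp only [e, Prod.mk.injEq] at hrs
    have h3 : |(N : ℝ) * θ r - N * θ s| < 1 := Int.abs_sub_lt_one_of_floor_eq_floor hrs.2.2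
    have h4 : (N : ℝ) * θ r - N * θ s = (r.val : ℝ) - s.val := by
      have e1 : θ r = (r.val : ℝ) / N - u r / v r := by linarith [h1.2.1]
      have e2 : θ s = (s.val : ℝ) / N - u s / v s := by linarith [h2.2.1]
      rw [e1, e2, hrs.1, hrs.2.1]
      field_simp
      ring
    rw [h4] at h3
    have h5 : |((r.val : ℤ) - s.val : ℤ)| < 1 := by exact_mod_cast h3
    rw [Int.abs_lt_one_iff] at h5
    exact ZMod.val_injective N (by omega)
  have hterm : ∀ r ∈ S, 1 / (v r : ℝ) ^ 4 * (1 / (1 + N * |θ r|) ^ 2) ≤ 36 * H (e r) := by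
    intro r hr
    obtain ⟨hv, hα, hθ⟩ := h r hr
    have hv1 : (1 : ℝ) ≤ v r := by exact_mod_cast hv
    have hr1 : (r.val : ℝ) / N ≤ 1 := by
      rw [div_le_one hN]; exact_mod_cast (ZMod.val_lt r).le
    have hr0 : 0 ≤ (r.val : ℝ) / N := by positivity
    have hu : |(u r : ℝ)| ≤ 2 * v r := by
      have e1 : (u r : ℝ) = ((r.val : ℝ) / N - θ r) * v r := by
        rw [hα]; field_simp; ring
      rw [e1, abs_mul, abs_of_pos (by linarith : (0 : ℝ) < v r)]
      gcongr
      rw [abs_le] at hθ ⊢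
      constructor <;> linarith
    have hj : |((⌊N * θ r⌋ : ℤ) : ℝ)| ≤ N * |θ r| + 1 := by
      have h1 := Int.floor_le (N * θ r)
      have h2 := Int.lt_floor_add_one (N * θ r)
      have h3 : |N * θ r| = N * |θ r| := by rw [abs_mul, abs_of_pos hN]
      rw [← h3]
      have := abs_sub_abs_le_abs_sub ((⌊N * θ r⌋ : ℤ) : ℝ) (N * θ r)
      have h4 : |((⌊N * θ r⌋ : ℤ) : ℝ) - N * θ r| ≤ 1 := by
        rw [abs_le]; constructor <;> linarith
      linarith
    have hNθ : 0 ≤ N * |θ r| := by positivity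
    have b1 : 1 / (v r : ℝ) ^ 2 ≤ 9 * (1 / (1 + |(u r : ℝ)|) ^ 2) := by
      rw [mul_one_div, div_le_div_iff₀ (by positivity) (by positivity)]
      have : 1 + |(u r : ℝ)| ≤ 3 * v r := by linarith
      have := pow_le_pow_left₀ (by positivity) this 2
      linarith
    have b2 : 1 / (1 + N * |θ r|) ^ 2 ≤ 4 * (1 / (1 + |((⌊N * θ r⌋ : ℤ) : ℝ)|) ^ 2) := by
      rw [mul_one_div, div_le_div_iff₀ (by positivity) (by positivity)]
      have : 1 + |((⌊N * θ r⌋ : ℤ) : ℝ)| ≤ 2 * (1 + N * |θ r|) := by linarith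
      have := pow_le_pow_left₀ (by positivity) this 2
      linarith
    calc 1 / (v r : ℝ) ^ 4 * (1 / (1 + N * |θ r|) ^ 2)
        = 1 / (v r : ℝ) ^ 2 * (1 / (v r : ℝ) ^ 2 * (1 / (1 + N * |θ r|) ^ 2)) := by
          rw [← mul_assoc, show 1 / (v r : ℝ) ^ 2 * (1 / (v r : ℝ) ^ 2) = 1 / (v r : ℝ) ^ 4 by
            rw [one_div_mul_one_div, ← pow_add]]
      _ ≤ 1 / (v r : ℝ) ^ 2 * (9 * (1 / (1 + |(u r : ℝ)|) ^ 2) *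
          (4 * (1 / (1 + |((⌊N * θ r⌋ : ℤ) : ℝ)|) ^ 2))) := by gcongr
      _ = 36 * H (e r) := by simp only [H, e]; ring
  refine (sum_le_sum hterm).trans ?_
  rw [← mul_sum]
  have h1 : ∑ r ∈ S, H (e r) = ∑ t ∈ S.image e, H t := (sum_image hinj).symm
  have h2 : S.image e ⊆ (S.image v) ×ˢ ((S.image u) ×ˢ (S.image fun r => ⌊N * θ r⌋)) := by
    intro t ht
    obtain ⟨r, hr, rfl⟩ := mem_image.1 ht
    exact mem_product.2 ⟨mem_image_of_mem _ hr, mem_product.2 ⟨mem_image_of_mem _ hr,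
      mem_image_of_mem (fun r => ⌊N * θ r⌋) hr⟩⟩
  have h3 : ∑ t ∈ S.image e, H t ≤ c1 * (c2 * c2) := by
    refine (sum_le_sum_of_subset_of_nonneg h2 fun _ _ _ => by simp only [H]; positivity).trans ?_
    rw [sum_product]
    simp only [H]
    simp_rw [← mul_sum]
    rw [← sum_mul]
    have hq : ∀ D : Finset ℤ, ∑ j ∈ D, 1 / (1 + |(j : ℝ)|) ^ 2 ≤ c2 := fun D =>
      hs2.sum_le_tsum D fun _ _ => by positivity
    refine mul_le_mul (hs1.sum_le_tsum _ fun _ _ => by positivity) ?_ (sum_nonneg fun _ _ => by positivity)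
      hc1'
    rw [sum_product]
    simp_rw [← mul_sum]
    rw [← sum_mul]
    exact mul_le_mul (hq _) (hq _) (sum_nonneg fun _ _ => by positivity) hc2'
  rw [h1]
  linarith

lemma eulerUpTo_zero : eulerUpTo 0 = 1 := by
  simp [eulerUpTo, primesUpTo]

/-- The moment bound for functions dominated by primes in polynomial values. -/
lemma exists_moment_le (k : ℕ) (hk : 1 ≤ k) {σ : ℝ} (hσ : σ = 1 / (k * 2 ^ (k + 2))) :
    ∃ C : ℝ, 0 < C ∧ ∀ (f : Polynomial ℤ) (W M N : ℕ) [NeZero N] (c : ℤ) (V L : ℝ) (K : ℕ), 0 < W →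
      Admissible k (σ / 400) f W M N V → 2 ≤ N → 8 ≤ (N : ℝ) ^ (1 / (8 * k) : ℝ) →
      0 ≤ L → L ≤ 2 * Real.log N → Nat.Coprime K N →
      ∀ g : ZMod N → ℝ, (∀ x, 0 ≤ g x) →
        (∀ x, g x ≤ 0 ∨ ∃ z : ℕ, z ≤ M ∧ x = ((K * f.eval (z : ℤ) : ℤ) : ZMod N) ∧
          Nat.Prime (W * z + c : ℤ).toNat ∧
          g x ≤ polyIncr f z * ((W.totient : ℝ) / W * L) / (f.eval (M : ℤ) : ℤ)) →
        ∑ r, ‖zhat (fun x => (g x : ℂ)) r‖ ^ (k * 2 ^ (k + 3)) ≤ C := by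
  classical
  obtain ⟨C, hC, hmaj⟩ := exists_majorant k hk hσ
  obtain ⟨C', hC', hloc⟩ := exists_localSum_le k hk
  obtain ⟨C'', hC'', happ⟩ := exists_sum_approximations_le
  set ρ := k * 2 ^ (k + 3) with hρ
  have hρ2 : 2 ≤ ρ := by
    calc 2 ≤ 1 * 2 ^ (k + 3) := by
          rw [one_mul]; calc 2 = 2 ^ 1 := rfl
            _ ≤ _ := Nat.pow_le_pow_right (by norm_num) (by omega)
      _ ≤ _ := Nat.mul_le_mul_right _ hk
  refine ⟨C ^ ρ + (C * (C' + 1)) ^ ρ * 2 ^ ρ * (C'' + 1), by positivity, ?_⟩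
  intro f W M N _ c V L K hW hA hN hN8 hL0 hL hKN g hg0 hg
  obtain ⟨P, _, ω, hPW, -, hω0, hωp, hω⟩ := hmaj f W M N c V 0 L hW hA hN hN8 le_rfl hL0 hL
  rw [eulerUpTo_zero, mul_one] at hω
  have hN1 : (1 : ℝ) ≤ N := by exact_mod_cast (by omega : 1 ≤ N)
  have hN0 : (0 : ℝ) < N := by linarith
  set F : ℝ := ((f.eval (M : ℤ) : ℤ) : ℝ) with hF
  have hF0 : 0 < F := by have := hA.half_le; rw [← hF] at this; linarith
  have hV := hA.incrBound.1
  let G : ZMod N → ℝ := fun x => ∑ z ∈ range (M + 1),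
    if x = ((K * f.eval (z : ℤ) : ℤ) : ZMod N) then ω z * polyIncr f z / F else 0
  have hterm : ∀ z ∈ range (M + 1), 0 ≤ ω z * polyIncr f z / F := fun z hz =>
    div_nonneg (mul_nonneg (hω0 z) (hV z (by have := mem_range.1 hz; omega)).1) hF0.le
  have hgG : ∀ x, g x ≤ G x := by
    intro x
    have hnn : ∀ z ∈ range (M + 1), 0 ≤ if x = ((K * f.eval (z : ℤ) : ℤ) : ZMod N) then
        ω z * polyIncr f z / F else 0 := fun z hz => by
      split_ifs
      · exact hterm z hz
      · exact le_rfl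
    rcases hg x with h | ⟨z, hzM, hx, hp, h⟩
    · exact h.trans (sum_nonneg hnn)
    · have hz : z ∈ range (M + 1) := mem_range.2 (by omega)
      refine h.trans (le_trans ?_ (single_le_sum hnn hz))
      rw [if_pos hx, mul_comm (ω z)]
      gcongr
      · exact (hV z hzM).1
      · exact hωp z hp
  set s := fun r : ZMod N => ∑ x ∈ range (M + 1), ((ω x * polyIncr f x : ℝ) : ℂ) *
    eC ((r.val : ℝ) / N * (f.eval (x : ℤ) : ℤ)) with hs
  have hGhat : ∀ r, zhat (fun x => (G x : ℂ)) r = 1 / (F : ℂ) * s (-(K * r)) := by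
    intro r
    simp only [zhat, G, hs]
    push_cast
    simp_rw [sum_mul]
    rw [sum_comm, mul_sum]
    refine sum_congr rfl fun z _ => ?_
    rw [sum_eq_single ((K : ZMod N) * ((f.eval (z : ℤ) : ℤ) : ZMod N))]
    · have h1 : zchar (-r) ((K : ZMod N) * ((f.eval (z : ℤ) : ℤ) : ZMod N)) =
          eC (((-((K : ZMod N) * r)).val : ℝ) / N * (f.eval (z : ℤ) : ℤ)) := by
        rw [← zchar_mul_left, zchar_intCast]; congr 4; ring
      simp only [if_true]
      rw [h1]
      push_cast
      ring
    · intro x _ hx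
      rw [if_neg hx, Complex.ofReal_zero, zero_mul]
    · simp
  have hinj : Function.Injective fun r : ZMod N => -((K : ZMod N) * r) := by
    intro x y hxy
    exact (ZMod.isUnit_iff_coprime K N).2 hKN |>.mul_left_cancel (neg_injective hxy)
  have hbij := Finite.injective_iff_bijective.1 hinj
  have hρs : ρ = 2 * (k * 2 ^ (k + 2)) := by rw [hρ]; ring
  have hstep : ∑ r, ‖zhat (fun x => (g x : ℂ)) r‖ ^ ρ ≤ ∑ r, (‖s r‖ / F) ^ ρ := by
    rw [hρs]
    refine (sum_norm_zhat_pow_le hg0 hgG _).trans (le_of_eq ?_)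
    rw [← hbij.sum_comp fun r => (‖s r‖ / F) ^ (2 * (k * 2 ^ (k + 2)))]
    refine sum_congr rfl fun r _ => ?_
    rw [hGhat, norm_mul, norm_div, norm_one, Complex.norm_real, Real.norm_eq_abs,
      abs_of_pos hF0, one_div, ← div_eq_inv_mul]
  refine hstep.trans ?_
  set E := (N : ℝ) ^ (-(3 / 4 * σ)) with hE
  have hE0 : 0 < E := by positivity
  have hEρ : N * E ^ ρ ≤ 1 := by
    have hρσ : (ρ : ℝ) * σ = 2 := by
      rw [hρ, hσ]; push_cast; field_simp; ring
    rw [hE, ← Real.rpow_natCast, ← Real.rpow_mul hN0.le]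
    have : -(3 / 4 * σ) * (ρ : ℝ) = -(3 / 2) := by
      have : -(3 / 4 * σ) * (ρ : ℝ) = -(3 / 4) * (ρ * σ) := by ring
      rw [this, hρσ]; norm_num
    rw [this]
    calc (N : ℝ) * (N : ℝ) ^ (-(3 / 2) : ℝ) = (N : ℝ) ^ (1 : ℝ) * (N : ℝ) ^ (-(3 / 2) : ℝ) := by
          rw [Real.rpow_one]
      _ ≤ (N : ℝ) ^ (0 : ℝ) := rpow_mul_rpow_le hN1 (by norm_num)
      _ = 1 := Real.rpow_zero _
  let S : Finset (ZMod N) := univ.filter fun r => ¬ ‖s r‖ ≤ C * F * E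
  have hmaj' : ∀ r : ZMod N, ∃ (u : ℤ) (v : ℕ) (θ : ℝ), r ∈ S → (0 < v ∧
      (r.val : ℝ) / N = u / v + θ ∧ |θ| ≤ 1) ∧
      ‖s r‖ / F ≤ C * (C' + 1) * ((v : ℝ) ^ (-(1 / 2 ^ k : ℝ)) / (1 + N * |θ|) + E) := by
    intro r
    by_cases hr : r ∈ S
    · rcases hω ((r.val : ℝ) / N) with h | ⟨u, v, θ, hv, huv, hα, hθ, h⟩
      · exact absurd h (mem_filter.1 hr).2
      · refine ⟨u, v, θ, fun _ => ⟨⟨hv, hα, hθ⟩, ?_⟩⟩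
        rw [div_le_iff₀ hF0]
        have hl := hloc f W P u v hA.natDegree_eq hA.eval_zero hA.leadingCoeff_pos hA.localCond
          hPW hv huv
        refine h.trans ?_
        have h1 : localSum f u v P / (1 + N * |θ|) ≤
            (C' + 1) * ((v : ℝ) ^ (-(1 / 2 ^ k : ℝ)) / (1 + N * |θ|)) := by
          rw [← mul_div_assoc]
          gcongr
          refine hl.trans ?_
          gcongr
          linarith
        have h2 : E ≤ (C' + 1) * E := le_mul_of_one_le_left hE0.le (by linarith)
        calc C * F * (localSum f u v P / (1 + N * |θ|) + E) ≤ C * F *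
              ((C' + 1) * ((v : ℝ) ^ (-(1 / 2 ^ k : ℝ)) / (1 + N * |θ|)) + (C' + 1) * E) := by
              gcongr
          _ = _ := by ring
    · exact ⟨0, 0, 0, fun h => absurd h hr⟩
  choose u v θ huvθ using hmaj'
  have hsum := happ N S u v θ fun r hr => (huvθ r hr).1
  rw [← sum_filter_add_sum_filter_not univ (fun r => ‖s r‖ ≤ C * F * E)]
  have hcard : ∀ T : Finset (ZMod N), (#T : ℝ) ≤ N := fun T => by
    have := card_le_univ T
    rw [ZMod.card] at this
    exact_mod_cast this
  refine add_le_add ?_ ?_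
  · calc _ ≤ ∑ r ∈ univ.filter (fun r => ‖s r‖ ≤ C * F * E), (C * E) ^ ρ := by
          refine sum_le_sum fun r hr => ?_
          gcongr
          rw [div_le_iff₀ hF0]
          linarith [(mem_filter.1 hr).2]
      _ = #(univ.filter (fun r => ‖s r‖ ≤ C * F * E)) * (C * E) ^ ρ := by
          rw [sum_const, nsmul_eq_mul]
      _ ≤ N * (C * E) ^ ρ := mul_le_mul_of_nonneg_right (hcard _) (by positivity)
      _ = C ^ ρ * (N * E ^ ρ) := by rw [mul_pow]; ring
      _ ≤ C ^ ρ := mul_le_of_le_one_right (by positivity) hEρ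
  · calc _ ≤ ∑ r ∈ S, (C * (C' + 1)) ^ ρ * 2 ^ ρ *
          (1 / (v r : ℝ) ^ 4 * (1 / (1 + N * |θ r|) ^ 2) + E ^ ρ) := by
          refine sum_le_sum fun r hr => ?_
          obtain ⟨⟨hv, hα, hθ⟩, hb⟩ := huvθ r hr
          have hv1 : (1 : ℝ) ≤ v r := by exact_mod_cast hv
          refine (pow_le_pow_left₀ (by positivity) hb ρ).trans ?_
          rw [mul_pow, mul_assoc ((C * (C' + 1)) ^ ρ)]
          gcongr
          set X := (v r : ℝ) ^ (-(1 / 2 ^ k : ℝ)) / (1 + N * |θ r|) with hX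
          have hX0 : 0 ≤ X := by positivity
          have h1 : (X + E) ^ ρ ≤ 2 ^ ρ * (X ^ ρ + E ^ ρ) := by
            have h2 := add_pow_le hX0 hE0.le ρ
            refine h2.trans ?_
            gcongr
            · norm_num
            · omega
          refine h1.trans ?_
          gcongr
          rw [hX, div_pow, ← Real.rpow_natCast, ← Real.rpow_mul (by linarith), div_eq_mul_one_div]
          refine mul_le_mul ?_ ?_ (by positivity) (by positivity)
          · have h3 : -(1 / 2 ^ k : ℝ) * (ρ : ℝ) = -(8 * k : ℕ) := by
              rw [hρ]; push_cast; field_simp; ring_nf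
            rw [h3, Real.rpow_neg (by linarith), Real.rpow_natCast, one_div]
            gcongr
            omega
          · gcongr
            have : 0 ≤ N * |θ r| := by positivity
            linarith
      _ = (C * (C' + 1)) ^ ρ * 2 ^ ρ *
          (∑ r ∈ S, 1 / (v r : ℝ) ^ 4 * (1 / (1 + N * |θ r|) ^ 2) + #S * E ^ ρ) := by
          rw [← mul_sum, sum_add_distrib, sum_const, nsmul_eq_mul]
      _ ≤ (C * (C' + 1)) ^ ρ * 2 ^ ρ * (C'' + 1) := by
          gcongr
          exact (mul_le_mul_of_nonneg_right (hcard S) (by positivity)).trans hEρ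

end moment

section linear

lemma polyIncr_X (z : ℕ) : polyIncr Polynomial.X z = if z = 0 then 0 else 1 := by
  unfold polyIncr
  split_ifs
  · rfl
  · simp

lemma incrBound_X (N : ℕ) : IncrBound Polynomial.X N 2 := by
  refine ⟨fun z _ => ?_, ?_⟩
  · rw [polyIncr_X]; split_ifs <;> norm_num
  · have h : ∑ z ∈ range N, |polyIncr Polynomial.X (z + 1) - polyIncr Polynomial.X z| ≤ 1 := by
      calc _ ≤ ∑ z ∈ range N, (if z = 0 then (1 : ℝ) else 0) := by
            refine sum_le_sum fun z _ => ?_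
            rw [polyIncr_X, polyIncr_X]
            by_cases hz : z = 0 <;> simp [hz]
        _ ≤ 1 := by
            rw [sum_ite_eq']
            split_ifs <;> norm_num
    have h2 : polyIncr Polynomial.X N ≤ 1 := by
      rw [polyIncr_X]; split_ifs <;> norm_num
    linarith

lemma localCond_X (W : ℕ) : LocalCond Polynomial.X W := by
  intro p hp
  have hp1 : ¬ (p : ℤ) ∣ 1 := fun h => hp.one_lt.ne' (by
    have := Int.eq_one_of_dvd_one (by positivity) h
    exact_mod_cast this)
  refine ⟨fun _ => ⟨by simpa using hp1, fun j hj => ?_⟩, fun _ => by simpa using hp1⟩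
  rw [Polynomial.coeff_X, if_neg (by omega)]
  exact dvd_zero _

lemma admissible_X {δ : ℝ} (W N : ℕ) (hN : 2 ≤ (N : ℝ) ^ δ) (hN1 : 1 ≤ N) :
    Admissible 1 δ Polynomial.X W N N 2 where
  natDegree_eq := Polynomial.natDegree_X
  eval_zero := by simp
  leadingCoeff_pos := by simp
  localCond := localCond_X W
  leadingCoeff_le := by simp; linarith
  incrBound := incrBound_X N
  mul_le := by
    simp only [Polynomial.eval_X, Int.cast_natCast]
    exact mul_le_mul_of_nonneg_right hN (by positivity)
  half_le := by
    simp only [Polynomial.eval_X, Int.cast_natCast]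
    linarith [show (0 : ℝ) ≤ N by positivity]
  le_size := by simp
  le_pow := by
    rw [pow_one]
    exact le_mul_of_one_le_left (by positivity) (by linarith)
  le := le_rfl

/-- A majorant of the primes in an arithmetic progression with small Fourier transform away
from the integers. -/
lemma exists_linear_majorant : ∃ C : ℝ, 0 < C ∧ ∀ (W N : ℕ) (c : ℤ) (z L : ℝ), 0 < W →
    1 ≤ N → 2 ≤ (N : ℝ) ^ (1 / 3200 : ℝ) → 1 ≤ z → 0 ≤ L → L ≤ 2 * Real.log N →
    ∃ s : ℕ → ℝ, (∀ x, 0 ≤ s x) ∧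
      (∀ x : ℕ, 1 ≤ x → Nat.Prime (W * x + c : ℤ).toNat → (W.totient : ℝ) / W * L / N ≤ s x) ∧
      ∀ α : ℝ, ∃ n : ℤ, |α - n| ≤ 1 ∧ ‖∑ x ∈ range (N + 1), (s x : ℂ) * eC (α * x)‖ ≤
        C * eulerUpTo z * (1 / (1 + N * |α - n|) + z ^ (-(1 / 2) : ℝ) +
          (N : ℝ) ^ (-(3 / 32) : ℝ)) := by
  obtain ⟨C, hC, hmain⟩ := exists_majorant 1 le_rfl (σ := 1 / 8) (by norm_num)
  obtain ⟨D, hD, hdiv⟩ := exists_card_divisors_le (1 / 6) (by norm_num)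
  refine ⟨C * D ^ 3, by positivity, ?_⟩
  intro W N c z L hW hN1 hN hz hL0 hL
  have hN0 : (0 : ℝ) < N := by exact_mod_cast hN1
  have hN1' : (1 : ℝ) ≤ N := by exact_mod_cast hN1
  have hN2 : 2 ≤ N := by
    by_contra h
    have : N = 1 := by omega
    rw [this] at hN
    norm_num at hN
  have h8 : 8 ≤ (N : ℝ) ^ (1 / (8 * (1 : ℕ)) : ℝ) := by
    have h1 : (N : ℝ) ^ (1 / (8 * (1 : ℕ)) : ℝ) = ((N : ℝ) ^ (1 / 3200 : ℝ)) ^ (400 : ℕ) := by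
      rw [← Real.rpow_natCast, ← Real.rpow_mul hN0.le]; norm_num
    rw [h1]
    calc (8 : ℝ) = 2 ^ 3 := by norm_num
      _ ≤ 2 ^ 400 := pow_le_pow_right₀ (by norm_num) (by norm_num)
      _ ≤ _ := by gcongr
  have hA : Admissible 1 (1 / 8 / 400) Polynomial.X W N N 2 :=
    admissible_X W N (by norm_num; norm_num at hN; exact hN) hN1
  obtain ⟨P, hP0, ω, hPW, hPz, hω0, hω, hsum⟩ :=
    hmain Polynomial.X W N N c 2 z L hW hA hN2 h8 (by linarith) hL0 hL
  have hZ := eulerUpTo_pos z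
  have hfac : ∀ α : ℝ, ∑ x ∈ range (N + 1), ((ω x * polyIncr Polynomial.X x / N : ℝ) : ℂ) * eC (α * x)
      = (1 / N : ℂ) * ∑ x ∈ range (N + 1), ((ω x * polyIncr Polynomial.X x : ℝ) : ℂ) *
        eC (α * ((Polynomial.X : Polynomial ℤ).eval (x : ℤ) : ℤ)) := by
    intro α
    rw [mul_sum]
    refine sum_congr rfl fun x _ => ?_
    simp only [Polynomial.eval_X, Int.cast_natCast]
    push_cast
    ring
  have hnorm : ∀ α : ℝ, ‖∑ x ∈ range (N + 1),
      ((ω x * polyIncr Polynomial.X x / N : ℝ) : ℂ) * eC (α * x)‖ = 1 / N *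
        ‖∑ x ∈ range (N + 1), ((ω x * polyIncr Polynomial.X x : ℝ) : ℂ) *
        eC (α * ((Polynomial.X : Polynomial ℤ).eval (x : ℤ) : ℤ))‖ := by
    intro α
    rw [hfac, norm_mul, norm_div, norm_one, Complex.norm_natCast]
  have hD3 : 1 ≤ D ^ 3 := one_le_pow₀ hD
  have hE : (N : ℝ) ^ (-(3 / 4 * (1 / 8)) : ℝ) = (N : ℝ) ^ (-(3 / 32) : ℝ) := by norm_num
  have hE0 : 0 < (N : ℝ) ^ (-(3 / 32) : ℝ) := by positivity
  have hz0 : 0 < z ^ (-(1 / 2) : ℝ) := Real.rpow_pos_of_pos (by linarith) _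
  refine ⟨fun x => ω x * polyIncr Polynomial.X x / N, fun x => ?_, fun x hx hp => ?_, fun α => ?_⟩
  · have := hω0 x
    dsimp only
    rw [polyIncr_X]; split_ifs <;> positivity
  · dsimp only
    rw [polyIncr_X, if_neg (by omega), mul_one]
    gcongr
    exact hω x hp
  rw [hnorm]
  rcases hsum α with h | ⟨u, v, θ, hv, huv, hα, hθ, h⟩
  · refine ⟨round α, (abs_sub_round α).trans (by norm_num), ?_⟩
    rw [hE] at h
    calc _ ≤ 1 / N * (C * eulerUpTo z * ((Polynomial.X : Polynomial ℤ).eval (N : ℤ) : ℤ) *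
          (N : ℝ) ^ (-(3 / 32) : ℝ)) := by gcongr
      _ = C * 1 * eulerUpTo z * (0 + 0 + (N : ℝ) ^ (-(3 / 32) : ℝ)) := by
          simp only [Polynomial.eval_X, Int.cast_natCast]; field_simp; ring
      _ ≤ _ := by gcongr; positivity
  · rw [hE] at h
    have hbase : ∀ X : ℝ, 0 ≤ X → localSum Polynomial.X u v P / (1 + N * |θ|) ≤ D ^ 3 * X →
        1 / N * ‖∑ x ∈ range (N + 1), ((ω x * polyIncr Polynomial.X x : ℝ) : ℂ) *
        eC (α * ((Polynomial.X : Polynomial ℤ).eval (x : ℤ) : ℤ))‖ ≤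
        C * D ^ 3 * eulerUpTo z * (X + (N : ℝ) ^ (-(3 / 32) : ℝ)) := by
      intro X hX hle
      calc _ ≤ 1 / N * (C * eulerUpTo z * ((Polynomial.X : Polynomial ℤ).eval (N : ℤ) : ℤ) *
            (localSum Polynomial.X u v P / (1 + N * |θ|) + (N : ℝ) ^ (-(3 / 32) : ℝ))) := by gcongr
        _ = C * eulerUpTo z * (localSum Polynomial.X u v P / (1 + N * |θ|) +
              1 * (N : ℝ) ^ (-(3 / 32) : ℝ)) := by
            simp only [Polynomial.eval_X, Int.cast_natCast]; field_simp
        _ ≤ C * eulerUpTo z * (D ^ 3 * X + D ^ 3 * (N : ℝ) ^ (-(3 / 32) : ℝ)) := by gcongr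
        _ = _ := by ring
    by_cases hv1 : v = 1
    · subst hv1
      have hαu : α - u = θ := by rw [hα]; push_cast; ring
      refine ⟨u, by rwa [hαu], ?_⟩
      rw [hαu]
      refine hbase _ (by positivity) ?_
      have hls : localSum Polynomial.X u 1 P ≤ 1 := by
        refine (localSum_X_le (P := P) hv huv).trans ?_
        simp
      calc localSum Polynomial.X u 1 P / (1 + N * |θ|) ≤ 1 * (1 / (1 + N * |θ|)) := by
            rw [one_mul]; gcongr
        _ ≤ D ^ 3 * (1 / (1 + N * |θ|) + z ^ (-(1 / 2) : ℝ)) := by gcongr; linarith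
    · refine ⟨round α, (abs_sub_round α).trans (by norm_num), ?_⟩
      refine hbase _ (by positivity) ?_
      have hls : localSum Polynomial.X u v P ≤ D ^ 3 * z ^ (-(1 / 2) : ℝ) := by
        by_cases hvP : v ∣ P
        · obtain ⟨p, hp, hpv⟩ := Nat.exists_prime_and_dvd hv1
          have hzv : z ≤ v := by
            have h1 := hPz p hp (hpv.trans hvP)
            have h2 : (p : ℝ) ≤ v := by exact_mod_cast Nat.le_of_dvd hv hpv
            linarith
          have hv0 : (0 : ℝ) < v := by exact_mod_cast hv
          calc _ ≤ (#v.divisors : ℝ) ^ 3 / v := localSum_X_le hv huv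
            _ ≤ (D * (v : ℝ) ^ (1 / 6 : ℝ)) ^ 3 / v := by gcongr; exact hdiv v hv.ne'
            _ = D ^ 3 * (v : ℝ) ^ (-(1 / 2) : ℝ) := by
                rw [mul_pow, ← Real.rpow_natCast ((v : ℝ) ^ (1 / 6 : ℝ)), ← Real.rpow_mul hv0.le,
                  mul_div_assoc]
                congr 1
                nth_rewrite 2 [← Real.rpow_one (v : ℝ)]
                rw [← Real.rpow_sub hv0]
                norm_num
            _ ≤ _ := mul_le_mul_of_nonneg_left
                (Real.rpow_le_rpow_of_nonpos (by linarith) hzv (by norm_num)) (by positivity)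
        · rw [localSum_X_eq_zero hv huv hvP]; positivity
      calc localSum Polynomial.X u v P / (1 + N * |θ|) ≤ localSum Polynomial.X u v P / 1 := by
            have := localSum_nonneg (P := P) Polynomial.X u v
            gcongr
            have : 0 ≤ N * |θ| := by positivity
            linarith
        _ ≤ D ^ 3 * (0 + z ^ (-(1 / 2) : ℝ)) := by rw [div_one, zero_add]; exact hls
        _ ≤ _ := by gcongr; positivity

end linear

section levelset

lemma exists_sum_one_div_le {κ : ℝ} (hκ : 0 < κ) : ∃ C : ℝ, 0 < C ∧
    ∀ {ι : Type} (S : Finset ι) (e : ι → ℤ), Set.InjOn e S →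
      ∑ i ∈ S, 1 / (1 + |(e i : ℝ)|) ≤ C * (#S : ℝ) ^ κ := by
  have hs : Summable fun j : ℤ => (1 / (1 + |(j : ℝ)|)) ^ (1 + κ) := by
    have h : Summable fun n : ℕ => (1 / (1 + (n : ℝ))) ^ (1 + κ) := by
      have := (summable_nat_add_iff 1).2
        (Real.summable_one_div_nat_rpow.2 (by linarith : 1 < 1 + κ))
      refine this.congr fun n => ?_
      rw [Real.div_rpow (by norm_num) (by positivity), Real.one_rpow]
      push_cast
      rw [add_comm (n : ℝ)]
    refine Summable.of_nat_of_neg (h.congr fun n => ?_) (h.congr fun n => ?_)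
    · simp
    · simp
  set T := ∑' j : ℤ, (1 / (1 + |(j : ℝ)|)) ^ (1 + κ) with hT
  have hT0 : 0 ≤ T := tsum_nonneg fun j => by positivity
  refine ⟨1 + T, by positivity, ?_⟩
  intro ι S e he
  rcases S.eq_empty_or_nonempty with rfl | hne
  · simp [Real.zero_rpow hκ.ne']
  have hm : (1 : ℝ) ≤ #S := by exact_mod_cast hne.card_pos
  set m : ℝ := (#S : ℝ) with hm'
  have hpt : ∀ i ∈ S, 1 / (1 + |(e i : ℝ)|) ≤ 1 / m + m ^ κ * (1 / (1 + |(e i : ℝ)|)) ^ (1 + κ) := by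
    intro i _
    set y := 1 / (1 + |(e i : ℝ)|) with hy
    have hy0 : 0 < y := by positivity
    by_cases h : y ≤ 1 / m
    · have : 0 ≤ m ^ κ * y ^ (1 + κ) := by positivity
      linarith
    · have h1 : 1 ≤ m * y := by
        rw [not_le, div_lt_iff₀ (by linarith)] at h
        linarith
      have h2 : 1 ≤ (m * y) ^ κ := Real.one_le_rpow h1 hκ.le
      have h3 : m ^ κ * y ^ (1 + κ) = y * (m * y) ^ κ := by
        rw [Real.rpow_add hy0, Real.rpow_one, Real.mul_rpow (by linarith) hy0.le]; ring
      have h4 : 0 ≤ 1 / m := by positivity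
      rw [h3]
      nlinarith
  calc _ ≤ ∑ i ∈ S, (1 / m + m ^ κ * (1 / (1 + |(e i : ℝ)|)) ^ (1 + κ)) := sum_le_sum hpt
    _ = 1 + m ^ κ * ∑ i ∈ S, (1 / (1 + |(e i : ℝ)|)) ^ (1 + κ) := by
        rw [sum_add_distrib, sum_const, nsmul_eq_mul, ← mul_sum, ← hm', mul_one_div,
          div_self (by linarith)]
    _ ≤ m ^ κ + m ^ κ * T := by
        have h1 : ∑ i ∈ S, (1 / (1 + |(e i : ℝ)|)) ^ (1 + κ) ≤ T := by
          rw [← sum_image (f := fun j : ℤ => (1 / (1 + |(j : ℝ)|)) ^ (1 + κ)) he]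
          exact hs.sum_le_tsum _ fun _ _ => by positivity
        have h2 : 1 ≤ m ^ κ := Real.one_le_rpow hm hκ.le
        gcongr
    _ = _ := by ring

lemma sq_mul_card_le_of_majorant {ι κ : Type*} (S : Finset κ) (T : Finset ι) (χ : κ → ι → ℂ)
    (a s : ι → ℝ) (ha : ∀ x ∈ T, 0 ≤ a x) (has : ∀ x ∈ T, a x ≤ s x) {δ : ℝ} (hδ : 0 ≤ δ)
    (h : ∀ r ∈ S, δ ≤ ‖∑ x ∈ T, (a x : ℂ) * χ r x‖) :
    (δ * #S) ^ 2 ≤ (∑ x ∈ T, s x) *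
      ∑ r ∈ S, ∑ r' ∈ S, ‖∑ x ∈ T, (s x : ℂ) * (χ r x * (starRingEnd ℂ) (χ r' x))‖ := by
  set F : κ → ℂ := fun r => ∑ x ∈ T, (a x : ℂ) * χ r x with hF
  set g : κ → ℂ := fun r => (starRingEnd ℂ) (F r) / ‖F r‖ with hg
  have hg1 : ∀ r, ‖g r‖ ≤ 1 := by
    intro r
    simp only [hg]
    rw [norm_div, RCLike.norm_conj, Complex.norm_real, norm_norm]
    exact div_self_le_one _
  have hgF : ∀ r, g r * F r = (‖F r‖ : ℂ) := by
    intro r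
    by_cases h0 : F r = 0
    · simp [hg, h0]
    · have h1 : (‖F r‖ : ℂ) ≠ 0 := by simpa using h0
      simp only [hg]
      rw [div_mul_eq_mul_div, mul_comm, Complex.mul_conj, Complex.normSq_eq_norm_sq,
        div_eq_iff h1]
      push_cast
      ring
  set G : ι → ℂ := fun x => ∑ r ∈ S, g r * χ r x with hG
  have h1 : δ * #S ≤ ∑ x ∈ T, a x * ‖G x‖ := by
    have h2 : ((∑ r ∈ S, ‖F r‖ : ℝ) : ℂ) = ∑ x ∈ T, (a x : ℂ) * G x := by
      push_cast
      simp_rw [← hgF, hF, hG, mul_sum]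
      rw [sum_comm]
      refine sum_congr rfl fun x _ => sum_congr rfl fun r _ => by ring
    have h3 : ∑ r ∈ S, ‖F r‖ ≤ ∑ x ∈ T, a x * ‖G x‖ := by
      calc ∑ r ∈ S, ‖F r‖ = ‖((∑ r ∈ S, ‖F r‖ : ℝ) : ℂ)‖ := by
            rw [Complex.norm_real, Real.norm_of_nonneg (sum_nonneg fun _ _ => norm_nonneg _)]
        _ ≤ ∑ x ∈ T, ‖(a x : ℂ) * G x‖ := by rw [h2]; exact norm_sum_le _ _
        _ = _ := by
            refine sum_congr rfl fun x hx => ?_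
            rw [norm_mul, Complex.norm_real, Real.norm_of_nonneg (ha x hx)]
    calc δ * #S = ∑ r ∈ S, δ := by rw [sum_const, nsmul_eq_mul, mul_comm]
      _ ≤ ∑ r ∈ S, ‖F r‖ := sum_le_sum h
      _ ≤ _ := h3
  have h2 : (∑ x ∈ T, a x * ‖G x‖) ^ 2 ≤ (∑ x ∈ T, a x) * ∑ x ∈ T, a x * ‖G x‖ ^ 2 := by
    refine sum_sq_le_sum_mul_sum_of_sq_le_mul T ha
      (fun x hx => mul_nonneg (ha x hx) (by positivity)) fun x _ => le_of_eq (by ring)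
  have hs : ∀ x ∈ T, 0 ≤ s x := fun x hx => (ha x hx).trans (has x hx)
  have h3 : ∑ x ∈ T, s x * ‖G x‖ ^ 2 ≤
      ∑ r ∈ S, ∑ r' ∈ S, ‖∑ x ∈ T, (s x : ℂ) * (χ r x * (starRingEnd ℂ) (χ r' x))‖ := by
    have h4 : ((∑ x ∈ T, s x * ‖G x‖ ^ 2 : ℝ) : ℂ) = ∑ r ∈ S, ∑ r' ∈ S,
        (g r * (starRingEnd ℂ) (g r')) *
          ∑ x ∈ T, (s x : ℂ) * (χ r x * (starRingEnd ℂ) (χ r' x)) := by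
      push_cast
      have h5 : ∀ x, (s x : ℂ) * (‖G x‖ : ℂ) ^ 2 = ∑ r ∈ S, ∑ r' ∈ S,
          (g r * (starRingEnd ℂ) (g r')) * ((s x : ℂ) * (χ r x * (starRingEnd ℂ) (χ r' x))) := by
        intro x
        have h6 : (‖G x‖ : ℂ) ^ 2 = G x * (starRingEnd ℂ) (G x) := by
          rw [Complex.mul_conj, Complex.normSq_eq_norm_sq]; push_cast; rfl
        rw [h6, hG]
        simp only [map_sum, map_mul]
        rw [sum_mul_sum, mul_sum]
        refine sum_congr rfl fun r _ => ?_
        rw [mul_sum]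
        refine sum_congr rfl fun r' _ => by ring
      simp_rw [h5]
      rw [sum_comm]
      refine sum_congr rfl fun r _ => ?_
      rw [sum_comm]
      refine sum_congr rfl fun r' _ => ?_
      rw [mul_sum]
    calc ∑ x ∈ T, s x * ‖G x‖ ^ 2 = ‖((∑ x ∈ T, s x * ‖G x‖ ^ 2 : ℝ) : ℂ)‖ := by
          rw [Complex.norm_real, Real.norm_of_nonneg
            (sum_nonneg fun x hx => mul_nonneg (hs x hx) (by positivity))]
      _ ≤ ∑ r ∈ S, ∑ r' ∈ S, ‖(g r * (starRingEnd ℂ) (g r')) *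
          ∑ x ∈ T, (s x : ℂ) * (χ r x * (starRingEnd ℂ) (χ r' x))‖ := by
          rw [h4]
          exact (norm_sum_le _ _).trans (sum_le_sum fun r _ => norm_sum_le _ _)
      _ ≤ _ := by
          refine sum_le_sum fun r _ => sum_le_sum fun r' _ => ?_
          rw [norm_mul, norm_mul, RCLike.norm_conj]
          exact mul_le_of_le_one_left (norm_nonneg _)
            (mul_le_one₀ (hg1 r) (norm_nonneg _) (hg1 r'))
  have h0 : 0 ≤ ∑ x ∈ T, a x * ‖G x‖ ^ 2 :=
    sum_nonneg fun x hx => mul_nonneg (ha x hx) (by positivity)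
  calc (δ * #S) ^ 2 ≤ (∑ x ∈ T, a x * ‖G x‖) ^ 2 := by gcongr
    _ ≤ _ := h2
    _ ≤ (∑ x ∈ T, s x) * ∑ x ∈ T, s x * ‖G x‖ ^ 2 := by
        refine mul_le_mul (sum_le_sum has) (sum_le_sum fun x hx => ?_) h0 (sum_nonneg hs)
        exact mul_le_mul_of_nonneg_right (has x hx) (by positivity)
    _ ≤ _ := mul_le_mul_of_nonneg_left h3 (sum_nonneg hs)

end levelset

section levelset

/-- `a` is dominated by the weighted indicator function of the primes of the form `W * x + c`
with `1 ≤ x ≤ N`. -/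
def PrimeDominated (N : ℕ) (W : ℕ) (c : ℤ) (L : ℝ) (a : ZMod N → ℝ) : Prop :=
  (∀ x, 0 ≤ a x) ∧ ∀ x ∈ Icc 1 N, a ((x : ℕ) : ZMod N) ≤ 0 ∨
    (Nat.Prime (W * x + c : ℤ).toNat ∧ a ((x : ℕ) : ZMod N) ≤ (W.totient : ℝ) / W * L / N)

variable {N : ℕ} [NeZero N]

lemma PrimeDominated.le {W : ℕ} {c : ℤ} {L : ℝ} {a : ZMod N → ℝ}
    (h : PrimeDominated N W c L a) (hW : 0 < W) (hL : 0 ≤ L) (x : ZMod N) : a x ≤ L / N := by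
  have hN : 0 < N := Nat.pos_of_ne_zero (NeZero.ne N)
  have hex : ∃ y ∈ Icc 1 N, ((y : ℕ) : ZMod N) = x := by
    by_cases hx : x = 0
    · exact ⟨N, mem_Icc.2 ⟨hN, le_rfl⟩, by rw [hx, ZMod.natCast_self]⟩
    · refine ⟨x.val, mem_Icc.2 ⟨?_, (ZMod.val_lt x).le⟩, ZMod.natCast_zmod_val x⟩
      have := (ZMod.val_ne_zero x).2 hx
      omega
  obtain ⟨y, hy, rfl⟩ := hex
  rcases h.2 y hy with h1 | ⟨-, h1⟩
  · exact h1.trans (by positivity)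
  · refine h1.trans ?_
    have hW0 : (0 : ℝ) < W := by exact_mod_cast hW
    have : (W.totient : ℝ) / W ≤ 1 := by
      rw [div_le_one hW0]; exact_mod_cast Nat.totient_le W
    gcongr
    exact mul_le_of_le_one_left hL this

lemma dft_eq_sum_range (a : ZMod N → ℝ) (r : ZMod N) : zhat (fun x => (a x : ℂ)) r =
    ∑ x ∈ range (N + 1), ((if x = 0 then 0 else a (x : ZMod N) : ℝ) : ℂ) *
      eC (-((x : ℝ) * r.val) / N) := by
  rw [← dft_eq_zhat, dft]
  have hsub : Icc 1 N ⊆ range (N + 1) := fun x hx => by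
    rw [mem_Icc] at hx; rw [mem_range]; omega
  rw [← sum_subset hsub]
  · refine sum_congr rfl fun x hx => ?_
    rw [mem_Icc] at hx
    rw [if_neg (by omega)]
  · intro x hx hx'
    rw [mem_range] at hx
    rw [mem_Icc] at hx'
    rw [if_pos (by omega)]
    simp

lemma sum_one_div_one_add_abs_sub_le {κ C : ℝ} (hC : ∀ {ι : Type} (S : Finset ι) (e : ι → ℤ),
      Set.InjOn e S → ∑ i ∈ S, 1 / (1 + |(e i : ℝ)|) ≤ C * (#S : ℝ) ^ κ)
    (S : Finset (ZMod N)) (r : ZMod N) (n : ZMod N → ℤ)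
    (hn : ∀ r' ∈ S, |((r'.val : ℝ) - r.val) / N - n r'| ≤ 1) :
    ∑ r' ∈ S, 1 / (1 + N * |((r'.val : ℝ) - r.val) / N - n r'|) ≤ 3 * (C * (#S : ℝ) ^ κ) := by
  have hN : 0 < N := Nat.pos_of_ne_zero (NeZero.ne N)
  have hN0 : (0 : ℝ) < N := by exact_mod_cast hN
  have hpt : ∀ r' ∈ S, 1 / (1 + N * |((r'.val : ℝ) - r.val) / N - n r'|) ≤
      ∑ j ∈ ({-1, 0, 1} : Finset ℤ), 1 / (1 + |(((r'.val : ℤ) - r.val - N * j : ℤ) : ℝ)|) := by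
    intro r' hr'
    have h1 : (r'.val : ℝ) < N := by exact_mod_cast ZMod.val_lt r'
    have h2 : (r.val : ℝ) < N := by exact_mod_cast ZMod.val_lt r
    have h3 : (0 : ℝ) ≤ r'.val := by positivity
    have h4 : (0 : ℝ) ≤ r.val := by positivity
    have h5 : |((r'.val : ℝ) - r.val) / N| < 1 := by
      rw [abs_lt, lt_div_iff₀ hN0, div_lt_iff₀ hN0]; constructor <;> linarith
    have h6 := hn r' hr'
    rw [abs_le] at h6
    rw [abs_lt] at h5
    have h7 : -2 < n r' ∧ n r' < 2 := by
      constructor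
      · have : (-2 : ℝ) < n r' := by linarith
        exact_mod_cast this
      · have : (n r' : ℝ) < 2 := by linarith
        exact_mod_cast this
    have hmem : n r' ∈ ({-1, 0, 1} : Finset ℤ) := by
      simp only [mem_insert, mem_singleton]; omega
    have heq : N * |((r'.val : ℝ) - r.val) / N - n r'| =
        |(((r'.val : ℤ) - r.val - N * n r' : ℤ) : ℝ)| := by
      rw [← abs_of_pos hN0, ← abs_mul, abs_of_pos hN0]
      congr 1
      push_cast
      field_simp
    rw [heq]
    exact single_le_sum (f := fun j : ℤ => 1 / (1 + |(((r'.val : ℤ) - r.val - N * j : ℤ) : ℝ)|))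
      (fun _ _ => by positivity) hmem
  refine (sum_le_sum hpt).trans ?_
  rw [sum_comm]
  have hj : ∀ j ∈ ({-1, 0, 1} : Finset ℤ),
      ∑ r' ∈ S, 1 / (1 + |(((r'.val : ℤ) - r.val - N * j : ℤ) : ℝ)|) ≤ C * (#S : ℝ) ^ κ := by
    intro j _
    refine hC S (fun r' : ZMod N => (r'.val : ℤ) - r.val - N * j) fun x _ y _ hxy => ?_
    have : (x.val : ℤ) = y.val := by simp only at hxy; linarith
    exact ZMod.val_injective N (by exact_mod_cast this)
  refine (sum_le_sum hj).trans ?_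
  rw [sum_const, nsmul_eq_mul]
  norm_num

lemma exists_level_card_le {τ : ℝ} (hτ : 0 < τ) : ∃ C : ℝ, 0 < C ∧
    ∀ (N : ℕ) [NeZero N] (W : ℕ) (c : ℤ) (L : ℝ), 0 < W → 2 ≤ (N : ℝ) ^ (1 / 3200 : ℝ) → 0 ≤ L →
      L ≤ 2 * Real.log N → ∀ a : ZMod N → ℝ, PrimeDominated N W c L a →
      ∀ (S : Finset (ZMod N)) (δ : ℝ), 0 ≤ δ → S.Nonempty →
        (∀ r ∈ S, δ ≤ ‖zhat (fun x => (a x : ℂ)) r‖) → δ ^ 2 * (#S : ℝ) ≤ C * (#S : ℝ) ^ τ := by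
  obtain ⟨C0, hC0, hmaj⟩ := exists_linear_majorant
  obtain ⟨C1, hC1, hone⟩ := exists_sum_one_div_le (show 0 < τ / 2 by positivity)
  obtain ⟨C2, hC2, heul⟩ := exists_eulerUpTo_le (show 0 < τ / 16 by positivity)
  refine ⟨9 * C0 ^ 2 * C2 ^ 2 * (C1 + 1) + 4 / (3 * τ / 64) ^ 2, by positivity, ?_⟩
  intro N _ W c L hW hN hL0 hL a ha S δ hδ hS hlev
  have hN1 : 1 ≤ N := Nat.pos_of_ne_zero (NeZero.ne N)
  have hN0 : (0 : ℝ) < N := by exact_mod_cast hN1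
  have hN1' : (1 : ℝ) ≤ N := by exact_mod_cast hN1
  have hm : (1 : ℝ) ≤ #S := by exact_mod_cast hS.card_pos
  set m : ℝ := (#S : ℝ) with hm'
  have hm0 : 0 < m := by linarith
  rcases le_or_gt m ((N : ℝ) ^ (3 / 32 : ℝ)) with hsmall | hbig
  · have hz : 1 ≤ m ^ 4 := one_le_pow₀ hm
    obtain ⟨s, hs0, hs, hsum⟩ := hmaj W N c (m ^ 4) L hW hN1 hN hz hL0 hL
    set Z := eulerUpTo (m ^ 4) with hZ
    have hZ1 : 1 ≤ Z := eulerUpTo_pos _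
    choose n hn1 hn2 using hsum
    have hzm : (m ^ 4) ^ (-(1 / 2) : ℝ) ≤ 1 / m := by
      rw [← Real.rpow_natCast, ← Real.rpow_mul hm0.le, one_div m, ← Real.rpow_neg_one m]
      refine Real.rpow_le_rpow_of_exponent_le hm ?_
      norm_num
    have hNm : (N : ℝ) ^ (-(3 / 32) : ℝ) ≤ 1 / m := by
      rw [Real.rpow_neg hN0.le, one_div]
      exact inv_anti₀ hm0 hsmall
    have h1m : 1 / m ≤ 1 := by rw [div_le_one hm0]; exact hm
    have ha0 : ∀ x ∈ range (N + 1), 0 ≤ (if x = 0 then 0 else a (x : ZMod N) : ℝ) := by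
      intro x _
      split_ifs
      exacts [le_rfl, ha.1 _]
    have has : ∀ x ∈ range (N + 1), (if x = 0 then 0 else a (x : ZMod N) : ℝ) ≤ s x := by
      intro x hx
      split_ifs with h0
      · exact hs0 x
      · have hx1 : 1 ≤ x := Nat.pos_of_ne_zero h0
        rcases ha.2 x (mem_Icc.2 ⟨hx1, Nat.lt_succ_iff.1 (mem_range.1 hx)⟩) with h | ⟨h, h'⟩
        · exact h.trans (hs0 x)
        · exact h'.trans (hs x hx1 h)
    have hdual := sq_mul_card_le_of_majorant S (range (N + 1))
      (fun r x => eC (-((x : ℝ) * r.val) / N)) (fun x => if x = 0 then 0 else a (x : ZMod N)) s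
      ha0 has hδ (fun r hr => by rw [← dft_eq_sum_range]; exact hlev r hr)
    have hstot : ∑ x ∈ range (N + 1), s x ≤ C0 * Z * 3 := by
      have h1 : ‖∑ x ∈ range (N + 1), (s x : ℂ) * eC (0 * x)‖ = ∑ x ∈ range (N + 1), s x := by
        simp only [zero_mul, eC_zero, mul_one]
        rw [← Complex.ofReal_sum, Complex.norm_real,
          Real.norm_of_nonneg (sum_nonneg fun _ _ => hs0 _)]
      rw [← h1]
      refine (hn2 0).trans ?_
      have : 1 / (1 + N * |0 - (n 0 : ℝ)|) ≤ 1 := by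
        rw [div_le_one (by positivity)]
        have : 0 ≤ N * |0 - (n 0 : ℝ)| := by positivity
        linarith
      gcongr
      linarith
    have hinner : ∀ r ∈ S, ∑ r' ∈ S, ‖∑ x ∈ range (N + 1), (s x : ℂ) *
        (eC (-((x : ℝ) * r.val) / N) * (starRingEnd ℂ) (eC (-((x : ℝ) * r'.val) / N)))‖ ≤
        C0 * Z * (3 * (C1 + 1) * m ^ (τ / 2)) := by
      intro r _
      have h1 : ∀ r' : ZMod N, ∑ x ∈ range (N + 1), (s x : ℂ) *
          (eC (-((x : ℝ) * r.val) / N) * (starRingEnd ℂ) (eC (-((x : ℝ) * r'.val) / N))) =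
          ∑ x ∈ range (N + 1), (s x : ℂ) * eC (((r'.val : ℝ) - r.val) / N * x) := by
        intro r'
        refine sum_congr rfl fun x _ => ?_
        rw [← eC_neg, ← eC_add]
        congr 2
        ring
      simp_rw [h1]
      calc _ ≤ ∑ r' ∈ S, C0 * Z * (1 / (1 + N * |((r'.val : ℝ) - r.val) / N -
            n (((r'.val : ℝ) - r.val) / N)|) + 1 / m + 1 / m) := by
            refine sum_le_sum fun r' _ => (hn2 _).trans ?_
            gcongr
        _ = C0 * Z * (∑ r' ∈ S, 1 / (1 + N * |((r'.val : ℝ) - r.val) / N -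
            n (((r'.val : ℝ) - r.val) / N)|) + 2) := by
            rw [← mul_sum, sum_add_distrib, sum_add_distrib, sum_const, nsmul_eq_mul, ← hm',
              mul_one_div_cancel hm0.ne']
            ring
        _ ≤ C0 * Z * (3 * (C1 * m ^ (τ / 2)) + 3 * m ^ (τ / 2)) := by
            have h2 := sum_one_div_one_add_abs_sub_le hone S r
              (fun r' => n (((r'.val : ℝ) - r.val) / N)) fun r' _ => hn1 _
            have h3 : 1 ≤ m ^ (τ / 2) := Real.one_le_rpow hm (by positivity)
            gcongr
            linarith
        _ = _ := by ring
    have hZm : Z ^ 2 ≤ C2 ^ 2 * m ^ (τ / 2) := by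
      calc Z ^ 2 ≤ (C2 * (m ^ 4) ^ (τ / 16)) ^ 2 := by
            gcongr; exact heul _ hz
        _ = C2 ^ 2 * m ^ (τ / 2) := by
            rw [mul_pow, ← Real.rpow_natCast m 4, ← Real.rpow_mul hm0.le,
              ← Real.rpow_natCast (m ^ _) 2, ← Real.rpow_mul hm0.le]
            congr 2
            push_cast
            ring
    have hfin : (δ * m) ^ 2 ≤ 9 * C0 ^ 2 * C2 ^ 2 * (C1 + 1) * m ^ τ * m := by
      calc (δ * m) ^ 2 ≤ _ := hdual
        _ ≤ C0 * Z * 3 * (m * (C0 * Z * (3 * (C1 + 1) * m ^ (τ / 2)))) := by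
            refine mul_le_mul hstot ?_ (by positivity) (by positivity)
            refine (sum_le_sum hinner).trans ?_
            rw [sum_const, nsmul_eq_mul]
        _ = 9 * C0 ^ 2 * (C1 + 1) * m ^ (τ / 2) * m * Z ^ 2 := by ring
        _ ≤ 9 * C0 ^ 2 * (C1 + 1) * m ^ (τ / 2) * m * (C2 ^ 2 * m ^ (τ / 2)) := by gcongr
        _ = 9 * C0 ^ 2 * C2 ^ 2 * (C1 + 1) * (m ^ (τ / 2) * m ^ (τ / 2)) * m := by ring
        _ = _ := by rw [← Real.rpow_add hm0, add_halves]
    have h2 : δ ^ 2 * m ≤ 9 * C0 ^ 2 * C2 ^ 2 * (C1 + 1) * m ^ τ := by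
      refine le_of_mul_le_mul_right ?_ hm0
      calc δ ^ 2 * m * m = (δ * m) ^ 2 := by ring
        _ ≤ _ := hfin
    refine h2.trans ?_
    gcongr
    linarith [show 0 ≤ 4 / (3 * τ / 64) ^ 2 by positivity]
  · set e := 3 * τ / 64 with he
    have he0 : 0 < e := by positivity
    have hlog : Real.log N ≤ (N : ℝ) ^ e / e := Real.log_le_rpow_div hN0.le he0
    have hlog0 : 0 ≤ Real.log N := Real.log_nonneg hN1'
    have h1 : δ ^ 2 * m ≤ L ^ 2 := by
      calc δ ^ 2 * m = ∑ r ∈ S, δ ^ 2 := by rw [sum_const, nsmul_eq_mul, mul_comm]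
        _ ≤ ∑ r ∈ S, ‖zhat (fun x => (a x : ℂ)) r‖ ^ 2 :=
            sum_le_sum fun r hr => pow_le_pow_left₀ hδ (hlev r hr) 2
        _ ≤ ∑ r, ‖zhat (fun x => (a x : ℂ)) r‖ ^ 2 :=
            sum_le_sum_of_subset_of_nonneg (subset_univ _) fun _ _ _ => by positivity
        _ = N * ∑ x, ‖(a x : ℂ)‖ ^ 2 := zhat_parseval _
        _ ≤ N * ∑ x : ZMod N, (L / N) ^ 2 := by
            gcongr with x
            rw [Complex.norm_real, Real.norm_of_nonneg (ha.1 x)]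
            exact ha.le hW hL0 x
        _ = L ^ 2 := by
            rw [sum_const, card_univ, ZMod.card, nsmul_eq_mul]
            field_simp
    have h2 : L ^ 2 ≤ 4 / e ^ 2 * m ^ τ := by
      calc L ^ 2 ≤ (2 * ((N : ℝ) ^ e / e)) ^ 2 := by gcongr; linarith
        _ = 4 / e ^ 2 * ((N : ℝ) ^ (3 / 32 : ℝ)) ^ τ := by
            rw [mul_pow, div_pow, ← Real.rpow_natCast ((N : ℝ) ^ e), ← Real.rpow_mul hN0.le,
              ← Real.rpow_mul hN0.le]
            have : e * (2 : ℕ) = 3 / 32 * τ := by rw [he]; push_cast; ring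
            rw [this]
            ring
        _ ≤ _ := by gcongr
    refine (h1.trans h2).trans ?_
    gcongr
    linarith [show 0 ≤ 9 * C0 ^ 2 * C2 ^ 2 * (C1 + 1) by positivity]

end levelset

section levelset

lemma sum_rpow_le_of_level_card_le {ι : Type*} [DecidableEq ι] (b : ι → ℝ) (hb : ∀ r, 0 ≤ b r)
    {C τ p : ℝ} (hC : 0 ≤ C) (hp : 0 < p)
    (h : ∀ (S : Finset ι) (δ : ℝ), 0 ≤ δ → S.Nonempty → (∀ r ∈ S, δ ≤ b r) →
      δ ^ 2 * (#S : ℝ) ≤ C * (#S : ℝ) ^ τ) (T : Finset ι) :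
    ∑ r ∈ T, b r ^ p ≤
      C ^ (p / 2) * ∑ i ∈ range #T, 1 / ((i + 1 : ℕ) : ℝ) ^ ((1 - τ) * (p / 2)) := by
  generalize hn : #T = n
  induction n generalizing T with
  | zero => rw [card_eq_zero] at hn; simp [hn]
  | succ n ih =>
    have hne : T.Nonempty := by rw [← card_pos]; omega
    obtain ⟨r, hr, hmin⟩ := exists_min_image T b hne
    have h1 := ih (T.erase r) (by rw [card_erase_of_mem hr]; omega)
    rw [← add_sum_erase T _ hr, sum_range_succ, mul_add, add_comm]
    refine add_le_add h1 ?_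
    have h2 := h T (b r) (hb r) hne hmin
    rw [hn] at h2
    set m : ℝ := ((n + 1 : ℕ) : ℝ) with hm
    have hm0 : 0 < m := by positivity
    have h3 : b r ^ 2 ≤ C * m ^ (τ - 1) := by
      rw [Real.rpow_sub hm0, Real.rpow_one, mul_div_assoc', le_div_iff₀ hm0]
      exact h2
    calc b r ^ p = (b r ^ 2) ^ (p / 2) := by
          rw [← Real.rpow_natCast, ← Real.rpow_mul (hb r)]; congr 1; push_cast; ring
      _ ≤ (C * m ^ (τ - 1)) ^ (p / 2) := Real.rpow_le_rpow (by positivity) h3 (by positivity)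
      _ = C ^ (p / 2) * (1 / m ^ ((1 - τ) * (p / 2))) := by
          rw [Real.mul_rpow hC (by positivity), ← Real.rpow_mul hm0.le, one_div,
            ← Real.rpow_neg hm0.le]
          congr 2
          ring

lemma exists_sum_rpow_le {p : ℝ} (hp : 2 < p) : ∃ C : ℝ, 0 < C ∧
    ∀ (N : ℕ) [NeZero N] (W : ℕ) (c : ℤ) (L : ℝ), 0 < W → 2 ≤ (N : ℝ) ^ (1 / 3200 : ℝ) → 0 ≤ L →
      L ≤ 2 * Real.log N → ∀ a : ZMod N → ℝ, PrimeDominated N W c L a →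
      ∑ r, ‖zhat (fun x => (a x : ℂ)) r‖ ^ p ≤ C := by
  classical
  have hp0 : 0 < p := by linarith
  set τ := (1 - 2 / p) / 2 with hτ
  have hτ0 : 0 < τ := by
    have : 2 / p < 1 := by rw [div_lt_one hp0]; exact hp
    rw [hτ]; linarith
  obtain ⟨C, hC, h⟩ := exists_level_card_le hτ0
  have hs : 1 < (1 - τ) * (p / 2) := by
    have : (1 - τ) * (p / 2) = p / 4 + 1 / 2 := by rw [hτ]; field_simp; ring
    rw [this]; linarith
  have hsum : Summable fun i : ℕ => 1 / ((i + 1 : ℕ) : ℝ) ^ ((1 - τ) * (p / 2)) :=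
    (summable_nat_add_iff 1).2 (Real.summable_one_div_nat_rpow.2 hs)
  set T := ∑' i : ℕ, 1 / ((i + 1 : ℕ) : ℝ) ^ ((1 - τ) * (p / 2)) with hT
  have hT0 : 0 ≤ T := tsum_nonneg fun i => by positivity
  refine ⟨C ^ (p / 2) * (T + 1), by positivity, ?_⟩
  intro N _ W c L hW hN hL0 hL a ha
  refine (sum_rpow_le_of_level_card_le (fun r => ‖zhat (fun x => (a x : ℂ)) r‖)
    (fun r => norm_nonneg _) hC.le hp0 (h N W c L hW hN hL0 hL a ha) univ).trans ?_
  gcongr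
  have := hsum.sum_le_tsum (range #(univ : Finset (ZMod N))) fun i _ => by positivity
  linarith

end levelset

section bohr

variable {N : ℕ} [NeZero N]

lemma norm_eC_sub_one_le_nint (t : ℝ) : ‖eC t - 1‖ ≤ 2 * Real.pi * nint t := by
  have h : eC t = eC (t - round t) := eC_eq_of_sub_eq_intCast (round t) (by ring)
  rw [h]
  exact norm_eC_sub_one_le _

lemma nint_val_neg (r x : ZMod N) :
    nint ((((-x).val : ℕ) : ℝ) * ((r.val : ℕ) : ℝ) / N) =
      nint (((x.val : ℕ) : ℝ) * ((r.val : ℕ) : ℝ) / N) := by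
  have hN : (N : ℝ) ≠ 0 := by exact_mod_cast NeZero.ne N
  by_cases hx : x = 0
  · simp [hx]
  · have h1 : (((-x).val : ℕ) : ℝ) = N - x.val := by
      rw [ZMod.neg_val, if_neg hx, Nat.cast_sub (ZMod.val_lt x).le]
    rw [h1, ← nint_neg (((x.val : ℕ) : ℝ) * ((r.val : ℕ) : ℝ) / N),
      ← nint_add_intCast (-(((x.val : ℕ) : ℝ) * ((r.val : ℕ) : ℝ) / N)) (r.val : ℤ)]
    congr 1
    push_cast
    field_simp
    ring

/-- The normalized indicator function of a Bohr set has Fourier transform bounded by `1`, and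
close to `1` on the frequencies defining the Bohr set. -/
lemma zhat_bohr {ε : ℝ} (hε : 0 ≤ ε) (R B : Finset (ZMod N))
    (hB : ∀ x : ZMod N, x ∈ B ↔ ∀ r ∈ R, nint (((x.val : ℕ) : ℝ) * ((r.val : ℕ) : ℝ) / N) ≤ ε)
    (β : ZMod N → ℝ) (hβ : ∀ x, β x = (if x ∈ B then (1 : ℝ) else 0) / (B.card : ℝ)) :
    (∀ r, ‖zhat (fun x => (β x : ℂ)) r‖ ≤ 1) ∧
      ∀ r ∈ R, ‖1 - zhat (fun x => (β x : ℂ)) r‖ ≤ 2 * Real.pi ^ 2 * ε ^ 2 := by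
  have h0 : (0 : ZMod N) ∈ B := by
    rw [hB]
    intro r _
    simpa [nint] using hε
  have hcard : (0 : ℝ) < #B := by exact_mod_cast card_pos.2 ⟨0, h0⟩
  have hβ0 : ∀ x, 0 ≤ β x := by
    intro x; rw [hβ]; split_ifs <;> positivity
  have hβ1 : ∑ x, β x = 1 := by
    simp_rw [hβ]
    rw [← sum_div, sum_ite_mem, univ_inter, sum_const, nsmul_eq_mul, mul_one, div_self hcard.ne']
  have hβneg : ∀ x, β (-x) = β x := by
    intro x
    have : -x ∈ B ↔ x ∈ B := by
      rw [hB, hB]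
      simp_rw [nint_val_neg]
    rw [hβ, hβ]
    simp only [this]
  refine ⟨fun r => ?_, fun r hr => ?_⟩
  · calc ‖zhat (fun x => (β x : ℂ)) r‖ ≤ ∑ x, ‖(β x : ℂ) * zchar (-r) x‖ := norm_sum_le _ _
      _ = ∑ x, β x := by
          refine sum_congr rfl fun x _ => ?_
          rw [norm_mul, norm_zchar, mul_one, Complex.norm_real, Real.norm_of_nonneg (hβ0 x)]
      _ ≤ 1 := hβ1.le
  · have h1 : zhat (fun x => (β x : ℂ)) r = ∑ x, (β x : ℂ) * zchar r x := by
      rw [zhat, ← Equiv.sum_comp (Equiv.neg (ZMod N))]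
      refine sum_congr rfl fun x _ => ?_
      simp only [Equiv.neg_apply]
      rw [hβneg, zchar_neg_right, neg_neg]
    have hone : (1 : ℂ) + 1 = ∑ x, ((β x : ℂ) + β x) := by
      rw [sum_add_distrib, ← Complex.ofReal_sum, hβ1, Complex.ofReal_one]
    have h2 : 2 * (1 - zhat (fun x => (β x : ℂ)) r) =
        ∑ x, (β x : ℂ) * ((‖zchar r x - 1‖ ^ 2 : ℝ) : ℂ) := by
      have h3 : 2 * (1 - zhat (fun x => (β x : ℂ)) r) =
          1 + 1 - zhat (fun x => (β x : ℂ)) r - ∑ x, (β x : ℂ) * zchar r x := by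
        rw [← h1]; ring
      rw [h3, hone, zhat, ← sum_sub_distrib, ← sum_sub_distrib]
      refine sum_congr rfl fun x _ => ?_
      have h4 : ((‖zchar r x - 1‖ ^ 2 : ℝ) : ℂ) =
          (zchar r x - 1) * ((starRingEnd ℂ) (zchar r x) - 1) := by
        rw [← Complex.normSq_eq_norm_sq, ← Complex.mul_conj, map_sub, map_one]
      have h5 : zchar r x * (starRingEnd ℂ) (zchar r x) = 1 := by
        rw [Complex.mul_conj, Complex.normSq_eq_norm_sq, norm_zchar]; norm_num
      rw [h4, zchar_neg_left]
      linear_combination -(β x : ℂ) * h5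
    have h6 : ∀ x, β x * ‖zchar r x - 1‖ ^ 2 ≤ β x * (4 * Real.pi ^ 2 * ε ^ 2) := by
      intro x
      by_cases hx : x ∈ B
      · refine mul_le_mul_of_nonneg_left ?_ (hβ0 x)
        have h7 : ‖zchar r x - 1‖ ≤ 2 * Real.pi * ε := by
          refine (norm_eC_sub_one_le_nint _).trans ?_
          have h8 := (hB x).1 hx r hr
          have h9 : (r.val : ℝ) / N * x.val = ((x.val : ℕ) : ℝ) * ((r.val : ℕ) : ℝ) / N := by ring
          rw [h9]
          gcongr
        calc ‖zchar r x - 1‖ ^ 2 ≤ (2 * Real.pi * ε) ^ 2 := by gcongr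
          _ = _ := by ring
      · have : β x = 0 := by rw [hβ, if_neg hx, zero_div]
        rw [this, zero_mul, zero_mul]
    have h7 : ‖2 * (1 - zhat (fun x => (β x : ℂ)) r)‖ ≤ 4 * Real.pi ^ 2 * ε ^ 2 := by
      rw [h2]
      calc _ ≤ ∑ x, ‖(β x : ℂ) * ((‖zchar r x - 1‖ ^ 2 : ℝ) : ℂ)‖ := norm_sum_le _ _
        _ = ∑ x, β x * ‖zchar r x - 1‖ ^ 2 := by
            refine sum_congr rfl fun x _ => ?_
            rw [norm_mul, Complex.norm_real, Complex.norm_real, Real.norm_of_nonneg (hβ0 x),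
              Real.norm_of_nonneg (by positivity)]
        _ ≤ ∑ x, β x * (4 * Real.pi ^ 2 * ε ^ 2) := sum_le_sum fun x _ => h6 x
        _ = _ := by rw [← sum_mul, hβ1, one_mul]
    rw [norm_mul, Complex.norm_ofNat] at h7
    linarith

lemma norm_one_sub_pow_le {u v : ℂ} (hu : ‖u‖ ≤ 1) (hv : ‖v‖ ≤ 1) {t : ℝ} (h1 : ‖1 - u‖ ≤ t)
    (h2 : ‖1 - v‖ ≤ t) : ‖1 - u ^ 4 * v ^ 2‖ ≤ 6 * t := by
  have h : 1 - u ^ 4 * v ^ 2 = (1 - u) * (1 + u + u ^ 2 + u ^ 3) + u ^ 4 * ((1 - v) * (1 + v)) := by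
    ring
  have ht : 0 ≤ t := (norm_nonneg _).trans h1
  have hp : ∀ (z : ℂ) (n : ℕ), ‖z‖ ≤ 1 → ‖z ^ n‖ ≤ 1 := fun z n hz => by
    rw [norm_pow]; exact pow_le_one₀ (norm_nonneg _) hz
  have a1 : ‖1 + u + u ^ 2 + u ^ 3‖ ≤ 4 := by
    calc _ ≤ ‖(1 : ℂ)‖ + ‖u‖ + ‖u ^ 2‖ + ‖u ^ 3‖ :=
          (norm_add_le _ _).trans (add_le_add_left (norm_add₃_le) _)
      _ ≤ 1 + 1 + 1 + 1 := by
          rw [norm_one]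
          have := hp u 2 hu
          have := hp u 3 hu
          linarith
      _ = 4 := by norm_num
  have a2 : ‖1 + v‖ ≤ 2 := by
    refine (norm_add_le _ _).trans ?_
    rw [norm_one]; linarith
  rw [h]
  calc _ ≤ ‖1 - u‖ * ‖1 + u + u ^ 2 + u ^ 3‖ + ‖u ^ 4‖ * (‖1 - v‖ * ‖1 + v‖) := by
        refine (norm_add_le _ _).trans ?_
        rw [norm_mul, norm_mul, norm_mul]
    _ ≤ t * 4 + 1 * (t * 2) := by
        gcongr
        exact hp u 4 hu
    _ = 6 * t := by ring

lemma norm_one_sub_pow_le_two {u v : ℂ} (hu : ‖u‖ ≤ 1) (hv : ‖v‖ ≤ 1) :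
    ‖1 - u ^ 4 * v ^ 2‖ ≤ 2 := by
  refine (norm_sub_le _ _).trans ?_
  rw [norm_one, norm_mul, norm_pow, norm_pow]
  have h1 : ‖u‖ ^ 4 * ‖v‖ ^ 2 ≤ 1 :=
    mul_le_one₀ (pow_le_one₀ (norm_nonneg _) hu) (by positivity) (pow_le_one₀ (norm_nonneg _) hv)
  linarith

lemma zhat_neg (f : ZMod N → ℝ) (r : ZMod N) :
    zhat (fun x => (f x : ℂ)) (-r) = (starRingEnd ℂ) (zhat (fun x => (f x : ℂ)) r) := by
  rw [zhat, zhat, map_sum]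
  refine sum_congr rfl fun x _ => ?_
  rw [map_mul, zchar_neg_left r, Complex.conj_conj, Complex.conj_ofReal, neg_neg]

lemma sum_sum_mul_eq (a g : ZMod N → ℝ) :
    (N : ℂ) * ((∑ x, ∑ y, a x * a y * g (x + y) : ℝ) : ℂ) =
      ∑ r, zhat (fun x => (g x : ℂ)) r * (starRingEnd ℂ) (zhat (fun x => (a x : ℂ)) r) ^ 2 := by
  have h1 : ∀ r, (starRingEnd ℂ) (zhat (fun x => (a x : ℂ)) r) = ∑ x, (a x : ℂ) * zchar r x := by
    intro r
    rw [← zhat_neg, zhat]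
    simp_rw [neg_neg]
  simp_rw [h1]
  push_cast
  rw [mul_sum]
  have h2 : ∀ x y : ZMod N, (N : ℂ) * ((a x : ℂ) * a y * g (x + y)) =
      ∑ r, (a x : ℂ) * a y * (zhat (fun x => (g x : ℂ)) r * zchar r (x + y)) := by
    intro x y
    rw [← mul_sum, zhat_inversion]
    ring
  simp_rw [mul_sum, h2]
  have h3 : ∀ r, zhat (fun x => (g x : ℂ)) r * (∑ x, (a x : ℂ) * zchar r x) ^ 2 =
      ∑ x, ∑ y, (a x : ℂ) * a y * (zhat (fun x => (g x : ℂ)) r * zchar r (x + y)) := by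
    intro r
    rw [pow_two, sum_mul_sum, mul_sum]
    refine sum_congr rfl fun x _ => ?_
    rw [mul_sum]
    refine sum_congr rfl fun y _ => ?_
    rw [zchar_add_right]
    ring
  simp_rw [h3]
  symm
  rw [sum_comm]
  refine sum_congr rfl fun x _ => ?_
  rw [sum_comm]

end bohr

section transfer

lemma mul_le_rpow_add_rpow {x y p q : ℝ} (hx : 0 ≤ x) (hy : 0 ≤ y) (hpq : p.HolderConjugate q) :
    x * y ≤ x ^ p + y ^ q := by
  refine (Real.young_inequality_of_nonneg hx hy hpq).trans ?_
  have hp : 1 ≤ p := hpq.lt.le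
  have hq : 1 ≤ q := hpq.symm.lt.le
  gcongr
  · exact div_le_self (by positivity) hp
  · exact div_le_self (by positivity) hq

/-- The pointwise inequality behind the transfer estimate. -/
lemma sq_mul_le_of_lt_left {ρ θ : ℝ} (hρ : 2 ≤ ρ) (hθ : θ = 1 / (ρ + 1)) {η b c : ℝ} (hc : 0 ≤ c)
    (hb : 0 ≤ b) (h : c < η) :
    c ^ 2 * b ≤ η ^ θ * (c ^ ((2 * ρ + 1) * ρ / (ρ ^ 2 - 1)) + b ^ ρ) := by
  have hθ0 : 0 < θ := by rw [hθ]; positivity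
  have hθ2 : 2 - θ = (2 * ρ + 1) / (ρ + 1) := by rw [hθ]; field_simp; ring
  have h1 : c ^ 2 = c ^ θ * c ^ (2 - θ) := by
    rw [← Real.rpow_add_of_nonneg hc hθ0.le (by rw [hθ2]; positivity)]
    norm_num
  have hρ1 : 0 < ρ - 1 := by linarith
  have hconj : (ρ / (ρ - 1)).HolderConjugate ρ :=
    (Real.HolderConjugate.conjExponent (by linarith : 1 < ρ)).symm
  have h2 := mul_le_rpow_add_rpow (Real.rpow_nonneg hc (2 - θ)) hb hconj
  rw [← Real.rpow_mul hc] at h2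
  have h3 : (2 - θ) * (ρ / (ρ - 1)) = (2 * ρ + 1) * ρ / (ρ ^ 2 - 1) := by
    rw [hθ2, div_mul_div_comm]
    congr 1
    ring
  rw [h3] at h2
  rw [h1, mul_assoc]
  have h4 : c ^ θ ≤ η ^ θ := Real.rpow_le_rpow hc h.le hθ0.le
  have h5 : 0 ≤ c ^ (2 - θ) * b := by positivity
  exact mul_le_mul h4 h2 h5 ((Real.rpow_nonneg hc θ).trans h4)

lemma sq_mul_le_of_lt_right {ρ θ : ℝ} (hρ : 2 ≤ ρ) (hθ : θ = 1 / (ρ + 1)) {η b c : ℝ} (hc : 0 ≤ c)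
    (hb : 0 ≤ b) (h : b < η) :
    c ^ 2 * b ≤ η ^ θ * (c ^ (2 * (ρ + 1) / ρ) + b ^ ρ) := by
  have hθ0 : 0 < θ := by rw [hθ]; positivity
  have hθ1 : 1 - θ = ρ / (ρ + 1) := by rw [hθ]; field_simp; ring
  have h1 : b = b ^ θ * b ^ (1 - θ) := by
    rw [← Real.rpow_add_of_nonneg hb hθ0.le (by rw [hθ1]; positivity)]
    norm_num
  have hconj : ((ρ + 1) / ρ).HolderConjugate (ρ + 1) := by
    have := (Real.HolderConjugate.conjExponent (by linarith : 1 < ρ + 1)).symm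
    rwa [Real.conjExponent, add_sub_cancel_right] at this
  have h2 := mul_le_rpow_add_rpow (by positivity : 0 ≤ c ^ 2) (Real.rpow_nonneg hb (1 - θ)) hconj
  rw [← Real.rpow_mul hb, ← Real.rpow_natCast c 2, ← Real.rpow_mul hc] at h2
  have h3 : (1 - θ) * (ρ + 1) = ρ := by rw [hθ1]; field_simp
  have h3' : ((2 : ℕ) : ℝ) * ((ρ + 1) / ρ) = 2 * (ρ + 1) / ρ := by push_cast; ring
  rw [h3, h3', Real.rpow_natCast] at h2
  have h4 : b ^ θ ≤ η ^ θ := Real.rpow_le_rpow hb h.le hθ0.le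
  have h5 : 0 ≤ c ^ 2 * b ^ (1 - θ) := by positivity
  calc c ^ 2 * b = c ^ 2 * (b ^ θ * b ^ (1 - θ)) := by rw [← h1]
    _ = b ^ θ * (c ^ 2 * b ^ (1 - θ)) := by ring
    _ ≤ _ := mul_le_mul h4 h2 h5 ((Real.rpow_nonneg hb θ).trans h4)

lemma sq_mul_le_of_le {ρ : ℝ} (hρ : 2 ≤ ρ) {η b c C : ℝ} (hη : 0 < η) (hη1 : η < 1) (hc : 0 ≤ c)
    (hcC : c ≤ C) (h : η ≤ b) : c ^ 2 * b ≤ C ^ 2 * (η ^ (-ρ) * b ^ ρ) := by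
  have hb : 0 < b := by linarith
  have h1 : b ≤ η ^ (-ρ) * b ^ ρ := by
    have h2 : 1 ≤ (b / η) ^ (ρ - 1) := by
      refine Real.one_le_rpow ?_ (by linarith)
      rwa [le_div_iff₀ hη, one_mul]
    have h3 : η ^ (-ρ) * b ^ ρ = η⁻¹ * (b * (b / η) ^ (ρ - 1)) := by
      rw [Real.div_rpow hb.le hη.le, Real.rpow_neg hη.le, Real.rpow_sub_one hb.ne',
        Real.rpow_sub_one hη.ne']
      field_simp
    have h4 : 1 ≤ η⁻¹ := (one_le_inv₀ hη).2 hη1.le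
    rw [h3]
    calc b = 1 * (b * 1) := by ring
      _ ≤ _ := by gcongr
  gcongr

lemma abs_sum_sub_sum_le {N : ℕ} [NeZero N] {ρ : ℕ} (hρ : 2 ≤ ρ) {p₁ p₂ : ℝ}
    (hp₁ : p₁ = (2 * (ρ : ℝ) + 1) * ρ / ((ρ : ℝ) ^ 2 - 1)) (hp₂ : p₂ = 2 * ((ρ : ℝ) + 1) / ρ)
    {C₁ C₂ C : ℝ} (a g : ZMod N → ℝ)
    (h1 : ∑ r, ‖zhat (fun x => (a x : ℂ)) r‖ ^ p₁ ≤ C₁)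
    (h2 : ∑ r, ‖zhat (fun x => (a x : ℂ)) r‖ ^ p₂ ≤ C₂)
    (h3 : ∑ r, ‖zhat (fun x => (g x : ℂ)) r‖ ^ ρ ≤ C) {η ε : ℝ} (hη : 0 < η) (hη1 : η < 1)
    (hε : 0 < ε) (R B : Finset (ZMod N)) (hR : ∀ r : ZMod N, r ∈ R ↔ η ≤ ‖dft N a r‖)
    (hB : ∀ x : ZMod N, x ∈ B ↔ ∀ r ∈ R, nint (((x.val : ℕ) : ℝ) * ((r.val : ℕ) : ℝ) / N) ≤ ε)
    (β : ZMod N → ℝ) (hβ : ∀ x, β x = (if x ∈ B then (1 : ℝ) else 0) / (B.card : ℝ))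
    (a' : ZMod N → ℝ)
    (ha' : ∀ x, a' x = ∑ y : ZMod N, (∑ u : ZMod N, a u * β (y - u)) * β (x - y))
    (R' B' : Finset (ZMod N)) (hR' : ∀ r : ZMod N, r ∈ R' ↔ η ≤ ‖dft N g r‖)
    (hB' : ∀ x : ZMod N, x ∈ B' ↔ ∀ r ∈ R', nint (((x.val : ℕ) : ℝ) * ((r.val : ℕ) : ℝ) / N) ≤ ε)
    (β' : ZMod N → ℝ) (hβ' : ∀ x, β' x = (if x ∈ B' then (1 : ℝ) else 0) / (B'.card : ℝ))
    (g' : ZMod N → ℝ)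
    (hg' : ∀ x, g' x = ∑ y : ZMod N, (∑ u : ZMod N, g u * β' (y - u)) * β' (x - y)) :
    |(∑ x : ZMod N, ∑ y : ZMod N, a x * a y * g (x + y))
        - (∑ x : ZMod N, ∑ y : ZMod N, a' x * a' y * g' (x + y))| ≤
      (12 * Real.pi ^ 2 * (1 + C₁) ^ 2 * C + 2 * (C₁ + C₂ + 2 * C)) *
        (ε ^ 2 * η ^ (-(ρ : ℝ)) + η ^ (1 / ((ρ : ℝ) + 1))) * (N : ℝ)⁻¹ := by
  have hρR : (2 : ℝ) ≤ ρ := by exact_mod_cast hρ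
  have hN0 : (0 : ℝ) < N := by exact_mod_cast Nat.pos_of_ne_zero (NeZero.ne N)
  have hp₁0 : 1 ≤ p₁ := by
    rw [hp₁, le_div_iff₀ (by nlinarith)]
    nlinarith
  set θ : ℝ := 1 / ((ρ : ℝ) + 1) with hθ
  set A : ZMod N → ℂ := fun r => zhat (fun x => (a x : ℂ)) r with hA
  set G : ZMod N → ℂ := fun r => zhat (fun x => (g x : ℂ)) r with hG
  have hAC : ∀ r, ‖A r‖ ≤ 1 + C₁ := by
    intro r
    have h4 : ‖A r‖ ^ p₁ ≤ C₁ :=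
      (single_le_sum (f := fun r => ‖A r‖ ^ p₁) (fun _ _ => by positivity) (mem_univ r)).trans h1
    by_cases h5 : ‖A r‖ ≤ 1
    · have : 0 ≤ ‖A r‖ ^ p₁ := by positivity
      linarith
    · have := Real.rpow_le_rpow_of_exponent_le (not_le.1 h5).le hp₁0
      rw [Real.rpow_one] at this
      linarith
  obtain ⟨hu1, hu2⟩ := zhat_bohr hε.le R B hB β hβ
  obtain ⟨hv1, hv2⟩ := zhat_bohr hε.le R' B' hB' β' hβ'
  set u : ZMod N → ℂ := fun r => (starRingEnd ℂ) (zhat (fun x => (β x : ℂ)) r) with hu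
  set v : ZMod N → ℂ := fun r => zhat (fun x => (β' x : ℂ)) r with hv
  have hu1' : ∀ r, ‖u r‖ ≤ 1 := fun r => by rw [hu]; simpa only [RCLike.norm_conj] using hu1 r
  have hu2' : ∀ r ∈ R, ‖1 - u r‖ ≤ 2 * Real.pi ^ 2 * ε ^ 2 := fun r hr => by
    have : 1 - u r = (starRingEnd ℂ) (1 - zhat (fun x => (β x : ℂ)) r) := by
      rw [map_sub, map_one]
    rw [this, RCLike.norm_conj]
    exact hu2 r hr
  have ha'' : ∀ r, zhat (fun x => (a' x : ℂ)) r = A r * zhat (fun x => (β x : ℂ)) r ^ 2 := by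
    intro r
    have : a' = zconv (zconv a β) β := funext ha'
    rw [this, zhat_zconv, zhat_zconv]; ring
  have hg'' : ∀ r, zhat (fun x => (g' x : ℂ)) r = G r * v r ^ 2 := by
    intro r
    have : g' = zconv (zconv g β') β' := funext hg'
    rw [this, zhat_zconv, zhat_zconv]; ring
  have key : (N : ℂ) * (((∑ x : ZMod N, ∑ y : ZMod N, a x * a y * g (x + y))
        - (∑ x : ZMod N, ∑ y : ZMod N, a' x * a' y * g' (x + y)) : ℝ) : ℂ) =
      ∑ r, G r * (starRingEnd ℂ) (A r) ^ 2 * (1 - u r ^ 4 * v r ^ 2) := by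
    rw [Complex.ofReal_sub, mul_sub, sum_sum_mul_eq, sum_sum_mul_eq, ← sum_sub_distrib]
    refine sum_congr rfl fun r _ => ?_
    rw [ha'', hg'', map_mul, map_pow]
    simp only [hu]
    ring
  set E : ℝ := ε ^ 2 * η ^ (-(ρ : ℝ)) with hE
  have hpt : ∀ r, ‖G r * (starRingEnd ℂ) (A r) ^ 2 * (1 - u r ^ 4 * v r ^ 2)‖ ≤
      12 * Real.pi ^ 2 * (1 + C₁) ^ 2 * E * ‖G r‖ ^ ρ +
        2 * η ^ θ * (‖A r‖ ^ p₁ + ‖A r‖ ^ p₂ + 2 * ‖G r‖ ^ ρ) := by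
    intro r
    rw [norm_mul, norm_mul, norm_pow, RCLike.norm_conj, mul_comm ‖G r‖]
    have hnn1 : 0 ≤ 12 * Real.pi ^ 2 * (1 + C₁) ^ 2 * E * ‖G r‖ ^ ρ := by positivity
    have hA1 : 0 ≤ ‖A r‖ ^ p₁ := by positivity
    have hA2 : 0 ≤ ‖A r‖ ^ p₂ := by positivity
    have hG1 : 0 ≤ ‖G r‖ ^ ρ := by positivity
    have hηθ : 0 < η ^ θ := by positivity
    have htwo := norm_one_sub_pow_le_two (hu1' r) (hv1 r)
    by_cases hr : r ∈ R
    · by_cases hr' : r ∈ R'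
      · have hd := norm_one_sub_pow_le (hu1' r) (hv1 r) (hu2' r hr) (hv2 r hr')
        have hηG : η ≤ ‖G r‖ := by have := (hR' r).1 hr'; rwa [dft_eq_zhat] at this
        have hb := sq_mul_le_of_le hρR hη hη1 (norm_nonneg (A r)) (hAC r) hηG
        rw [Real.rpow_natCast] at hb
        calc _ ≤ (1 + C₁) ^ 2 * (η ^ (-(ρ : ℝ)) * ‖G r‖ ^ ρ) * (6 * (2 * Real.pi ^ 2 * ε ^ 2)) := by
              gcongr
          _ = 12 * Real.pi ^ 2 * (1 + C₁) ^ 2 * E * ‖G r‖ ^ ρ := by rw [hE]; ring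
          _ ≤ _ := le_add_of_nonneg_right (by positivity)
      · have hηG : ‖G r‖ < η := by
          rw [hR', not_le, dft_eq_zhat] at hr'; exact hr'
        have hb := sq_mul_le_of_lt_right hρR hθ (norm_nonneg (A r)) (norm_nonneg (G r)) hηG
        rw [Real.rpow_natCast, ← hp₂] at hb
        calc _ ≤ η ^ θ * (‖A r‖ ^ p₂ + ‖G r‖ ^ ρ) * 2 := by gcongr
          _ ≤ 2 * η ^ θ * (‖A r‖ ^ p₁ + ‖A r‖ ^ p₂ + 2 * ‖G r‖ ^ ρ) := by
              rw [mul_comm _ (2 : ℝ), ← mul_assoc]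
              refine mul_le_mul_of_nonneg_left ?_ (by positivity)
              linarith
          _ ≤ _ := le_add_of_nonneg_left hnn1
    · have hηA : ‖A r‖ < η := by
        rw [hR, not_le, dft_eq_zhat] at hr; exact hr
      have hb := sq_mul_le_of_lt_left hρR hθ (norm_nonneg (A r)) (norm_nonneg (G r)) hηA
      rw [Real.rpow_natCast, ← hp₁] at hb
      calc _ ≤ η ^ θ * (‖A r‖ ^ p₁ + ‖G r‖ ^ ρ) * 2 := by gcongr
        _ ≤ 2 * η ^ θ * (‖A r‖ ^ p₁ + ‖A r‖ ^ p₂ + 2 * ‖G r‖ ^ ρ) := by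
            rw [mul_comm _ (2 : ℝ), ← mul_assoc]
            refine mul_le_mul_of_nonneg_left ?_ (by positivity)
            linarith
        _ ≤ _ := le_add_of_nonneg_left hnn1
  have hC0 : 0 ≤ C := (sum_nonneg fun _ _ => by positivity).trans h3
  have hC₁0 : 0 ≤ C₁ := (sum_nonneg fun _ _ => by positivity).trans h1
  have hC₂0 : 0 ≤ C₂ := (sum_nonneg fun _ _ => by positivity).trans h2
  have hE0 : 0 ≤ E := by positivity
  have hηθ : 0 < η ^ θ := by positivity
  rw [← div_eq_mul_inv, le_div_iff₀ hN0]
  calc _ = ‖(N : ℂ) * (((∑ x : ZMod N, ∑ y : ZMod N, a x * a y * g (x + y))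
        - (∑ x : ZMod N, ∑ y : ZMod N, a' x * a' y * g' (x + y)) : ℝ) : ℂ)‖ := by
        rw [norm_mul, Complex.norm_natCast, Complex.norm_real, Real.norm_eq_abs, mul_comm]
    _ ≤ ∑ r, (12 * Real.pi ^ 2 * (1 + C₁) ^ 2 * E * ‖G r‖ ^ ρ +
        2 * η ^ θ * (‖A r‖ ^ p₁ + ‖A r‖ ^ p₂ + 2 * ‖G r‖ ^ ρ)) := by
        rw [key]
        exact (norm_sum_le _ _).trans (sum_le_sum fun r _ => hpt r)
    _ = 12 * Real.pi ^ 2 * (1 + C₁) ^ 2 * E * ∑ r, ‖G r‖ ^ ρ +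
        2 * η ^ θ * (∑ r, ‖A r‖ ^ p₁ + ∑ r, ‖A r‖ ^ p₂ + 2 * ∑ r, ‖G r‖ ^ ρ) := by
        rw [sum_add_distrib, ← mul_sum, ← mul_sum, sum_add_distrib, sum_add_distrib, ← mul_sum]
    _ ≤ 12 * Real.pi ^ 2 * (1 + C₁) ^ 2 * E * C + 2 * η ^ θ * (C₁ + C₂ + 2 * C) := by gcongr
    _ ≤ _ := by
        have i1 : 0 ≤ 12 * Real.pi ^ 2 * (1 + C₁) ^ 2 * C * η ^ θ := by positivity
        have i2 : 0 ≤ 2 * (C₁ + C₂ + 2 * C) * E := by positivity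
        nlinarith

end transfer

section powers

lemma pow_sub_pow_le_mul {x y : ℝ} (hy : 0 ≤ y) (hxy : y ≤ x) (j : ℕ) :
    x ^ j - y ^ j ≤ j * x ^ (j - 1) * (x - y) := by
  induction j with
  | zero => simp
  | succ j ih =>
    have hx : 0 ≤ x := hy.trans hxy
    rcases Nat.eq_zero_or_pos j with rfl | hj
    · simp
    · have h1 : y ^ j ≤ x ^ j := pow_le_pow_left₀ hy hxy j
      have h2 : x * x ^ (j - 1) = x ^ j := by rw [← pow_succ']; congr 1; omega
      have h3 : x * (x ^ j - y ^ j) ≤ x * (j * x ^ (j - 1) * (x - y)) :=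
        mul_le_mul_of_nonneg_left ih hx
      have h4 : x * (j * x ^ (j - 1) * (x - y)) = j * x ^ j * (x - y) := by rw [← h2]; ring
      have h5 : y ^ j * (x - y) ≤ x ^ j * (x - y) :=
        mul_le_mul_of_nonneg_right h1 (by linarith)
      rw [Nat.add_sub_cancel]
      push_cast
      rw [pow_succ', pow_succ']
      nlinarith

lemma mul_le_pow_sub_pow {x y : ℝ} (hy : 0 ≤ y) (hxy : y ≤ x) {j : ℕ} (hj : 1 ≤ j) :
    x ^ (j - 1) * (x - y) ≤ x ^ j - y ^ j := by
  obtain ⟨i, rfl⟩ : ∃ i, j = i + 1 := ⟨j - 1, by omega⟩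
  have h1 : y ^ i * y ≤ x ^ i * y := mul_le_mul_of_nonneg_right (pow_le_pow_left₀ hy hxy i) hy
  rw [Nat.add_sub_cancel, pow_succ, pow_succ]
  linarith

/-- The increment `z ^ j - (z - 1) ^ j`, with the value `0` at `z = 0`. -/
noncomputable def powIncr (j z : ℕ) : ℝ := if z = 0 then 0 else (z : ℝ) ^ j - ((z : ℝ) - 1) ^ j

lemma powIncr_succ (j z : ℕ) : powIncr j (z + 1) = ((z : ℝ) + 1) ^ j - (z : ℝ) ^ j := by
  simp [powIncr]

lemma powIncr_le_succ (j z : ℕ) : powIncr j z ≤ powIncr j (z + 1) := by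
  rcases z with _ | z
  · rw [powIncr_succ, powIncr, if_pos rfl, sub_nonneg]
    gcongr
    simp
  · rw [powIncr_succ, powIncr_succ]
    rcases j with _ | j
    · simp
    · have h := add_pow_le (a := (z : ℝ)) (b := (z : ℝ) + 1 + 1) (by positivity)
        (by positivity) (j + 1)
      have h2 : (z : ℝ) + (z + 1 + 1) = 2 * (z + 1) := by ring
      rw [h2, mul_pow, Nat.add_sub_cancel, pow_succ 2 j, mul_assoc] at h
      have h3 := le_of_mul_le_mul_left h (by positivity)
      push_cast
      linarith

lemma powIncr_nonneg (j z : ℕ) : 0 ≤ powIncr j z := by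
  have := monotone_nat_of_le_succ (powIncr_le_succ j) (Nat.zero_le z)
  simpa [powIncr] using this

lemma powIncr_le {j k z M : ℕ} (hjk : j ≤ k) (hzM : z ≤ M) (hM : 1 ≤ M) :
    powIncr j z ≤ k * (M : ℝ) ^ (k - 1) := by
  have hM1 : (1 : ℝ) ≤ M := by exact_mod_cast hM
  rcases z with _ | z
  · rw [powIncr, if_pos rfl]; positivity
  · rw [powIncr_succ]
    have hz : (z : ℝ) + 1 ≤ M := by exact_mod_cast hzM
    have h := pow_sub_pow_le_mul (x := (z : ℝ) + 1) (y := z) (by positivity) (by linarith) j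
    have h2 : ((z : ℝ) + 1) ^ (j - 1) ≤ (M : ℝ) ^ (k - 1) :=
      (pow_le_pow_left₀ (by positivity) hz _).trans (pow_le_pow_right₀ hM1 (by omega))
    calc _ ≤ _ := h
      _ = j * ((z : ℝ) + 1) ^ (j - 1) := by ring
      _ ≤ _ := by gcongr

end powers

section coefficients

variable {k : ℕ} {f : Polynomial ℤ}

lemma cast_eval_eq_sum (hk : f.natDegree = k) (z : ℤ) :
    ((f.eval z : ℤ) : ℝ) = ∑ j ∈ range (k + 1), (f.coeff j : ℝ) * (z : ℝ) ^ j := by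
  rw [Polynomial.eval_eq_sum_range, hk]
  push_cast
  rfl

lemma polyIncr_eq_sum (hk : f.natDegree = k) (z : ℕ) :
    polyIncr f z = ∑ j ∈ range (k + 1), (f.coeff j : ℝ) * powIncr j z := by
  rcases z with _ | z
  · simp [polyIncr, powIncr]
  · rw [polyIncr_succ, cast_eval_eq_sum hk, cast_eval_eq_sum hk, ← sum_sub_distrib]
    refine sum_congr rfl fun j _ => ?_
    rw [powIncr_succ]
    push_cast
    ring

variable {Λ : ℝ}

lemma sum_abs_coeff_mul_le (h0 : f.eval 0 = 0) (hΛ : ∀ j, |(f.coeff j : ℝ)| ≤ Λ)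
    {F : ℕ → ℝ} {G : ℝ} (hF : ∀ j ≤ k, F j ≤ G) (hF0 : ∀ j, 0 ≤ F j) :
    ∑ j ∈ range (k + 1), |(f.coeff j : ℝ)| * F j ≤ k * (Λ * G) := by
  have hΛ0 : 0 ≤ Λ := (abs_nonneg _).trans (hΛ 0)
  rw [sum_range_succ']
  have hc : f.coeff 0 = 0 := by rw [Polynomial.coeff_zero_eq_eval_zero, h0]
  rw [hc, Int.cast_zero, abs_zero, zero_mul, add_zero]
  calc _ ≤ ∑ j ∈ range k, Λ * G := by
        refine sum_le_sum fun j hj => ?_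
        have hj := mem_range.1 hj
        exact mul_le_mul (hΛ _) (hF _ (by omega)) (hF0 _) hΛ0
    _ = _ := by rw [sum_const, card_range, nsmul_eq_mul]

lemma abs_polyIncr_le (hk : f.natDegree = k) (h0 : f.eval 0 = 0)
    (hΛ : ∀ j, |(f.coeff j : ℝ)| ≤ Λ) {z M : ℕ} (hz : z ≤ M) (hM : 1 ≤ M) :
    |polyIncr f z| ≤ k * (Λ * (k * (M : ℝ) ^ (k - 1))) := by
  rw [polyIncr_eq_sum hk]
  refine (abs_sum_le_sum_abs _ _).trans ?_
  simp_rw [abs_mul, abs_of_nonneg (powIncr_nonneg _ _)]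
  exact sum_abs_coeff_mul_le h0 hΛ (fun j hj => powIncr_le hj hz hM)
    (fun j => powIncr_nonneg _ _)

lemma sum_abs_polyIncr_sub_le (hk : f.natDegree = k) (h0 : f.eval 0 = 0)
    (hΛ : ∀ j, |(f.coeff j : ℝ)| ≤ Λ) {M : ℕ} (hM : 1 ≤ M) :
    ∑ z ∈ range M, |polyIncr f (z + 1) - polyIncr f z| ≤
      k * (Λ * (k * (M : ℝ) ^ (k - 1))) := by
  calc _ ≤ ∑ z ∈ range M, ∑ j ∈ range (k + 1),
        |(f.coeff j : ℝ)| * (powIncr j (z + 1) - powIncr j z) := by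
        refine sum_le_sum fun z _ => ?_
        rw [polyIncr_eq_sum hk, polyIncr_eq_sum hk, ← sum_sub_distrib]
        refine (abs_sum_le_sum_abs _ _).trans (le_of_eq (sum_congr rfl fun j _ => ?_))
        rw [← mul_sub, abs_mul, abs_of_nonneg (sub_nonneg.2 (powIncr_le_succ j z))]
    _ = ∑ j ∈ range (k + 1), |(f.coeff j : ℝ)| * powIncr j M := by
        rw [sum_comm]
        refine sum_congr rfl fun j _ => ?_
        rw [← mul_sum, sum_range_sub]
        simp [powIncr]
    _ ≤ _ := sum_abs_coeff_mul_le h0 hΛ (fun j hj => powIncr_le hj le_rfl hM)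
        (fun j => powIncr_nonneg _ _)

lemma abs_eval_le (hk : f.natDegree = k) (h0 : f.eval 0 = 0)
    (hΛ : ∀ j, |(f.coeff j : ℝ)| ≤ Λ) {M : ℕ} (hM : 1 ≤ M) :
    |((f.eval (M : ℤ) : ℤ) : ℝ)| ≤ k * (Λ * (M : ℝ) ^ k) := by
  have hM1 : (1 : ℝ) ≤ M := by exact_mod_cast hM
  rw [cast_eval_eq_sum hk]
  refine (abs_sum_le_sum_abs _ _).trans ?_
  simp_rw [abs_mul]
  refine sum_abs_coeff_mul_le h0 hΛ (fun j hj => ?_) (fun j => abs_nonneg _)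
  rw [abs_of_nonneg (by positivity)]
  exact pow_le_pow_right₀ hM1 hj

/-- A polynomial with small coefficients whose values grow at the expected rate is admissible
on the longest initial interval where it stays below `N`. -/
lemma exists_admissible (hk1 : 1 ≤ k) (hk : f.natDegree = k) (h0 : f.eval 0 = 0)
    (hlc : 0 < f.leadingCoeff) {W : ℕ} (hloc : LocalCond f W)
    (hΛ : ∀ j, |(f.coeff j : ℝ)| ≤ Λ)
    {κ : ℝ} (hκ : 1 ≤ κ) (hincr : ∀ z : ℕ, 1 ≤ polyIncr f (z + 1))
    (hgrow : ∀ z : ℕ, (z : ℝ) ^ k ≤ 2 * κ * (f.eval (z : ℤ) : ℤ))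
    {δ : ℝ} {N M : ℕ} (hN : 2 ≤ N) (hδ : δ * (k + 1) < 1)
    (hQ : 4 * κ * k ^ 2 * 2 ^ k * Λ ≤ (N : ℝ) ^ δ)
    (hM : f.eval (M : ℤ) < N) (hM' : (N : ℤ) ≤ f.eval ((M + 1 : ℕ) : ℤ)) :
    ∃ V, Admissible k δ f W M N V := by
  have hk1' : (1 : ℝ) ≤ k := by exact_mod_cast hk1
  have hN2 : (2 : ℝ) ≤ N := by exact_mod_cast hN
  have hMr : ((f.eval (M : ℤ) : ℤ) : ℝ) < N := by exact_mod_cast hM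
  have hMr' : (N : ℝ) ≤ ((f.eval ((M + 1 : ℕ) : ℤ) : ℤ) : ℝ) := by exact_mod_cast hM'
  have hlcΛ : (f.leadingCoeff : ℝ) ≤ Λ := (le_abs_self _).trans (hΛ _)
  have hΛ1 : 1 ≤ Λ := by
    have : (1 : ℝ) ≤ f.leadingCoeff := by exact_mod_cast hlc
    linarith
  have h2k : (1 : ℝ) ≤ 2 ^ k := one_le_pow₀ (by norm_num)
  have hk2 : (1 : ℝ) ≤ (k : ℝ) ^ 2 := one_le_pow₀ hk1'
  have hkk : (k : ℝ) ≤ (k : ℝ) ^ 2 := by nlinarith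
  set Q : ℝ := 4 * κ * k ^ 2 * 2 ^ k * Λ with hQdef
  have hQ1 : 4 * κ * k ^ 2 * Λ ≤ Q := by
    rw [hQdef]
    have : 0 ≤ 4 * κ * (k : ℝ) ^ 2 * Λ := by positivity
    nlinarith
  have hkQ : k * Λ ≤ Q := by
    refine le_trans ?_ hQ1
    refine mul_le_mul_of_nonneg_right ?_ (by linarith)
    nlinarith
  have hMQ : 4 * κ * k ^ 2 * Λ < (M : ℝ) + 1 := by
    by_contra! hle
    have h1 := abs_eval_le hk h0 hΛ (M := M + 1) (by omega)
    have h2 : (N : ℝ) ≤ k * (Λ * ((M : ℝ) + 1) ^ k) := by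
      refine hMr'.trans ((le_abs_self _).trans (h1.trans (le_of_eq ?_)))
      push_cast; rfl
    have h3 : (N : ℝ) ≤ Q ^ (k + 1) := by
      refine h2.trans ?_
      rw [pow_succ', ← mul_assoc]
      exact mul_le_mul hkQ (pow_le_pow_left₀ (by positivity) (hle.trans hQ1) _)
        (by positivity) (by positivity)
    have h4 : Q ^ (k + 1) ≤ (N : ℝ) ^ (δ * (k + 1)) := by
      have : ((k : ℝ) + 1) = ((k + 1 : ℕ) : ℝ) := by push_cast; rfl
      rw [this, Real.rpow_mul (by positivity), Real.rpow_natCast]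
      exact pow_le_pow_left₀ (by positivity) hQ _
    have h5 : (N : ℝ) ^ (δ * (k + 1)) < (N : ℝ) ^ (1 : ℝ) :=
      Real.rpow_lt_rpow_of_exponent_lt (by linarith) hδ
    rw [Real.rpow_one] at h5
    linarith
  have hM1 : 1 ≤ M := by
    have : (1 : ℝ) < (M : ℝ) + 1 := by
      refine lt_of_le_of_lt ?_ hMQ
      calc (1 : ℝ) ≤ 4 * 1 * 1 * 1 := by norm_num
        _ ≤ _ := by gcongr
    by_contra! h
    have : M = 0 := by omega
    subst this
    norm_num at this
  have hM1' : (1 : ℝ) ≤ M := by exact_mod_cast hM1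
  have hMk : (M : ℝ) ^ (k - 1) * M = (M : ℝ) ^ k := by
    rw [← pow_succ]; congr 1; omega
  have hnn : ∀ z : ℕ, 0 ≤ polyIncr f z := by
    intro z
    rcases z with _ | z
    · simp [polyIncr]
    · linarith [hincr z]
  have hP : (0 : ℝ) ≤ (f.eval (M : ℤ) : ℤ) := by
    have := hgrow M
    have h : (0 : ℝ) ≤ (M : ℝ) ^ k := by positivity
    by_contra! hneg
    nlinarith
  refine ⟨2 * (k * (Λ * (k * (M : ℝ) ^ (k - 1)))), hk, h0, hlc, hloc, ?_, ⟨?_, ?_⟩, ?_, ?_, hMr.le,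
    ?_, ?_⟩
  · refine hlcΛ.trans (le_trans ?_ hQ)
    refine le_trans ?_ hkQ
    nlinarith
  · intro z hz
    refine ⟨hnn z, ?_⟩
    have := abs_polyIncr_le hk h0 hΛ hz hM1
    have h2 := le_abs_self (polyIncr f z)
    have h3 := abs_nonneg (polyIncr f z)
    linarith
  · have h1 := abs_polyIncr_le hk h0 hΛ (le_refl M) hM1
    have h2 := sum_abs_polyIncr_sub_le hk h0 hΛ hM1
    have h3 := le_abs_self (polyIncr f M)
    linarith
  · calc _ = 2 * k ^ 2 * Λ * (M : ℝ) ^ k := by rw [← hMk]; ring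
      _ ≤ 2 * k ^ 2 * Λ * (2 * κ * (f.eval (M : ℤ) : ℤ)) := by gcongr; exact hgrow M
      _ = (4 * κ * k ^ 2 * Λ) * (f.eval (M : ℤ) : ℤ) := by ring
      _ ≤ _ := by gcongr; exact hQ1.trans hQ
  · have h1 := abs_polyIncr_le hk h0 hΛ (le_refl (M + 1)) (by omega)
    have h2 := (le_abs_self _).trans h1
    rw [polyIncr_succ] at h2
    have h3 := hgrow (M + 1)
    push_cast at h2 h3 hMr'
    set F : ℝ := ((f.eval ((M : ℤ) + 1) : ℤ) : ℝ) with hF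
    have hMk' : ((M : ℝ) + 1) ^ (k - 1) * (M + 1) = ((M : ℝ) + 1) ^ k := by
      rw [← pow_succ]; congr 1; omega
    have h4 : ((M : ℝ) + 1) * (k * (Λ * (k * ((M : ℝ) + 1) ^ (k - 1)))) ≤
        ((M : ℝ) + 1) * (F / 2) := by
      calc _ = k ^ 2 * Λ * ((M : ℝ) + 1) ^ k := by rw [← hMk']; ring
        _ ≤ k ^ 2 * Λ * (2 * κ * F) := by gcongr
        _ = (4 * κ * k ^ 2 * Λ) * (F / 2) := by ring
        _ ≤ _ := by
          refine mul_le_mul_of_nonneg_right hMQ.le ?_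
          linarith
    have h5 := le_of_mul_le_mul_left h4 (by positivity)
    linarith
  · have h1 := abs_eval_le hk h0 hΛ (M := M + 1) (by omega)
    push_cast at h1 hMr'
    calc (N : ℝ) ≤ k * (Λ * ((M : ℝ) + 1) ^ k) := hMr'.trans ((le_abs_self _).trans h1)
      _ ≤ k * (Λ * (2 * (M : ℝ)) ^ k) := by gcongr; linarith
      _ = (1 * k * 2 ^ k * Λ) * (M : ℝ) ^ k := by rw [mul_pow]; ring
      _ ≤ Q * (M : ℝ) ^ k := by
        rw [hQdef]
        gcongr
        linarith
      _ ≤ _ := by gcongr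
  · have h1 : ∀ z : ℕ, z ≤ M → (z : ℝ) ≤ ((f.eval (z : ℤ) : ℤ) : ℝ) := by
      intro z
      induction z with
      | zero => intro _; simp [h0]
      | succ z ih =>
        intro hz
        have h2 := hincr z
        rw [polyIncr_succ] at h2
        have h3 := ih (by omega)
        push_cast at h2 ⊢
        linarith
    have h2 := (h1 M le_rfl).trans hMr.le
    exact_mod_cast h2

end coefficients

section reduced

variable {k : ℕ} {ψ : Polynomial ℤ}

lemma exists_pow_le_two_mul_eval_sub (hk : 1 ≤ k) (hψ : ψ.natDegree = k)
    (hlc : 0 < ψ.leadingCoeff) :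
    ∃ X : ℕ, ∀ y d : ℕ, X ≤ d →
      (d : ℝ) ^ k ≤ 2 * (((ψ.eval ((y + d : ℕ) : ℤ) : ℤ) : ℝ) - ((ψ.eval (y : ℤ) : ℤ) : ℝ)) := by
  set S : ℝ := ∑ j ∈ range k, |(ψ.coeff j : ℝ)| with hS
  have hS0 : 0 ≤ S := sum_nonneg fun _ _ => abs_nonneg _
  refine ⟨⌈2 * k * S⌉₊ + 1, fun y d hd => ?_⟩
  have hd0 : 1 ≤ d := by omega
  have hd1 : (1 : ℝ) ≤ d := by exact_mod_cast hd0
  have hdS : 2 * k * S ≤ d := by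
    refine (Nat.le_ceil _).trans ?_
    exact_mod_cast (by omega : ⌈2 * k * S⌉₊ ≤ d)
  set s : ℝ := (y : ℝ) + d with hs
  have hy0 : (0 : ℝ) ≤ y := by positivity
  have hs1 : 1 ≤ s := by linarith
  have hlc' : (1 : ℝ) ≤ ψ.coeff k := by
    have h : 0 < ψ.coeff k := by rw [← hψ]; exact hlc
    exact_mod_cast h
  have hdiff : ((ψ.eval ((y + d : ℕ) : ℤ) : ℤ) : ℝ) - ((ψ.eval (y : ℤ) : ℤ) : ℝ) =
      ∑ j ∈ range k, (ψ.coeff j : ℝ) * (s ^ j - (y : ℝ) ^ j) +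
        ψ.coeff k * (s ^ k - (y : ℝ) ^ k) := by
    rw [cast_eval_eq_sum hψ, cast_eval_eq_sum hψ, ← sum_sub_distrib, sum_range_succ]
    push_cast
    simp_rw [mul_sub, hs]
  have hlow : s * |∑ j ∈ range k, (ψ.coeff j : ℝ) * (s ^ j - (y : ℝ) ^ j)| ≤
      s * (d * s ^ (k - 1) / 2) := by
    have h1 : ∀ j ∈ range k, s * |s ^ j - (y : ℝ) ^ j| ≤ k * (d * s ^ (k - 1)) := by
      intro j hj
      have hj := mem_range.1 hj
      have hnn : 0 ≤ s ^ j - (y : ℝ) ^ j :=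
        sub_nonneg.2 (pow_le_pow_left₀ hy0 (by linarith) _)
      rw [abs_of_nonneg hnn]
      rcases Nat.eq_zero_or_pos j with rfl | hj0
      · simp only [pow_zero, sub_self, mul_zero]; positivity
      · have h2 := pow_sub_pow_le_mul hy0 (by linarith : (y : ℝ) ≤ s) j
        have h3 : s - y = d := by rw [hs]; ring
        rw [h3] at h2
        have h4 : s * s ^ (j - 1) ≤ s ^ (k - 1) := by
          rw [← pow_succ']
          exact pow_le_pow_right₀ hs1 (by omega)
        calc _ ≤ s * (j * s ^ (j - 1) * d) := by gcongr
          _ = j * (d * (s * s ^ (j - 1))) := by ring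
          _ ≤ _ := by gcongr
    calc _ ≤ s * ∑ j ∈ range k, |(ψ.coeff j : ℝ)| * |s ^ j - (y : ℝ) ^ j| := by
          gcongr
          refine (abs_sum_le_sum_abs _ _).trans (le_of_eq ?_)
          simp_rw [abs_mul]
      _ = ∑ j ∈ range k, |(ψ.coeff j : ℝ)| * (s * |s ^ j - (y : ℝ) ^ j|) := by
          rw [mul_sum]
          refine sum_congr rfl fun j _ => by ring
      _ ≤ ∑ j ∈ range k, |(ψ.coeff j : ℝ)| * (k * (d * s ^ (k - 1))) :=
          sum_le_sum fun j hj => mul_le_mul_of_nonneg_left (h1 j hj) (abs_nonneg _)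
      _ = (2 * k * S) * (d * s ^ (k - 1) / 2) := by rw [← sum_mul, hS]; ring
      _ ≤ _ := by
          refine mul_le_mul_of_nonneg_right ?_ (by positivity)
          linarith
  have hlow' := le_of_mul_le_mul_left hlow (by linarith)
  have htop := mul_le_pow_sub_pow hy0 (by linarith : (y : ℝ) ≤ s) hk
  have h3 : s - y = d := by rw [hs]; ring
  rw [h3] at htop
  have htop' : s ^ (k - 1) * d ≤ ψ.coeff k * (s ^ k - (y : ℝ) ^ k) := by
    have : 0 ≤ s ^ (k - 1) * d := by positivity
    nlinarith
  have hfin : (d : ℝ) ^ k ≤ s ^ (k - 1) * d := by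
    have : (d : ℝ) ^ k = (d : ℝ) ^ (k - 1) * d := by rw [← pow_succ]; congr 1; omega
    rw [this]
    gcongr
    linarith
  have h4 := neg_abs_le (∑ j ∈ range k, (ψ.coeff j : ℝ) * (s ^ j - (y : ℝ) ^ j))
  rw [hdiff]
  linarith

lemma exists_abs_taylor_coeff_le (hψ : ψ.natDegree = k) :
    ∃ S : ℝ, 1 ≤ S ∧ ∀ b W j : ℕ, b < W →
      |(((Polynomial.taylor (b : ℤ) ψ).coeff j : ℤ) : ℝ)| ≤ S * (W : ℝ) ^ k := by
  set c : ℕ → ℕ → ℝ := fun j i => |((Polynomial.hasseDeriv j ψ).coeff i : ℝ)| with hc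
  set S : ℝ := ∑ j ∈ range (k + 1), ∑ i ∈ range (k + 1), c j i with hS
  have hc0 : ∀ j i, 0 ≤ c j i := fun _ _ => abs_nonneg _
  have hS0 : 0 ≤ S := sum_nonneg fun _ _ => sum_nonneg fun _ _ => hc0 _ _
  refine ⟨S + 1, by linarith, fun b W j hb => ?_⟩
  have hW : (1 : ℝ) ≤ W := by exact_mod_cast (by omega : 1 ≤ W)
  have hbW : (b : ℝ) ≤ W := by exact_mod_cast hb.le
  rw [Polynomial.taylor_coeff]
  rcases lt_or_ge k j with hj | hj
  · rw [Polynomial.hasseDeriv_eq_zero_of_lt_natDegree _ _ (by omega)]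
    simp only [Polynomial.eval_zero, Int.cast_zero, abs_zero]
    positivity
  · have hdeg : (Polynomial.hasseDeriv j ψ).natDegree < k + 1 := by
      have := Polynomial.natDegree_hasseDeriv_le ψ j
      omega
    rw [Polynomial.eval_eq_sum_range' hdeg]
    push_cast
    calc _ ≤ ∑ i ∈ range (k + 1), c j i * (W : ℝ) ^ k := by
          refine (abs_sum_le_sum_abs _ _).trans (sum_le_sum fun i hi => ?_)
          have hi := mem_range.1 hi
          rw [abs_mul, abs_of_nonneg (by positivity : (0 : ℝ) ≤ (b : ℝ) ^ i)]
          refine mul_le_mul_of_nonneg_left ?_ (hc0 _ _)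
          exact (pow_le_pow_left₀ (by positivity) hbW _).trans
            (pow_le_pow_right₀ hW (by omega))
      _ = (∑ i ∈ range (k + 1), c j i) * (W : ℝ) ^ k := by rw [sum_mul]
      _ ≤ (S + 1) * (W : ℝ) ^ k := by
          refine mul_le_mul_of_nonneg_right ?_ (by positivity)
          have := single_le_sum (f := fun j => ∑ i ∈ range (k + 1), c j i)
            (fun j _ => sum_nonneg fun _ _ => hc0 _ _) (mem_range.2 (by omega : j < k + 1))
          linarith

/-- The polynomial `(ψ(Wx + b) - ψ(b)) / (KW)`, given coefficientwise. -/
noncomputable def reducedPoly (ψ : Polynomial ℤ) (W b K : ℕ) : Polynomial ℤ :=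
  ∑ j ∈ Icc 1 ψ.natDegree, Polynomial.monomial j
    (if j = 1 then ψ.derivative.eval (b : ℤ) / K
      else (Polynomial.taylor (b : ℤ) ψ).coeff j * (W : ℤ) ^ (j - 2) * ((W : ℤ) / K))

variable {W b K : ℕ}

lemma reducedPoly_coeff (j : ℕ) : (reducedPoly ψ W b K).coeff j =
    if j ∈ Icc 1 ψ.natDegree then (if j = 1 then ψ.derivative.eval (b : ℤ) / K
      else (Polynomial.taylor (b : ℤ) ψ).coeff j * (W : ℤ) ^ (j - 2) * ((W : ℤ) / K)) else 0 := by
  rw [reducedPoly, Polynomial.finsetSum_coeff]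
  simp only [Polynomial.coeff_monomial, sum_ite_eq']

lemma mul_reducedPoly_coeff (hKd : (K : ℤ) ∣ ψ.derivative.eval (b : ℤ)) (hKW : (K : ℤ) ∣ W)
    {j : ℕ} (hj : j ∈ Icc 1 ψ.natDegree) :
    (K : ℤ) * W * (reducedPoly ψ W b K).coeff j =
      (Polynomial.taylor (b : ℤ) ψ).coeff j * (W : ℤ) ^ j := by
  rw [reducedPoly_coeff, if_pos hj]
  split_ifs with h1
  · subst h1
    rw [Polynomial.taylor_coeff_one, pow_one]
    calc _ = W * (K * (ψ.derivative.eval (b : ℤ) / K)) := by ring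
      _ = _ := by rw [Int.mul_ediv_cancel' hKd]; ring
  · have hj1 := (mem_Icc.1 hj).1
    have hp : (W : ℤ) ^ j = W ^ (j - 2) * W * W := by
      rw [← pow_succ, ← pow_succ]; congr 1; omega
    calc _ = W * ((Polynomial.taylor (b : ℤ) ψ).coeff j * (W : ℤ) ^ (j - 2)) *
          (K * ((W : ℤ) / K)) := by ring
      _ = _ := by rw [Int.mul_ediv_cancel' hKW, hp]; ring

lemma mul_reducedPoly_eval (hKd : (K : ℤ) ∣ ψ.derivative.eval (b : ℤ)) (hKW : (K : ℤ) ∣ W)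
    (x : ℤ) : (K : ℤ) * W * (reducedPoly ψ W b K).eval x =
      ψ.eval (W * x + b) - ψ.eval (b : ℤ) := by
  have h1 : ψ.eval ((W : ℤ) * x + b) =
      ∑ j ∈ range (ψ.natDegree + 1), (Polynomial.taylor (b : ℤ) ψ).coeff j * (W * x) ^ j := by
    rw [← Polynomial.taylor_eval, Polynomial.eval_eq_sum_range, Polynomial.natDegree_taylor]
  have h2 : (reducedPoly ψ W b K).eval x =
      ∑ j ∈ Icc 1 ψ.natDegree, (reducedPoly ψ W b K).coeff j * x ^ j := by
    conv_lhs => rw [reducedPoly]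
    rw [Polynomial.eval_finsetSum]
    refine sum_congr rfl fun j hj => ?_
    rw [Polynomial.eval_monomial, reducedPoly_coeff, if_pos hj]
  have h3 : range (ψ.natDegree + 1) = insert 0 (Icc 1 ψ.natDegree) := by
    ext j; simp only [mem_range, mem_insert, mem_Icc]; omega
  rw [h1, h2, h3, sum_insert (by simp), mul_sum, pow_zero, mul_one, Polynomial.taylor_coeff_zero,
    add_sub_cancel_left]
  refine sum_congr rfl fun j hj => ?_
  rw [← mul_assoc, mul_reducedPoly_coeff hKd hKW hj, mul_pow]
  ring

lemma reducedPoly_natDegree (hk : 1 ≤ k) (hψ : ψ.natDegree = k) (hlc : 0 < ψ.leadingCoeff)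
    (hKd : (K : ℤ) ∣ ψ.derivative.eval (b : ℤ)) (hKW : (K : ℤ) ∣ W) (hW : 0 < W) :
    (reducedPoly ψ W b K).natDegree = k ∧
      (K : ℤ) * W * (reducedPoly ψ W b K).leadingCoeff = ψ.leadingCoeff * (W : ℤ) ^ k := by
  have hmem : k ∈ Icc 1 ψ.natDegree := by rw [hψ, mem_Icc]; exact ⟨hk, le_rfl⟩
  have hW' : (0 : ℤ) < W := by exact_mod_cast hW
  have htop : (K : ℤ) * W * (reducedPoly ψ W b K).coeff k = ψ.leadingCoeff * (W : ℤ) ^ k := by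
    rw [mul_reducedPoly_coeff hKd hKW hmem, ← hψ, ← Polynomial.natDegree_taylor ψ (b : ℤ),
      Polynomial.coeff_natDegree, Polynomial.leadingCoeff_taylor]
  have hne : (reducedPoly ψ W b K).coeff k ≠ 0 := by
    intro h
    rw [h, mul_zero] at htop
    have : 0 < ψ.leadingCoeff * (W : ℤ) ^ k := by positivity
    omega
  have hdeg : (reducedPoly ψ W b K).natDegree = k := by
    refine le_antisymm ?_ (Polynomial.le_natDegree_of_ne_zero hne)
    refine Polynomial.natDegree_le_iff_coeff_eq_zero.2 fun j hj => ?_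
    rw [reducedPoly_coeff, if_neg]
    simp only [mem_Icc]; omega
  refine ⟨hdeg, ?_⟩
  rw [Polynomial.leadingCoeff, hdeg, htop]

lemma abs_reducedPoly_coeff_le (hψ : ψ.natDegree = k) (hK : 0 < K)
    (hKd : (K : ℤ) ∣ ψ.derivative.eval (b : ℤ)) (hKW : (K : ℤ) ∣ W) (hW : 0 < W) {S : ℝ}
    (hS : ∀ j, |(((Polynomial.taylor (b : ℤ) ψ).coeff j : ℤ) : ℝ)| ≤ S * (W : ℝ) ^ k) (j : ℕ) :
    |(((reducedPoly ψ W b K).coeff j : ℤ) : ℝ)| ≤ S * (W : ℝ) ^ (2 * k) := by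
  have hS0 : 0 ≤ S * (W : ℝ) ^ k := (abs_nonneg _).trans (hS 0)
  have hW1 : (1 : ℝ) ≤ W := by exact_mod_cast hW
  have hK1 : (1 : ℝ) ≤ K := by exact_mod_cast hK
  have hSW : S * (W : ℝ) ^ (2 * k) = S * (W : ℝ) ^ k * (W : ℝ) ^ k := by
    rw [two_mul, pow_add]; ring
  by_cases hj : j ∈ Icc 1 ψ.natDegree
  · have h := congrArg (fun z : ℤ => |(z : ℝ)|) (mul_reducedPoly_coeff hKd hKW hj)
    simp only [Int.cast_mul, abs_mul, Int.cast_natCast, Int.cast_pow, abs_pow, Nat.abs_cast] at h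
    have hKW1 : (1 : ℝ) ≤ K * W := by nlinarith
    have hjk : j ≤ k := hψ ▸ (mem_Icc.1 hj).2
    calc _ ≤ (K * W : ℝ) * |(((reducedPoly ψ W b K).coeff j : ℤ) : ℝ)| :=
          le_mul_of_one_le_left (abs_nonneg _) hKW1
      _ = _ := h
      _ ≤ S * (W : ℝ) ^ k * (W : ℝ) ^ k := by
          refine mul_le_mul (hS j) (pow_le_pow_right₀ hW1 hjk) (by positivity) hS0
      _ = _ := hSW.symm
  · rw [reducedPoly_coeff, if_neg hj, Int.cast_zero, abs_zero, hSW]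
    positivity

lemma reducedPoly_localCond (hk : 1 ≤ k) (hψ : ψ.natDegree = k) (hlc : 0 < ψ.leadingCoeff)
    (hK : 0 < K) (hgcd : Int.gcd (ψ.derivative.eval (b : ℤ)) (W : ℤ) = K) (hW : 0 < W)
    {W₀ : ℕ} (hW₀ : ∀ p : ℕ, p.Prime → p ∣ W₀ → p ∣ W)
    (hKp : ∀ p : ℕ, p.Prime → p ∣ W → K * p ∣ W)
    (hlcp : ∀ p : ℕ, p.Prime → ¬ p ∣ W → ¬ (p : ℤ) ∣ ψ.leadingCoeff) :
    LocalCond (reducedPoly ψ W b K) (W * W₀) := by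
  have hKd : (K : ℤ) ∣ ψ.derivative.eval (b : ℤ) := by rw [← hgcd]; exact Int.gcd_dvd_left _ _
  have hKW : (K : ℤ) ∣ W := by
    have := Int.gcd_dvd_right (ψ.derivative.eval (b : ℤ)) (W : ℤ)
    rwa [hgcd] at this
  have hK0 : (K : ℤ) ≠ 0 := by exact_mod_cast hK.ne'
  intro p hp
  refine ⟨fun hpW => ?_, fun hpW => ?_⟩
  · have hpW' : p ∣ W := ((Nat.Prime.dvd_mul hp).1 hpW).elim id (hW₀ p hp)
    have hKpW : (K : ℤ) * p ∣ W := by exact_mod_cast hKp p hp hpW'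
    refine ⟨fun hdvd => ?_, fun j hj => ?_⟩
    · rw [reducedPoly_coeff, if_pos (by rw [mem_Icc, hψ]; exact ⟨le_rfl, hk⟩), if_pos rfl] at hdvd
      have h1 : (K : ℤ) * p ∣ ψ.derivative.eval (b : ℤ) := by
        have := mul_dvd_mul_left (K : ℤ) hdvd
        rwa [Int.mul_ediv_cancel' hKd] at this
      have h2 : (K : ℤ) * p ∣ (Int.gcd (ψ.derivative.eval (b : ℤ)) (W : ℤ) : ℤ) :=
        Int.dvd_coe_gcd h1 hKpW
      rw [hgcd] at h2
      have h3 : K * p ∣ K := by exact_mod_cast h2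
      have h4 := Nat.le_of_dvd hK h3
      have h5 := hp.two_le
      nlinarith
    · rw [reducedPoly_coeff]
      split_ifs with h1 h2
      · omega
      · refine Dvd.dvd.mul_left ?_ _
        have : (K : ℤ) * p ∣ K * ((W : ℤ) / K) := by rwa [Int.mul_ediv_cancel' hKW]
        exact Int.dvd_of_mul_dvd_mul_left hK0 this
      · exact dvd_zero _
  · have hpW' : ¬ p ∣ W := fun h => hpW (h.mul_right _)
    intro hdvd
    have h := (reducedPoly_natDegree hk hψ hlc hKd hKW hW).2
    have h1 : (p : ℤ) ∣ ψ.leadingCoeff * (W : ℤ) ^ k := by rw [← h]; exact hdvd.mul_left _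
    have hpZ : Prime (p : ℤ) := Nat.prime_iff_prime_int.1 hp
    rcases hpZ.dvd_or_dvd h1 with h2 | h2
    · exact hlcp p hp hpW' h2
    · exact hpW' (by exact_mod_cast hpZ.dvd_of_dvd_pow h2)

end reduced

section asymptotics

open Filter

lemma prod_prime_pow_le_exp (w : ℕ) :
    ((∏ p ∈ (range (w + 1)).filter Nat.Prime, p ^ w : ℕ) : ℝ) ≤ Real.exp (12 * Real.exp w) := by
  have h1 : ((∏ p ∈ (range (w + 1)).filter Nat.Prime, p ^ w : ℕ) : ℝ) ≤
      Real.exp ((w : ℝ) ^ 2 * (w + 1)) := by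
    push_cast
    have h2 : ∀ p ∈ (range (w + 1)).filter Nat.Prime, (p : ℝ) ^ w ≤ Real.exp ((w : ℝ) ^ 2) := by
      intro p hp
      have hp := mem_range.1 (mem_filter.1 hp).1
      have hpw : (p : ℝ) ≤ w := by exact_mod_cast (by omega : p ≤ w)
      have h3 : (p : ℝ) ≤ Real.exp w := hpw.trans (by linarith [Real.add_one_le_exp (w : ℝ)])
      calc _ ≤ (Real.exp w) ^ w := pow_le_pow_left₀ (by positivity) h3 _
        _ = _ := by rw [← Real.exp_nat_mul]; congr 1; ring
    calc _ ≤ ∏ p ∈ (range (w + 1)).filter Nat.Prime, Real.exp ((w : ℝ) ^ 2) :=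
          prod_le_prod (fun _ _ => by positivity) h2
      _ = Real.exp ((w : ℝ) ^ 2) ^ #((range (w + 1)).filter Nat.Prime) := by rw [prod_const]
      _ ≤ Real.exp ((w : ℝ) ^ 2) ^ (w + 1) := by
          refine pow_le_pow_right₀ (Real.one_le_exp (by positivity)) ?_
          exact (card_filter_le _ _).trans (by rw [card_range])
      _ = _ := by rw [← Real.exp_nat_mul]; congr 1; push_cast; ring
  refine h1.trans (Real.exp_le_exp.2 ?_)
  have h3 := Real.pow_div_factorial_le_exp (w : ℝ) (by positivity) 3
  have h3' : (w : ℝ) ^ 3 ≤ 6 * Real.exp w := by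
    norm_num [Nat.factorial] at h3; linarith
  have h4 : (w : ℝ) ^ 2 ≤ (w : ℝ) ^ 3 := by
    rcases Nat.eq_zero_or_pos w with rfl | hw
    · simp
    · exact pow_le_pow_right₀ (by exact_mod_cast hw) (by norm_num)
  nlinarith

lemma tendsto_log_cast_atTop : Tendsto (fun n : ℕ => Real.log n) atTop atTop :=
  Real.tendsto_log_atTop.comp tendsto_natCast_atTop_atTop

lemma tendsto_iterated_log :
    Tendsto (fun n : ℕ => Real.log (Real.log (Real.log (Real.log n)))) atTop atTop :=
  Real.tendsto_log_atTop.comp (Real.tendsto_log_atTop.comp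
    (Real.tendsto_log_atTop.comp tendsto_log_cast_atTop))

lemma eventually_prod_prime_pow_le {ε : ℝ} (hε : 0 < ε) : ∀ᶠ n : ℕ in atTop,
    ∀ w : ℕ, w = ⌊Real.log (Real.log (Real.log (Real.log n)))⌋₊ →
      ((∏ p ∈ (range (w + 1)).filter Nat.Prime, p ^ w : ℕ) : ℝ) ≤ (n : ℝ) ^ ε := by
  have h4 := tendsto_iterated_log.eventually_ge_atTop 0
  have h3 := (Real.tendsto_log_atTop.comp
    (Real.tendsto_log_atTop.comp tendsto_log_cast_atTop)).eventually_gt_atTop 0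
  have h2 := (Real.tendsto_log_atTop.comp tendsto_log_cast_atTop).eventually_gt_atTop 0
  have h1 := tendsto_log_cast_atTop.eventually_gt_atTop 0
  have hlog : ∀ᶠ n : ℕ in atTop, Real.log n ≤ (n : ℝ) ^ (ε / 12) := by
    have h := (isLittleO_log_rpow_atTop (by positivity : 0 < ε / 12)).bound one_pos
    filter_upwards [tendsto_natCast_atTop_atTop.eventually h] with n hn
    rw [one_mul, Real.norm_of_nonneg (by positivity : (0 : ℝ) ≤ (n : ℝ) ^ (ε / 12))] at hn
    exact (le_abs_self _).trans hn
  filter_upwards [h4, h3, h2, h1, hlog] with n h4 h3 h2 h1 hlog w hw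
  simp only [Function.comp_apply] at h3 h2
  refine (prod_prime_pow_le_exp w).trans ?_
  have hw' : (w : ℝ) ≤ Real.log (Real.log (Real.log (Real.log n))) := by
    rw [hw]; exact Nat.floor_le h4
  have hew : Real.exp w ≤ Real.log (Real.log n) := by
    calc _ ≤ Real.exp (Real.log (Real.log (Real.log (Real.log n)))) := Real.exp_le_exp.2 hw'
      _ = Real.log (Real.log (Real.log n)) := Real.exp_log h3
      _ ≤ _ := Real.log_le_self h2.le
  calc _ ≤ Real.exp (12 * Real.log (Real.log n)) := Real.exp_le_exp.2 (by linarith)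
    _ = (Real.log n) ^ 12 := by
        have : (12 : ℝ) * Real.log (Real.log n) = ((12 : ℕ) : ℝ) * Real.log (Real.log n) := by
          norm_num
        rw [this, Real.exp_nat_mul, Real.exp_log h1]
    _ ≤ ((n : ℝ) ^ (ε / 12)) ^ 12 := pow_le_pow_left₀ h1.le hlog _
    _ = _ := by
        rw [← Real.rpow_natCast, ← Real.rpow_mul (by positivity)]
        congr 1
        push_cast
        ring

/-- The modulus `W` is smaller than any power of `N`. -/
lemma eventually_mul_pow_le (T : ℝ) (A : ℕ) {δ : ℝ} (hδ : 0 < δ) : ∀ᶠ n : ℕ in atTop,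
    ∀ w W N : ℕ, w = ⌊Real.log (Real.log (Real.log (Real.log n)))⌋₊ →
      W = ∏ p ∈ (range (w + 1)).filter Nat.Prime, p ^ w → 2 * (n : ℝ) / W < N →
      T * (W : ℝ) ^ A ≤ (N : ℝ) ^ δ := by
  set ε : ℝ := min (1 / 2) (δ / (4 * (A + 1))) with hεdef
  have hε : 0 < ε := lt_min (by norm_num) (by positivity)
  have hε2 : ε ≤ 1 / 2 := min_le_left _ _
  have hεA : A * ε ≤ δ / 4 := by
    calc A * ε ≤ (A + 1) * (δ / (4 * (A + 1))) := by
          gcongr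
          · linarith
          · exact min_le_right _ _
      _ = δ / 4 := by field_simp
  have hT : ∀ᶠ n : ℕ in atTop, T ≤ (n : ℝ) ^ (δ / 4) :=
    ((tendsto_rpow_atTop (by positivity : 0 < δ / 4)).comp
      tendsto_natCast_atTop_atTop).eventually_ge_atTop T
  filter_upwards [eventually_prod_prime_pow_le hε, hT, eventually_ge_atTop 1] with
    n hn hT hn1 w W N hw hW hN
  have hn1' : (1 : ℝ) ≤ n := by exact_mod_cast hn1
  have hn0 : (0 : ℝ) < n := by linarith
  have hWn : (W : ℝ) ≤ (n : ℝ) ^ ε := by rw [hW]; exact hn w hw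
  have hW0 : 0 < W := by
    rw [hW]
    exact prod_pos fun p hp => pow_pos (mem_filter.1 hp).2.pos _
  have hW0' : (0 : ℝ) < W := by exact_mod_cast hW0
  have hNn : (n : ℝ) ^ (1 / 2 : ℝ) ≤ N := by
    refine le_trans ?_ hN.le
    rw [le_div_iff₀ hW0']
    calc _ ≤ (n : ℝ) ^ (1 / 2 : ℝ) * (n : ℝ) ^ (1 / 2 : ℝ) := by
          refine mul_le_mul_of_nonneg_left ?_ (by positivity)
          exact hWn.trans (Real.rpow_le_rpow_of_exponent_le hn1' hε2)
      _ = n := by rw [← Real.rpow_add hn0]; norm_num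
      _ ≤ _ := by linarith
  calc T * (W : ℝ) ^ A ≤ (n : ℝ) ^ (δ / 4) * ((n : ℝ) ^ ε) ^ A := by gcongr
    _ = (n : ℝ) ^ (δ / 4 + A * ε) := by
        rw [← Real.rpow_natCast, ← Real.rpow_mul hn0.le, Real.rpow_add hn0, mul_comm ε]
    _ ≤ (n : ℝ) ^ (1 / 2 * δ) := Real.rpow_le_rpow_of_exponent_le hn1' (by linarith)
    _ = ((n : ℝ) ^ (1 / 2 : ℝ)) ^ δ := by rw [Real.rpow_mul hn0.le]
    _ ≤ _ := Real.rpow_le_rpow (by positivity) hNn hδ.le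

lemma eventually_le_floor_log (c : ℕ) : ∀ᶠ n : ℕ in atTop,
    c ≤ ⌊Real.log (Real.log (Real.log (Real.log n)))⌋₊ := by
  filter_upwards [tendsto_iterated_log.eventually_ge_atTop (c : ℝ)] with n hn
  exact Nat.le_floor hn

lemma prime_dvd_prod_pow_iff {p w : ℕ} (hp : p.Prime) (hw : 1 ≤ w) :
    p ∣ ∏ q ∈ (range (w + 1)).filter Nat.Prime, q ^ w ↔ p ≤ w := by
  constructor
  · intro h
    obtain ⟨q, hq, hpq⟩ := (hp.prime.dvd_finsetProd_iff _).1 h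
    have hq' := mem_filter.1 hq
    have := (Nat.prime_dvd_prime_iff_eq hp hq'.2).1 (hp.dvd_of_dvd_pow hpq)
    have := mem_range.1 hq'.1
    omega
  · intro h
    exact (dvd_pow_self p (by omega)).trans (dvd_prod_of_mem (fun q => q ^ w)
      (mem_filter.2 ⟨mem_range.2 (by omega), hp⟩))

lemma mul_prime_dvd_prod_pow {p w K : ℕ} (hp : p.Prime) (hpw : p ≤ w) (hK : 0 < K)
    (hKw : K ≤ w) : K * p ∣ ∏ q ∈ (range (w + 1)).filter Nat.Prime, q ^ w := by
  have hne : ∀ q ∈ (range (w + 1)).filter Nat.Prime, q ^ w ≠ 0 := fun q hq =>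
    pow_ne_zero _ (mem_filter.1 hq).2.ne_zero
  rw [← Nat.factorization_prime_le_iff_dvd (mul_ne_zero hK.ne' hp.ne_zero)
    (prod_ne_zero_iff.2 hne)]
  intro q hq
  rw [Nat.factorization_mul hK.ne' hp.ne_zero, Finsupp.add_apply]
  have h1 : K.factorization q < K := Nat.factorization_lt q hK.ne'
  have h2 : p.factorization q ≤ 1 := by
    rw [hp.factorization, Finsupp.single_apply]; split_ifs <;> simp
  by_cases hqw : q ≤ w
  · have h3 : q ^ w ∣ ∏ q ∈ (range (w + 1)).filter Nat.Prime, q ^ w :=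
      dvd_prod_of_mem (fun q => q ^ w) (mem_filter.2 ⟨mem_range.2 (by omega), hq⟩)
    have h4 := (hq.pow_dvd_iff_le_factorization (prod_ne_zero_iff.2 hne)).1 h3
    omega
  · have h5 : K.factorization q = 0 := Nat.factorization_eq_zero_of_lt (by omega)
    have h6 : p.factorization q = 0 := Nat.factorization_eq_zero_of_lt (by omega)
    omega

end asymptotics

section assembly

lemma reducedPoly_growth {k : ℕ} {ψ : Polynomial ℤ} {W b K X : ℕ} (hk : 1 ≤ k) (hK : 0 < K)
    (hW : 0 < W) (hKd : (K : ℤ) ∣ ψ.derivative.eval (b : ℤ)) (hKW : (K : ℤ) ∣ W)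
    (hX : ∀ y d : ℕ, X ≤ d →
      (d : ℝ) ^ k ≤ 2 * (((ψ.eval ((y + d : ℕ) : ℤ) : ℤ) : ℝ) - ((ψ.eval (y : ℤ) : ℤ) : ℝ)))
    (hXW : X ≤ W) :
    (∀ z : ℕ, 1 ≤ polyIncr (reducedPoly ψ W b K) (z + 1)) ∧
      ∀ z : ℕ, (z : ℝ) ^ k ≤ 2 * (K : ℝ) * ((reducedPoly ψ W b K).eval (z : ℤ) : ℤ) := by
  have hK0 : (0 : ℝ) < K := by exact_mod_cast hK
  have hW1 : (1 : ℝ) ≤ W := by exact_mod_cast hW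
  have hW0 : (0 : ℝ) < W := by linarith
  have hev : ∀ z : ℕ, (K : ℝ) * W * (((reducedPoly ψ W b K).eval (z : ℤ) : ℤ) : ℝ) =
      ((ψ.eval ((W * z + b : ℕ) : ℤ) : ℤ) : ℝ) - ((ψ.eval (b : ℤ) : ℤ) : ℝ) := by
    intro z
    have := congrArg (fun t : ℤ => (t : ℝ)) (mul_reducedPoly_eval hKd hKW (z : ℤ))
    push_cast at this ⊢
    exact this
  refine ⟨fun z => ?_, fun z => ?_⟩
  · have h1 := hX (W * z + b) W hXW
    have h2 := hev (z + 1)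
    have h3 := hev z
    have h4 : W * (z + 1) + b = W * z + b + W := by ring
    rw [h4] at h2
    have h5 : 0 < (K : ℝ) * W * polyIncr (reducedPoly ψ W b K) (z + 1) := by
      rw [polyIncr_succ, mul_sub, h2, h3]
      have : 0 < (W : ℝ) ^ k := by positivity
      linarith
    have h6 : 0 < polyIncr (reducedPoly ψ W b K) (z + 1) :=
      (mul_pos_iff_of_pos_left (by positivity)).1 h5
    rw [polyIncr_succ] at h6 ⊢
    rw [← Int.cast_sub] at h6 ⊢
    have h7 := Int.cast_pos.1 h6
    exact_mod_cast (by omega : (1 : ℤ) ≤ _ - _)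
  · rcases Nat.eq_zero_or_pos z with rfl | hz
    · have h := hev 0
      simp only [mul_zero, zero_add, sub_self] at h
      have h0 := (mul_eq_zero.1 h).resolve_left (by positivity)
      rw [h0, Nat.cast_zero, zero_pow (by omega), mul_zero]
    · have h1 := hX b (W * z) (hXW.trans (Nat.le_mul_of_pos_right W hz))
      rw [add_comm b, ← hev z] at h1
      push_cast at h1
      rw [mul_pow] at h1
      have h2 : (W : ℝ) ≤ (W : ℝ) ^ k := le_self_pow₀ hW1 (by omega)
      have h3 : (W : ℝ) * (z : ℝ) ^ k ≤ (W : ℝ) ^ k * (z : ℝ) ^ k :=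
        mul_le_mul_of_nonneg_right h2 (by positivity)
      refine le_of_mul_le_mul_left ?_ hW0
      linarith

lemma exists_cast_eq_of_mem_Icc {N : ℕ} [NeZero N] (x : ZMod N) :
    ∃ y ∈ Icc 1 N, ((y : ℕ) : ZMod N) = x := by
  have hN : 0 < N := Nat.pos_of_ne_zero (NeZero.ne N)
  rcases Nat.eq_zero_or_pos x.val with h | h
  · refine ⟨N, mem_Icc.2 ⟨hN, le_rfl⟩, ?_⟩
    rw [ZMod.natCast_self, eq_comm]
    exact (ZMod.val_eq_zero x).1 h
  · exact ⟨x.val, mem_Icc.2 ⟨h, (ZMod.val_lt x).le⟩, ZMod.natCast_zmod_val x⟩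

lemma lamZ_nonneg (c : ℤ) (W x : ℕ) : 0 ≤ lamZ c W x := by
  unfold lamZ
  split_ifs with h
  · have h1 : (1 : ℤ) ≤ (W * x + c : ℤ) := by have := h.two_le; omega
    have : (1 : ℝ) ≤ ((W * x + c : ℤ) : ℝ) := by exact_mod_cast h1
    exact mul_nonneg (by positivity) (Real.log_nonneg this)
  · exact le_rfl

lemma primeDominated_of_eq {N : ℕ} [NeZero N] {W : ℕ} {c : ℤ} {A : Finset ℕ}
    {a : ZMod N → ℝ}
    (ha : ∀ x ∈ Icc 1 N, a ((x : ℕ) : ZMod N) = (if x ∈ A then lamZ c W x else 0) / N)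
    (hsize : (W : ℝ) * N + |(c : ℝ)| ≤ (N : ℝ) ^ 2) :
    PrimeDominated N W c (2 * Real.log N) a := by
  refine ⟨fun x => ?_, fun x hx => ?_⟩
  · obtain ⟨y, hy, rfl⟩ := exists_cast_eq_of_mem_Icc x
    rw [ha y hy]
    refine div_nonneg ?_ (by positivity)
    split_ifs
    · exact lamZ_nonneg _ _ _
    · exact le_rfl
  · rw [ha x hx]
    by_cases h : x ∈ A ∧ Nat.Prime (W * x + c : ℤ).toNat
    · right
      refine ⟨h.2, ?_⟩
      rw [if_pos h.1, lamZ, if_pos h.2]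
      have hx2 : (x : ℝ) ≤ N := by exact_mod_cast (mem_Icc.1 hx).2
      have h1 : (1 : ℤ) ≤ (W * x + c : ℤ) := by have := h.2.two_le; omega
      have h1' : (1 : ℝ) ≤ ((W * x + c : ℤ) : ℝ) := by exact_mod_cast h1
      have h2 : ((W * x + c : ℤ) : ℝ) ≤ (N : ℝ) ^ 2 := by
        push_cast
        have h3 := le_abs_self (c : ℝ)
        have h4 : (W : ℝ) * x ≤ W * N := by gcongr
        linarith
      have h5 : Real.log ((W * x + c : ℤ) : ℝ) ≤ 2 * Real.log N := by
        have := Real.log_le_log (by linarith) h2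
        rwa [Real.log_pow] at this
      gcongr
    · left
      have h0 : (if x ∈ A then lamZ c W x else 0) = 0 := by
        split_ifs with hA
        · rw [lamZ, if_neg fun hp => h ⟨hA, hp⟩]
        · rfl
      rw [h0, zero_div]

lemma lam_nonneg (c W x : ℕ) : 0 ≤ lam c W x := by
  unfold lam
  split_ifs with h
  · have : (1 : ℝ) ≤ (W : ℝ) * x + c := by exact_mod_cast h.one_le
    exact mul_nonneg (by positivity) (Real.log_nonneg this)
  · exact le_rfl

lemma weighted_le_of_eq {N : ℕ} [NeZero N] {f : Polynomial ℤ} {K M W c : ℕ} {ψ' : ℤ → ℤ}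
    (hK : 0 < K) (hψ : ∀ x, ψ' x = K * f.eval x)
    (hM : 0 < f.eval (M : ℤ)) (hincr : ∀ z : ℕ, 1 ≤ polyIncr f (z + 1))
    (hsize : (W : ℝ) * M + c ≤ (N : ℝ) ^ 2) {g : ZMod N → ℝ}
    (hg : ∀ z : ℕ, 1 ≤ z → z ≤ M → g ((ψ' (z : ℤ) : ℤ) : ZMod N) =
      ((ψ' (z : ℤ) - ψ' ((z : ℤ) - 1) : ℤ) : ℝ) * lam c W z / ((ψ' (M : ℤ) : ℤ) : ℝ))
    (hg0 : ∀ x : ZMod N, (¬ ∃ z : ℕ, 1 ≤ z ∧ z ≤ M ∧ x = ((ψ' (z : ℤ) : ℤ) : ZMod N)) →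
      g x = 0) :
    (∀ x, 0 ≤ g x) ∧ ∀ x, g x ≤ 0 ∨ ∃ z : ℕ, z ≤ M ∧
      x = ((K * f.eval (z : ℤ) : ℤ) : ZMod N) ∧ Nat.Prime (W * z + (c : ℤ) : ℤ).toNat ∧
      g x ≤ polyIncr f z * ((W.totient : ℝ) / W * (2 * Real.log N)) /
        (f.eval (M : ℤ) : ℤ) := by
  have hK0 : (0 : ℝ) < K := by exact_mod_cast hK
  have hM0 : (0 : ℝ) < ((f.eval (M : ℤ) : ℤ) : ℝ) := by exact_mod_cast hM
  have hval : ∀ z : ℕ, 1 ≤ z → z ≤ M → g ((ψ' (z : ℤ) : ℤ) : ZMod N) =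
      polyIncr f z * lam c W z / (f.eval (M : ℤ) : ℤ) := by
    intro z hz hzM
    rw [hg z hz hzM, hψ, hψ, hψ, ← mul_sub, polyIncr, if_neg (by omega), Int.cast_mul,
      Int.cast_mul, Int.cast_natCast, mul_assoc, mul_div_mul_left _ _ hK0.ne']
  have hpos : ∀ z : ℕ, 1 ≤ z → 0 ≤ polyIncr f z := by
    intro z hz
    obtain ⟨y, rfl⟩ : ∃ y, z = y + 1 := ⟨z - 1, by omega⟩
    linarith [hincr y]
  refine ⟨fun x => ?_, fun x => ?_⟩
  · by_cases h : ∃ z : ℕ, 1 ≤ z ∧ z ≤ M ∧ x = ((ψ' (z : ℤ) : ℤ) : ZMod N)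
    · obtain ⟨z, hz, hzM, rfl⟩ := h
      rw [hval z hz hzM]
      exact div_nonneg (mul_nonneg (hpos z hz) (lam_nonneg _ _ _)) hM0.le
    · rw [hg0 x h]
  · by_cases h : ∃ z : ℕ, 1 ≤ z ∧ z ≤ M ∧ x = ((ψ' (z : ℤ) : ℤ) : ZMod N)
    · obtain ⟨z, hz, hzM, rfl⟩ := h
      rw [hval z hz hzM]
      by_cases hp : Nat.Prime (W * z + c)
      · right
        refine ⟨z, hzM, by rw [hψ], ?_, ?_⟩
        · have : (W * z + (c : ℤ) : ℤ).toNat = W * z + c := by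
            rw [show (W * z + (c : ℤ) : ℤ) = ((W * z + c : ℕ) : ℤ) by push_cast; rfl]
            exact Int.toNat_natCast _
          rwa [this]
        · rw [lam, if_pos hp]
          have h1 : (1 : ℝ) ≤ (W : ℝ) * z + c := by exact_mod_cast hp.one_le
          have hzM' : (z : ℝ) ≤ M := by exact_mod_cast hzM
          have h2 : (W : ℝ) * z + c ≤ (N : ℝ) ^ 2 := by
            refine le_trans ?_ hsize
            gcongr
          have h5 : Real.log ((W : ℝ) * z + c) ≤ 2 * Real.log N := by
            have := Real.log_le_log (by linarith) h2
            rwa [Real.log_pow] at this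
          have h6 := hpos z hz
          gcongr
      · left
        rw [lam, if_neg hp, mul_zero, zero_div]
    · left
      rw [hg0 x h]

end assembly

set_option maxHeartbeats 1000000 in
/-- Lemma 3.2 of the paper: there is a constant `C₃` depending only on `k` such
that, in the setup of Section 3 (with `ρ = k·2^{k+3}`,
`a(x) = 1_A(x)λ_{ψ(b)/2,KW}(x)/N`, `R, B, β, a'` and `ℛ, ℬ, 𝔟, 𝔞'` the
corresponding Bohr-set smoothings), for all sufficiently large `n` and all
`η, ε ∈ (0,1)`:
`|Σ_{x+y=z} a(x)a(y)𝔞(z) − Σ_{x+y=z} a'(x)a'(y)𝔞'(z)|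
  ≤ C₃ K^{1/(ρ+1)} (ε² η^{−ρ} + η^{1/(ρ+1)}) N⁻¹`. -/
theorem transfer_error_bound_primes (k : ℕ) (hk : 1 ≤ k) :
    ∃ C₃ : ℝ, 0 < C₃ ∧
    ∀ ψ : Polynomial ℤ, ψ.natDegree = k → 0 < ψ.leadingCoeff →
    ∀ m b₀ W₀ K : ℕ, 0 < m → 0 < b₀ → b₀ ≤ W₀ → Nat.gcd b₀ W₀ = 1 → 0 < K →
    ∃ n₀ : ℕ, ∀ n : ℕ, n₀ ≤ n →
    ∀ (w W : ℕ),
      w = ⌊Real.log (Real.log (Real.log (Real.log n)))⌋₊ →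
      W = ∏ p ∈ (Finset.range (w + 1)).filter Nat.Prime, p ^ w →
    ∀ (N : ℕ) [NeZero N], N.Prime →
      (2 * (n : ℝ)) / W < N → (N : ℝ) ≤ (2 + (1 / 10000 : ℝ) / ((K : ℝ) * m)) * n / W →
    ∀ b : ℕ, b < W →
      Nat.gcd (W₀ * b + b₀) (W * W₀) = 1 → Even (ψ.eval (b : ℤ)) →
      Int.gcd (ψ.derivative.eval (b : ℤ)) (ψ.leadingCoeff * (W : ℤ) ^ (k - 1)) = K →
      Int.gcd (ψ.derivative.eval (b : ℤ)) (W : ℤ) = K →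
    ∀ ψbW : ℤ → ℤ,
      (∀ x : ℤ, ψbW x = (ψ.eval ((W : ℤ) * x + (b : ℤ)) - ψ.eval (b : ℤ)) / (W : ℤ)) →
    ∀ M : ℕ, ψbW (M : ℤ) < (K : ℤ) * N → (∀ x : ℕ, ψbW (x : ℤ) < (K : ℤ) * N → x ≤ M) →
    ∀ 𝔞 : ZMod N → ℝ,
      (∀ z : ℕ, 1 ≤ z → z ≤ M →
        𝔞 ((ψbW (z : ℤ) : ℤ) : ZMod N) =
          ((ψbW (z : ℤ) - ψbW ((z : ℤ) - 1) : ℤ) : ℝ) * lam (W₀ * b + b₀) (W * W₀) z /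
            ((ψbW (M : ℤ) : ℤ) : ℝ)) →
      (∀ x : ZMod N, (¬ ∃ z : ℕ, 1 ≤ z ∧ z ≤ M ∧ x = ((ψbW (z : ℤ) : ℤ) : ZMod N)) →
        𝔞 x = 0) →
    ∀ A : Finset ℕ, A ⊆ Finset.Icc 1 N →
    ∀ a : ZMod N → ℝ,
      (∀ x ∈ Finset.Icc 1 N,
        a ((x : ℕ) : ZMod N) =
          (if x ∈ A then lamZ (ψ.eval (b : ℤ) / 2) (K * W) x else 0) / N) →
    ∀ η ε : ℝ, 0 < η → η < 1 → 0 < ε → ε < 1 →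
    ∀ R : Finset (ZMod N), (∀ r : ZMod N, r ∈ R ↔ η ≤ ‖dft N a r‖) →
    ∀ B : Finset (ZMod N),
      (∀ x : ZMod N, x ∈ B ↔
        ∀ r ∈ R, nint (((x.val : ℕ) : ℝ) * ((r.val : ℕ) : ℝ) / N) ≤ ε) →
    ∀ β : ZMod N → ℝ, (∀ x, β x = (if x ∈ B then (1 : ℝ) else 0) / (B.card : ℝ)) →
    ∀ a' : ZMod N → ℝ,
      (∀ x, a' x = ∑ y : ZMod N, (∑ u : ZMod N, a u * β (y - u)) * β (x - y)) →
    ∀ ℛ : Finset (ZMod N), (∀ r : ZMod N, r ∈ ℛ ↔ η ≤ ‖dft N 𝔞 r‖) →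
    ∀ ℬ : Finset (ZMod N),
      (∀ x : ZMod N, x ∈ ℬ ↔
        ∀ r ∈ ℛ, nint (((x.val : ℕ) : ℝ) * ((r.val : ℕ) : ℝ) / N) ≤ ε) →
    ∀ 𝔟 : ZMod N → ℝ, (∀ x, 𝔟 x = (if x ∈ ℬ then (1 : ℝ) else 0) / (ℬ.card : ℝ)) →
    ∀ 𝔞' : ZMod N → ℝ,
      (∀ x, 𝔞' x = ∑ y : ZMod N, (∑ u : ZMod N, 𝔞 u * 𝔟 (y - u)) * 𝔟 (x - y)) →
      |(∑ x : ZMod N, ∑ y : ZMod N, a x * a y * 𝔞 (x + y))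
        - (∑ x : ZMod N, ∑ y : ZMod N, a' x * a' y * 𝔞' (x + y))|
        ≤ C₃ * (K : ℝ) ^ ((1 : ℝ) / ((k : ℝ) * 2 ^ (k + 3) + 1)) *
            (ε ^ 2 * η ^ (-((k : ℝ) * 2 ^ (k + 3)))
              + η ^ ((1 : ℝ) / ((k : ℝ) * 2 ^ (k + 3) + 1))) * ((N : ℝ))⁻¹ := by
  set ρ : ℕ := k * 2 ^ (k + 3) with hρdef
  have hρ2 : 2 ≤ ρ := by
    calc 2 ≤ 1 * 2 ^ (k + 3) := by
          rw [one_mul]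
          calc 2 = 2 ^ 1 := rfl
            _ ≤ _ := Nat.pow_le_pow_right (by norm_num) (by omega)
      _ ≤ _ := Nat.mul_le_mul_right _ hk
  have hρ2' : (2 : ℝ) ≤ ρ := by exact_mod_cast hρ2
  have hρcast : (k : ℝ) * 2 ^ (k + 3) = (ρ : ℝ) := by rw [hρdef]; push_cast; rfl
  have hk1 : (1 : ℝ) ≤ k := by exact_mod_cast hk
  obtain ⟨σ, hσ⟩ : ∃ σ : ℝ, σ = 1 / (k * 2 ^ (k + 2)) := ⟨_, rfl⟩
  have hσ0 : 0 < σ := by rw [hσ]; positivity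
  have hσk : σ * k ≤ 1 := by
    rw [hσ, one_div_mul_eq_div, div_le_one (by positivity)]
    exact le_mul_of_one_le_right (by positivity) (one_le_pow₀ (by norm_num))
  obtain ⟨C, hC, hmoment⟩ := exists_moment_le k hk hσ
  obtain ⟨p₁, hp₁⟩ : ∃ p : ℝ, p = (2 * (ρ : ℝ) + 1) * ρ / ((ρ : ℝ) ^ 2 - 1) := ⟨_, rfl⟩
  obtain ⟨p₂, hp₂⟩ : ∃ p : ℝ, p = 2 * ((ρ : ℝ) + 1) / ρ := ⟨_, rfl⟩
  have hp₁2 : 2 < p₁ := by rw [hp₁, lt_div_iff₀ (by nlinarith)]; nlinarith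
  have hp₂2 : 2 < p₂ := by rw [hp₂, lt_div_iff₀ (by linarith)]; linarith
  obtain ⟨C₁, hC₁, hrest₁⟩ := exists_sum_rpow_le hp₁2
  obtain ⟨C₂, hC₂, hrest₂⟩ := exists_sum_rpow_le hp₂2
  refine ⟨12 * Real.pi ^ 2 * (1 + C₁) ^ 2 * C + 2 * (C₁ + C₂ + 2 * C), by positivity, ?_⟩
  intro ψ hψ hlc m b₀ W₀ K _ hb₀ hb₀W₀ _ hK
  obtain ⟨X, hX⟩ := exists_pow_le_two_mul_eval_sub hk hψ hlc
  obtain ⟨S, hS1, hS⟩ := exists_abs_taylor_coeff_le hψ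
  have hev := (eventually_le_floor_log (K + W₀ + ψ.leadingCoeff.toNat + X + 1)).and <|
    (eventually_mul_pow_le (2 * K + 2 * W₀ + S + 2) (2 * k + 1) one_pos).and <|
    (eventually_mul_pow_le (4 * K * k ^ 2 * 2 ^ k * S) (2 * k)
      (by positivity : 0 < σ / 400)).and <|
    (eventually_mul_pow_le 2 0 (by norm_num : (0 : ℝ) < 1 / 3200)).and <|
    eventually_mul_pow_le 8 0 (by positivity : (0 : ℝ) < 1 / (8 * k))
  obtain ⟨n₀, hn₀⟩ := Filter.eventually_atTop.1 hev
  refine ⟨n₀, ?_⟩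
  intro n hn w W hw hW N _ hNp hNn _ b hb _ _ _ hgcd ψ' hψ' M hM hM' g hg hg0 A _ a ha
    η ε hη hη1 hε _ R hR B hB β hβ a' ha' R' hR' B' hB' β' hβ' g' hg'
  obtain ⟨hwn, hs1, hs2, hs3, hs4⟩ := hn₀ n hn
  rw [← hw] at hwn
  have hs1 := hs1 w W N hw hW hNn
  have hs2 := hs2 w W N hw hW hNn
  have hs3 := hs3 w W N hw hW hNn
  have hs4 := hs4 w W N hw hW hNn
  rw [Real.rpow_one] at hs1
  rw [pow_zero, mul_one] at hs3 hs4
  have hN2 : 2 ≤ N := hNp.two_le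
  have hN2' : (2 : ℝ) ≤ N := by exact_mod_cast hN2
  have hlogN : 0 ≤ Real.log N := Real.log_nonneg (by linarith)
  have hW0 : 0 < W := by
    rw [hW]
    exact prod_pos fun p hp => pow_pos (mem_filter.1 hp).2.pos _
  have hW1 : (1 : ℝ) ≤ W := by exact_mod_cast hW0
  have hdvdW : ∀ p : ℕ, p.Prime → (p ∣ W ↔ p ≤ w) := fun p hp => by
    rw [hW]; exact prime_dvd_prod_pow_iff hp (by omega)
  have hwW : w ≤ W := by
    have h1 : K * 2 ∣ W ∧ 2 ^ w ∣ W := by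
      rw [hW]
      exact ⟨mul_prime_dvd_prod_pow Nat.prime_two (by omega) hK (by omega),
        dvd_prod_of_mem (fun q => q ^ w)
          (mem_filter.2 ⟨mem_range.2 (by omega), Nat.prime_two⟩)⟩
    exact Nat.lt_two_pow_self.le.trans (Nat.le_of_dvd hW0 h1.2)
  have hKd : (K : ℤ) ∣ ψ.derivative.eval (b : ℤ) := by rw [← hgcd]; exact Int.gcd_dvd_left _ _
  have hKW : (K : ℤ) ∣ W := by
    have := Int.gcd_dvd_right (ψ.derivative.eval (b : ℤ)) (W : ℤ)
    rwa [hgcd] at this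
  have hloc : LocalCond (reducedPoly ψ W b K) (W * W₀) := by
    refine reducedPoly_localCond hk hψ hlc hK hgcd hW0 ?_ ?_ ?_
    · intro p hp hpW₀
      have := Nat.le_of_dvd (by omega) hpW₀
      exact (hdvdW p hp).2 (by omega)
    · intro p hp hpW
      have := (hdvdW p hp).1 hpW
      rw [hW]
      exact mul_prime_dvd_prod_pow hp this hK (by omega)
    · intro p hp hpW hpl
      have h1 : ¬ p ≤ w := fun h => hpW ((hdvdW p hp).2 h)
      have h2 := Int.le_of_dvd hlc hpl
      omega
  have hcoeff := abs_reducedPoly_coeff_le hψ hK hKd hKW hW0 (fun j => hS b W j hb)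
  obtain ⟨hincr, hgrow⟩ := reducedPoly_growth hk hK hW0 hKd hKW hX (by omega)
  obtain ⟨hdeg, hlead⟩ := reducedPoly_natDegree hk hψ hlc hKd hKW hW0
  have heval := mul_reducedPoly_eval (ψ := ψ) hKd hKW
  generalize reducedPoly ψ W b K = f at hloc hcoeff hincr hgrow hdeg hlead heval
  have hKZ : (0 : ℤ) < K := by exact_mod_cast hK
  have hWZ : (0 : ℤ) < W := by exact_mod_cast hW0
  have hψf : ∀ x, ψ' x = K * f.eval x := by
    intro x
    rw [hψ', ← heval, mul_right_comm, Int.mul_ediv_cancel _ hWZ.ne']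
  have hf0 : f.eval 0 = 0 := by
    have h := heval 0
    rw [mul_zero, zero_add, sub_self] at h
    exact (mul_eq_zero.1 h).resolve_left (by positivity)
  have hflc : 0 < f.leadingCoeff := by
    have h : 0 < (K : ℤ) * W * f.leadingCoeff := by rw [hlead]; positivity
    exact (mul_pos_iff_of_pos_left (by positivity)).1 h
  have hfM : f.eval (M : ℤ) < N := by
    rw [hψf] at hM
    exact lt_of_mul_lt_mul_left hM hKZ.le
  have hfM' : (N : ℤ) ≤ f.eval ((M + 1 : ℕ) : ℤ) := by
    by_contra! h
    have := hM' (M + 1) (by rw [hψf]; exact mul_lt_mul_of_pos_left h hKZ)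
    omega
  obtain ⟨V, hadm⟩ := exists_admissible (δ := σ / 400) hk hdeg hf0 hflc hloc hcoeff
    (by exact_mod_cast hK : (1 : ℝ) ≤ K) hincr hgrow hN2
    (by nlinarith) (by rw [← mul_assoc]; exact hs2) hfM hfM'
  have hMN : (M : ℝ) ≤ N := by exact_mod_cast hadm.le
  have hW0' : (0 : ℝ) ≤ W₀ := by positivity
  have hKr : (1 : ℝ) ≤ K := by exact_mod_cast hK
  have hWp : (W : ℝ) ≤ (W : ℝ) ^ (2 * k + 1) := le_self_pow₀ hW1 (by omega)
  have hWp1 : (1 : ℝ) ≤ (W : ℝ) ^ (2 * k + 1) := one_le_pow₀ hW1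
  have hWpk : (W : ℝ) ^ k ≤ (W : ℝ) ^ (2 * k + 1) := pow_le_pow_right₀ hW1 (by omega)
  have hsum : 2 * (K * (W : ℝ)) + 2 * (W₀ * (W : ℝ)) + S * (W : ℝ) ^ k + 2 ≤ N := by
    refine le_trans ?_ hs1
    have h1 : (K : ℝ) * W ≤ K * (W : ℝ) ^ (2 * k + 1) := by gcongr
    have h2 : (W₀ : ℝ) * W ≤ W₀ * (W : ℝ) ^ (2 * k + 1) := by gcongr
    have h3 : S * (W : ℝ) ^ k ≤ S * (W : ℝ) ^ (2 * k + 1) := by gcongr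
    linarith
  have hSW : 0 ≤ S * (W : ℝ) ^ k := by positivity
  have hW₀W : 0 ≤ (W₀ : ℝ) * W := by positivity
  have hKWr : (K : ℝ) ≤ K * W := le_mul_of_one_le_right (by positivity) hW1
  have hcop : Nat.Coprime K N := by
    have h1 : (K : ℝ) < N := by linarith
    have h2 : K < N := by exact_mod_cast h1
    exact (Nat.coprime_of_lt_prime hK.ne' h2 hNp).symm
  have hψb : |((ψ.eval (b : ℤ) / 2 : ℤ) : ℝ)| ≤ S * (W : ℝ) ^ k := by
    have h1 := hS b W 0 hb
    rw [Polynomial.taylor_coeff_zero] at h1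
    refine le_trans ?_ h1
    exact_mod_cast Int.abs_ediv_le_abs (ψ.eval (b : ℤ)) 2
  have hadom : PrimeDominated N (K * W) (ψ.eval (b : ℤ) / 2) (2 * Real.log N) a := by
    refine primeDominated_of_eq ha ?_
    push_cast
    nlinarith
  have hsize : ((W * W₀ : ℕ) : ℝ) * M + ((W₀ * b + b₀ : ℕ) : ℝ) ≤ (N : ℝ) ^ 2 := by
    have h1 : (b : ℝ) + 1 ≤ W := by exact_mod_cast hb
    have h2 : (b₀ : ℝ) ≤ W₀ := by exact_mod_cast hb₀W₀
    have h3 : (W₀ : ℝ) * (b + 1) ≤ W₀ * W := by gcongr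
    have h4 : (W : ℝ) * W₀ * M ≤ W * W₀ * N := by gcongr
    push_cast
    nlinarith
  have hfMpos : 0 < f.eval (M : ℤ) := by
    have h1 := hadm.half_le
    have h2 : (0 : ℝ) < ((f.eval (M : ℤ) : ℤ) : ℝ) := by linarith
    exact_mod_cast h2
  obtain ⟨hgnn, hgle⟩ := weighted_le_of_eq hK hψf hfMpos hincr hsize hg hg0
  have hL0 : 0 ≤ 2 * Real.log N := by linarith
  have h3 := hmoment f (W * W₀) M N ((W₀ * b + b₀ : ℕ) : ℤ) V (2 * Real.log N) K
    (Nat.mul_pos hW0 (by omega)) hadm hN2 hs4 hL0 le_rfl hcop g hgnn hgle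
  have h1 := hrest₁ N (K * W) _ _ (Nat.mul_pos hK hW0) hs3 hL0 le_rfl a hadom
  have h2 := hrest₂ N (K * W) _ _ (Nat.mul_pos hK hW0) hs3 hL0 le_rfl a hadom
  have hmain := abs_sum_sub_sum_le hρ2 hp₁ hp₂ a g h1 h2 h3 hη hη1 hε R B hR hB β hβ a' ha'
    R' B' hR' hB' β' hβ' g' hg'
  rw [hρcast]
  refine hmain.trans (mul_le_mul_of_nonneg_right ?_ (by positivity))
  refine mul_le_mul_of_nonneg_right ?_ (by positivity)
  exact le_mul_of_one_le_right (by positivity) (Real.one_le_rpow hKr (by positivity))
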